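/- Let N ≥ 2 and 0 < c₁⁰ < c₂⁰ < … < c_N⁰. There exist constants α₀, A₀, L₀, γ₀, K > 0 such that the following holds. Let L > L₀, α ∈ (0, α₀), and x₁⁰ < x₂⁰ < … < x_N⁰ with x_j⁰ > x_{j-1}⁰ + L for j = 2, …, N. Let u be a classical solution of the KdV equation such that ‖u(0,·) − Σ_{j=1}^N Q_{c_j⁰}(· − x_j⁰)‖_{L²(ℝ)} ≤ α. Then there exist functions c₁, …, c_N : [0,∞) → (0,∞) and x₁, …, x_N : [0,∞) → ℝ such that ∫_{x ≥ c₁⁰ t / 10} |u(t,x) − Σ_{j=1}^N Q_{c_j(t)}(x − x_j(t))|² dx → 0 as t → +∞; moreover, for each j = 1, …, N the limit c_j⁺ := lim_{t→+∞} c_j(t) exists, satisfies c_j⁺ > 0, and Σ_{j=1}^N |c_j⁺ − c_j⁰| ≤ K A₀ (α + e^{−γ₀ L}). -/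

import Mathlib

open MeasureTheory Filter Real

/-- The KdV soliton profile `Q_c(s) = 3c / (1 + cosh(√c s))`. -/
noncomputable def Q (c s : ℝ) : ℝ := 3 * c / (1 + Real.cosh (Real.sqrt c * s))

/-- Squared `L²(ℝ)` norm. -/
noncomputable def L2sq (f : ℝ → ℝ) : ℝ := ∫ x : ℝ, (f x) ^ 2

/-- `f` satisfies the Schwartz class decay estimates. -/
def IsSchwartzFn (f : ℝ → ℝ) : Prop :=
  ∀ k n : ℕ, ∃ C : ℝ, ∀ x : ℝ, |x| ^ k * |iteratedDeriv n f x| ≤ C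

/-- `u` is a classical solution of the KdV equation `u_t + (u_xx + u²)_x = 0`,
smooth and Schwartz in space for each time. -/
def IsKdVSolution (u : ℝ → ℝ → ℝ) : Prop :=
  ContDiff ℝ (⊤ : ℕ∞) (Function.uncurry u) ∧ (∀ t : ℝ, IsSchwartzFn (u t)) ∧
  ∀ t x : ℝ,
    deriv (fun τ => u τ x) t +
      deriv (fun y => deriv (deriv (u t)) y + (u t y) ^ 2) x = 0

namespace KdV

/-- Joint smoothness of a function of time and space. -/
def Sm (f : ℝ → ℝ → ℝ) : Prop := ContDiff ℝ (⊤ : ℕ∞) (Function.uncurry f)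

/-- Space derivative. -/
noncomputable def Dx (f : ℝ → ℝ → ℝ) : ℝ → ℝ → ℝ := fun t x => deriv (f t) x

/-- Time derivative. -/
noncomputable def Dt (f : ℝ → ℝ → ℝ) : ℝ → ℝ → ℝ := fun t x => deriv (fun τ => f τ x) t

namespace Sm

variable {f g : ℝ → ℝ → ℝ}

theorem diff (hf : Sm f) : Differentiable ℝ (Function.uncurry f) :=
  ContDiff.differentiable hf (by simp)

theorem cont (hf : Sm f) : Continuous (Function.uncurry f) := ContDiff.continuous hf

theorem cont_x (hf : Sm f) (t : ℝ) : Continuous (f t) :=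
  hf.cont.comp (by fun_prop : Continuous fun x : ℝ => (t, x))

theorem cont_t (hf : Sm f) (x : ℝ) : Continuous (fun t => f t x) :=
  hf.cont.comp (by fun_prop : Continuous fun t : ℝ => (t, x))

theorem hasDx_fderiv (hf : Sm f) (t x : ℝ) :
    HasDerivAt (f t) (fderiv ℝ (Function.uncurry f) (t, x) (0, 1)) x := by
  have h1 : HasFDerivAt (Function.uncurry f) (fderiv ℝ (Function.uncurry f) (t, x)) (t, x) :=
    (hf.diff (t, x)).hasFDerivAt
  have h2 : HasDerivAt (fun y : ℝ => ((t, y) : ℝ × ℝ)) ((0 : ℝ), (1 : ℝ)) x :=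
    (hasDerivAt_const x t).prodMk (hasDerivAt_id x)
  exact h1.comp_hasDerivAt x h2

theorem hasDt_fderiv (hf : Sm f) (t x : ℝ) :
    HasDerivAt (fun τ => f τ x) (fderiv ℝ (Function.uncurry f) (t, x) (1, 0)) t := by
  have h1 : HasFDerivAt (Function.uncurry f) (fderiv ℝ (Function.uncurry f) (t, x)) (t, x) :=
    (hf.diff (t, x)).hasFDerivAt
  have h2 : HasDerivAt (fun y : ℝ => ((y, x) : ℝ × ℝ)) ((1 : ℝ), (0 : ℝ)) t :=
    (hasDerivAt_id t).prodMk (hasDerivAt_const t x)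
  exact h1.comp_hasDerivAt t h2

theorem hasDx (hf : Sm f) (t x : ℝ) : HasDerivAt (f t) (Dx f t x) x :=
  (hf.hasDx_fderiv t x).differentiableAt.hasDerivAt

theorem hasDt (hf : Sm f) (t x : ℝ) : HasDerivAt (fun τ => f τ x) (Dt f t x) t :=
  (hf.hasDt_fderiv t x).differentiableAt.hasDerivAt

theorem Dx_eq (hf : Sm f) (t x : ℝ) : Dx f t x = fderiv ℝ (Function.uncurry f) (t, x) (0, 1) :=
  (hf.hasDx_fderiv t x).deriv

theorem Dt_eq (hf : Sm f) (t x : ℝ) : Dt f t x = fderiv ℝ (Function.uncurry f) (t, x) (1, 0) :=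
  (hf.hasDt_fderiv t x).deriv

theorem smooth_fderiv (hf : Sm f) : ContDiff ℝ (⊤ : ℕ∞) (fderiv ℝ (Function.uncurry f)) :=
  ContDiff.fderiv_right hf (by simp)

theorem dx (hf : Sm f) : Sm (Dx f) := by
  have : Function.uncurry (Dx f) = fun p : ℝ × ℝ => fderiv ℝ (Function.uncurry f) p (0, 1) := by
    ext ⟨t, x⟩; exact hf.Dx_eq t x
  unfold Sm; rw [this]
  exact hf.smooth_fderiv.clm_apply contDiff_const

theorem dt (hf : Sm f) : Sm (Dt f) := by
  have : Function.uncurry (Dt f) = fun p : ℝ × ℝ => fderiv ℝ (Function.uncurry f) p (1, 0) := by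
    ext ⟨t, x⟩; exact hf.Dt_eq t x
  unfold Sm; rw [this]
  exact hf.smooth_fderiv.clm_apply contDiff_const

theorem comm (hf : Sm f) (t x : ℝ) : Dt (Dx f) t x = Dx (Dt f) t x := by
  have hs : IsSymmSndFDerivAt ℝ (Function.uncurry f) (t, x) := by
    refine ContDiffAt.isSymmSndFDerivAt (n := (⊤ : ℕ∞)) (ContDiff.contDiffAt hf) ?_
    simp only [minSmoothness_of_isRCLikeNormedField]
    exact WithTop.coe_le_coe.mpr (le_top : (2 : ℕ∞) ≤ ⊤)
  have hd : DifferentiableAt ℝ (fderiv ℝ (Function.uncurry f)) (t, x) :=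
    hf.smooth_fderiv.differentiable (by simp) _
  have e1 : Dt (Dx f) t x = fderiv ℝ (fderiv ℝ (Function.uncurry f)) (t, x) (1, 0) (0, 1) := by
    rw [hf.dx.Dt_eq]
    have : Function.uncurry (Dx f) = fun p : ℝ × ℝ => fderiv ℝ (Function.uncurry f) p (0, 1) := by
      ext ⟨t, x⟩; exact hf.Dx_eq t x
    rw [this, fderiv_clm_apply hd (by fun_prop)]
    simp
  have e2 : Dx (Dt f) t x = fderiv ℝ (fderiv ℝ (Function.uncurry f)) (t, x) (0, 1) (1, 0) := by
    rw [hf.dt.Dx_eq]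
    have : Function.uncurry (Dt f) = fun p : ℝ × ℝ => fderiv ℝ (Function.uncurry f) p (1, 0) := by
      ext ⟨t, x⟩; exact hf.Dt_eq t x
    rw [this, fderiv_clm_apply hd (by fun_prop)]
    simp
  rw [e1, e2]; exact hs _ _

theorem add (hf : Sm f) (hg : Sm g) : Sm (fun t x => f t x + g t x) := ContDiff.add hf hg
theorem sub (hf : Sm f) (hg : Sm g) : Sm (fun t x => f t x - g t x) := ContDiff.sub hf hg
theorem mul (hf : Sm f) (hg : Sm g) : Sm (fun t x => f t x * g t x) := ContDiff.mul hf hg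
theorem neg (hf : Sm f) : Sm (fun t x => - f t x) := ContDiff.neg hf
theorem pow (hf : Sm f) (n : ℕ) : Sm (fun t x => f t x ^ n) := ContDiff.pow hf n
theorem const (c : ℝ) : Sm (fun _ _ => c) := contDiff_const
theorem cmul (c : ℝ) (hf : Sm f) : Sm (fun t x => c * f t x) := (const c).mul hf

theorem comp_aff (hf : Sm f) {a b : ℝ → ℝ → ℝ} (ha : Sm a) (hb : Sm b) :
    Sm (fun t x => f (a t x) (b t x)) := by
  have : ContDiff ℝ (⊤ : ℕ∞) (fun p : ℝ × ℝ => (Function.uncurry a p, Function.uncurry b p)) :=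
    ContDiff.prodMk ha hb
  exact ContDiff.comp hf this

theorem of_space {ρ : ℝ → ℝ} (h : ContDiff ℝ (⊤ : ℕ∞) ρ) {a : ℝ → ℝ → ℝ} (ha : Sm a) :
    Sm (fun t x => ρ (a t x)) := ContDiff.comp h ha

end Sm

namespace Sm

variable {f g : ℝ → ℝ → ℝ}

theorem Dx_add (hf : Sm f) (hg : Sm g) :
    Dx (fun t x => f t x + g t x) = fun t x => Dx f t x + Dx g t x := by
  ext t x; exact ((hf.hasDx t x).add (hg.hasDx t x)).deriv

theorem Dx_sub (hf : Sm f) (hg : Sm g) :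
    Dx (fun t x => f t x - g t x) = fun t x => Dx f t x - Dx g t x := by
  ext t x; exact ((hf.hasDx t x).sub (hg.hasDx t x)).deriv

theorem Dx_mul (hf : Sm f) (hg : Sm g) :
    Dx (fun t x => f t x * g t x) = fun t x => Dx f t x * g t x + f t x * Dx g t x := by
  ext t x; exact ((hf.hasDx t x).mul (hg.hasDx t x)).deriv

theorem Dx_neg (hf : Sm f) : Dx (fun t x => - f t x) = fun t x => - Dx f t x := by
  ext t x; exact ((hf.hasDx t x).neg).deriv

theorem Dx_pow (hf : Sm f) (n : ℕ) :
    Dx (fun t x => f t x ^ n) = fun t x => n * f t x ^ (n - 1) * Dx f t x := by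
  ext t x; exact ((hf.hasDx t x).fun_pow n).deriv

theorem Dx_const (c : ℝ) : Dx (fun _ _ => c) = fun _ _ => 0 := by
  ext t x; exact deriv_const _ _

theorem Dt_add (hf : Sm f) (hg : Sm g) :
    Dt (fun t x => f t x + g t x) = fun t x => Dt f t x + Dt g t x := by
  ext t x; exact ((hf.hasDt t x).add (hg.hasDt t x)).deriv

theorem Dt_sub (hf : Sm f) (hg : Sm g) :
    Dt (fun t x => f t x - g t x) = fun t x => Dt f t x - Dt g t x := by
  ext t x; exact ((hf.hasDt t x).sub (hg.hasDt t x)).deriv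

theorem Dt_mul (hf : Sm f) (hg : Sm g) :
    Dt (fun t x => f t x * g t x) = fun t x => Dt f t x * g t x + f t x * Dt g t x := by
  ext t x; exact ((hf.hasDt t x).mul (hg.hasDt t x)).deriv

theorem Dt_neg (hf : Sm f) : Dt (fun t x => - f t x) = fun t x => - Dt f t x := by
  ext t x; exact ((hf.hasDt t x).neg).deriv

theorem Dt_pow (hf : Sm f) (n : ℕ) :
    Dt (fun t x => f t x ^ n) = fun t x => n * f t x ^ (n - 1) * Dt f t x := by
  ext t x; exact ((hf.hasDt t x).fun_pow n).deriv

theorem Dt_const (c : ℝ) : Dt (fun _ _ => c) = fun _ _ => 0 := by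
  ext t x; exact deriv_const _ _

theorem comm' (hf : Sm f) : Dt (Dx f) = Dx (Dt f) := by
  ext t x; exact hf.comm t x

end Sm

end KdV

namespace KdV

/-- Continuous square integrable functions. -/
def SqI (f : ℝ → ℝ) : Prop := Continuous f ∧ Integrable (fun x => f x ^ 2)

namespace SqI

variable {f g : ℝ → ℝ}

theorem mul_int (hf : SqI f) (hg : SqI g) : Integrable (fun x => f x * g x) := by
  refine ((hf.2.add hg.2)).mono' (hf.1.mul hg.1).aestronglyMeasurable (Eventually.of_forall ?_)
  intro x
  simp only [norm_eq_abs, abs_mul, Pi.add_apply]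
  nlinarith [sq_nonneg (|f x| - |g x|), sq_abs (f x), sq_abs (g x), sq_nonneg (f x), sq_nonneg (g x)]

theorem of_le (hf : Continuous f) (hg : SqI g) {C : ℝ} (h : ∀ x, f x ^ 2 ≤ C * g x ^ 2) : SqI f := by
  refine ⟨hf, (hg.2.const_mul C).mono' (hf.pow 2).aestronglyMeasurable (Eventually.of_forall ?_)⟩
  intro x
  rw [norm_eq_abs, abs_of_nonneg (sq_nonneg _)]
  exact h x

theorem add (hf : SqI f) (hg : SqI g) : SqI (fun x => f x + g x) := by
  refine ⟨hf.1.add hg.1, ?_⟩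
  have : (fun x => (f x + g x) ^ 2) = fun x => f x ^ 2 + 2 * (f x * g x) + g x ^ 2 := by
    ext x; ring
  rw [this]
  exact (hf.2.add ((hf.mul_int hg).const_mul 2)).add hg.2

theorem bdd_mul (hg : SqI g) (hf : Continuous f) {M : ℝ} (h : ∀ x, |f x| ≤ M) :
    SqI (fun x => f x * g x) := by
  refine of_le (hf.mul hg.1) hg (C := M ^ 2) fun x => ?_
  rw [mul_pow]
  refine mul_le_mul_of_nonneg_right ?_ (sq_nonneg _)
  rw [← sq_abs]
  exact pow_le_pow_left₀ (abs_nonneg _) (h x) 2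

theorem cmul (c : ℝ) (hf : SqI f) : SqI (fun x => c * f x) :=
  bdd_mul hf continuous_const (M := |c|) fun _ => le_rfl

theorem neg (hf : SqI f) : SqI (fun x => - f x) := by
  simpa using hf.cmul (-1)

theorem sub (hf : SqI f) (hg : SqI g) : SqI (fun x => f x - g x) := by
  simpa [sub_eq_add_neg] using hf.add hg.neg

theorem zero : SqI (fun _ => (0 : ℝ)) := ⟨continuous_const, by simp⟩

theorem sum {ι : Type*} (s : Finset ι) (F : ι → ℝ → ℝ) (h : ∀ i ∈ s, SqI (F i)) :
    SqI (fun x => ∑ i ∈ s, F i x) := by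
  classical
  induction s using Finset.induction_on with
  | empty => simpa using zero
  | insert a s ha ih =>
    simp only [Finset.sum_insert ha]
    exact (h a (by simp)).add (ih fun i hi => h i (by simp [hi]))

end SqI

variable {f g : ℝ → ℝ}

theorem setInt_sq_add_le (hf : SqI f) (hg : SqI g) (S : Set ℝ) :
    ∫ x in S, (f x + g x) ^ 2 ≤ 2 * (∫ x in S, f x ^ 2) + 2 * ∫ x in S, g x ^ 2 := by
  rw [← integral_const_mul, ← integral_const_mul, ← integral_add]
  · refine integral_mono (hf.add hg).2.integrableOn
      ((hf.2.integrableOn.const_mul 2).add (hg.2.integrableOn.const_mul 2)) fun x => ?_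
    simp only
    nlinarith [sq_nonneg (f x - g x)]
  · exact hf.2.integrableOn.const_mul 2
  · exact hg.2.integrableOn.const_mul 2

theorem int_sq_add_le (hf : SqI f) (hg : SqI g) :
    ∫ x, (f x + g x) ^ 2 ≤ 2 * (∫ x, f x ^ 2) + 2 * ∫ x, g x ^ 2 := by
  simpa using setInt_sq_add_le hf hg Set.univ

theorem setInt_sq_sub_le (hf : SqI f) (hg : SqI g) (S : Set ℝ) :
    ∫ x in S, (f x - g x) ^ 2 ≤ 2 * (∫ x in S, f x ^ 2) + 2 * ∫ x in S, g x ^ 2 := by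
  simpa [sub_eq_add_neg] using setInt_sq_add_le hf hg.neg S

theorem int_sq_sub_le (hf : SqI f) (hg : SqI g) :
    ∫ x, (f x - g x) ^ 2 ≤ 2 * (∫ x, f x ^ 2) + 2 * ∫ x, g x ^ 2 := by
  simpa using setInt_sq_sub_le hf hg Set.univ

theorem setInt_sq_nonneg (f : ℝ → ℝ) (S : Set ℝ) : 0 ≤ ∫ x in S, f x ^ 2 :=
  integral_nonneg fun _ => sq_nonneg _

theorem int_sq_nonneg (f : ℝ → ℝ) : 0 ≤ ∫ x, f x ^ 2 :=
  integral_nonneg fun _ => sq_nonneg _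

theorem setInt_sq_le (hf : Integrable (fun x => f x ^ 2)) (S : Set ℝ) :
    ∫ x in S, f x ^ 2 ≤ ∫ x, f x ^ 2 :=
  setIntegral_le_integral hf (Eventually.of_forall fun _ => sq_nonneg _)

/-- Pointwise majorisation of squares gives majorisation of integrals. -/
theorem setInt_sq_le_of_le (hf : SqI f) (hg : SqI g) {C : ℝ} {S : Set ℝ} (hS : MeasurableSet S)
    (h : ∀ x ∈ S, f x ^ 2 ≤ C * g x ^ 2) :
    ∫ x in S, f x ^ 2 ≤ C * ∫ x in S, g x ^ 2 := by
  rw [← integral_const_mul]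
  exact setIntegral_mono_on hf.2.integrableOn (hg.2.integrableOn.const_mul C) hS h

theorem int_sq_le_of_le (hf : SqI f) (hg : SqI g) {C : ℝ}
    (h : ∀ x, f x ^ 2 ≤ C * g x ^ 2) :
    ∫ x, f x ^ 2 ≤ C * ∫ x, g x ^ 2 := by
  simpa using setInt_sq_le_of_le hf hg (S := Set.univ) MeasurableSet.univ fun x _ => h x

/-- Cauchy–Schwarz. -/
theorem int_mul_sq_le (hf : SqI f) (hg : SqI g) (S : Set ℝ) :
    (∫ x in S, f x * g x) ^ 2 ≤ (∫ x in S, f x ^ 2) * ∫ x in S, g x ^ 2 := by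
  have key : ∀ s : ℝ, 0 ≤ (∫ x in S, g x ^ 2) * (s * s) + (2 * ∫ x in S, f x * g x) * s
      + ∫ x in S, f x ^ 2 := by
    intro s
    have h := setInt_sq_nonneg (fun x => f x + s * g x) S
    have e : ∫ x in S, (f x + s * g x) ^ 2 = (∫ x in S, g x ^ 2) * (s * s)
        + (2 * ∫ x in S, f x * g x) * s + ∫ x in S, f x ^ 2 := by
      have : (fun x => (f x + s * g x) ^ 2)
          = fun x => (s * s) * g x ^ 2 + (2 * s) * (f x * g x) + f x ^ 2 := by ext x; ring
      rw [this, integral_add, integral_add, integral_const_mul, integral_const_mul]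
      · ring
      · exact hg.2.integrableOn.const_mul _
      · exact (hf.mul_int hg).integrableOn.const_mul _
      · exact (hg.2.integrableOn.const_mul _).add ((hf.mul_int hg).integrableOn.const_mul _)
      · exact hf.2.integrableOn
    rw [e] at h
    exact h
  have := discrim_le_zero key
  unfold discrim at this
  nlinarith

theorem hasDeriv_sq {f' : ℝ → ℝ} (hd : ∀ x, HasDerivAt f (f' x) x) (x : ℝ) : HasDerivAt (fun y => f y ^ 2) (2 * (f x * f' x)) x := by
  have := (hd x).fun_pow 2
  norm_num at this
  rw [← mul_assoc]
  exact this

theorem sq_tendsto_top {f' : ℝ → ℝ} (hf : SqI f) (hf' : SqI f') (hd : ∀ x, HasDerivAt f (f' x) x) : Tendsto (fun x => f x ^ 2) atTop (nhds 0) :=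
  tendsto_zero_of_hasDerivAt_of_integrableOn_Ioi (a := 0) (fun x _ => hasDeriv_sq hd x)
    ((hf.mul_int hf').const_mul 2).integrableOn hf.2.integrableOn

theorem sobolev_Ioi {f' : ℝ → ℝ} (hf : SqI f) (hf' : SqI f') (hd : ∀ x, HasDerivAt f (f' x) x)
    {ε : ℝ} (hε : 0 < ε) (x : ℝ) :
    f x ^ 2 ≤ ε⁻¹ * (∫ y in Set.Ioi x, f y ^ 2) + ε * ∫ y in Set.Ioi x, f' y ^ 2 := by
  have h := integral_Ioi_of_hasDerivAt_of_tendsto' (a := x)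
    (fun y _ => hasDeriv_sq hd y) ((hf.mul_int hf').const_mul 2).integrableOn
    (sq_tendsto_top hf hf' hd)
  have : f x ^ 2 = ∫ y in Set.Ioi x, -(2 * (f y * f' y)) := by
    rw [integral_neg, h]; ring
  rw [this, ← integral_const_mul, ← integral_const_mul, ← integral_add]
  · refine integral_mono ((hf.mul_int hf').const_mul 2).integrableOn.neg
      ((hf.2.integrableOn.const_mul _).add (hf'.2.integrableOn.const_mul _)) fun y => ?_
    have e : ε⁻¹ * f y ^ 2 + ε * f' y ^ 2 + 2 * (f y * f' y) = ε⁻¹ * (f y + ε * f' y) ^ 2 := by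
      field_simp; ring
    have : 0 ≤ ε⁻¹ * (f y + ε * f' y) ^ 2 := by positivity
    simp only; linarith
  · exact hf.2.integrableOn.const_mul _
  · exact hf'.2.integrableOn.const_mul _

theorem sobolev {f' : ℝ → ℝ} (hf : SqI f) (hf' : SqI f') (hd : ∀ x, HasDerivAt f (f' x) x)
    (x : ℝ) : f x ^ 2 ≤ (∫ y, f y ^ 2) + ∫ y, f' y ^ 2 := by
  have := sobolev_Ioi hf hf' hd one_pos x
  have h1 := setInt_sq_le hf.2 (Set.Ioi x)
  have h2 := setInt_sq_le hf'.2 (Set.Ioi x)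
  linarith

end KdV

namespace KdV

theorem param_deriv {f f' : ℝ → ℝ → ℝ} (hf : Continuous (Function.uncurry f))
    (hf' : Continuous (Function.uncurry f'))
    (hd : ∀ t x, HasDerivAt (fun τ => f τ x) (f' t x) t) {R : ℝ}
    (h0 : ∀ t x, R < |x| → f t x = 0) (h0' : ∀ t x, R < |x| → f' t x = 0) (t : ℝ) :
    HasDerivAt (fun τ => ∫ x, f τ x) (∫ x, f' t x) t := by
  have hcomp : IsCompact (Set.Icc (t - 1) (t + 1) ×ˢ Set.Icc (-R) R) :=
    isCompact_Icc.prod isCompact_Icc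
  obtain ⟨C, hC⟩ := hcomp.exists_bound_of_continuousOn hf'.continuousOn
  have hfx : ∀ τ, Continuous (f τ) := fun τ =>
    hf.comp (by fun_prop : Continuous fun x : ℝ => (τ, x))
  have hfx' : ∀ τ, Continuous (f' τ) := fun τ =>
    hf'.comp (by fun_prop : Continuous fun x : ℝ => (τ, x))
  have hcs : HasCompactSupport (f t) := by
    refine HasCompactSupport.of_support_subset_isCompact (isCompact_Icc (a := -R) (b := R)) ?_
    intro x hx
    by_contra hxR
    refine hx (h0 t x ?_)
    by_contra hle
    exact hxR (abs_le.mp (not_lt.mp hle))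
  have hbi : Integrable (Set.indicator (Set.Icc (-R) R) (fun _ => C)) := by
    rw [integrable_indicator_iff measurableSet_Icc]
    exact continuous_const.continuousOn.integrableOn_compact isCompact_Icc
  refine (hasDerivAt_integral_of_dominated_loc_of_deriv_le (F := f) (F' := f')
    (bound := Set.indicator (Set.Icc (-R) R) (fun _ => C)) (Metric.ball_mem_nhds t one_pos)
    (Eventually.of_forall fun τ => (hfx τ).aestronglyMeasurable)
    ((hfx t).integrable_of_hasCompactSupport hcs) (hfx' t).aestronglyMeasurable
    (Eventually.of_forall fun x τ hτ => ?_) hbi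
    (Eventually.of_forall fun x τ _ => hd τ x)).2
  by_cases hx : x ∈ Set.Icc (-R) R
  · rw [Set.indicator_of_mem hx]
    refine hC (τ, x) ⟨?_, hx⟩
    rw [Metric.mem_ball, dist_eq] at hτ
    have := abs_lt.mp hτ
    constructor <;> linarith
  · rw [Set.indicator_of_notMem hx, h0' τ x, norm_zero]
    by_contra hle
    exact hx (abs_le.mp (not_lt.mp hle))

theorem param_cont {f : ℝ → ℝ → ℝ} (hf : Continuous (Function.uncurry f)) {R : ℝ}
    (h0 : ∀ t x, R < |x| → f t x = 0) : Continuous (fun τ => ∫ x, f τ x) := by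
  refine continuous_parametric_integral_of_continuous (μ := volume) (f := f) hf (isCompact_Icc (a := -R) (b := R)) |>.congr ?_
  intro τ
  refine setIntegral_eq_integral_of_forall_compl_eq_zero ?_
  intro x hx
  refine h0 τ x ?_
  by_contra hle
  exact hx (abs_le.mp (not_lt.mp hle))

/-- A smooth cutoff together with its first three derivatives. -/
theorem exists_cutoff : ∃ (χ χ₁ χ₂ χ₃ : ℝ → ℝ) (C : ℝ),
    ContDiff ℝ (⊤ : ℕ∞) χ ∧ (∀ x, HasDerivAt χ (χ₁ x) x) ∧ (∀ x, HasDerivAt χ₁ (χ₂ x) x) ∧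
    (∀ x, HasDerivAt χ₂ (χ₃ x) x) ∧ Continuous χ₃ ∧
    (∀ x, |x| ≤ 1 → χ x = 1) ∧ (∀ x, 0 ≤ χ x ∧ χ x ≤ 1) ∧
    (∀ x, 2 < |x| → χ x = 0 ∧ χ₁ x = 0 ∧ χ₂ x = 0 ∧ χ₃ x = 0) ∧
    (∀ x, |χ₁ x| ≤ C ∧ |χ₃ x| ≤ C) := by
  let b : ContDiffBump (0 : ℝ) := ⟨1, 2, one_pos, one_lt_two⟩
  have hb : ContDiff ℝ (⊤ : ℕ∞) b := b.contDiff
  have hD : ∀ f : ℝ → ℝ, ContDiff ℝ (⊤ : ℕ∞) f → ContDiff ℝ (⊤ : ℕ∞) (deriv f) := fun f hf =>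
    (contDiff_infty_iff_deriv.mp hf).2
  have hdd : ∀ f : ℝ → ℝ, ContDiff ℝ (⊤ : ℕ∞) f → ∀ x, HasDerivAt f (deriv f x) x := fun f hf x =>
    (hf.differentiable (by simp) x).hasDerivAt
  have h1 := hD _ hb
  have h2 := hD _ h1
  have h3 := hD _ h2
  have hz : ∀ f : ℝ → ℝ, (∀ x, 2 < |x| → f x = 0) → ∀ x, 2 < |x| → deriv f x = 0 := by
    intro f hf x hx
    have : f =ᶠ[nhds x] fun _ => 0 := by
      filter_upwards [(isOpen_lt continuous_const continuous_abs).mem_nhds hx] with y hy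
      exact hf y hy
    rw [this.deriv_eq]; simp
  have z0 : ∀ x : ℝ, 2 < |x| → b x = 0 := fun x hx =>
    b.zero_of_le_dist (by simpa [dist_eq] using hx.le)
  have hbd : ∀ f : ℝ → ℝ, Continuous f → (∀ x, 2 < |x| → f x = 0) → ∃ C, ∀ x, |f x| ≤ C := by
    intro f hf h0
    obtain ⟨C, hC⟩ := (isCompact_Icc (a := (-2 : ℝ)) (b := 2)).exists_bound_of_continuousOn
      hf.continuousOn
    refine ⟨C, fun x => ?_⟩
    by_cases hx : x ∈ Set.Icc (-2 : ℝ) 2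
    · exact hC x hx
    · have h00 := h0 x (by
        by_contra hle
        exact hx (abs_le.mp (not_lt.mp hle)))
      rw [h00, abs_zero]
      exact (norm_nonneg _).trans (hC 0 (by constructor <;> norm_num))
  obtain ⟨C1, hC1⟩ := hbd _ h1.continuous (hz _ z0)
  obtain ⟨C3, hC3⟩ := hbd _ h3.continuous (hz _ (hz _ (hz _ z0)))
  refine ⟨b, deriv b, deriv (deriv b), deriv (deriv (deriv b)), max C1 C3, hb, hdd _ hb, hdd _ h1,
    hdd _ h2, h3.continuous, fun x hx => ?_, fun x => ⟨b.nonneg, b.le_one⟩, fun x hx =>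
    ⟨z0 x hx, hz _ z0 x hx, hz _ (hz _ z0) x hx, hz _ (hz _ (hz _ z0)) x hx⟩, fun x =>
    ⟨(hC1 x).trans (le_max_left _ _), (hC3 x).trans (le_max_right _ _)⟩⟩
  exact b.one_of_mem_closedBall (by simpa [Metric.mem_closedBall, dist_eq] using hx)

/-- Integration by parts against a compactly supported weight. -/
theorem ibp_compact {F F' w w' : ℝ → ℝ} (hF : ∀ x, HasDerivAt F (F' x) x) (hF' : Continuous F')
    (hw : ∀ x, HasDerivAt w (w' x) x) (hw' : Continuous w') {R : ℝ}
    (h0 : ∀ x, R < |x| → w x = 0 ∧ w' x = 0) :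
    ∫ x, F' x * w x = - ∫ x, F x * w' x := by
  have cF : Continuous F := continuous_iff_continuousAt.mpr fun x => (hF x).continuousAt
  have cw : Continuous w := continuous_iff_continuousAt.mpr fun x => (hw x).continuousAt
  have hcs : ∀ g h : ℝ → ℝ, Continuous g → Continuous h → (∀ x, R < |x| → h x = 0) →
      Integrable (fun x => g x * h x) := by
    intro g h hg hh hz
    refine (hg.mul hh).integrable_of_hasCompactSupport
      (HasCompactSupport.of_support_subset_isCompact (isCompact_Icc (a := -R) (b := R)) ?_)
    intro x hx
    by_contra hxR
    refine hx ?_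
    have := hz x (by
      by_contra hle
      exact hxR (abs_le.mp (not_lt.mp hle)))
    simp [this]
  have i1 := hcs F' w hF' cw fun x hx => (h0 x hx).1
  have i2 := hcs F w' cF hw' fun x hx => (h0 x hx).2
  have i3 := hcs F w cF cw fun x hx => (h0 x hx).1
  have := integral_eq_zero_of_hasDerivAt_of_integrable (fun x => (hF x).mul (hw x)) (i1.add i2) i3
  have e : ∫ x, (F' x * w x + F x * w' x) = 0 := this
  rw [integral_add i1 i2] at e
  linarith

/-- Integrated form of a conservation law with remainder. -/
theorem conservation {e F P H : ℝ → ℝ → ℝ} (se : Sm e) (sF : Sm F) (sP : Sm P) (sH : Sm H)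
    (hlaw : ∀ t x, Dt e t x = Dx F t x + Dx (Dx (Dx P)) t x + H t x) {s t C B : ℝ} (hst : s ≤ t)
    (he_s : Integrable (e s)) (he_t : Integrable (e t))
    (hF : ∀ τ ∈ Set.Icc s t, Integrable (F τ) ∧ ∫ x, |F τ x| ≤ C)
    (hP : ∀ τ ∈ Set.Icc s t, Integrable (P τ) ∧ ∫ x, |P τ x| ≤ C)
    (hH : ∀ τ ∈ Set.Icc s t, Integrable (H τ) ∧ ∫ x, |H τ x| ≤ C ∧ ∫ x, H τ x ≤ B) :
    (∫ x, e t x) - ∫ x, e s x ≤ B * (t - s) := by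
  obtain ⟨χ, χ₁, χ₂, χ₃, K, sχ, d1, d2, d3, c3, hone, h01, hz, hK⟩ := exists_cutoff
  have c0 : Continuous χ := sχ.continuous
  have c1 : Continuous χ₁ := continuous_iff_continuousAt.mpr fun x => (d2 x).continuousAt
  have c2 : Continuous χ₂ := continuous_iff_continuousAt.mpr fun x => (d3 x).continuousAt
  have K0 : 0 ≤ K := (abs_nonneg _).trans (hK 0).1
  have C0 : 0 ≤ C := (integral_nonneg fun _ => abs_nonneg _).trans (hF s ⟨le_rfl, hst⟩).2
  -- integrability and limits against the cutoffs
  have bint : ∀ (g : ℝ → ℝ), Integrable g → ∀ (w : ℝ → ℝ) (M : ℝ), Continuous w →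
      (∀ x, |w x| ≤ M) → Integrable (fun x => g x * w x) := by
    intro g hg w M hw hM
    exact hg.mul_bdd (c := M) hw.aestronglyMeasurable (Eventually.of_forall fun x => by simpa using hM x)
  have bbound : ∀ (g : ℝ → ℝ), Integrable g → ∀ (w : ℝ → ℝ) (M : ℝ), Continuous w →
      (∀ x, |w x| ≤ M) → |∫ x, g x * w x| ≤ M * ∫ x, |g x| := by
    intro g hg w M hw hM
    refine (abs_integral_le_integral_abs).trans ?_
    rw [← integral_const_mul]
    refine integral_mono (bint g hg w M hw hM).abs (hg.abs.const_mul M) fun x => ?_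
    simp only [abs_mul]
    rw [mul_comm]
    exact mul_le_mul_of_nonneg_right (hM x) (abs_nonneg _)
  have lim : ∀ g : ℝ → ℝ, Integrable g →
      Tendsto (fun n : ℕ => ∫ x, g x * χ (x / (n + 1))) atTop (nhds (∫ x, g x)) := by
    intro g hg
    refine tendsto_integral_of_dominated_convergence (fun x => |g x|) (fun n => ?_) hg.abs
      (fun n => Eventually.of_forall fun x => ?_) (Eventually.of_forall fun x => ?_)
    · exact hg.1.mul (c0.comp (by fun_prop)).aestronglyMeasurable
    · rw [norm_mul]
      refine mul_le_of_le_one_right (norm_nonneg _) ?_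
      rw [norm_eq_abs, abs_of_nonneg (h01 _).1]; exact (h01 _).2
    · obtain ⟨N, hN⟩ := exists_nat_gt |x|
      refine tendsto_const_nhds.congr' ?_
      filter_upwards [eventually_ge_atTop N] with n hn
      rw [hone, mul_one]
      have hn' : (N : ℝ) ≤ n := Nat.cast_le.mpr hn
      rw [abs_div, abs_of_pos (by positivity : (0 : ℝ) < n + 1), div_le_one (by positivity)]
      linarith
  -- evolution against the cutoff
  have main : ∀ n : ℕ, (∫ x, e t x * χ (x / (n + 1))) - ∫ x, e s x * χ (x / (n + 1)) ≤
      (2 * K * C / (n + 1)) * (t - s) + ∫ τ in s..t, max (∫ x, H τ x * χ (x / (n + 1))) B := by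
    intro n
    set ρ : ℝ := (n + 1 : ℝ) with hρ
    have ρ1 : 1 ≤ ρ := by rw [hρ]; linarith [Nat.cast_nonneg (α := ℝ) n]
    have ρ0 : 0 < ρ := by linarith
    have far : ∀ x : ℝ, 2 * ρ < |x| → 2 < |x / ρ| := by
      intro x hx
      rw [abs_div, abs_of_pos ρ0, lt_div_iff₀ ρ0]; exact hx
    have hsc : ∀ g g' : ℝ → ℝ, (∀ x, HasDerivAt g (g' x) x) →
        ∀ x, HasDerivAt (fun y => g (y / ρ)) (g' (x / ρ) / ρ) x := by
      intro g g' hg x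
      have := (hg (x / ρ)).comp x ((hasDerivAt_id x).div_const ρ)
      rw [show g' (x / ρ) / ρ = g' (id x / ρ) * (1 / ρ) by simp [div_eq_mul_inv]]
      exact this
    have e1 := hsc _ _ d1
    have e2 : ∀ x, HasDerivAt (fun y => χ₁ (y / ρ) / ρ) (χ₂ (x / ρ) / ρ / ρ) x := fun x =>
      (hsc _ _ d2 x).div_const ρ
    have e3 : ∀ x, HasDerivAt (fun y => χ₂ (y / ρ) / ρ / ρ) (χ₃ (x / ρ) / ρ / ρ / ρ) x := fun x =>
      ((hsc _ _ d3 x).div_const ρ).div_const ρ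
    have hGd : ∀ τ, HasDerivAt (fun τ => ∫ x, e τ x * χ (x / ρ))
        (∫ x, Dt e τ x * χ (x / ρ)) τ := by
      intro τ
      refine param_deriv (f := fun τ x => e τ x * χ (x / ρ)) (f' := fun τ x => Dt e τ x * χ (x / ρ))
        (se.cont.mul (c0.comp (by fun_prop))) (se.dt.cont.mul (c0.comp (by fun_prop)))
        (fun τ x => (se.hasDt τ x).mul_const _) (R := 2 * ρ) ?_ ?_ τ
      · intro τ x hx; simp [(hz _ (far x hx)).1]
      · intro τ x hx; simp [(hz _ (far x hx)).1]
    have hGc : Continuous (fun τ => ∫ x, Dt e τ x * χ (x / ρ)) :=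
      param_cont (f := fun τ x => Dt e τ x * χ (x / ρ)) (R := 2 * ρ)
        (se.dt.cont.mul (c0.comp (by fun_prop)))
        (fun τ x hx => by simp [(hz _ (far x hx)).1])
    have hHc : Continuous (fun τ => ∫ x, H τ x * χ (x / ρ)) :=
      param_cont (f := fun τ x => H τ x * χ (x / ρ)) (R := 2 * ρ)
        (sH.cont.mul (c0.comp (by fun_prop)))
        (fun τ x hx => by simp [(hz _ (far x hx)).1])
    have split : ∀ τ, ∫ x, Dt e τ x * χ (x / ρ) =
        -(∫ x, F τ x * (χ₁ (x / ρ) / ρ)) - (∫ x, P τ x * (χ₃ (x / ρ) / ρ / ρ / ρ))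
          + ∫ x, H τ x * χ (x / ρ) := by
      intro τ
      have z1 : ∀ x, 2 * ρ < |x| → χ (x / ρ) = 0 ∧ χ₁ (x / ρ) / ρ = 0 := fun x hx => by
        simp [hz _ (far x hx)]
      have z2 : ∀ x, 2 * ρ < |x| → χ₁ (x / ρ) / ρ = 0 ∧ χ₂ (x / ρ) / ρ / ρ = 0 := fun x hx => by
        simp [hz _ (far x hx)]
      have z3 : ∀ x, 2 * ρ < |x| → χ₂ (x / ρ) / ρ / ρ = 0 ∧ χ₃ (x / ρ) / ρ / ρ / ρ = 0 :=
        fun x hx => by simp [hz _ (far x hx)]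
      have k1 : Continuous fun x => χ₁ (x / ρ) / ρ := by fun_prop
      have k2 : Continuous fun x => χ₂ (x / ρ) / ρ / ρ := by fun_prop
      have k3 : Continuous fun x => χ₃ (x / ρ) / ρ / ρ / ρ := by fun_prop
      have i1 := ibp_compact (sF.hasDx τ) (sF.dx.cont_x τ) e1 k1 z1
      have p1 := ibp_compact (sP.dx.dx.hasDx τ) (sP.dx.dx.dx.cont_x τ) e1 k1 z1
      have p2 := ibp_compact (sP.dx.hasDx τ) (sP.dx.dx.cont_x τ) e2 k2 z2
      have p3 := ibp_compact (sP.hasDx τ) (sP.dx.cont_x τ) e3 k3 z3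
      have ci : ∀ g : ℝ → ℝ, Continuous g → Integrable (fun x => g x * χ (x / ρ)) := by
        intro g hg
        refine (hg.mul (c0.comp (by fun_prop))).integrable_of_hasCompactSupport
          (HasCompactSupport.of_support_subset_isCompact
            (isCompact_Icc (a := -(2 * ρ)) (b := 2 * ρ)) ?_)
        intro x hx
        by_contra hxR
        refine hx ?_
        have := (z1 x (by
          by_contra hle
          exact hxR (abs_le.mp (not_lt.mp hle)))).1
        simp [this]
      have : (fun x => Dt e τ x * χ (x / ρ)) = fun x => Dx F τ x * χ (x / ρ)
          + Dx (Dx (Dx P)) τ x * χ (x / ρ) + H τ x * χ (x / ρ) := by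
        ext x; rw [hlaw]; ring
      have hs : Integrable (fun x => Dx F τ x * χ (x / ρ) + Dx (Dx (Dx P)) τ x * χ (x / ρ)) :=
        (ci _ (sF.dx.cont_x τ)).add (ci _ (sP.dx.dx.dx.cont_x τ))
      rw [this, integral_add hs
        (ci _ (sH.cont_x τ)), integral_add (ci _ (sF.dx.cont_x τ)) (ci _ (sP.dx.dx.dx.cont_x τ)),
        i1, p1, p2, p3]
      ring
    have ftc := intervalIntegral.integral_eq_sub_of_hasDerivAt (a := s) (b := t)
      (fun τ _ => hGd τ) (hGc.intervalIntegrable s t)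
    rw [← ftc, ← sub_nonneg]
    have hmax : Continuous fun τ => max (∫ x, H τ x * χ (x / ρ)) B := hHc.max continuous_const
    have hle : ∫ τ in s..t, (∫ x, Dt e τ x * χ (x / ρ)) ≤
        ∫ τ in s..t, (2 * K * C / ρ + max (∫ x, H τ x * χ (x / ρ)) B) := by
      refine intervalIntegral.integral_mono_on hst (hGc.intervalIntegrable s t)
        ((continuous_const.add hmax).intervalIntegrable s t) fun τ hτ => ?_
      rw [split τ]
      have b1 := bbound (F τ) (hF τ hτ).1 (fun x => χ₁ (x / ρ) / ρ) (K / ρ) (by fun_prop)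
        (fun x => by
          rw [abs_div, abs_of_pos ρ0]; gcongr; exact (hK _).1)
      have b2 := bbound (P τ) (hP τ hτ).1 (fun x => χ₃ (x / ρ) / ρ / ρ / ρ) (K / ρ) (by fun_prop)
        (fun x => by
          rw [abs_div, abs_div, abs_div, abs_of_pos ρ0]
          have : |χ₃ (x / ρ)| / ρ / ρ ≤ K := by
            rw [div_div]
            refine (div_le_self (abs_nonneg _) (by nlinarith)).trans (hK _).2
          gcongr)
      have q1 : K / ρ * ∫ x, |F τ x| ≤ K / ρ * C :=
        mul_le_mul_of_nonneg_left (hF τ hτ).2 (by positivity)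
      have q2 : K / ρ * ∫ x, |P τ x| ≤ K / ρ * C :=
        mul_le_mul_of_nonneg_left (hP τ hτ).2 (by positivity)
      have q3 : 2 * K * C / ρ = K / ρ * C + K / ρ * C := by ring
      have := (abs_le.mp b1).1
      have := (abs_le.mp b2).1
      have := le_max_left (∫ x, H τ x * χ (x / ρ)) B
      linarith
    rw [intervalIntegral.integral_add (by simp) (hmax.intervalIntegrable s t)] at hle
    simp only [intervalIntegral.integral_const, smul_eq_mul] at hle
    linarith
  have l1 := (lim _ he_t).sub (lim _ he_s)
  have l2 : Tendsto (fun n : ℕ => (2 * K * C / (n + 1)) * (t - s)) atTop (nhds (0 * (t - s))) := by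
    refine Tendsto.mul_const _ ?_
    refine Tendsto.div_atTop tendsto_const_nhds ?_
    exact tendsto_atTop_add_const_right _ _ tendsto_natCast_atTop_atTop
  have l3 : Tendsto (fun n : ℕ => ∫ τ in s..t, max (∫ x, H τ x * χ (x / (n + 1))) B) atTop
      (nhds (∫ τ in s..t, B)) := by
    refine intervalIntegral.tendsto_integral_filter_of_dominated_convergence
      (fun _ => C + |B|) (Eventually.of_forall fun n => ?_) (Eventually.of_forall fun n => ?_)
      (by simp) (Eventually.of_forall fun τ hτ => ?_)
    · refine Continuous.aestronglyMeasurable ?_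
      refine Continuous.max (param_cont (f := fun τ x => H τ x * χ (x / (n + 1)))
        (R := 2 * (n + 1)) (sH.cont.mul (c0.comp (by fun_prop))) fun τ x hx => ?_) continuous_const
      have : 2 < |x / (n + 1)| := by
        rw [abs_div, abs_of_pos (by positivity : (0 : ℝ) < n + 1), lt_div_iff₀ (by positivity)]
        exact hx
      simp [(hz _ this).1]
    · refine Eventually.of_forall fun τ hτ => ?_
      rw [Set.uIoc_of_le hst] at hτ
      have hτ' : τ ∈ Set.Icc s t := ⟨hτ.1.le, hτ.2⟩
      have b := bbound (H τ) (hH τ hτ').1 (fun x => χ (x / (n + 1))) 1 (by fun_prop)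
        (fun x => by rw [abs_of_nonneg (h01 _).1]; exact (h01 _).2)
      have := (hH τ hτ').2.1
      rw [norm_eq_abs]
      refine abs_max_le_max_abs_abs.trans (max_le ?_ ?_)
      · linarith [abs_nonneg B]
      · linarith
    · rw [Set.uIoc_of_le hst] at hτ
      have hτ' : τ ∈ Set.Icc s t := ⟨hτ.1.le, hτ.2⟩
      have := (lim _ (hH τ hτ').1).max (tendsto_const_nhds (x := B))
      rwa [max_eq_right (hH τ hτ').2.2] at this
  have := le_of_tendsto_of_tendsto' l1 (l2.add l3) main
  simp only [intervalIntegral.integral_const, smul_eq_mul] at this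
  linarith

end KdV

namespace KdV

/-- Local boundedness at a point. -/
def LocB (f : ℝ → ℝ) (t : ℝ) : Prop := ∃ C, ∀ᶠ τ in nhds t, f τ ≤ C

theorem LocB.bdd_Icc {f : ℝ → ℝ} {a b : ℝ} (h : ∀ τ ∈ Set.Icc a b, LocB f τ) :
    ∃ C, ∀ τ ∈ Set.Icc a b, f τ ≤ C := by
  refine (isCompact_Icc (a := a) (b := b)).induction_on (p := fun s => ∃ C, ∀ τ ∈ s, f τ ≤ C)
    ⟨0, by simp⟩ (fun s t hst ⟨C, hC⟩ => ⟨C, fun τ hτ => hC τ (hst hτ)⟩)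
    (fun s t ⟨C, hC⟩ ⟨D, hD⟩ => ⟨max C D, fun τ hτ => ?_⟩) (fun τ hτ => ?_)
  · rcases hτ with hτ | hτ
    · exact (hC τ hτ).trans (le_max_left _ _)
    · exact (hD τ hτ).trans (le_max_right _ _)
  · obtain ⟨C, hC⟩ := h τ hτ
    exact ⟨{τ | f τ ≤ C}, mem_nhdsWithin_of_mem_nhds hC, C, fun _ h => h⟩

/-- The growth hypotheses on a pair (low norm, top seminorm). -/
structure Growth (p q : ℝ → ℝ) : Prop where
  p_nonneg : ∀ t, 0 ≤ p t
  q_nonneg : ∀ t, 0 ≤ q t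
  low : ∀ C, ∃ M, ∀ s t, p s + q s ≤ C → (∃ B, ∀ τ ∈ Set.uIcc s t, p τ + q τ ≤ B) → p t ≤ M
  top : ∀ M, ∃ K, 0 ≤ K ∧ ∀ s t G, (∀ τ ∈ Set.uIcc s t, p τ ≤ M ∧ q τ ≤ G) →
    q t ≤ q s + K * (1 + G) * |t - s|

theorem Growth.neg {p q : ℝ → ℝ} (h : Growth p q) : Growth (fun t => p (-t)) (fun t => q (-t)) := by
  have key : ∀ s t τ : ℝ, τ ∈ Set.uIcc (-s) (-t) → -τ ∈ Set.uIcc s t := by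
    intro s t τ hτ
    rw [Set.mem_uIcc] at hτ ⊢
    rcases hτ with h | h
    · right; constructor <;> linarith
    · left; constructor <;> linarith
  refine ⟨fun t => h.p_nonneg _, fun t => h.q_nonneg _, fun C => ?_, fun M => ?_⟩
  · obtain ⟨M, hM⟩ := h.low C
    refine ⟨M, fun s t hs ⟨B, hB⟩ => hM (-s) (-t) hs ⟨B, fun τ hτ => ?_⟩⟩
    simpa using hB (-τ) (key s t τ hτ)
  · obtain ⟨K, hK0, hK⟩ := h.top M
    refine ⟨K, hK0, fun s t G hG => ?_⟩
    have := hK (-s) (-t) G fun τ hτ => by simpa using hG (-τ) (key s t τ hτ)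
    have e : |-t - -s| = |t - s| := by rw [← abs_neg]; ring_nf
    rwa [e] at this

/-- On a short interval the top seminorm at most doubles. -/
theorem Growth.short {p q : ℝ → ℝ} (h : Growth p q) {M K s t : ℝ} (hK0 : 0 ≤ K)
    (hK : ∀ s t G, (∀ τ ∈ Set.uIcc s t, p τ ≤ M ∧ q τ ≤ G) → q t ≤ q s + K * (1 + G) * |t - s|)
    (hp : ∀ τ ∈ Set.uIcc s t, p τ ≤ M) (hq : ∃ B, ∀ τ ∈ Set.uIcc s t, q τ ≤ B)
    (hst : K * |t - s| ≤ 1 / 2) : q t ≤ 2 * q s + 1 := by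
  set S := q '' Set.uIcc s t
  have hb : BddAbove S := by
    obtain ⟨B, hB⟩ := hq
    exact ⟨B, by rintro _ ⟨τ, hτ, rfl⟩; exact hB τ hτ⟩
  have hne : S.Nonempty := ⟨_, s, Set.left_mem_uIcc, rfl⟩
  set G := sSup S
  have hG : ∀ τ ∈ Set.uIcc s t, q τ ≤ G := fun τ hτ => le_csSup hb ⟨τ, hτ, rfl⟩
  have hG0 : 0 ≤ G := (h.q_nonneg s).trans (hG s Set.left_mem_uIcc)
  have hle : G ≤ q s + (1 + G) * (1 / 2) := by
    refine csSup_le hne ?_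
    rintro _ ⟨τ, hτ, rfl⟩
    have hsub : Set.uIcc s τ ⊆ Set.uIcc s t := Set.uIcc_subset_uIcc Set.left_mem_uIcc hτ
    have h1 := hK s τ G fun r hr => ⟨hp r (hsub hr), hG r (hsub hr)⟩
    have h2 : |τ - s| ≤ |t - s| := by
      have := Set.abs_sub_left_of_mem_uIcc hτ
      rwa [abs_sub_comm τ s, abs_sub_comm t s, abs_sub_comm s τ, abs_sub_comm s t]
    have h3 : K * |τ - s| ≤ 1 / 2 := (mul_le_mul_of_nonneg_left h2 hK0).trans hst
    nlinarith
  have := hG t Set.right_mem_uIcc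
  linarith

theorem Growth.right {p q : ℝ → ℝ} (h : Growth p q) (C : ℝ) : ∃ τ₀ > 0, ∃ C', ∀ a t, a < t →
    t - a ≤ τ₀ → p a + q a ≤ C → (∀ τ ∈ Set.Ioc a t, LocB (fun r => p r + q r) τ) →
    p t + q t ≤ C' := by
  obtain ⟨M, hM⟩ := h.low C
  obtain ⟨K, hK0, hK⟩ := h.top M
  refine ⟨1 / (2 * (K + 1)), by positivity, M + (2 * C + 1), fun a t hat hta hC hloc => ?_⟩
  -- boundedness up to the left endpoint
  have hbdd : ∃ B, ∀ τ ∈ Set.Icc a t, p τ + q τ ≤ B := by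
    obtain ⟨M', hM'⟩ := h.low (p t + q t)
    have hr : ∀ r, a < r → ∃ B, ∀ τ ∈ Set.Icc r t, p τ + q τ ≤ B := fun r har =>
      LocB.bdd_Icc fun τ hτ => hloc τ ⟨har.trans_le hτ.1, hτ.2⟩
    have hp : ∀ r ∈ Set.Ioc a t, p r ≤ M' := fun r hr' => by
      refine hM' t r le_rfl ?_
      rw [Set.uIcc_of_ge hr'.2]
      exact hr r hr'.1
    obtain ⟨K', hK0', hK'⟩ := h.top M'
    set t₁ := min t (a + 1 / (2 * (K' + 1))) with ht1
    have hpos : 0 < 1 / (2 * (K' + 1)) := by positivity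
    have hat1 : a < t₁ := lt_min hat (by linarith)
    have ht1t : t₁ ≤ t := min_le_left _ _
    obtain ⟨B, hB⟩ := hr t₁ hat1
    refine ⟨max (max (p a + q a) B) (M' + (2 * q t₁ + 1)), fun τ hτ => ?_⟩
    rcases eq_or_lt_of_le hτ.1 with rfl | h1
    · exact (le_max_left _ _).trans (le_max_left _ _)
    rcases le_or_gt t₁ τ with h2 | h2
    · exact (hB τ ⟨h2, hτ.2⟩).trans ((le_max_right _ _).trans (le_max_left _ _))
    refine le_trans (add_le_add (hp τ ⟨h1, hτ.2⟩) ?_) (le_max_right _ _)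
    have hu : Set.uIcc t₁ τ = Set.Icc τ t₁ := Set.uIcc_of_ge h2.le
    refine h.short hK0' hK' (fun r hr' => ?_) ?_ ?_
    · rw [hu] at hr'
      exact hp r ⟨h1.trans_le hr'.1, hr'.2.trans ht1t⟩
    · obtain ⟨D, hD⟩ := hr τ h1
      refine ⟨D, fun r hr' => ?_⟩
      rw [hu] at hr'
      have := hD r ⟨hr'.1, hr'.2.trans ht1t⟩
      linarith [h.p_nonneg r]
    · rw [abs_sub_comm, abs_of_nonneg (by linarith)]
      have : t₁ ≤ a + 1 / (2 * (K' + 1)) := min_le_right _ _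
      have e : (K' + 1) * (1 / (2 * (K' + 1))) = 1 / 2 := by field_simp
      have : t₁ - τ ≤ 1 / (2 * (K' + 1)) := by linarith
      nlinarith
  have hu : Set.uIcc a t = Set.Icc a t := Set.uIcc_of_le hat.le
  have hp : ∀ τ ∈ Set.Icc a t, p τ ≤ M := fun τ hτ => by
    refine hM a τ hC ?_
    obtain ⟨B, hB⟩ := hbdd
    refine ⟨B, fun r hr => hB r ?_⟩
    rw [Set.uIcc_of_le hτ.1] at hr
    exact ⟨hr.1, hr.2.trans hτ.2⟩
  have := h.short (s := a) (t := t) hK0 hK (by rwa [hu]) (by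
    obtain ⟨B, hB⟩ := hbdd
    refine ⟨B, fun r hr => ?_⟩
    rw [hu] at hr
    linarith [hB r hr, h.p_nonneg r]) (by
    rw [abs_of_nonneg (by linarith)]
    have e : (K + 1) * (1 / (2 * (K + 1))) = 1 / 2 := by field_simp
    nlinarith)
  have h2 := hp t ⟨hat.le, le_rfl⟩
  linarith [h.p_nonneg a]

theorem Growth.left {p q : ℝ → ℝ} (h : Growth p q) (C : ℝ) : ∃ τ₀ > 0, ∃ C', ∀ a t, t < a →
    a - t ≤ τ₀ → p a + q a ≤ C → (∀ τ ∈ Set.Ico t a, LocB (fun r => p r + q r) τ) →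
    p t + q t ≤ C' := by
  obtain ⟨τ₀, h0, C', hC'⟩ := h.neg.right C
  refine ⟨τ₀, h0, C', fun a t hta hle hC hloc => ?_⟩
  have := hC' (-a) (-t) (by linarith) (by linarith) (by simpa using hC) fun τ hτ => by
    obtain ⟨D, hD⟩ := hloc (-τ) ⟨by linarith [hτ.2], by linarith [hτ.1]⟩
    exact ⟨D, (continuous_neg.tendsto τ).eventually hD⟩
  simpa using this

theorem Growth.locB {p q : ℝ → ℝ} (h : Growth p q) (hcl : ∀ C, IsClosed {t | p t + q t ≤ C})
    (t : ℝ) : LocB (fun r => p r + q r) t := by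
  set f := fun r => p r + q r
  set E : Set ℝ := {t | ¬ LocB f t} with hE
  have hop : IsOpen {t | LocB f t} := by
    rw [isOpen_iff_mem_nhds]
    rintro τ ⟨C, hC⟩
    filter_upwards [eventually_eventually_nhds.mpr hC] with r hr
    exact ⟨C, hr⟩
  have hEc : IsClosed E := hop.isClosed_compl
  by_contra ht
  have : CompleteSpace E := hEc.completeSpace_coe
  have : Nonempty E := ⟨⟨t, ht⟩⟩
  obtain ⟨n, e, he⟩ := nonempty_interior_of_iUnion_of_closed
    (f := fun n : ℕ => {x : E | f x ≤ n}) (fun n => (hcl n).preimage continuous_subtype_val) (by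
      rw [Set.eq_univ_iff_forall]
      intro x
      obtain ⟨n, hn⟩ := exists_nat_ge (f x)
      exact Set.mem_iUnion.mpr ⟨n, hn⟩)
  rw [mem_interior_iff_mem_nhds, Metric.mem_nhds_iff] at he
  obtain ⟨ε, hε, hball⟩ := he
  have hball' : ∀ x ∈ E, |x - e| < ε → f x ≤ n := fun x hx hxe =>
    hball (show (⟨x, hx⟩ : E) ∈ Metric.ball e ε from hxe)
  obtain ⟨τ₁, h1, C₁, hC₁⟩ := h.right n
  obtain ⟨τ₂, h2, C₂, hC₂⟩ := h.left n
  refine e.2 ⟨max n (max C₁ C₂), ?_⟩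
  have hδ : 0 < min ε (min τ₁ τ₂) := lt_min hε (lt_min h1 h2)
  filter_upwards [Metric.ball_mem_nhds (e : ℝ) hδ] with r hr
  rw [Metric.mem_ball, dist_eq] at hr
  have hr1 : |r - e| < ε := hr.trans_le (min_le_left _ _)
  have hr2 : |r - e| < τ₁ := hr.trans_le ((min_le_right _ _).trans (min_le_left _ _))
  have hr3 : |r - e| < τ₂ := hr.trans_le ((min_le_right _ _).trans (min_le_right _ _))
  by_cases hrE : r ∈ E
  · exact (hball' r hrE hr1).trans (le_max_left _ _)
  rcases lt_trichotomy r e with hlt | heq | hlt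
  · rw [abs_of_neg (by linarith)] at hr1 hr2 hr3
    set A := E ∩ Set.Icc r e
    have hAc : IsCompact A := isCompact_Icc.inter_left hEc
    have hAn : A.Nonempty := ⟨e, e.2, hlt.le, le_rfl⟩
    have ha := hAc.sInf_mem hAn
    set a := sInf A
    have har : r < a := lt_of_le_of_ne ha.2.1 fun h => hrE (h ▸ ha.1)
    have hfa : f a ≤ n := hball' a ha.1 (by rw [abs_sub_comm, abs_of_nonneg] <;> linarith [ha.2.2])
    refine (hC₂ a r har (by linarith [ha.2.2]) hfa fun τ hτ => ?_).trans
      ((le_max_right _ _).trans (le_max_right _ _))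
    by_contra hcon
    have : a ≤ τ := csInf_le hAc.bddBelow ⟨hcon, hτ.1, hτ.2.le.trans ha.2.2⟩
    linarith [hτ.2]
  · exact absurd e.2 (heq ▸ hrE)
  · rw [abs_of_pos (by linarith)] at hr1 hr2 hr3
    set A := E ∩ Set.Icc e r
    have hAc : IsCompact A := isCompact_Icc.inter_left hEc
    have hAn : A.Nonempty := ⟨e, e.2, le_rfl, hlt.le⟩
    have ha := hAc.sSup_mem hAn
    set a := sSup A
    have har : a < r := lt_of_le_of_ne ha.2.2 fun h => hrE (h ▸ ha.1)
    have hfa : f a ≤ n := hball' a ha.1 (by rw [abs_of_nonneg] <;> linarith [ha.2.1])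
    refine (hC₁ a r har (by linarith [ha.2.1]) hfa fun τ hτ => ?_).trans
      ((le_max_left _ _).trans (le_max_right _ _))
    by_contra hcon
    have : τ ≤ a := le_csSup hAc.bddAbove ⟨hcon, ha.2.1.trans hτ.1.le, hτ.2⟩
    linarith [hτ.1]

theorem Growth.bounded {p q : ℝ → ℝ} (h : Growth p q) (hcl : ∀ C, IsClosed {t | p t + q t ≤ C})
    (T : ℝ) : ∃ C, ∀ t, |t| ≤ T → p t + q t ≤ C := by
  obtain ⟨C, hC⟩ := LocB.bdd_Icc (a := -T) (b := T) fun τ _ => h.locB hcl τ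
  exact ⟨C, fun t ht => hC t (abs_le.mp ht)⟩

end KdV

namespace KdV

set_option linter.unusedSimpArgs false

/-- Smooth solutions of the normalised KdV equation. -/
structure Sol (V : ℝ → ℝ → ℝ) : Prop where
  sm : Sm V
  eq : ∀ t x, Dt V t x = 6 * V t x * Dx V t x - Dx (Dx (Dx V)) t x

namespace Sol

variable {V : ℝ → ℝ → ℝ}

theorem Dt_eq (h : Sol V) : Dt V = fun t x => 6 * V t x * Dx V t x - Dx (Dx (Dx V)) t x := by
  ext t x; exact h.eq t x

theorem Dt1 (h : Sol V) : Dt (Dx V) = fun t x => 6 * Dx V t x ^ 2 + 6 * V t x * Dx (Dx V) t x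
    - Dx (Dx (Dx (Dx V))) t x := by
  have s0 := h.sm
  rw [s0.comm', h.Dt_eq]
  simp (maxDischargeDepth := 20) only [Sm.Dx_sub, Sm.Dx_mul, Sm.Dx_const, Sm.mul, Sm.const, s0, s0.dx, s0.dx.dx.dx]
  ext t x; ring

theorem Dt2 (h : Sol V) : Dt (Dx (Dx V)) = fun t x => 18 * Dx V t x * Dx (Dx V) t x
    + 6 * V t x * Dx (Dx (Dx V)) t x - Dx (Dx (Dx (Dx (Dx V)))) t x := by
  have s0 := h.sm
  rw [s0.dx.comm', h.Dt1]
  simp (maxDischargeDepth := 20) only [Sm.Dx_sub, Sm.Dx_add, Sm.Dx_mul, Sm.Dx_pow, Sm.Dx_const, Sm.add, Sm.mul, Sm.pow,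
    Sm.const, s0, s0.dx, s0.dx.dx, s0.dx.dx.dx.dx]
  ext t x; norm_num; ring

theorem law0 (h : Sol V) (t x : ℝ) : Dt (fun t x => V t x ^ 2) t x =
    Dx (fun t x => 3 * Dx V t x ^ 2 + 4 * V t x ^ 3) t x
    + Dx (Dx (Dx (fun t x => - V t x ^ 2))) t x := by
  have s0 := h.sm
  simp (maxDischargeDepth := 20) only [Sm.Dx_sub, Sm.Dx_add, Sm.Dx_mul, Sm.Dx_pow, Sm.Dx_neg, Sm.Dx_const, Sm.Dt_pow, Sm.add,
    Sm.mul, Sm.pow, Sm.neg, Sm.const, s0, s0.dx, s0.dx.dx, h.Dt_eq]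
  norm_num; ring

theorem law1 (h : Sol V) (t x : ℝ) : Dt (fun t x => (1 / 2) * Dx V t x ^ 2 + V t x ^ 3) t x =
    Dx (fun t x => -3 * V t x ^ 2 * Dx (Dx V) t x + (3 / 2) * Dx (Dx V) t x ^ 2
      + 6 * V t x * Dx V t x ^ 2 + (9 / 2) * V t x ^ 4) t x
    + Dx (Dx (Dx (fun t x => (-1 / 2) * Dx V t x ^ 2))) t x := by
  have s0 := h.sm
  simp (maxDischargeDepth := 20) only [Sm.Dx_sub, Sm.Dx_add, Sm.Dx_mul, Sm.Dx_pow, Sm.Dx_neg, Sm.Dx_const, Sm.Dt_pow,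
    Sm.Dt_add, Sm.Dt_mul, Sm.Dt_const, Sm.add,
    Sm.mul, Sm.pow, Sm.neg, Sm.const, s0, s0.dx, s0.dx.dx, s0.dx.dx.dx, h.Dt_eq, h.Dt1]
  norm_num; ring

theorem law2 (h : Sol V) (t x : ℝ) :
    Dt (fun t x => Dx (Dx V) t x ^ 2 + 10 * V t x * Dx V t x ^ 2 + 5 * V t x ^ 4) t x =
    Dx (fun t x => -20 * V t x * Dx V t x * Dx (Dx (Dx V)) t x + 3 * Dx (Dx (Dx V)) t x ^ 2
      + 10 * Dx V t x ^ 2 * Dx (Dx V) t x + -20 * V t x ^ 3 * Dx (Dx V) t x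
      + 16 * V t x * Dx (Dx V) t x ^ 2 + 90 * V t x ^ 2 * Dx V t x ^ 2 + 24 * V t x ^ 5) t x
    + Dx (Dx (Dx (fun t x => - Dx (Dx V) t x ^ 2))) t x := by
  have s0 := h.sm
  simp (maxDischargeDepth := 20) only [Sm.Dx_sub, Sm.Dx_add, Sm.Dx_mul, Sm.Dx_pow, Sm.Dx_neg, Sm.Dx_const, Sm.Dt_pow,
    Sm.Dt_add, Sm.Dt_mul, Sm.Dt_const, Sm.add,
    Sm.mul, Sm.pow, Sm.neg, Sm.const, s0, s0.dx, s0.dx.dx, s0.dx.dx.dx, s0.dx.dx.dx.dx, h.Dt_eq,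
    h.Dt1, h.Dt2]
  norm_num; ring

end Sol

end KdV

namespace KdV

set_option linter.unusedSimpArgs false

theorem conservation_dom {e F P H : ℝ → ℝ → ℝ} (se : Sm e) (sF : Sm F) (sP : Sm P) (sH : Sm H)
    (hlaw : ∀ t x, Dt e t x = Dx F t x + Dx (Dx (Dx P)) t x + H t x) {s t C B : ℝ}
    {w : ℝ → ℝ → ℝ} (he : ∀ τ, Integrable (e τ))
    (hw : ∀ τ ∈ Set.uIcc s t, Integrable (w τ) ∧ ∫ x, w τ x ≤ C)
    (hF : ∀ τ ∈ Set.uIcc s t, ∀ x, |F τ x| ≤ w τ x)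
    (hP : ∀ τ ∈ Set.uIcc s t, ∀ x, |P τ x| ≤ w τ x)
    (hH : ∀ τ ∈ Set.uIcc s t, Integrable (H τ) ∧ ∫ x, |H τ x| ≤ B) :
    |(∫ x, e t x) - ∫ x, e s x| ≤ B * |t - s| := by
  wlog hst : s ≤ t generalizing s t with hg
  · have h1 := Set.uIcc_comm s t
    have := hg (s := t) (t := s) (by rwa [← h1]) (by rwa [← h1]) (by rwa [← h1])
      (by rwa [← h1]) (le_of_not_ge hst)
    rwa [abs_sub_comm, abs_sub_comm t s]
  rw [Set.uIcc_of_le hst] at hw hF hP hH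
  rw [abs_of_nonneg (sub_nonneg.2 hst)]
  have dom : ∀ {Y : ℝ → ℝ → ℝ}, Sm Y → (∀ τ ∈ Set.Icc s t, ∀ x, |Y τ x| ≤ w τ x) →
      ∀ τ ∈ Set.Icc s t, Integrable (Y τ) ∧ ∫ x, |Y τ x| ≤ C := by
    intro Y sY hY τ hτ
    have hi : Integrable (Y τ) := (hw τ hτ).1.mono' (sY.cont_x τ).aestronglyMeasurable
      (Filter.Eventually.of_forall (hY τ hτ))
    exact ⟨hi, (integral_mono hi.abs (hw τ hτ).1 (hY τ hτ)).trans (hw τ hτ).2⟩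
  have hF' := dom sF hF
  have hP' := dom sP hP
  have hC : ∀ τ ∈ Set.Icc s t, ∫ x, |H τ x| ≤ max B C := fun τ hτ =>
    (hH τ hτ).2.trans (le_max_left _ _)
  have hle : C ≤ max B C := le_max_right _ _
  have u1 := conservation (C := max B C) (B := B) se sF sP sH hlaw hst (he s) (he t)
    (fun τ hτ => ⟨(hF' τ hτ).1, (hF' τ hτ).2.trans hle⟩)
    (fun τ hτ => ⟨(hP' τ hτ).1, (hP' τ hτ).2.trans hle⟩)
    (fun τ hτ => ⟨(hH τ hτ).1, hC τ hτ,
      (integral_mono (hH τ hτ).1 (hH τ hτ).1.abs (fun x => le_abs_self _)).trans (hH τ hτ).2⟩)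
  have u2 := conservation (C := max B C) (B := B) (e := fun t x => - e t x) (F := fun t x => - F t x)
    (P := fun t x => - P t x) (H := fun t x => - H t x) se.neg sF.neg sP.neg sH.neg
    (by
      intro t x
      simp only [Sm.Dx_neg, Sm.Dt_neg, se, sF, sP, sP.dx, sP.dx.dx]
      rw [hlaw]; ring) hst (he s).neg (he t).neg
    (fun τ hτ => ⟨(hF' τ hτ).1.neg, by simpa only [abs_neg] using (hF' τ hτ).2.trans hle⟩)
    (fun τ hτ => ⟨(hP' τ hτ).1.neg, by simpa only [abs_neg] using (hP' τ hτ).2.trans hle⟩)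
    (fun τ hτ => ⟨(hH τ hτ).1.neg, by simpa only [abs_neg] using hC τ hτ,
      (integral_mono (hH τ hτ).1.neg (hH τ hτ).1.abs (fun x => neg_le_abs _)).trans (hH τ hτ).2⟩)
  rw [integral_neg, integral_neg] at u2
  rw [abs_le]
  constructor <;> linarith

theorem abs_le_one_add {a B : ℝ} (h : a ^ 2 ≤ B) : |a| ≤ 1 + B := by
  rw [abs_le]; constructor <;> nlinarith [sq_nonneg (a - 1 / 2), sq_nonneg (a + 1 / 2)]

theorem abs_mul_mul_le {m a b N w : ℝ} (hm : |m| ≤ N) (hw : a ^ 2 + b ^ 2 ≤ 2 * w) :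
    |m * (a * b)| ≤ N * w := by
  rw [abs_mul]
  have h2 : |a * b| ≤ w := by
    rw [abs_mul]; nlinarith [sq_nonneg (|a| - |b|), sq_abs a, sq_abs b]
  have := abs_nonneg (a * b); have := abs_nonneg m
  exact mul_le_mul hm h2 (abs_nonneg _) ((abs_nonneg m).trans hm)

namespace Sol

variable {V : ℝ → ℝ → ℝ}

theorem mono_bounds {a b c N : ℝ} (hN : 1 ≤ N) (ha : |a| ≤ N) (hb : |b| ≤ N) (hc : |c| ≤ N) (d : ℝ) :
    |3 * b ^ 2 + 4 * a ^ 3| ≤ 200 * N ^ 3 * (a ^ 2 + b ^ 2 + c ^ 2 + d ^ 2) ∧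
    |-3 * a ^ 2 * c + (3 / 2) * c ^ 2 + 6 * a * b ^ 2 + (9 / 2) * a ^ 4| ≤
      200 * N ^ 3 * (a ^ 2 + b ^ 2 + c ^ 2 + d ^ 2) ∧
    |-20 * a * b * d + 3 * d ^ 2 + 10 * b ^ 2 * c + -20 * a ^ 3 * c + 16 * a * c ^ 2
      + 90 * a ^ 2 * b ^ 2 + 24 * a ^ 5| ≤ 200 * N ^ 3 * (a ^ 2 + b ^ 2 + c ^ 2 + d ^ 2) ∧
    |- a ^ 2| ≤ 200 * N ^ 3 * (a ^ 2 + b ^ 2 + c ^ 2 + d ^ 2) ∧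
    |(-1 / 2) * b ^ 2| ≤ 200 * N ^ 3 * (a ^ 2 + b ^ 2 + c ^ 2 + d ^ 2) ∧
    |- c ^ 2| ≤ 200 * N ^ 3 * (a ^ 2 + b ^ 2 + c ^ 2 + d ^ 2) := by
  set w := a ^ 2 + b ^ 2 + c ^ 2 + d ^ 2 with hw
  have hw0 : 0 ≤ w := by positivity
  have N1 : N ≤ N ^ 3 := by nlinarith [sq_nonneg (N - 1)]
  have N2 : N ^ 2 ≤ N ^ 3 := by nlinarith [sq_nonneg N]
  have N3 : 1 ≤ N ^ 3 := one_le_pow₀ hN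
  have a2 : |a ^ 2| ≤ N ^ 3 := by rw [abs_pow]; exact (pow_le_pow_left₀ (abs_nonneg _) ha 2).trans N2
  have a3 : |a ^ 3| ≤ N ^ 3 := by rw [abs_pow]; exact (pow_le_pow_left₀ (abs_nonneg _) ha 3)
  have c1 : |(1:ℝ)| ≤ N ^ 3 := by simpa using N3
  have a1 := ha.trans N1
  have b1 := hb.trans N1
  have d1 := hc.trans N1
  clear_value w
  generalize N ^ 3 = K at *
  have p : ∀ m, |m| ≤ K → ∀ x y : ℝ, x ^ 2 + y ^ 2 ≤ 2 * w → |m * (x * y)| ≤ K * w :=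
    fun m hm x y h => abs_mul_mul_le hm h
  have A := sq_nonneg a
  have B := sq_nonneg b
  have C := sq_nonneg c
  have D := sq_nonneg d
  have q1 := p 1 c1 a a (by linarith)
  have q2 := p 1 c1 b b (by linarith)
  have q3 := p 1 c1 c c (by linarith)
  have q4 := p 1 c1 d d (by linarith)
  have q5 := p a a1 a a (by linarith)
  have q6 := p a a1 a c (by linarith)
  have q7 := p a a1 b b (by linarith)
  have q8 := p _ a2 a a (by linarith)
  have q9 := p a a1 b d (by linarith)
  have q10 := p _ b1 b c (by linarith)
  have q11 := p _ a2 a c (by linarith)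
  have q12 := p _ a1 c c (by linarith)
  have q13 := p _ a2 b b (by linarith)
  have q14 := p _ a3 a a (by linarith)
  have hz : 0 ≤ K * w := by positivity
  have e1 : 3 * b ^ 2 + 4 * a ^ 3 = 3 * (1 * (b * b)) + 4 * (a * (a * a)) := by ring
  have e2 : -3 * a ^ 2 * c + (3 / 2) * c ^ 2 + 6 * a * b ^ 2 + (9 / 2) * a ^ 4 =
    -3 * (a * (a * c)) + (3 / 2) * (1 * (c * c)) + 6 * (a * (b * b))
      + (9 / 2) * (a ^ 2 * (a * a)) := by ring
  have e3 : -20 * a * b * d + 3 * d ^ 2 + 10 * b ^ 2 * c + -20 * a ^ 3 * c + 16 * a * c ^ 2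
      + 90 * a ^ 2 * b ^ 2 + 24 * a ^ 5 = -20 * (a * (b * d)) + 3 * (1 * (d * d))
      + 10 * (b * (b * c)) - 20 * (a ^ 2 * (a * c)) + 16 * (a * (c * c))
      + 90 * (a ^ 2 * (b * b)) + 24 * (a ^ 3 * (a * a)) := by ring
  have e4 : - a ^ 2 = - (1 * (a * a)) := by ring
  have e5 : (-1 / 2) * b ^ 2 = (-1 / 2) * (1 * (b * b)) := by ring
  have e6 : - c ^ 2 = - (1 * (c * c)) := by ring
  rw [e1, e2, e3, e4, e5, e6]
  clear e1 e2 e3 e4 e5 e6 A B C D p hw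
  generalize 1 * (a * a) = m1 at *
  generalize 1 * (b * b) = m2 at *
  generalize 1 * (c * c) = m3 at *
  generalize 1 * (d * d) = m4 at *
  generalize a * (a * a) = m5 at *
  generalize a * (a * c) = m6 at *
  generalize a * (b * b) = m7 at *
  generalize a ^ 2 * (a * a) = m8 at *
  generalize a * (b * d) = m9 at *
  generalize b * (b * c) = m10 at *
  generalize a ^ 2 * (a * c) = m11 at *
  generalize a * (c * c) = m12 at *
  generalize a ^ 2 * (b * b) = m13 at *
  generalize a ^ 3 * (a * a) = m14 at *
  have eK : 200 * K * w = 200 * (K * w) := by ring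
  rw [eK]
  generalize K * w = Z at *
  rw [abs_le] at q1 q2 q3 q4 q5 q6 q7 q8 q9 q10 q11 q12 q13 q14
  refine ⟨?_, ?_, ?_, ?_, ?_, ?_⟩ <;> rw [abs_le] <;> constructor <;> linarith

/-- The first four space derivatives of `V` are square integrable at each time. -/
structure Reg (V : ℝ → ℝ → ℝ) : Prop extends Sol V where
  i0 : ∀ t, SqI (V t)
  i1 : ∀ t, SqI (Dx V t)
  i2 : ∀ t, SqI (Dx (Dx V) t)
  i3 : ∀ t, SqI (Dx (Dx (Dx V)) t)

/-- The square of the H² norm. -/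
noncomputable def p (V : ℝ → ℝ → ℝ) (t : ℝ) : ℝ :=
  (∫ x, V t x ^ 2) + (∫ x, Dx V t x ^ 2) + ∫ x, Dx (Dx V) t x ^ 2

/-- The square of the L² norm of the third derivative. -/
noncomputable def q (V : ℝ → ℝ → ℝ) (t : ℝ) : ℝ := ∫ x, Dx (Dx (Dx V)) t x ^ 2

namespace Reg

theorem nn (V : ℝ → ℝ → ℝ) (t : ℝ) : 0 ≤ (∫ x, V t x ^ 2) ∧ 0 ≤ (∫ x, Dx V t x ^ 2) ∧
    0 ≤ (∫ x, Dx (Dx V) t x ^ 2) ∧ 0 ≤ q V t :=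
  ⟨int_sq_nonneg _, int_sq_nonneg _, int_sq_nonneg _, int_sq_nonneg _⟩

theorem sob0 (h : Reg V) (t x : ℝ) : V t x ^ 2 ≤ (∫ x, V t x ^ 2) + ∫ x, Dx V t x ^ 2 :=
  sobolev (h.i0 t) (h.i1 t) (h.sm.hasDx t) x

theorem sob1 (h : Reg V) (t x : ℝ) :
    Dx V t x ^ 2 ≤ (∫ x, Dx V t x ^ 2) + ∫ x, Dx (Dx V) t x ^ 2 :=
  sobolev (h.i1 t) (h.i2 t) (h.sm.dx.hasDx t) x

theorem sob2 (h : Reg V) (t x : ℝ) : Dx (Dx V) t x ^ 2 ≤ (∫ x, Dx (Dx V) t x ^ 2) + q V t :=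
  sobolev (h.i2 t) (h.i3 t) (h.sm.dx.dx.hasDx t) x

theorem int_cube (h : Reg V) (t : ℝ) : Integrable (fun x => V t x ^ 3) := by
  have := (SqI.bdd_mul (h.i0 t) (h.sm.cont_x t)
    (fun x => abs_le_one_add (h.sob0 t x))).mul_int (h.i0 t)
  exact this.congr (Filter.Eventually.of_forall fun x => by simp only; ring)

theorem int_four (h : Reg V) (t : ℝ) : Integrable (fun x => V t x ^ 4) := by
  have := (SqI.bdd_mul (h.i0 t) (h.sm.cont_x t)
    (fun x => abs_le_one_add (h.sob0 t x))).2
  exact this.congr (Filter.Eventually.of_forall fun x => by simp only; ring)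

theorem int_mix (h : Reg V) (t : ℝ) : Integrable (fun x => V t x * Dx V t x ^ 2) := by
  have := (SqI.bdd_mul (h.i1 t) (h.sm.cont_x t)
    (fun x => abs_le_one_add (h.sob0 t x))).mul_int (h.i1 t)
  exact this.congr (Filter.Eventually.of_forall fun x => by simp only; ring)

theorem abs_cube_le (h : Reg V) (t : ℝ) {S : ℝ} (hS : ∀ x, |V t x| ≤ S) :
    |∫ x, V t x ^ 3| ≤ S * ∫ x, V t x ^ 2 := by
  have h1 : |∫ x, V t x ^ 3| ≤ ∫ x, |V t x ^ 3| := abs_integral_le_integral_abs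
  refine h1.trans ?_
  rw [← integral_const_mul]
  refine integral_mono (h.int_cube t).abs ((h.i0 t).2.const_mul _) fun x => ?_
  have : |V t x ^ 3| = |V t x| * V t x ^ 2 := by rw [pow_succ', abs_mul, abs_pow, sq_abs]
  rw [this]
  exact mul_le_mul_of_nonneg_right (hS x) (sq_nonneg _)

theorem abs_mix_le (h : Reg V) (t : ℝ) {S : ℝ} (hS : ∀ x, |V t x| ≤ S) :
    |∫ x, V t x * Dx V t x ^ 2| ≤ S * ∫ x, Dx V t x ^ 2 := by
  have h1 : |∫ x, V t x * Dx V t x ^ 2| ≤ ∫ x, |V t x * Dx V t x ^ 2| :=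
    abs_integral_le_integral_abs
  refine h1.trans ?_
  rw [← integral_const_mul]
  refine integral_mono (h.int_mix t).abs ((h.i1 t).2.const_mul _) fun x => ?_
  simp only [abs_mul, abs_pow, sq_abs]
  exact mul_le_mul_of_nonneg_right (hS x) (sq_nonneg _)

theorem E1_int (h : Reg V) (t : ℝ) : Integrable (fun x => (1 / 2) * Dx V t x ^ 2 + V t x ^ 3) ∧
    ∫ x, ((1 / 2) * Dx V t x ^ 2 + V t x ^ 3) = (1 / 2) * (∫ x, Dx V t x ^ 2) + ∫ x, V t x ^ 3 := by
  have a1 : Integrable (fun x => (1 / 2) * Dx V t x ^ 2) := (h.i1 t).2.const_mul _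
  exact ⟨a1.add (h.int_cube t), by rw [integral_add a1 (h.int_cube t), integral_const_mul]⟩

theorem E2_int (h : Reg V) (t : ℝ) :
    Integrable (fun x => Dx (Dx V) t x ^ 2 + 10 * V t x * Dx V t x ^ 2 + 5 * V t x ^ 4) ∧
    ∫ x, (Dx (Dx V) t x ^ 2 + 10 * V t x * Dx V t x ^ 2 + 5 * V t x ^ 4) =
      (∫ x, Dx (Dx V) t x ^ 2) + 10 * (∫ x, V t x * Dx V t x ^ 2) + 5 * ∫ x, V t x ^ 4 := by
  have a1 : Integrable (fun x => 10 * V t x * Dx V t x ^ 2) :=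
    ((h.int_mix t).const_mul 10).congr (Filter.Eventually.of_forall fun x => by simp only; ring)
  have a2 : Integrable (fun x => 5 * V t x ^ 4) := (h.int_four t).const_mul _
  have a3 : Integrable (fun x => Dx (Dx V) t x ^ 2 + 10 * V t x * Dx V t x ^ 2) :=
    (h.i2 t).2.add a1
  refine ⟨a3.add a2, ?_⟩
  rw [integral_add a3 a2, integral_add (h.i2 t).2 a1, integral_const_mul, ← integral_const_mul 10]
  simp only [mul_assoc]

theorem conserved (h : Reg V) {s t B : ℝ} (hB : ∀ τ ∈ Set.uIcc s t, p V τ + q V τ ≤ B) :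
    (∫ x, V t x ^ 2) = (∫ x, V s x ^ 2) ∧
    (∫ x, ((1 / 2) * Dx V t x ^ 2 + V t x ^ 3)) = (∫ x, ((1 / 2) * Dx V s x ^ 2 + V s x ^ 3)) ∧
    (∫ x, (Dx (Dx V) t x ^ 2 + 10 * V t x * Dx V t x ^ 2 + 5 * V t x ^ 4)) =
      ∫ x, (Dx (Dx V) s x ^ 2 + 10 * V s x * Dx V s x ^ 2 + 5 * V s x ^ 4) := by
  have s0 := h.sm
  set N := 1 + B
  have hB0 : 0 ≤ B := by
    have := hB s Set.left_mem_uIcc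
    have := nn V s; unfold p at *; linarith
  have hN : 1 ≤ N := by simp only [N]; linarith
  let w : ℝ → ℝ → ℝ := fun τ x => 200 * N ^ 3 * (V τ x ^ 2 + Dx V τ x ^ 2 + Dx (Dx V) τ x ^ 2
    + Dx (Dx (Dx V)) τ x ^ 2)
  have key : ∀ τ ∈ Set.uIcc s t, ∀ x, _ := fun τ hτ x => by
    have h0 := hB τ hτ
    have h1 := nn V τ
    unfold p at h0
    exact mono_bounds hN (a := V τ x) (b := Dx V τ x) (c := Dx (Dx V) τ x)
      (abs_le_one_add ((h.sob0 τ x).trans (by linarith)))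
      (abs_le_one_add ((h.sob1 τ x).trans (by linarith)))
      (abs_le_one_add ((h.sob2 τ x).trans (by linarith))) (Dx (Dx (Dx V)) τ x)
  have hw : ∀ τ ∈ Set.uIcc s t, Integrable (w τ) ∧ ∫ x, w τ x ≤ 200 * N ^ 3 * B := by
    intro τ hτ
    have i01 : Integrable (fun x => V τ x ^ 2 + Dx V τ x ^ 2) := (h.i0 τ).2.add (h.i1 τ).2
    have i012 : Integrable (fun x => V τ x ^ 2 + Dx V τ x ^ 2 + Dx (Dx V) τ x ^ 2) :=
      i01.add (h.i2 τ).2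
    have i0123 : Integrable (fun x => V τ x ^ 2 + Dx V τ x ^ 2 + Dx (Dx V) τ x ^ 2
      + Dx (Dx (Dx V)) τ x ^ 2) := i012.add (h.i3 τ).2
    refine ⟨i0123.const_mul _, ?_⟩
    simp only [w]
    rw [integral_const_mul, integral_add i012 (h.i3 τ).2, integral_add i01 (h.i2 τ).2,
      integral_add (h.i0 τ).2 (h.i1 τ).2]
    exact mul_le_mul_of_nonneg_left (hB τ hτ) (by positivity)
  have sz : Sm (fun _ _ => (0 : ℝ)) := Sm.const 0
  have hz : ∀ τ ∈ Set.uIcc s t, Integrable (fun _ : ℝ => (0:ℝ)) ∧ ∫ _ : ℝ, |(0:ℝ)| ≤ 0 :=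
    fun τ _ => ⟨integrable_zero _ _ _, by simp⟩
  have fin : ∀ {a b : ℝ}, |a - b| ≤ 0 * |t - s| → a = b := by
    intro a b hab
    have : |a - b| ≤ 0 := by simpa using hab
    linarith [abs_nonpos_iff.1 this]
  refine ⟨fin ?_, fin ?_, fin ?_⟩
  · exact conservation_dom (e := fun t x => V t x ^ 2) (s0.pow 2)
      (((Sm.const 3).mul (s0.dx.pow 2)).add ((Sm.const 4).mul (s0.pow 3)))
      (s0.pow 2).neg sz (fun t x => by rw [h.law0]; ring) (fun τ => (h.i0 τ).2) hw
      (fun τ hτ x => (key τ hτ x).1) (fun τ hτ x => (key τ hτ x).2.2.2.1) hz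
  · exact conservation_dom (e := fun t x => (1 / 2) * Dx V t x ^ 2 + V t x ^ 3)
      (((Sm.const _).mul (s0.dx.pow 2)).add (s0.pow 3))
      (((((Sm.const _).mul (s0.pow 2)).mul s0.dx.dx).add ((Sm.const _).mul (s0.dx.dx.pow 2))).add
        (((Sm.const _).mul s0).mul (s0.dx.pow 2)) |>.add ((Sm.const _).mul (s0.pow 4)))
      ((Sm.const _).mul (s0.dx.pow 2)) sz
      (fun t x => by rw [h.law1]; ring) (fun τ => (h.E1_int τ).1) hw
      (fun τ hτ x => (key τ hτ x).2.1) (fun τ hτ x => (key τ hτ x).2.2.2.2.1) hz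
  · exact conservation_dom
      (e := fun t x => Dx (Dx V) t x ^ 2 + 10 * V t x * Dx V t x ^ 2 + 5 * V t x ^ 4)
      (((s0.dx.dx.pow 2).add (((Sm.const _).mul s0).mul (s0.dx.pow 2))).add
        ((Sm.const _).mul (s0.pow 4)))
      (((((((((Sm.const _).mul s0).mul s0.dx).mul s0.dx.dx.dx).add
        ((Sm.const _).mul (s0.dx.dx.dx.pow 2))).add
        (((Sm.const _).mul (s0.dx.pow 2)).mul s0.dx.dx)).add
        (((Sm.const _).mul (s0.pow 3)).mul s0.dx.dx)).add
        (((Sm.const _).mul s0).mul (s0.dx.dx.pow 2))).add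
        (((Sm.const _).mul (s0.pow 2)).mul (s0.dx.pow 2)) |>.add ((Sm.const _).mul (s0.pow 5)))
      (s0.dx.dx.pow 2).neg sz (fun t x => by rw [h.law2]; ring) (fun τ => (h.E2_int τ).1) hw
      (fun τ hτ x => (key τ hτ x).2.2.1) (fun τ hτ x => (key τ hτ x).2.2.2.2.2) hz

theorem low (h : Reg V) (C : ℝ) : ∃ M, ∀ s t, p V s + q V s ≤ C →
    (∃ B, ∀ τ ∈ Set.uIcc s t, p V τ + q V τ ≤ B) → p V t ≤ M := by
  set e1 := C / 2 + (1 + 2 * C) * C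
  set m1 := 4 * e1 + C + 4 * C ^ 2
  set e2 := C + 10 * (1 + 2 * C) * C + 10 * C ^ 2
  refine ⟨C + m1 + (e2 + 10 * (1 + (C + m1)) * m1), fun s t hs ⟨B, hB⟩ => ?_⟩
  obtain ⟨c0, c1, c2⟩ := h.conserved hB
  rw [(h.E1_int t).2, (h.E1_int s).2] at c1
  rw [(h.E2_int t).2, (h.E2_int s).2] at c2
  obtain ⟨n0, n1, n2, n3⟩ := nn V s
  obtain ⟨k0, k1, k2, k3⟩ := nn V t
  have V1 := h.abs_cube_le s (fun x => abs_le_one_add (h.sob0 s x))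
  have V2 := h.abs_mix_le s (fun x => abs_le_one_add (h.sob0 s x))
  have W2 := h.abs_mix_le t (fun x => abs_le_one_add (h.sob0 t x))
  have W1 := h.abs_cube_le t (fun x => abs_le_sqrt (h.sob0 t x))
  have V4 : ∫ x, V s x ^ 4 ≤ ((∫ x, V s x ^ 2) + ∫ x, Dx V s x ^ 2) * ∫ x, V s x ^ 2 := by
    rw [← integral_const_mul]
    refine integral_mono (h.int_four s) ((h.i0 s).2.const_mul _) fun x => ?_
    have := h.sob0 s x
    simp only
    nlinarith [sq_nonneg (V s x)]
  have W4 : 0 ≤ ∫ x, V t x ^ 4 := integral_nonneg fun x => by positivity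
  have sq := Real.sq_sqrt (add_nonneg k0 k1)
  unfold p at hs ⊢
  generalize Real.sqrt _ = S at W1 sq
  generalize (∫ x, V s x ^ 2) = f0 at *
  generalize (∫ x, V t x ^ 2) = g0 at *
  generalize (∫ x, Dx V s x ^ 2) = f1 at *
  generalize (∫ x, Dx V t x ^ 2) = g1 at *
  generalize (∫ x, Dx (Dx V) s x ^ 2) = f2 at *
  generalize (∫ x, Dx (Dx V) t x ^ 2) = g2 at *
  subst c0
  rw [abs_le] at V1 V2 W1 W2
  have C0 : g0 ≤ C := by linarith
  have C1 : f1 ≤ C := by linarith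
  have C2 : f2 ≤ C := by linarith
  have hC : 0 ≤ C := by linarith
  have x1 : (1 + (g0 + f1)) * g0 ≤ (1 + 2 * C) * C := by gcongr; linarith
  have x2 : (1 + (g0 + f1)) * f1 ≤ (1 + 2 * C) * C := by gcongr; linarith
  have x3 : (g0 + f1) * g0 ≤ (2 * C) * C := by gcongr; linarith
  have hE1 : 1 / 2 * f1 + ∫ x, V s x ^ 3 ≤ e1 := by simp only [e1]; linarith
  have x4 : S * g0 ≤ S ^ 2 / 4 + g0 ^ 2 := by nlinarith [sq_nonneg (S / 2 - g0)]
  have x5 : g0 ^ 2 ≤ C ^ 2 := by gcongr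
  have hm1 : g1 ≤ m1 := by simp only [m1]; linarith
  have x6 : (1 + (g0 + g1)) * g1 ≤ (1 + (C + m1)) * m1 := by
    have : 0 ≤ m1 := k1.trans hm1
    gcongr
  have hE2 : f2 + 10 * (∫ x, V s x * Dx V s x ^ 2) + 5 * ∫ x, V s x ^ 4 ≤ e2 := by
    simp only [e2]; linarith
  linarith

end Reg

end Sol

end KdV

namespace KdV

open Set
set_option linter.unusedSimpArgs false

theorem int_le_of_interval_le {f : ℝ → ℝ} (hf : Integrable f) {C : ℝ}
    (h : ∀ n : ℕ, ∫ x in (-(n : ℝ))..n, f x ≤ C) : ∫ x, f x ≤ C :=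
  le_of_tendsto' (intervalIntegral_tendsto_integral hf
    (tendsto_neg_atTop_atBot.comp tendsto_natCast_atTop_atTop) tendsto_natCast_atTop_atTop) h

theorem interval_le_int {f : ℝ → ℝ} (hf : Integrable f) (h0 : ∀ x, 0 ≤ f x) {a b : ℝ} (hab : a ≤ b) :
    ∫ x in a..b, f x ≤ ∫ x, f x := by
  rw [intervalIntegral.integral_of_le hab]
  exact setIntegral_le_integral hf (Filter.Eventually.of_forall h0)

theorem isClosed_int_le {f : ℝ → ℝ → ℝ} (hf : Continuous (Function.uncurry f))
    (hi : ∀ t, Integrable (f t)) (h0 : ∀ t x, 0 ≤ f t x) (C : ℝ) :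
    IsClosed {t | ∫ x, f t x ≤ C} := by
  have : {t | ∫ x, f t x ≤ C} = ⋂ n : ℕ, {t | ∫ x in (-(n : ℝ))..n, f t x ≤ C} := by
    ext t
    simp only [mem_ofPred_eq, mem_iInter]
    exact ⟨fun h n => (interval_le_int (hi t) (h0 t) (by
      have : (0:ℝ) ≤ n := n.cast_nonneg
      linarith)).trans h, int_le_of_interval_le (hi t)⟩
  rw [this]
  exact isClosed_iInter fun n => isClosed_le
    (intervalIntegral.continuous_parametric_intervalIntegral_of_continuous' hf _ _)
    continuous_const

/-- Difference quotient. -/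
noncomputable def dq (h : ℝ) (w : ℝ → ℝ) (x : ℝ) : ℝ := (w (x + h) - w x) / h

theorem SqI.shift {f : ℝ → ℝ} (hf : SqI f) (h : ℝ) : SqI (fun x => f (x + h)) :=
  ⟨hf.1.comp (by fun_prop), hf.2.comp_add_right h⟩

theorem SqI.dq {f : ℝ → ℝ} (hf : SqI f) (h : ℝ) : SqI (dq h f) := by
  have := ((hf.shift h).sub hf).cmul h⁻¹
  have e : KdV.dq h f = fun x => h⁻¹ * (f (x + h) - f x) := by
    ext x; unfold KdV.dq; rw [div_eq_inv_mul]
  rw [e]; exact this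

theorem int_dq_sq_le {w w' : ℝ → ℝ} (hw : SqI w) (hw' : SqI w') (hd : ∀ x, HasDerivAt w (w' x) x)
    {h : ℝ} (hh : 0 < h) : ∫ x, dq h w x ^ 2 ≤ ∫ x, w' x ^ 2 := by
  have ci : ∀ a b, IntervalIntegrable (fun x => w' x ^ 2) volume a b := fun a b =>
    (hw'.1.pow 2).intervalIntegrable a b
  set Φ : ℝ → ℝ := fun x => ∫ y in (0:ℝ)..x, w' y ^ 2 with hΦ
  have Φd : ∀ x, HasDerivAt Φ (w' x ^ 2) x := fun x =>
    intervalIntegral.integral_hasDerivAt_right (ci _ _)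
      (hw'.1.pow 2).stronglyMeasurable.stronglyMeasurableAtFilter (hw'.1.pow 2).continuousAt
  have Φc : Continuous Φ := continuous_iff_continuousAt.2 fun x => (Φd x).continuousAt
  have Φs : ∀ a b, Φ b - Φ a = ∫ y in a..b, w' y ^ 2 := fun a b =>
    intervalIntegral.integral_interval_sub_left (ci _ _) (ci _ _)
  have pt : ∀ x, dq h w x ^ 2 ≤ h⁻¹ * (Φ (x + h) - Φ x) := by
    intro x
    have h1 : w (x + h) - w x = ∫ y in x..(x + h), w' y :=
      (intervalIntegral.integral_eq_sub_of_hasDerivAt (fun y _ => hd y)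
        (hw'.1.intervalIntegrable _ _)).symm
    have h2 : ∫ y in x..(x + h), (2 * dq h w x * w' y - dq h w x ^ 2) ≤
        ∫ y in x..(x + h), w' y ^ 2 := by
      refine intervalIntegral.integral_mono_on (by linarith)
        (((continuous_const.mul hw'.1).sub continuous_const).intervalIntegrable _ _) (ci _ _) ?_
      intro y _
      nlinarith [sq_nonneg (dq h w x - w' y)]
    have ii : IntervalIntegrable (fun y => 2 * dq h w x * w' y) volume x (x + h) :=
      (continuous_const.mul hw'.1).intervalIntegrable _ _
    rw [intervalIntegral.integral_sub ii
      (continuous_const.intervalIntegrable _ _), intervalIntegral.integral_const_mul, ← h1,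
      intervalIntegral.integral_const] at h2
    have h3 : w (x + h) - w x = h * dq h w x := by unfold dq; field_simp
    rw [h3, ← Φs] at h2
    simp only [smul_eq_mul, add_sub_cancel_left] at h2
    rw [inv_mul_eq_div, le_div_iff₀ hh]
    linarith
  refine int_le_of_interval_le (hw.dq h).2 fun n => ?_
  have hn : (0:ℝ) ≤ n := n.cast_nonneg
  have cs : Continuous fun x => Φ (x + h) := Φc.comp (by fun_prop)
  have cI : ∀ a b, IntervalIntegrable Φ volume a b := fun a b => Φc.intervalIntegrable a b
  have step : ∫ x in (-(n:ℝ))..n, dq h w x ^ 2 ≤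
      ∫ x in (-(n:ℝ))..n, h⁻¹ * (Φ (x + h) - Φ x) := by
    refine intervalIntegral.integral_mono_on (by linarith)
      (((hw.dq h).1.pow 2).intervalIntegrable _ _)
      ((continuous_const.mul (cs.sub Φc)).intervalIntegrable _ _) fun x _ => pt x
  refine step.trans ?_
  rw [intervalIntegral.integral_const_mul, intervalIntegral.integral_sub
    (cs.intervalIntegrable _ _) (cI _ _), intervalIntegral.integral_comp_add_right (fun x => Φ x)]
  have e1 : (∫ x in (-(n:ℝ) + h)..(n + h), Φ x) - ∫ x in (-(n:ℝ))..n, Φ x =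
      (∫ x in (n:ℝ)..(n + h), Φ x) - ∫ x in (-(n:ℝ))..(-(n:ℝ) + h), Φ x := by
    have a1 := intervalIntegral.integral_add_adjacent_intervals (cI (-(n:ℝ)) n) (cI n (n + h))
    have a2 := intervalIntegral.integral_add_adjacent_intervals (cI (-(n:ℝ)) (-(n:ℝ) + h))
      (cI (-(n:ℝ) + h) (n + h))
    linarith
  have e2 : ∫ x in (n:ℝ)..(n + h), Φ x = ∫ x in (0:ℝ)..h, Φ (x + n) := by
    rw [intervalIntegral.integral_comp_add_right (fun x => Φ x)]; congr 1 <;> ring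
  have e3 : ∫ x in (-(n:ℝ))..(-(n:ℝ) + h), Φ x = ∫ x in (0:ℝ)..h, Φ (x + -n) := by
    rw [intervalIntegral.integral_comp_add_right (fun x => Φ x)]; congr 1 <;> ring
  have c1 : ∀ m : ℝ, IntervalIntegrable (fun x => Φ (x + m)) volume 0 h := fun m =>
    (Φc.comp (by fun_prop : Continuous fun x => x + m)).intervalIntegrable _ _
  rw [e1, e2, e3, ← intervalIntegral.integral_sub (c1 n) (c1 (-n))]
  have bd : ∫ x in (0:ℝ)..h, (Φ (x + n) - Φ (x + -n)) ≤ ∫ x in (0:ℝ)..h, ∫ y, w' y ^ 2 := by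
    refine intervalIntegral.integral_mono_on hh.le ((c1 n).sub (c1 (-n)))
      (continuous_const.intervalIntegrable _ _) fun x _ => ?_
    rw [Φs]
    exact interval_le_int hw'.2 (fun y => sq_nonneg _) (by linarith)
  rw [intervalIntegral.integral_const, sub_zero, smul_eq_mul] at bd
  rw [inv_mul_eq_div, div_le_iff₀ hh]
  linarith

theorem int_sq_le_of_dq {w w' : ℝ → ℝ} (hw : SqI w) (hw' : SqI w') (hd : ∀ x, HasDerivAt w (w' x) x)
    {C : ℝ} (h : ∀ h, 0 < h → ∫ x, dq h w x ^ 2 ≤ C) : ∫ x, w' x ^ 2 ≤ C := by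
  have hC : 0 ≤ C := (int_sq_nonneg _).trans (h 1 one_pos)
  have lim : ∀ x, Tendsto (fun n : ℕ => ENNReal.ofReal (dq (1 / ((n:ℝ) + 1)) w x ^ 2)) atTop
      (nhds (ENNReal.ofReal (w' x ^ 2))) := by
    intro x
    refine ENNReal.tendsto_ofReal (Tendsto.pow ?_ 2)
    have h1 := (hasDerivAt_iff_tendsto_slope_zero.1 (hd x)).comp
      (tendsto_nhdsWithin_iff.2 ⟨tendsto_one_div_add_atTop_nhds_zero_nat (𝕜 := ℝ),
        Eventually.of_forall fun n => by
          simp only [mem_compl_iff, mem_singleton_iff]; positivity⟩)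
    refine h1.congr fun n => ?_
    simp only [Function.comp, dq, smul_eq_mul]
    ring
  have fat := lintegral_liminf_le (μ := volume) (u := atTop)
    (f := fun (n : ℕ) x => ENNReal.ofReal (dq (1 / ((n:ℝ) + 1)) w x ^ 2))
    (fun n => (((hw.dq _).1.pow 2).measurable).ennreal_ofReal)
  have le1 : liminf (fun n : ℕ => ∫⁻ x, ENNReal.ofReal (dq (1 / ((n:ℝ) + 1)) w x ^ 2)) atTop ≤
      ENNReal.ofReal C := by
    refine liminf_le_of_le (by isBoundedDefault) fun b hb => ?_
    obtain ⟨n, hn⟩ := hb.exists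
    refine hn.trans ?_
    rw [← ofReal_integral_eq_lintegral_ofReal (hw.dq _).2 (Eventually.of_forall fun x => sq_nonneg _)]
    exact ENNReal.ofReal_le_ofReal (h _ (by positivity))
  simp only [fun x => (lim x).liminf_eq] at fat
  rw [← ofReal_integral_eq_lintegral_ofReal hw'.2 (Eventually.of_forall fun x => sq_nonneg _)] at fat
  exact (ENNReal.ofReal_le_ofReal_iff hC).1 (fat.trans le1)

end KdV

namespace KdV

open Set
set_option linter.unusedSimpArgs false

theorem Sm.shift {f : ℝ → ℝ → ℝ} (hf : Sm f) (h : ℝ) : Sm (fun t x => f t (x + h)) := by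
  refine hf.comp_aff (a := fun t _ => t) (b := fun _ x => x + h) ?_ ?_
  · exact contDiff_fst
  · exact contDiff_snd.add contDiff_const

theorem Dx_shift (f : ℝ → ℝ → ℝ) (h : ℝ) :
    Dx (fun t x => f t (x + h)) = fun t x => Dx f t (x + h) := by
  ext t x; exact deriv_comp_add_const (f t) h x

theorem Dt_shift (f : ℝ → ℝ → ℝ) (h : ℝ) :
    Dt (fun t x => f t (x + h)) = fun t x => Dt f t (x + h) := rfl

namespace Sol

variable {V W : ℝ → ℝ → ℝ}

theorem shift (hV : Sol V) (h : ℝ) : Sol (fun t x => V t (x + h)) where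
  sm := hV.sm.shift h
  eq t x := by
    simp only [Dx_shift, Dt_shift]
    exact hV.eq t (x + h)

theorem law_diff (hV : Sol V) (hW : Sol W) (k : ℝ) (t x : ℝ) :
    Dt (fun t x => (k * (Dx (Dx W) t x - Dx (Dx V) t x)) ^ 2) t x =
    Dx (fun t x => 3 * (k * (Dx (Dx (Dx W)) t x - Dx (Dx (Dx V)) t x)) ^ 2
      + 6 * W t x * (k * (Dx (Dx W) t x - Dx (Dx V) t x)) ^ 2) t x
    + Dx (Dx (Dx (fun t x => - (k * (Dx (Dx W) t x - Dx (Dx V) t x)) ^ 2))) t x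
    + ((42 - 12) * Dx W t x * (k * (Dx (Dx W) t x - Dx (Dx V) t x)) ^ 2
      + 12 * (k * (Dx (Dx W) t x - Dx (Dx V) t x)) * (k * (W t x - V t x)) * Dx (Dx (Dx V)) t x
      + 36 * (k * (Dx (Dx W) t x - Dx (Dx V) t x)) *
        ((k * (Dx W t x - Dx V t x)) * Dx (Dx V) t x)) := by
  have s0 := hV.sm
  have w0 := hW.sm
  simp (maxDischargeDepth := 20) only [Sm.Dx_sub, Sm.Dx_add, Sm.Dx_mul, Sm.Dx_pow, Sm.Dx_neg,
    Sm.Dx_const, Sm.Dt_pow, Sm.Dt_sub,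
    Sm.Dt_add, Sm.Dt_mul, Sm.Dt_const, Sm.add, Sm.sub,
    Sm.mul, Sm.pow, Sm.neg, Sm.const, s0, s0.dx, s0.dx.dx, s0.dx.dx.dx, s0.dx.dx.dx.dx, hV.Dt2,
    w0, w0.dx, w0.dx.dx, w0.dx.dx.dx, w0.dx.dx.dx.dx, hW.Dt2]
  norm_num; ring

theorem Reg.shift (hV : Reg V) (h : ℝ) : Reg (fun t x => V t (x + h)) where
  toSol := hV.toSol.shift h
  i0 t := (hV.i0 t).shift h
  i1 t := by simp only [Dx_shift]; exact (hV.i1 t).shift h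
  i2 t := by simp only [Dx_shift]; exact (hV.i2 t).shift h
  i3 t := by simp only [Dx_shift]; exact (hV.i3 t).shift h

theorem Reg.dq_top (hV : Reg V) {M : ℝ} (hM : 0 ≤ M) {s t G h : ℝ} (hh : 0 < h)
    (hb : ∀ τ ∈ uIcc s t, p V τ ≤ M ∧ q V τ ≤ G) :
    ∫ x, dq h (Dx (Dx V) t) x ^ 2 ≤ q V s + 200 * (1 + M) ^ 2 * (1 + G) * |t - s| := by
  set W : ℝ → ℝ → ℝ := fun t x => V t (x + h) with hWd
  have hW : Reg W := hV.shift h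
  have s0 := hV.sm
  have w0 := hW.sm
  set k := h⁻¹
  set N := 1 + M with hN
  have hG : 0 ≤ G := (nn V s).2.2.2.trans (hb s left_mem_uIcc).2
  have eq0 : ∀ τ x, k * (W τ x - V τ x) = dq h (V τ) x := fun τ x => by
    simp only [k, hWd, dq]; ring
  have eq1 : ∀ τ x, k * (Dx W τ x - Dx V τ x) = dq h (Dx V τ) x := fun τ x => by
    simp only [k, hWd, dq, Dx_shift]; ring
  have eq2 : ∀ τ x, k * (Dx (Dx W) τ x - Dx (Dx V) τ x) = dq h (Dx (Dx V) τ) x := fun τ x => by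
    simp only [k, hWd, dq, Dx_shift]; ring
  have eq3 : ∀ τ x, k * (Dx (Dx (Dx W)) τ x - Dx (Dx (Dx V)) τ x) = dq h (Dx (Dx (Dx V)) τ) x :=
    fun τ x => by simp only [k, hWd, dq, Dx_shift]; ring
  have bnd : ∀ τ ∈ uIcc s t, ∀ x, |V τ x| ≤ N ∧ |Dx V τ x| ≤ N ∧ Dx (Dx V) τ x ^ 2 ≤ M + G := by
    intro τ hτ x
    obtain ⟨h1, h2⟩ := hb τ hτ
    have h3 := nn V τ
    unfold p at h1
    exact ⟨abs_le_one_add ((hV.sob0 τ x).trans (by linarith)),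
      abs_le_one_add ((hV.sob1 τ x).trans (by linarith)), (hV.sob2 τ x).trans (by linarith)⟩
  have bdq : ∀ τ ∈ uIcc s t, ∀ x, |dq h (V τ) x| ≤ N := by
    intro τ hτ x
    obtain ⟨c, -, hc⟩ := exists_hasDerivAt_eq_slope (V τ) (Dx V τ) (by linarith : x < x + h)
      (s0.cont_x τ).continuousOn (fun y _ => s0.hasDx τ y)
    have : dq h (V τ) x = Dx V τ c := by rw [hc]; simp [dq]
    rw [this]; exact (bnd τ hτ c).2.1
  have d1 : ∀ τ, ∫ x, dq h (Dx V τ) x ^ 2 ≤ ∫ x, Dx (Dx V) τ x ^ 2 := fun τ =>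
    int_dq_sq_le (hV.i1 τ) (hV.i2 τ) (s0.dx.hasDx τ) hh
  have d2 : ∀ τ, ∫ x, dq h (Dx (Dx V) τ) x ^ 2 ≤ q V τ := fun τ =>
    int_dq_sq_le (hV.i2 τ) (hV.i3 τ) (s0.dx.dx.hasDx τ) hh
  let w : ℝ → ℝ → ℝ := fun τ x => 3 * dq h (Dx (Dx (Dx V)) τ) x ^ 2
    + 6 * N * dq h (Dx (Dx V) τ) x ^ 2
  have hN1 : 1 ≤ N := by linarith
  have sg : Sm (fun t x => k * (Dx (Dx W) t x - Dx (Dx V) t x)) :=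
    (Sm.const _).mul (w0.dx.dx.sub s0.dx.dx)
  have key := conservation_dom (s := s) (t := t) (w := w)
    (C := 3 * (k ^ 2 * (4 * G)) + 6 * N * G)
    (B := 200 * N ^ 2 * (1 + G)) (sg.pow 2)
    (((Sm.const _).mul (((Sm.const _).mul (w0.dx.dx.dx.sub s0.dx.dx.dx)).pow 2)).add
      (((Sm.const _).mul w0).mul (sg.pow 2)))
    (sg.pow 2).neg
    (((((Sm.const _).mul w0.dx).mul (sg.pow 2)).add
      ((((Sm.const _).mul sg).mul ((Sm.const k).mul (w0.sub s0))).mul s0.dx.dx.dx)).add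
      (((Sm.const _).mul sg).mul (((Sm.const k).mul (w0.dx.sub s0.dx)).mul s0.dx.dx)))
    (law_diff hV.toSol hW.toSol k)
    (fun τ => by simp only [eq2]; exact ((hV.i2 τ).dq h).2) ?_ ?_ ?_ ?_
  · simp only [eq2] at key
    rw [abs_le] at key
    have := d2 s
    linarith
  · intro τ hτ
    have i1 : Integrable fun x => 3 * dq h (Dx (Dx (Dx V)) τ) x ^ 2 :=
      ((hV.i3 τ).dq h).2.const_mul _
    have i2 : Integrable fun x => 6 * N * dq h (Dx (Dx V) τ) x ^ 2 :=
      ((hV.i2 τ).dq h).2.const_mul _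
    refine ⟨i1.add i2, ?_⟩
    simp only [w]
    rw [integral_add i1 i2, integral_const_mul, integral_const_mul]
    have a2 := (d2 τ).trans (hb τ hτ).2
    have a3 : ∫ x, dq h (Dx (Dx (Dx V)) τ) x ^ 2 ≤ k ^ 2 * (4 * G) := by
      have := int_sq_sub_le ((hV.i3 τ).shift h) (hV.i3 τ)
      rw [integral_add_right_eq_self (fun x => Dx (Dx (Dx V)) τ x ^ 2)] at this
      have hq := (hb τ hτ).2
      unfold q at hq
      have e : ∀ x, dq h (Dx (Dx (Dx V)) τ) x ^ 2 =
          k ^ 2 * (Dx (Dx (Dx V)) τ (x + h) - Dx (Dx (Dx V)) τ x) ^ 2 := fun x => by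
        simp only [dq, k]; ring
      simp only [e]
      rw [integral_const_mul]
      exact mul_le_mul_of_nonneg_left (by linarith) (sq_nonneg k)
    gcongr
  · intro τ hτ x
    simp only [eq2, eq3, w]
    have hWx : |W τ x| ≤ N := (bnd τ hτ (x + h)).1
    rw [abs_le] at hWx ⊢
    have h2 := sq_nonneg (dq h (Dx (Dx V) τ) x)
    have h3 := sq_nonneg (dq h (Dx (Dx (Dx V)) τ) x)
    constructor <;> nlinarith
  · intro τ hτ x
    simp only [eq2, w]
    have h2 := sq_nonneg (dq h (Dx (Dx V) τ) x)
    have h3 := sq_nonneg (dq h (Dx (Dx (Dx V)) τ) x)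
    rw [abs_neg, abs_of_nonneg h2]
    nlinarith
  · intro τ hτ
    have g2 := (hV.i2 τ).dq h
    have g1 := (hV.i1 τ).dq h
    let dm : ℝ → ℝ := fun x => (54 * N + 18) * dq h (Dx (Dx V) τ) x ^ 2
      + (6 * N * Dx (Dx (Dx V)) τ x ^ 2 + 18 * (M + G) * dq h (Dx V τ) x ^ 2)
    have j1 : Integrable fun x => (54 * N + 18) * dq h (Dx (Dx V) τ) x ^ 2 := g2.2.const_mul _
    have j2 : Integrable fun x => 6 * N * Dx (Dx (Dx V)) τ x ^ 2 := (hV.i3 τ).2.const_mul _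
    have j3 : Integrable fun x => 18 * (M + G) * dq h (Dx V τ) x ^ 2 := g1.2.const_mul _
    have j23 : Integrable fun x => 6 * N * Dx (Dx (Dx V)) τ x ^ 2
      + 18 * (M + G) * dq h (Dx V τ) x ^ 2 := j2.add j3
    have jd : Integrable dm := j1.add j23
    simp only [eq0, eq1, eq2]
    have pt : ∀ x, |(42 - 12) * Dx W τ x * dq h (Dx (Dx V) τ) x ^ 2
        + 12 * dq h (Dx (Dx V) τ) x * dq h (V τ) x * Dx (Dx (Dx V)) τ x
        + 36 * dq h (Dx (Dx V) τ) x * (dq h (Dx V τ) x * Dx (Dx V) τ x)| ≤ dm x := by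
      intro x
      have b1 : |Dx W τ x| ≤ N := by rw [hWd, Dx_shift]; exact (bnd τ hτ (x + h)).2.1
      have b2 := (bnd τ hτ x).2.2
      have b3 := bdq τ hτ x
      simp only [dm]
      generalize dq h (Dx (Dx V) τ) x = g at *
      generalize dq h (Dx V τ) x = u at *
      generalize dq h (V τ) x = z at *
      generalize Dx (Dx (Dx V)) τ x = y at *
      generalize Dx (Dx V) τ x = r at *
      generalize Dx W τ x = m at *
      have k1 := abs_mul_mul_le (a := g) (b := g) (w := g ^ 2) b1 (by linarith)
      have k2 := abs_mul_mul_le (a := g) (b := y) (w := (g ^ 2 + y ^ 2) / 2) b3 (by linarith)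
      have k3 : |g * (u * r)| ≤ (g ^ 2 + (M + G) * u ^ 2) / 2 := by
        have : (u * r) ^ 2 ≤ (M + G) * u ^ 2 := by nlinarith [sq_nonneg u]
        rw [abs_le]
        constructor <;> nlinarith [sq_nonneg (g + u * r), sq_nonneg (g - u * r)]
      rw [abs_le] at k1 k2 k3 ⊢
      constructor <;> nlinarith [sq_nonneg g]
    have ct : Continuous fun x => (42 - 12) * Dx W τ x * dq h (Dx (Dx V) τ) x ^ 2
        + 12 * dq h (Dx (Dx V) τ) x * dq h (V τ) x * Dx (Dx (Dx V)) τ x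
        + 36 * dq h (Dx (Dx V) τ) x * (dq h (Dx V τ) x * Dx (Dx V) τ x) := by
      have c0 := ((hV.i0 τ).dq h).1
      have c1 := g1.1
      have c2 := g2.1
      have c3 := (hV.i3 τ).1
      have c4 := (hV.i2 τ).1
      have c5 := (hW.i1 τ).1
      fun_prop
    have hi := jd.mono' ct.aestronglyMeasurable (Eventually.of_forall pt)
    refine ⟨hi, (integral_mono hi.abs jd pt).trans ?_⟩
    simp only [dm]
    rw [integral_add j1 j23, integral_add j2 j3, integral_const_mul, integral_const_mul,
      integral_const_mul]
    have a2 := (d2 τ).trans (hb τ hτ).2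
    have a3 := (hb τ hτ).2
    have a1 := d1 τ
    have hp := (hb τ hτ).1
    have hnn := nn V τ
    unfold q at a3
    unfold p at hp
    have a4 : ∫ x, dq h (Dx V τ) x ^ 2 ≤ M := by linarith
    calc _ ≤ (54 * N + 18) * G + (6 * N * G + 18 * (M + G) * M) := by gcongr
      _ ≤ _ := by rw [hN]; nlinarith [mul_nonneg hM hG, mul_nonneg (mul_nonneg hM hM) hG]

theorem Reg.growth (hV : Reg V) : Growth (p V) (q V) where
  p_nonneg t := by have := nn V t; unfold p; linarith
  q_nonneg t := (nn V t).2.2.2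
  low := hV.low
  top M := by
    refine ⟨200 * (1 + |M|) ^ 2, by positivity, fun s t G hb => ?_⟩
    exact int_sq_le_of_dq (hV.i2 t) (hV.i3 t) (hV.sm.dx.dx.hasDx t) fun h hh =>
      hV.dq_top (abs_nonneg M) hh fun τ hτ => ⟨(hb τ hτ).1.trans (le_abs_self M), (hb τ hτ).2⟩

theorem Reg.closed (hV : Reg V) (C : ℝ) : IsClosed {t | p V t + q V t ≤ C} := by
  have i01 : ∀ t, Integrable (fun x => V t x ^ 2 + Dx V t x ^ 2) := fun t =>
    (hV.i0 t).2.add (hV.i1 t).2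
  have i012 : ∀ t, Integrable (fun x => V t x ^ 2 + Dx V t x ^ 2 + Dx (Dx V) t x ^ 2) := fun t =>
    (i01 t).add (hV.i2 t).2
  have s0 := hV.sm
  have := isClosed_int_le (f := fun t x => V t x ^ 2 + Dx V t x ^ 2 + Dx (Dx V) t x ^ 2
    + Dx (Dx (Dx V)) t x ^ 2)
    (Sm.cont ((((s0.pow 2).add (s0.dx.pow 2)).add (s0.dx.dx.pow 2)).add (s0.dx.dx.dx.pow 2)))
    (fun t => (i012 t).add (hV.i3 t).2) (fun t x => by positivity) C
  convert this using 3 with t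
  rw [integral_add (i012 t) (hV.i3 t).2, integral_add (i01 t) (hV.i2 t).2,
    integral_add (hV.i0 t).2 (hV.i1 t).2]
  rfl

/-- Smooth solutions bounded in H¹ locally uniformly in time. -/
structure KC (V : ℝ → ℝ → ℝ) : Prop extends Sol V where
  i0 : ∀ t, SqI (V t)
  i1 : ∀ t, SqI (Dx V t)
  bdd : ∀ T, ∃ C, ∀ t, |t| ≤ T → (∫ x, V t x ^ 2) ≤ C ∧ (∫ x, Dx V t x ^ 2) ≤ C

theorem Reg.kc (hV : Reg V) : KC V where
  toSol := hV.toSol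
  i0 := hV.i0
  i1 := hV.i1
  bdd T := by
    obtain ⟨C, hC⟩ := hV.growth.bounded hV.closed T
    refine ⟨C, fun t ht => ?_⟩
    have h1 := hC t ht
    have h2 := nn V t
    unfold p at h1
    constructor <;> linarith

end Sol

end KdV

namespace KdV

open Set
set_option linter.unusedSimpArgs false

theorem hasDerivAt_tanh (x : ℝ) : HasDerivAt tanh (1 - tanh x ^ 2) x := by
  have h := (hasDerivAt_sinh x).div (hasDerivAt_cosh x) (cosh_pos x).ne'
  have e : (fun y => sinh y / cosh y) = tanh := by ext y; rw [tanh_eq_sinh_div_cosh]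
  have h' : HasDerivAt tanh ((cosh x * cosh x - sinh x * sinh x) / cosh x ^ 2) x := by
    rw [← e]; exact h
  convert h' using 1
  rw [tanh_eq_sinh_div_cosh]
  have := (cosh_pos x).ne'
  field_simp

theorem contDiff_tanh : ContDiff ℝ (⊤ : ℕ∞) tanh := by
  have e : tanh = fun y => sinh y / cosh y := by ext y; rw [tanh_eq_sinh_div_cosh]
  rw [e]
  exact contDiff_sinh.div contDiff_cosh fun x => (cosh_pos x).ne'

theorem one_sub_tanh (x : ℝ) : 1 - tanh x = 2 * exp (-(2 * x)) / (1 + exp (-(2 * x))) := by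
  rw [tanh_eq]
  have h1 : exp (-x) = exp x * exp (-(2 * x)) := by rw [← exp_add]; congr 1; ring
  have := exp_pos x
  have := exp_pos (-(2 * x))
  rw [h1]
  field_simp
  ring

theorem one_sub_tanh_le (x : ℝ) : 1 - tanh x ≤ 2 * exp (-(2 * x)) := by
  rw [one_sub_tanh]
  have := exp_pos (-(2 * x))
  rw [div_le_iff₀ (by linarith)]
  nlinarith

theorem one_add_tanh_le (x : ℝ) : 1 + tanh x ≤ 2 * exp (2 * x) := by
  have := one_sub_tanh_le (-x)
  rw [tanh_neg] at this
  simpa using this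

theorem one_sub_tanh_sq_le (x : ℝ) : 1 - tanh x ^ 2 ≤ 4 * exp (-(2 * |x|)) := by
  have h1 := tanh_lt_one x
  have h2 := neg_one_lt_tanh x
  rcases le_total 0 x with h | h
  · rw [abs_of_nonneg h]
    nlinarith [one_sub_tanh_le x]
  · rw [abs_of_nonpos h, mul_neg, neg_neg]
    nlinarith [one_add_tanh_le x]

theorem tanh_nonneg {x : ℝ} (h : 0 ≤ x) : 0 ≤ tanh x := by
  rw [tanh_eq_sinh_div_cosh]; exact div_nonneg (sinh_nonneg_iff.2 h) (cosh_pos x).le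

theorem tendsto_tanh_atBot : Tendsto tanh atBot (nhds (-1)) := by
  have h : Tendsto (fun x : ℝ => 2 * exp (2 * x)) atBot (nhds 0) := by
    have := (tendsto_exp_atBot.comp (tendsto_id.const_mul_atBot (by norm_num : (0:ℝ) < 2))).const_mul 2
    simpa [Function.comp_def] using this
  have h2 : Tendsto (fun x => 1 + tanh x) atBot (nhds 0) :=
    tendsto_of_tendsto_of_tendsto_of_le_of_le tendsto_const_nhds h
      (fun x => by have := neg_one_lt_tanh x; simp only; linarith) one_add_tanh_le
  have := h2.sub_const 1
  simpa using this

namespace Sol.KC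

variable {V : ℝ → ℝ → ℝ}

theorem sob (h : KC V) (t x : ℝ) : V t x ^ 2 ≤ (∫ x, V t x ^ 2) + ∫ x, Dx V t x ^ 2 :=
  sobolev (h.i0 t) (h.i1 t) (h.sm.hasDx t) x

theorem bdd' (h : KC V) (T : ℝ) : ∃ N, 1 ≤ N ∧ ∀ t, |t| ≤ T → (∫ x, V t x ^ 2) ≤ N ∧
    (∫ x, Dx V t x ^ 2) ≤ N ∧ ∀ x, |V t x| ≤ N := by
  obtain ⟨C, hC⟩ := h.bdd T
  refine ⟨1 + |C| + |C|, by linarith [abs_nonneg C], fun t ht => ?_⟩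
  obtain ⟨h1, h2⟩ := hC t ht
  have := le_abs_self C
  have := abs_nonneg C
  exact ⟨by linarith, by linarith, fun x =>
    (abs_le_one_add ((h.sob t x).trans (by linarith : _ ≤ |C| + |C|))).trans (by linarith)⟩

/-- Weighted L² identity. -/
theorem law_weight (h : KC V) {φ : ℝ → ℝ → ℝ} (sφ : Sm φ) (t x : ℝ) :
    Dt (fun t x => V t x ^ 2 * φ t x) t x =
    Dx (fun t x => 6 * Dx φ t x * V t x * Dx V t x + 3 * φ t x * Dx V t x ^ 2
      + 4 * φ t x * V t x ^ 3) t x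
    + Dx (Dx (Dx (fun t x => - (V t x ^ 2 * φ t x)))) t x
    + (V t x ^ 2 * Dx (Dx (Dx φ)) t x - 3 * Dx V t x ^ 2 * Dx φ t x - 4 * V t x ^ 3 * Dx φ t x
      + V t x ^ 2 * Dt φ t x) := by
  have s0 := h.sm
  simp (maxDischargeDepth := 20) only [Sm.Dx_sub, Sm.Dx_add, Sm.Dx_mul, Sm.Dx_pow, Sm.Dx_neg,
    Sm.Dx_const, Sm.Dt_pow, Sm.Dt_sub,
    Sm.Dt_add, Sm.Dt_mul, Sm.Dt_const, Sm.add, Sm.sub,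
    Sm.mul, Sm.pow, Sm.neg, Sm.const, s0, s0.dx, s0.dx.dx, sφ, sφ.dx, sφ.dx.dx, h.Dt_eq]
  norm_num; ring

theorem l2 (h : KC V) (s t : ℝ) : ∫ x, V t x ^ 2 = ∫ x, V s x ^ 2 := by
  obtain ⟨N, hN, hb⟩ := h.bdd' (max |s| |t|)
  have hu : ∀ τ ∈ uIcc s t, |τ| ≤ max |s| |t| := by
    intro τ hτ
    rw [mem_uIcc] at hτ
    rcases hτ with hτ | hτ
    · exact abs_le_max_abs_abs hτ.1 hτ.2
    · rw [max_comm]; exact abs_le_max_abs_abs hτ.1 hτ.2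
  have s0 := h.sm
  let w : ℝ → ℝ → ℝ := fun τ x => 3 * Dx V τ x ^ 2 + 4 * N * V τ x ^ 2
  have key := conservation_dom (s := s) (t := t) (e := fun t x => V t x ^ 2) (w := w)
    (C := 3 * N + 4 * N * N) (B := 0) (s0.pow 2)
      (((Sm.const 3).mul (s0.dx.pow 2)).add ((Sm.const 4).mul (s0.pow 3)))
      (s0.pow 2).neg (Sm.const 0) (fun t x => by rw [h.law0]; ring) (fun τ => (h.i0 τ).2)
      ?_ ?_ ?_ (fun τ _ => ⟨integrable_zero _ _ _, by simp⟩)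
  · rw [zero_mul] at key
    linarith [abs_nonpos_iff.1 key]
  · intro τ hτ
    have i1 : Integrable fun x => 3 * Dx V τ x ^ 2 := (h.i1 τ).2.const_mul _
    have i2 : Integrable fun x => 4 * N * V τ x ^ 2 := (h.i0 τ).2.const_mul _
    refine ⟨i1.add i2, ?_⟩
    simp only [w]
    rw [integral_add i1 i2, integral_const_mul, integral_const_mul]
    obtain ⟨b1, b2, -⟩ := hb τ (hu τ hτ)
    gcongr
  · intro τ hτ x
    have hv := (hb τ (hu τ hτ)).2.2 x
    rw [abs_le] at hv ⊢
    simp only [w]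
    constructor <;> nlinarith [sq_nonneg (V τ x), sq_nonneg (Dx V τ x)]
  · intro τ hτ x
    simp only [w]
    rw [abs_neg, abs_of_nonneg (sq_nonneg _)]
    nlinarith [sq_nonneg (V τ x), sq_nonneg (Dx V τ x)]

end Sol.KC

end KdV

namespace KdV

open Set
set_option linter.unusedSimpArgs false

/-- The travelling transition profile. -/
noncomputable def tw (μ b s : ℝ) : ℝ → ℝ → ℝ := fun t x => tanh (μ * (x - (b + s * t)))

section tw

variable (μ b s : ℝ)

theorem tw_sm : Sm (tw μ b s) := by
  refine Sm.of_space (a := fun t x => μ * (x - (b + s * t))) contDiff_tanh ?_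
  unfold Sm Function.uncurry
  fun_prop

theorem tw_dx : Dx (tw μ b s) = fun t x => μ * (1 - tw μ b s t x ^ 2) := by
  ext t x
  refine HasDerivAt.deriv ?_
  have h : HasDerivAt (fun y => μ * (y - (b + s * t))) (μ * 1) x :=
    ((hasDerivAt_id x).sub_const _).const_mul μ
  have := (hasDerivAt_tanh (μ * (x - (b + s * t)))).comp x h
  exact this.congr_deriv (by simp only [tw]; ring)

theorem tw_dt : Dt (tw μ b s) = fun t x => -(s * μ) * (1 - tw μ b s t x ^ 2) := by
  ext t x
  refine HasDerivAt.deriv ?_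
  have h : HasDerivAt (fun τ => μ * (x - (b + s * τ))) (μ * (-(s * 1))) t :=
    ((((hasDerivAt_id t).const_mul s).const_add b).const_sub x).const_mul μ
  have := (hasDerivAt_tanh (μ * (x - (b + s * t)))).comp t h
  exact this.congr_deriv (by simp only [tw]; ring)

theorem tw_lt (t x : ℝ) : tw μ b s t x ^ 2 < 1 := tanh_sq_lt_one _

end tw

/-- Control of the cubic term by the weighted energy. -/
theorem cubic_le {f f' g g' : ℝ → ℝ} (hf : SqI f) (hf' : SqI f') (hd : ∀ x, HasDerivAt f (f' x) x)
    (hg : ∀ x, HasDerivAt g (g' x) x) (cg' : Continuous g') (hg1 : ∀ x, |g x| ≤ 1)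
    (hg' : ∀ x, |g' x| ≤ |g x|) {δ : ℝ} (hδ : 0 ≤ δ) (h : ∫ x, f x ^ 2 ≤ δ ^ 2) :
    |∫ x, f x ^ 3 * g x ^ 2| ≤ δ * (3 * (∫ x, f x ^ 2 * g x ^ 2) + 2 * ∫ x, f' x ^ 2 * g x ^ 2) := by
  have cg : Continuous g := continuous_iff_continuousAt.mpr fun x => (hg x).continuousAt
  have h1 : SqI (fun x => g x * f x) := hf.bdd_mul cg hg1
  have h2 : SqI (fun x => g x * f' x) := hf'.bdd_mul cg hg1
  have h3 : SqI (fun x => g' x * f x) :=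
    hf.bdd_mul cg' (M := 1) fun x => (hg' x).trans (hg1 x)
  have h4 : SqI (fun x => g' x * f x + g x * f' x) := h3.add h2
  have hS := sobolev h1 h4 (fun x => (hg x).mul (hd x))
  set S := (∫ x, (g x * f x) ^ 2) + ∫ x, (g' x * f x + g x * f' x) ^ 2 with hSdef
  have S0 : 0 ≤ S := add_nonneg (int_sq_nonneg _) (int_sq_nonneg _)
  have hSle : S ≤ 3 * (∫ x, f x ^ 2 * g x ^ 2) + 2 * ∫ x, f' x ^ 2 * g x ^ 2 := by
    have e1 := int_sq_add_le h3 h2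
    have e2 : ∫ x, (g' x * f x) ^ 2 ≤ 1 * ∫ x, (g x * f x) ^ 2 := by
      refine int_sq_le_of_le h3 h1 fun x => ?_
      rw [one_mul, mul_pow, mul_pow, ← sq_abs (g' x), ← sq_abs (g x)]
      exact mul_le_mul_of_nonneg_right (pow_le_pow_left₀ (abs_nonneg _) (hg' x) 2) (sq_nonneg _)
    have e3 : ∫ x, f x ^ 2 * g x ^ 2 = ∫ x, (g x * f x) ^ 2 := by congr 1; ext x; ring
    have e4 : ∫ x, f' x ^ 2 * g x ^ 2 = ∫ x, (g x * f' x) ^ 2 := by congr 1; ext x; ring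
    rw [e3, e4]
    linarith
  have h5 : SqI (fun x => (g x * f x) * (g x * f x)) :=
    SqI.of_le (h1.1.mul h1.1) h1 (C := S) fun x => by
      rw [mul_pow]; exact mul_le_mul_of_nonneg_right (hS x) (sq_nonneg _)
  have e5 : ∫ x, ((g x * f x) * (g x * f x)) ^ 2 ≤ S * ∫ x, (g x * f x) ^ 2 :=
    int_sq_le_of_le h5 h1 fun x => by
      rw [mul_pow]; exact mul_le_mul_of_nonneg_right (hS x) (sq_nonneg _)
  have cs := int_mul_sq_le hf h5 univ
  simp only [Measure.restrict_univ] at cs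
  have e6 : ∫ x, f x ^ 3 * g x ^ 2 = ∫ x, f x * ((g x * f x) * (g x * f x)) := by
    congr 1; ext x; ring
  rw [e6]
  refine le_trans ?_ (mul_le_mul_of_nonneg_left hSle hδ)
  refine abs_le_of_sq_le_sq ?_ (mul_nonneg hδ S0)
  refine cs.trans ?_
  have e7 : ∫ x, (g x * f x) ^ 2 ≤ S := by
    have := int_sq_nonneg (fun x => g' x * f x + g x * f' x); linarith
  calc _ ≤ δ ^ 2 * (S * S) := by
        refine mul_le_mul h (e5.trans (mul_le_mul_of_nonneg_left e7 S0)) (int_sq_nonneg _)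
          (sq_nonneg _)
    _ = _ := by ring

namespace Sol.KC

variable {V : ℝ → ℝ → ℝ}

theorem energy_flux_le {f f' : ℝ → ℝ} (hf : SqI f) (hf' : SqI f')
    (hd : ∀ x, HasDerivAt f (f' x) x) {μ θ δ : ℝ} (hμ : 0 < μ) (hμ1 : μ ≤ 1)
    (hμθ : 16 * μ ^ 2 ≤ θ) (hδ : 0 ≤ δ) (hδθ : 48 * δ ≤ θ) (hδ1 : δ ≤ 1 / 4)
    (h : ∫ x, f x ^ 2 ≤ δ ^ 2) (c : ℝ) :
    ∫ x, (f x ^ 2 * (-μ ^ 3 * (1 - tanh (μ * (x - c)) ^ 2) * (1 - 3 * tanh (μ * (x - c)) ^ 2))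
      - 3 * f' x ^ 2 * (1 / 2 * μ * (1 - tanh (μ * (x - c)) ^ 2))
      - 4 * f x ^ 3 * (1 / 2 * μ * (1 - tanh (μ * (x - c)) ^ 2))
      - θ / 2 * (f x ^ 2 * (1 / 2 * μ * (1 - tanh (μ * (x - c)) ^ 2)))) ≤ 0 := by
  let g : ℝ → ℝ := fun x => sqrt (μ / 2) / cosh (μ * (x - c))
  have hch : ∀ x, 1 - tanh (μ * (x - c)) ^ 2 = 1 / cosh (μ * (x - c)) ^ 2 := by
    intro x
    rw [tanh_eq_sinh_div_cosh]
    have := (cosh_pos (μ * (x - c))).ne'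
    have := cosh_sq (μ * (x - c))
    field_simp
    linarith
  have g2 : ∀ x, 1 / 2 * μ * (1 - tanh (μ * (x - c)) ^ 2) = g x ^ 2 := by
    intro x
    simp only [g]
    rw [hch, div_pow, sq_sqrt (by positivity)]
    ring
  have T1 : ∀ x, tanh (μ * (x - c)) ^ 2 < 1 := fun x => tanh_sq_lt_one _
  let g' : ℝ → ℝ := fun x => -μ * tanh (μ * (x - c)) * g x
  have ct : Continuous fun x : ℝ => tanh (μ * (x - c)) :=
    contDiff_tanh.continuous.comp (by fun_prop)
  have cg : Continuous g := by
    refine continuous_const.div (continuous_cosh.comp (by fun_prop)) fun x => (cosh_pos _).ne'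
  have hg : ∀ x, HasDerivAt g (g' x) x := by
    intro x
    have h0 : HasDerivAt (fun y => μ * (y - c)) (μ * 1) x :=
      ((hasDerivAt_id x).sub_const _).const_mul μ
    have h1 := (hasDerivAt_const x (sqrt (μ / 2))).div ((hasDerivAt_cosh _).comp x h0)
      (cosh_pos _).ne'
    refine h1.congr_deriv ?_
    simp only [g', g, Function.comp]
    rw [tanh_eq_sinh_div_cosh]
    have := (cosh_pos (μ * (x - c))).ne'
    field_simp
    ring
  have hg1 : ∀ x, |g x| ≤ 1 := by
    intro x
    refine abs_le_of_sq_le_sq ?_ one_pos.le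
    rw [← g2]
    nlinarith [sq_nonneg (tanh (μ * (x - c))), T1 x]
  have hg' : ∀ x, |g' x| ≤ |g x| := by
    intro x
    simp only [g']
    rw [abs_mul]
    refine mul_le_of_le_one_left (abs_nonneg _) ?_
    refine abs_le_of_sq_le_sq ?_ one_pos.le
    nlinarith [sq_nonneg (tanh (μ * (x - c))), T1 x]
  have key := cubic_le hf hf' hd hg (by fun_prop) hg1 hg' hδ h
  have iB : Integrable (fun x => f x ^ 2 * g x ^ 2) := by
    have := (hf.bdd_mul cg hg1).2
    refine this.congr (Eventually.of_forall fun x => ?_); simp only; ring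
  have iA : Integrable (fun x => f' x ^ 2 * g x ^ 2) := by
    have := (hf'.bdd_mul cg hg1).2
    refine this.congr (Eventually.of_forall fun x => ?_); simp only; ring
  have iC : Integrable (fun x => f x ^ 3 * g x ^ 2) := by
    refine (hf.2.add (hf.2.const_mul ((∫ x, f x ^ 2) + ∫ x, f' x ^ 2))).mono'
      ((hf.1.pow 3).mul (cg.pow 2)).aestronglyMeasurable (Eventually.of_forall fun x => ?_)
    have hs := sobolev hf hf' hd x
    have hg2 : g x ^ 2 ≤ 1 := by rw [← sq_abs]; exact pow_le_one₀ (abs_nonneg _) (hg1 x)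
    simp only [norm_eq_abs, Pi.add_apply]
    have h3 : |f x ^ 3 * g x ^ 2| ≤ |f x| * f x ^ 2 := by
      rw [abs_mul, abs_of_nonneg (sq_nonneg (g x)), pow_succ, mul_comm, abs_mul,
        abs_of_nonneg (sq_nonneg (f x))]
      have : 0 ≤ f x ^ 2 * |f x| := by positivity
      nlinarith
    have h4 : |f x| ≤ 1 + ((∫ x, f x ^ 2) + ∫ x, f' x ^ 2) := abs_le_one_add hs
    nlinarith [sq_nonneg (f x)]
  have hle : ∀ x, f x ^ 2 * (-μ ^ 3 * (1 - tanh (μ * (x - c)) ^ 2) * (1 - 3 * tanh (μ * (x - c)) ^ 2))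
      - 3 * f' x ^ 2 * (1 / 2 * μ * (1 - tanh (μ * (x - c)) ^ 2))
      - 4 * f x ^ 3 * (1 / 2 * μ * (1 - tanh (μ * (x - c)) ^ 2))
      - θ / 2 * (f x ^ 2 * (1 / 2 * μ * (1 - tanh (μ * (x - c)) ^ 2))) ≤
      (-3) * (f' x ^ 2 * g x ^ 2) + ((-4) * (f x ^ 3 * g x ^ 2) +
        (4 * μ ^ 2 - θ / 2) * (f x ^ 2 * g x ^ 2)) := by
    intro x
    have e : -μ ^ 3 * (1 - tanh (μ * (x - c)) ^ 2) * (1 - 3 * tanh (μ * (x - c)) ^ 2)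
        = g x ^ 2 * (2 * μ ^ 2 * (3 * tanh (μ * (x - c)) ^ 2 - 1)) := by
      rw [← g2]; ring
    rw [e, g2]
    have h1 : 0 ≤ f x ^ 2 * g x ^ 2 * μ ^ 2 := by positivity
    nlinarith [T1 x]
  have hR : Integrable (fun x => (-3) * (f' x ^ 2 * g x ^ 2) + ((-4) * (f x ^ 3 * g x ^ 2) +
        (4 * μ ^ 2 - θ / 2) * (f x ^ 2 * g x ^ 2))) :=
    (iA.const_mul _).add ((iC.const_mul _).add (iB.const_mul _))
  have hR2 : Integrable (fun x => (-4) * (f x ^ 3 * g x ^ 2) +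
        (4 * μ ^ 2 - θ / 2) * (f x ^ 2 * g x ^ 2)) := (iC.const_mul _).add (iB.const_mul _)
  by_cases hi : Integrable (fun x => f x ^ 2 * (-μ ^ 3 * (1 - tanh (μ * (x - c)) ^ 2) *
      (1 - 3 * tanh (μ * (x - c)) ^ 2))
      - 3 * f' x ^ 2 * (1 / 2 * μ * (1 - tanh (μ * (x - c)) ^ 2))
      - 4 * f x ^ 3 * (1 / 2 * μ * (1 - tanh (μ * (x - c)) ^ 2))
      - θ / 2 * (f x ^ 2 * (1 / 2 * μ * (1 - tanh (μ * (x - c)) ^ 2))))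
  swap
  · rw [integral_undef hi]
  refine (integral_mono hi hR hle).trans ?_
  rw [integral_add (iA.const_mul _) hR2, integral_add (iC.const_mul _) (iB.const_mul _),
    integral_const_mul, integral_const_mul, integral_const_mul]
  have A0 : 0 ≤ ∫ x, f' x ^ 2 * g x ^ 2 := integral_nonneg fun x => by positivity
  have B0 : 0 ≤ ∫ x, f x ^ 2 * g x ^ 2 := integral_nonneg fun x => by positivity
  have := (abs_le.1 key).1
  generalize (∫ x, f' x ^ 2 * g x ^ 2) = A at *
  generalize (∫ x, f x ^ 2 * g x ^ 2) = B at *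
  nlinarith

theorem weighted_mono (h : KC V) {μ θ δ : ℝ} (hμ : 0 < μ) (hμ1 : μ ≤ 1)
    (hμθ : 16 * μ ^ 2 ≤ θ) (hδ : 0 ≤ δ) (hδθ : 48 * δ ≤ θ) (hδ1 : δ ≤ 1 / 4)
    (h0 : ∫ x, V 0 x ^ 2 ≤ δ ^ 2) (b : ℝ) {t : ℝ} (ht : 0 ≤ t) :
    ∫ x, V t x ^ 2 * (1 / 2 * (1 + tanh (μ * (x - (b + θ / 2 * t))))) ≤
      ∫ x, V 0 x ^ 2 * (1 / 2 * (1 + tanh (μ * (x - (b + θ / 2 * 0))))) := by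
  obtain ⟨N, hN, hb⟩ := h.bdd' t
  have hu : ∀ τ ∈ Icc 0 t, |τ| ≤ t := fun τ hτ => by rw [abs_of_nonneg hτ.1]; exact hτ.2
  set T := tw μ b (θ / 2) with hT
  have sT : Sm T := tw_sm _ _ _
  have T1 : ∀ t x, T t x ^ 2 < 1 := tw_lt _ _ _
  let φ : ℝ → ℝ → ℝ := fun t x => 1 / 2 * (1 + T t x)
  have sφ : Sm φ := (Sm.const _).mul ((Sm.const _).add sT)
  have dT := tw_dx μ b (θ / 2)
  have dtT := tw_dt μ b (θ / 2)
  rw [← hT] at dT dtT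
  have φx : Dx φ = fun t x => 1 / 2 * μ * (1 - T t x ^ 2) := by
    simp only [φ]
    simp (maxDischargeDepth := 20) only [Sm.Dx_sub, Sm.Dx_add, Sm.Dx_mul, Sm.Dx_pow, Sm.Dx_const,
      Sm.add, Sm.mul, Sm.const, sT, dT]
    ext t x; ring
  have φt : Dt φ = fun t x => -(θ / 2 * (1 / 2 * μ * (1 - T t x ^ 2))) := by
    simp only [φ]
    simp (maxDischargeDepth := 20) only [Sm.Dt_sub, Sm.Dt_add, Sm.Dt_mul, Sm.Dt_pow, Sm.Dt_const,
      Sm.add, Sm.mul, Sm.const, sT, dtT]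
    ext t x; ring
  have φxxx : Dx (Dx (Dx φ)) = fun t x => -μ ^ 3 * (1 - T t x ^ 2) * (1 - 3 * T t x ^ 2) := by
    rw [φx]
    simp (maxDischargeDepth := 20) only [Sm.Dx_sub, Sm.Dx_add, Sm.Dx_mul, Sm.Dx_pow, Sm.Dx_const,
      Sm.add, Sm.mul, Sm.sub, Sm.pow, Sm.const, sT, dT]
    ext t x; norm_num; ring
  have s0 := h.sm
  have bφ : ∀ t x, |φ t x| ≤ 1 := by
    intro t x
    have := abs_lt.1 ((sq_lt_one_iff_abs_lt_one _).1 (T1 t x))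
    simp only [φ]
    rw [abs_le]; constructor <;> linarith [this.1, this.2]
  have bφx : ∀ t x, 0 ≤ Dx φ t x ∧ Dx φ t x ≤ 1 := by
    intro t x
    rw [φx]
    have := T1 t x
    have := sq_nonneg (T t x)
    constructor
    · have : 0 ≤ 1 - T t x ^ 2 := by linarith
      positivity
    · nlinarith
  have bφxxx : ∀ t x, |Dx (Dx (Dx φ)) t x| ≤ 2 := by
    intro t x
    rw [φxxx]
    have h1 := T1 t x
    have h2 := sq_nonneg (T t x)
    have hμ3 : |-μ ^ 3| ≤ 1 := by rw [abs_neg, abs_of_pos (by positivity)]; exact pow_le_one₀ hμ.le hμ1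
    have h3 : |1 - T t x ^ 2| ≤ 1 := by rw [abs_le]; constructor <;> linarith
    have h4 : |1 - 3 * T t x ^ 2| ≤ 2 := by rw [abs_le]; constructor <;> linarith
    simp only [abs_mul]
    have := abs_nonneg (1 - T t x ^ 2)
    have := abs_nonneg (1 - 3 * T t x ^ 2)
    calc |-μ ^ 3| * |1 - T t x ^ 2| * |1 - 3 * T t x ^ 2| ≤ 1 * 1 * 2 := by gcongr
      _ = 2 := by norm_num
  have hθ : 0 ≤ θ := by nlinarith
  let w : ℝ → ℝ → ℝ := fun τ x => (2 + 10 * N + θ) * V τ x ^ 2 + 12 * Dx V τ x ^ 2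
  have hw : ∀ τ ∈ Icc 0 t, Integrable (w τ) ∧ ∫ x, w τ x ≤ (2 + 10 * N + θ) * N + 12 * N := by
    intro τ hτ
    have i1 : Integrable fun x => 12 * Dx V τ x ^ 2 := (h.i1 τ).2.const_mul _
    have i2 : Integrable fun x => (2 + 10 * N + θ) * V τ x ^ 2 := (h.i0 τ).2.const_mul _
    refine ⟨i2.add i1, ?_⟩
    simp only [w]
    rw [integral_add i2 i1, integral_const_mul, integral_const_mul]
    obtain ⟨b1, b2, -⟩ := hb τ (hu τ hτ)
    gcongr
  have dom : ∀ G : ℝ → ℝ → ℝ, Sm G → (∀ τ ∈ Icc 0 t, ∀ x, |G τ x| ≤ w τ x) → ∀ τ ∈ Icc 0 t,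
      Integrable (G τ) ∧ ∫ x, |G τ x| ≤ (2 + 10 * N + θ) * N + 12 * N := by
    intro G sG hG τ hτ
    have : Integrable (G τ) := (hw τ hτ).1.mono' (sG.cont_x τ).aestronglyMeasurable
      (Eventually.of_forall (hG τ hτ))
    exact ⟨this, (integral_mono this.abs (hw τ hτ).1 (hG τ hτ)).trans (hw τ hτ).2⟩
  have eint : ∀ τ, Integrable (fun x => V τ x ^ 2 * φ τ x) := fun τ =>
    (h.i0 τ).2.mono' (((s0.pow 2).mul sφ).cont_x τ).aestronglyMeasurable
      (Eventually.of_forall fun x => by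
        rw [norm_eq_abs, abs_mul, abs_of_nonneg (sq_nonneg _)]
        exact mul_le_of_le_one_right (sq_nonneg _) (bφ τ x))
  have cube : ∀ τ ∈ Icc 0 t, ∀ x, |V τ x ^ 3| ≤ N * V τ x ^ 2 := by
    intro τ hτ x
    rw [pow_succ, abs_mul, abs_of_nonneg (sq_nonneg _), mul_comm]
    exact mul_le_mul_of_nonneg_right ((hb τ (hu τ hτ)).2.2 x) (sq_nonneg _)
  have cr : ∀ a b : ℝ, |a * b| ≤ a ^ 2 / 2 + b ^ 2 / 2 := by
    intro a b
    rw [abs_le]; constructor <;> nlinarith [sq_nonneg (a + b), sq_nonneg (a - b)]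
  have key := conservation (s := 0) (t := t) (e := fun t x => V t x ^ 2 * φ t x)
    (F := fun t x => 6 * Dx φ t x * V t x * Dx V t x + 3 * φ t x * Dx V t x ^ 2
      + 4 * φ t x * V t x ^ 3) (P := fun t x => - (V t x ^ 2 * φ t x))
    (H := fun t x => (V t x ^ 2 * Dx (Dx (Dx φ)) t x - 3 * Dx V t x ^ 2 * Dx φ t x
      - 4 * V t x ^ 3 * Dx φ t x + V t x ^ 2 * Dt φ t x)) (B := 0)
      (C := (2 + 10 * N + θ) * N + 12 * N)
    ((s0.pow 2).mul sφ)
    ((((((Sm.const 6).mul sφ.dx).mul s0).mul s0.dx).add (((Sm.const 3).mul sφ).mul (s0.dx.pow 2))).add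
      (((Sm.const 4).mul sφ).mul (s0.pow 3)))
    ((s0.pow 2).mul sφ).neg
    (((((s0.pow 2).mul sφ.dx.dx.dx).sub (((Sm.const 3).mul (s0.dx.pow 2)).mul sφ.dx)).sub
      (((Sm.const 4).mul (s0.pow 3)).mul sφ.dx)).add ((s0.pow 2).mul sφ.dt))
    (fun t x => h.law_weight sφ t x) ht (eint 0) (eint t) ?_ ?_ ?_
  · simp only [φ, zero_mul, hT, tw] at key
    linarith
  · refine dom _ ((((((Sm.const 6).mul sφ.dx).mul s0).mul s0.dx).add (((Sm.const 3).mul sφ).mul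
      (s0.dx.pow 2))).add (((Sm.const 4).mul sφ).mul (s0.pow 3))) ?_
    intro τ hτ x
    have h1 := cr (V τ x) (Dx V τ x)
    have h3 := cube τ hτ x
    obtain ⟨p1, p2⟩ := bφx τ x
    have p3 := bφ τ x
    have e1 : |6 * Dx φ τ x * V τ x * Dx V τ x| ≤ 3 * V τ x ^ 2 + 3 * Dx V τ x ^ 2 := by
      rw [show 6 * Dx φ τ x * V τ x * Dx V τ x = Dx φ τ x * (6 * (V τ x * Dx V τ x)) by ring,
        abs_mul, abs_of_nonneg p1, abs_mul 6, abs_of_pos (by norm_num : (0:ℝ) < 6)]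
      have := abs_nonneg (V τ x * Dx V τ x)
      nlinarith
    have e2 : |3 * φ τ x * Dx V τ x ^ 2| ≤ 3 * Dx V τ x ^ 2 := by
      rw [abs_mul, abs_mul, abs_of_nonneg (sq_nonneg (Dx V τ x)), abs_of_pos (by norm_num : (0:ℝ) < 3)]
      nlinarith [sq_nonneg (Dx V τ x)]
    have e3 : |4 * φ τ x * V τ x ^ 3| ≤ 4 * (N * V τ x ^ 2) := by
      rw [abs_mul, abs_mul, abs_of_pos (by norm_num : (0:ℝ) < 4)]
      have := abs_nonneg (V τ x ^ 3)
      nlinarith [abs_nonneg (φ τ x)]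
    refine (abs_add_le _ _).trans ((add_le_add (abs_add_le _ _) le_rfl).trans ?_)
    simp only [w]
    nlinarith [sq_nonneg (V τ x), sq_nonneg (Dx V τ x), mul_nonneg hθ (sq_nonneg (V τ x)),
      mul_nonneg (sub_nonneg.2 hN) (sq_nonneg (V τ x))]
  · refine dom _ ((s0.pow 2).mul sφ).neg ?_
    intro τ hτ x
    rw [abs_neg, abs_mul, abs_of_nonneg (sq_nonneg _)]
    have p3 := bφ τ x
    simp only [w]
    nlinarith [sq_nonneg (V τ x), sq_nonneg (Dx V τ x), mul_nonneg hθ (sq_nonneg (V τ x)),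
      mul_nonneg (sub_nonneg.2 hN) (sq_nonneg (V τ x))]
  · intro τ hτ
    obtain ⟨d1, d2⟩ := dom _ (((((s0.pow 2).mul sφ.dx.dx.dx).sub (((Sm.const 3).mul
      (s0.dx.pow 2)).mul sφ.dx)).sub (((Sm.const 4).mul (s0.pow 3)).mul sφ.dx)).add
      ((s0.pow 2).mul sφ.dt)) (fun τ hτ x => by
        have h3 := cube τ hτ x
        obtain ⟨p1, p2⟩ := bφx τ x
        have p3 := bφxxx τ x
        have p4 : |Dt φ τ x| ≤ θ := by
          have : Dt φ τ x = -(θ / 2 * Dx φ τ x) := by rw [φt, φx]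
          rw [this, abs_neg, abs_of_nonneg (by positivity)]
          nlinarith
        have e1 : |V τ x ^ 2 * Dx (Dx (Dx φ)) τ x| ≤ 2 * V τ x ^ 2 := by
          rw [abs_mul, abs_of_nonneg (sq_nonneg _)]; nlinarith [sq_nonneg (V τ x)]
        have e2 : |3 * Dx V τ x ^ 2 * Dx φ τ x| ≤ 3 * Dx V τ x ^ 2 := by
          rw [abs_of_nonneg (by positivity)]; nlinarith [sq_nonneg (Dx V τ x)]
        have e3 : |4 * V τ x ^ 3 * Dx φ τ x| ≤ 4 * (N * V τ x ^ 2) := by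
          rw [abs_mul, abs_mul, abs_of_pos (by norm_num : (0:ℝ) < 4), abs_of_nonneg p1]
          have := abs_nonneg (V τ x ^ 3)
          nlinarith
        have e4 : |V τ x ^ 2 * Dt φ τ x| ≤ θ * V τ x ^ 2 := by
          rw [abs_mul, abs_of_nonneg (sq_nonneg _)]; nlinarith [sq_nonneg (V τ x)]
        refine (abs_add_le _ _).trans ((add_le_add ((abs_sub _ _).trans (add_le_add (abs_sub _ _) le_rfl)) le_rfl).trans ?_)
        simp only [w]
        nlinarith [sq_nonneg (V τ x), sq_nonneg (Dx V τ x),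
          mul_nonneg (sub_nonneg.2 hN) (sq_nonneg (V τ x))]) τ hτ
    refine ⟨d1, d2, ?_⟩
    have en := energy_flux_le (h.i0 τ) (h.i1 τ) (s0.hasDx τ) hμ hμ1 hμθ hδ hδθ hδ1
      ((h.l2 0 τ).le.trans h0) (b + θ / 2 * τ)
    refine le_trans (le_of_eq ?_) en
    congr 1
    ext x
    rw [φxxx, φx, φt]
    simp only [hT, tw]
    ring

theorem small_tendsto {θ : ℝ} (hθ : 0 < θ) : ∃ δ > 0, ∀ V, KC V → ∫ x, V 0 x ^ 2 ≤ δ ^ 2 →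
    Tendsto (fun t => ∫ x in Ici (θ * t), V t x ^ 2) atTop (nhds 0) := by
  obtain ⟨μ, hμ, hμ1, hμθ⟩ : ∃ μ : ℝ, 0 < μ ∧ μ ≤ 1 ∧ 16 * μ ^ 2 ≤ θ := by
    refine ⟨min 1 (θ / 16), by positivity, min_le_left _ _, ?_⟩
    have h1 := min_le_left 1 (θ / 16)
    have h2 := min_le_right 1 (θ / 16)
    have h3 : 0 < min 1 (θ / 16) := by positivity
    nlinarith
  refine ⟨min (1 / 4) (θ / 48), by positivity, fun V h h0 => ?_⟩
  have hδ1 := min_le_left (1 / 4) (θ / 48)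
  have hδ2 := min_le_right (1 / 4) (θ / 48)
  set δ := min (1 / 4) (θ / 48)
  have hlim : Tendsto (fun t : ℝ => ∫ x, V 0 x ^ 2 * (1 / 2 * (1 + tanh (μ * (x - θ / 2 * t)))))
      atTop (nhds (∫ _ : ℝ, (0 : ℝ))) := by
    refine tendsto_integral_filter_of_dominated_convergence (fun x => V 0 x ^ 2)
      (Eventually.of_forall fun t => ?_) (Eventually.of_forall fun t => Eventually.of_forall fun x => ?_)
      (h.i0 0).2 (Eventually.of_forall fun x => ?_)
    · refine Continuous.aestronglyMeasurable (((h.i0 0).1.pow 2).mul ?_)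
      have : Continuous fun x : ℝ => tanh (μ * (x - θ / 2 * t)) :=
        contDiff_tanh.continuous.comp (by fun_prop)
      fun_prop
    · rw [norm_eq_abs, abs_mul, abs_of_nonneg (sq_nonneg _)]
      refine mul_le_of_le_one_right (sq_nonneg _) ?_
      have h1 := tanh_lt_one (μ * (x - θ / 2 * t))
      have h2 := neg_one_lt_tanh (μ * (x - θ / 2 * t))
      rw [abs_le]; constructor <;> linarith
    · have : Tendsto (fun t : ℝ => μ * (x - θ / 2 * t)) atTop atBot := by
        refine Tendsto.const_mul_atBot hμ ?_
        simp only [sub_eq_add_neg]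
        refine tendsto_atBot_add_const_left _ _ ?_
        exact tendsto_neg_atTop_atBot.comp (tendsto_id.const_mul_atTop (by positivity))
      have := (((tendsto_tanh_atBot.comp this).const_add 1).const_mul (1 / 2)).const_mul (V 0 x ^ 2)
      simpa using this
  rw [integral_zero] at hlim
  have hlim2 := hlim.const_mul 2
  rw [mul_zero] at hlim2
  refine tendsto_of_tendsto_of_tendsto_of_le_of_le' tendsto_const_nhds hlim2
    (Eventually.of_forall fun t => setInt_sq_nonneg _ _) ?_
  filter_upwards [eventually_ge_atTop 0] with t ht
  have key := h.weighted_mono hμ hμ1 hμθ (by positivity) (by linarith) hδ1 h0 (θ / 2 * t) ht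
  have tb : ∀ z : ℝ, 0 ≤ 1 / 2 * (1 + tanh z) ∧ 1 / 2 * (1 + tanh z) ≤ 1 := fun z => by
    have h1 := tanh_lt_one z
    have h2 := neg_one_lt_tanh z
    constructor <;> linarith
  have hcut : Integrable fun x => V t x ^ 2 * (1 / 2 * (1 + tanh (μ * (x - (θ / 2 * t + θ / 2 * t))))) := by
    refine (h.i0 t).2.mono' (Continuous.aestronglyMeasurable (((h.i0 t).1.pow 2).mul ?_))
      (Eventually.of_forall fun x => ?_)
    · have : Continuous fun x : ℝ => tanh (μ * (x - (θ / 2 * t + θ / 2 * t))) :=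
        contDiff_tanh.continuous.comp (by fun_prop)
      fun_prop
    · rw [norm_eq_abs, abs_of_nonneg (mul_nonneg (sq_nonneg _) (tb _).1)]
      exact mul_le_of_le_one_right (sq_nonneg _) (tb _).2
  calc ∫ x in Ici (θ * t), V t x ^ 2
      ≤ ∫ x in Ici (θ * t), 2 * (V t x ^ 2 * (1 / 2 * (1 + tanh (μ * (x - (θ / 2 * t + θ / 2 * t)))))) := by
        refine setIntegral_mono_on (h.i0 t).2.integrableOn (hcut.const_mul 2).integrableOn
          measurableSet_Ici fun x hx => ?_
        have : 0 ≤ tanh (μ * (x - (θ / 2 * t + θ / 2 * t))) := by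
          refine tanh_nonneg (mul_nonneg hμ.le ?_)
          have : θ * t ≤ x := hx
          linarith
        nlinarith [sq_nonneg (V t x)]
    _ ≤ ∫ x, 2 * (V t x ^ 2 * (1 / 2 * (1 + tanh (μ * (x - (θ / 2 * t + θ / 2 * t)))))) :=
        setIntegral_le_integral (hcut.const_mul 2) (Eventually.of_forall fun x =>
          mul_nonneg two_pos.le (mul_nonneg (sq_nonneg _) (tb _).1))
    _ = 2 * ∫ x, (V t x ^ 2 * (1 / 2 * (1 + tanh (μ * (x - (θ / 2 * t + θ / 2 * t)))))) :=
        integral_const_mul _ _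
    _ ≤ _ := by
        simp only [mul_zero, add_zero] at key
        linarith

end Sol.KC

end KdV

namespace KdV

open Set
set_option linter.unusedSimpArgs false

theorem gronwall_right {f f' : ℝ → ℝ × ℝ} {K ε δ T : ℝ} (hK : 1 ≤ K) (hε : 0 ≤ ε) (hδ : 0 ≤ δ)
    (hd : ∀ t ∈ Icc (-T) T, HasDerivWithinAt f (f' t) (Icc (-T) T) t) (h0 : ‖f 0‖ ≤ δ)
    (hb : ∀ t ∈ Icc (-T) T, ‖f' t‖ ≤ K * ‖f t‖ + ε) {t : ℝ} (ht : t ∈ Icc 0 T) :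
    ‖f t‖ ≤ (δ + ε) * exp (K * T) := by
  have hT : 0 ≤ T := ht.1.trans ht.2
  have sub : Icc 0 T ⊆ Icc (-T) T := Icc_subset_Icc (by linarith) le_rfl
  have key := norm_le_gronwallBound_of_norm_deriv_right_le (f := f) (f' := f') (δ := δ) (K := K)
    (ε := ε) (a := 0) (b := T) (fun t ht => (hd t (sub ht)).continuousWithinAt.mono sub)
    (fun t ht => (hd t (sub ⟨ht.1, ht.2.le⟩)).mono_of_mem_nhdsWithin
      (Icc_mem_nhdsGE_of_mem ⟨by linarith [ht.1], ht.2⟩)) h0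
    (fun t ht => hb t (sub ⟨ht.1, ht.2.le⟩)) t ht
  rw [sub_zero, gronwallBound_of_K_ne_0 (by linarith)] at key
  refine key.trans ?_
  have e1 : exp (K * t) ≤ exp (K * T) := exp_le_exp.2 (by nlinarith [ht.2])
  have e2 : 1 ≤ exp (K * t) := one_le_exp (by nlinarith [ht.1])
  have e3 : ε / K ≤ ε := div_le_self hε hK
  have e4 : 0 ≤ ε / K := by positivity
  nlinarith [mul_le_mul_of_nonneg_left e1 hδ, mul_le_mul_of_nonneg_left e1 hε,
    mul_le_mul_of_nonneg_right e3 (sub_nonneg.2 e2)]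

theorem gronwall {f f' : ℝ → ℝ × ℝ} {K ε δ T : ℝ} (hK : 1 ≤ K) (hε : 0 ≤ ε) (hδ : 0 ≤ δ)
    (hd : ∀ t ∈ Icc (-T) T, HasDerivWithinAt f (f' t) (Icc (-T) T) t) (h0 : ‖f 0‖ ≤ δ)
    (hb : ∀ t ∈ Icc (-T) T, ‖f' t‖ ≤ K * ‖f t‖ + ε) {t : ℝ} (ht : t ∈ Icc (-T) T) :
    ‖f t‖ ≤ (δ + ε) * exp (K * T) := by
  rcases le_total 0 t with h | h
  · exact gronwall_right hK hε hδ hd h0 hb ⟨h, ht.2⟩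
  · have neg_mem : ∀ s ∈ Icc (-T) T, -s ∈ Icc (-T) T := fun s hs =>
      ⟨by linarith [hs.2], by linarith [hs.1]⟩
    have := gronwall_right (f := fun s => f (-s)) (f' := fun s => -f' (-s)) (t := -t) hK hε hδ
      (fun s hs => by
        have h1 : HasDerivWithinAt (fun s : ℝ => -s) (-1) (Icc (-T) T) s :=
          (hasDerivAt_neg s).hasDerivWithinAt
        exact ((hd (-s) (neg_mem s hs)).scomp s h1 neg_mem).congr_deriv (by simp))
      (by simpa using h0) (fun s hs => by simpa using hb _ (neg_mem s hs))
      ⟨by linarith, by linarith [ht.1]⟩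
    simpa using this

/-- A planar linear system. -/
def linF (a b c d : ℝ → ℝ) (t : ℝ) (y : ℝ × ℝ) : ℝ × ℝ :=
  (a t * y.1 + b t * y.2, c t * y.1 + d t * y.2)

theorem linF_norm_le {a b c d : ℝ → ℝ} {K t : ℝ} (ha : |a t| ≤ K) (hb : |b t| ≤ K)
    (hc : |c t| ≤ K) (hd : |d t| ≤ K) (y : ℝ × ℝ) : ‖linF a b c d t y‖ ≤ 2 * K * ‖y‖ := by
  have h1 := norm_fst_le y
  have h2 := norm_snd_le y
  rw [norm_eq_abs] at h1 h2
  have K0 := (abs_nonneg _).trans ha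
  have aux : ∀ u v : ℝ, |u| ≤ K → |v| ≤ K → |u * y.1 + v * y.2| ≤ 2 * K * ‖y‖ := by
    intro u v hu hv
    refine (abs_add_le _ _).trans ?_
    rw [abs_mul, abs_mul]
    have e1 := mul_le_mul hu h1 (abs_nonneg _) K0
    have e2 := mul_le_mul hv h2 (abs_nonneg _) K0
    linarith
  exact max_le (aux _ _ ha hb) (aux _ _ hc hd)

theorem linF_sub {a b c d : ℝ → ℝ} (t : ℝ) (y z : ℝ × ℝ) :
    linF a b c d t y - linF a b c d t z = linF a b c d t (y - z) := by
  ext <;> simp [linF] <;> ring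

/-- Truncation to a box. -/
noncomputable def cl (R : ℝ) (y : ℝ × ℝ) : ℝ × ℝ := (max (-R) (min R y.1), max (-R) (min R y.2))

theorem clamp_abs_le {R : ℝ} (hR : 0 ≤ R) (u : ℝ) : |max (-R) (min R u)| ≤ R ∧ |max (-R) (min R u)| ≤ |u| := by
  constructor
  · rw [abs_le]; exact ⟨le_max_left _ _, max_le (by linarith) (min_le_left _ _)⟩
  · rw [abs_le]
    rcases abs_cases u with ⟨h, h'⟩ | ⟨h, h'⟩ <;> rw [h]
    · exact ⟨by rw [le_max_iff, le_min_iff]; right; constructor <;> linarith,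
        max_le (by linarith) (min_le_right _ _)⟩
    · exact ⟨by rw [le_max_iff, le_min_iff]; right; constructor <;> linarith,
        max_le (by linarith) ((min_le_right _ _).trans (by linarith))⟩

theorem cl_norm {R : ℝ} (hR : 0 ≤ R) (y : ℝ × ℝ) : ‖cl R y‖ ≤ R ∧ ‖cl R y‖ ≤ ‖y‖ :=
  ⟨max_le (clamp_abs_le hR _).1 (clamp_abs_le hR _).1,
    max_le_max (clamp_abs_le hR _).2 (clamp_abs_le hR _).2⟩

theorem cl_eq {R : ℝ} {y : ℝ × ℝ} (h : ‖y‖ ≤ R) : cl R y = y := by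
  have h1 := abs_le.1 ((norm_fst_le y).trans h)
  have h2 := abs_le.1 ((norm_snd_le y).trans h)
  ext
  · simp [cl, h1.1, h1.2]
  · simp [cl, h2.1, h2.2]

theorem cl_sub_le (R : ℝ) (y z : ℝ × ℝ) : ‖cl R y - cl R z‖ ≤ ‖y - z‖ := by
  have aux : ∀ u v : ℝ, |max (-R) (min R u) - max (-R) (min R v)| ≤ |u - v| := fun u v => by
    refine (abs_max_sub_max_le_max _ _ _ _).trans ?_
    rw [sub_self, abs_zero]
    refine max_le (abs_nonneg _) ((abs_min_sub_min_le_max _ _ _ _).trans ?_)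
    rw [sub_self, abs_zero]
    exact max_le (abs_nonneg _) le_rfl
  exact max_le_max (aux _ _) (aux _ _)

theorem linear_ode_Icc {a b c d : ℝ → ℝ} (ha : Continuous a) (hb : Continuous b)
    (hc : Continuous c) (hd : Continuous d) (y₀ : ℝ × ℝ) {T : ℝ} (hT : 0 < T) :
    ∃ y : ℝ → ℝ × ℝ, y 0 = y₀ ∧
      ∀ t ∈ Icc (-T) T, HasDerivWithinAt y (linF a b c d t (y t)) (Icc (-T) T) t := by
  obtain ⟨K, hK1, hK⟩ : ∃ K : ℝ, 1 ≤ K ∧ ∀ t ∈ Icc (-T) T,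
      |a t| ≤ K ∧ |b t| ≤ K ∧ |c t| ≤ K ∧ |d t| ≤ K := by
    have hcp := isCompact_Icc (a := -T) (b := T)
    obtain ⟨A, hA⟩ := hcp.exists_bound_of_continuousOn ha.continuousOn
    obtain ⟨B, hB⟩ := hcp.exists_bound_of_continuousOn hb.continuousOn
    obtain ⟨C, hC⟩ := hcp.exists_bound_of_continuousOn hc.continuousOn
    obtain ⟨D, hD⟩ := hcp.exists_bound_of_continuousOn hd.continuousOn
    refine ⟨1 + |A| + |B| + |C| + |D|, by
      have := abs_nonneg A; have := abs_nonneg B; have := abs_nonneg C; have := abs_nonneg D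
      linarith, fun t ht => ?_⟩
    have := hA t ht; have := hB t ht; have := hC t ht; have := hD t ht
    simp only [norm_eq_abs] at *
    have := le_abs_self A; have := le_abs_self B; have := le_abs_self C; have := le_abs_self D
    have := abs_nonneg A; have := abs_nonneg B; have := abs_nonneg C; have := abs_nonneg D
    refine ⟨?_, ?_, ?_, ?_⟩ <;> linarith
  have hF : ∀ t ∈ Icc (-T) T, ∀ y, ‖linF a b c d t y‖ ≤ 2 * K * ‖y‖ := fun t ht y =>
    linF_norm_le (hK t ht).1 (hK t ht).2.1 (hK t ht).2.2.1 (hK t ht).2.2.2 y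
  let R : ℝ := ‖y₀‖ * exp (2 * K * T)
  have R0 : 0 ≤ R := by positivity
  let K' : NNReal := ⟨2 * K, by linarith⟩
  let L : NNReal := ⟨2 * K * R, by positivity⟩
  let T' : NNReal := ⟨T, hT.le⟩
  have hpl : IsPicardLindelof (fun t y => linF a b c d t (cl R y)) (tmin := -T) (tmax := T)
      ⟨0, by constructor <;> linarith⟩ y₀ (L * T') 0 L K' := by
    refine ⟨fun t ht => LipschitzWith.lipschitzOnWith (LipschitzWith.of_dist_le_mul fun y z => ?_),
      fun y _ => ?_, fun t ht y _ => ?_, ?_⟩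
    · rw [dist_eq_norm, dist_eq_norm, linF_sub]
      exact (hF t ht _).trans (mul_le_mul_of_nonneg_left (cl_sub_le R y z) (by linarith))
    · unfold linF; fun_prop
    · exact (hF t ht _).trans (mul_le_mul_of_nonneg_left (cl_norm R0 y).1 (by linarith))
    · simp only [sub_zero, zero_sub, neg_neg, max_self, NNReal.coe_zero, NNReal.coe_mul]
      exact le_rfl
  obtain ⟨y, hy0, hy⟩ := hpl.exists_eq_forall_mem_Icc_hasDerivWithinAt₀
  refine ⟨y, hy0, fun t ht => ?_⟩
  have := gronwall (K := 2 * K) (ε := 0) (δ := ‖y₀‖) (by linarith) le_rfl (norm_nonneg _) hy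
    (by rw [← hy0]) (fun t ht => by
      rw [add_zero]
      exact (hF t ht _).trans (mul_le_mul_of_nonneg_left (cl_norm R0 _).2 (by linarith))) ht
  rw [add_zero] at this
  have h2 := hy t ht
  rwa [cl_eq this] at h2

theorem linear_ode {a b c d : ℝ → ℝ} (ha : Continuous a) (hb : Continuous b)
    (hc : Continuous c) (hd : Continuous d) (y₀ : ℝ × ℝ) :
    ∃ p q : ℝ → ℝ, p 0 = y₀.1 ∧ q 0 = y₀.2 ∧ (∀ t, HasDerivAt p (a t * p t + b t * q t) t) ∧
      ∀ t, HasDerivAt q (c t * p t + d t * q t) t := by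
  have ex : ∀ n : ℕ, ∃ y : ℝ → ℝ × ℝ, y 0 = y₀ ∧ ∀ t ∈ Icc (-(n + 1 : ℝ)) (n + 1),
      HasDerivWithinAt y (linF a b c d t (y t)) (Icc (-(n + 1 : ℝ)) (n + 1)) t := fun n =>
    linear_ode_Icc ha hb hc hd y₀ (by positivity)
  choose y hy0 hy using ex
  have uniq : ∀ m n : ℕ, m ≤ n → ∀ t ∈ Icc (-(m + 1 : ℝ)) (m + 1), y m t = y n t := by
    intro m n hmn t ht
    have hmn' : (m : ℝ) ≤ n := by exact_mod_cast hmn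
    have sub : Icc (-(m + 1 : ℝ)) (m + 1) ⊆ Icc (-(n + 1 : ℝ)) (n + 1) :=
      Icc_subset_Icc (by linarith) (by linarith)
    obtain ⟨C, hC⟩ := (isCompact_Icc (a := -(m + 1 : ℝ)) (b := m + 1)).exists_bound_of_continuousOn
      (f := fun t => ((a t, b t), (c t, d t))) (by fun_prop)
    have hK : ∀ t ∈ Icc (-(m + 1 : ℝ)) (m + 1), ∀ z, ‖linF a b c d t z‖ ≤ (2 * |C| + 1) * ‖z‖ := by
      intro t ht z
      have h := (hC t ht).trans (le_abs_self C)
      have h1 := (norm_fst_le _).trans h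
      have h2 := (norm_snd_le _).trans h
      refine (linF_norm_le (K := |C|) ((norm_fst_le _).trans h1) ((norm_snd_le _).trans h1)
        ((norm_fst_le _).trans h2) ((norm_snd_le _).trans h2) z).trans ?_
      nlinarith [norm_nonneg z]
    have := gronwall (f := fun t => y m t - y n t) (K := 2 * |C| + 1) (ε := 0) (δ := 0)
      (by linarith [abs_nonneg C]) le_rfl le_rfl
      (fun t ht => (hy m t ht).sub ((hy n t (sub ht)).mono sub)) (by simp [hy0])
      (fun t ht => by rw [add_zero, linF_sub]; exact hK t ht _) ht
    rw [add_zero, zero_mul] at this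
    exact sub_eq_zero.1 (norm_le_zero_iff.1 this)
  let Y : ℝ → ℝ × ℝ := fun t => y ⌈|t|⌉₊ t
  have hY : ∀ t, HasDerivAt Y (linF a b c d t (Y t)) t := by
    intro t
    have hct := Nat.le_ceil |t|
    have h1 : t ∈ Ioo (-((⌈|t|⌉₊ : ℝ) + 1)) (⌈|t|⌉₊ + 1) :=
      ⟨by linarith [neg_abs_le t], by linarith [le_abs_self t]⟩
    have h2 := (hy _ t (Ioo_subset_Icc_self h1)).hasDerivAt (Icc_mem_nhds h1.1 h1.2)
    refine h2.congr_of_eventuallyEq ?_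
    filter_upwards [Ioo_mem_nhds h1.1 h1.2] with s hs
    simp only [Y]
    have hcs := Nat.le_ceil |s|
    rcases le_total ⌈|s|⌉₊ ⌈|t|⌉₊ with h | h
    · exact uniq _ _ h s ⟨by linarith [neg_abs_le s], by linarith [le_abs_self s]⟩
    · exact (uniq _ _ h s (Ioo_subset_Icc_self hs)).symm
  refine ⟨fun t => (Y t).1, fun t => (Y t).2, by simp [Y, hy0], by simp [Y, hy0],
    fun t => ?_, fun t => ?_⟩
  · exact (hasFDerivAt_fst (p := Y t)).comp_hasDerivAt t (hY t)
  · exact (hasFDerivAt_snd (p := Y t)).comp_hasDerivAt t (hY t)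

end KdV

namespace KdV

open Set
set_option linter.unusedSimpArgs false

theorem taylor_two {f f1 f2 : ℝ → ℝ} (hd : ∀ y, HasDerivAt f (f1 y) y)
    (hd1 : ∀ y, HasDerivAt f1 (f2 y) y) {C x : ℝ} (hC : ∀ y, |y - x| ≤ 1 → |f2 y| ≤ C) {h : ℝ}
    (hh : |h| ≤ 1) : |f (x + h) - f x - h * f1 x| ≤ C * h ^ 2 := by
  have C0 : 0 ≤ C := (abs_nonneg _).trans (hC x (by simp))
  have conv : Convex ℝ (Metric.closedBall x |h|) := convex_closedBall _ _
  have mem : ∀ y, y ∈ Metric.closedBall x |h| → |y - x| ≤ |h| := fun y hy => by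
    rwa [Metric.mem_closedBall, dist_eq_norm] at hy
  have hx : x ∈ Metric.closedBall x |h| := Metric.mem_closedBall_self (abs_nonneg _)
  have hxh : x + h ∈ Metric.closedBall x |h| := by
    rw [Metric.mem_closedBall, dist_eq_norm]; simp
  have h1 : ∀ y ∈ Metric.closedBall x |h|, |f1 y - f1 x| ≤ C * |h| := fun y hy =>
    (conv.norm_image_sub_le_of_norm_hasDerivWithin_le (fun z _ => (hd1 z).hasDerivWithinAt)
      (fun z hz => hC z ((mem z hz).trans hh)) hx hy).trans
      (mul_le_mul_of_nonneg_left (mem y hy) C0)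
  have h2 := conv.norm_image_sub_le_of_norm_hasDerivWithin_le (f := fun y => f y - (y - x) * f1 x)
    (f' := fun y => f1 y - 1 * f1 x) (C := C * |h|) (x := x) (y := x + h)
    (fun z _ => ((hd z).sub (((hasDerivAt_id z).sub_const x).mul_const (f1 x))).hasDerivWithinAt)
    (fun z hz => by simpa using h1 z hz) hx hxh
  simp only [norm_eq_abs, add_sub_cancel_left, sub_self, zero_mul, sub_zero] at h2
  rw [mul_assoc, ← abs_mul, ← sq, abs_of_nonneg (sq_nonneg h)] at h2
  rwa [show f (x + h) - f x - h * f1 x = f (x + h) - h * f1 x - f x by ring]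

theorem Sm.local_bounds {f : ℝ → ℝ → ℝ} (hf : Sm f) (T x : ℝ) : ∃ C, 0 ≤ C ∧
    ∀ t ∈ Icc (-T) T, ∀ h, |h| ≤ 1 → |f t (x + h)| ≤ C ∧ |f t (x + h) - f t x| ≤ C * |h| ∧
      |f t (x + h) - f t x - h * Dx f t x| ≤ C * h ^ 2 := by
  have hcp : IsCompact (Icc (-T) T ×ˢ Icc (x - 1) (x + 1)) := isCompact_Icc.prod isCompact_Icc
  obtain ⟨A, hA⟩ := hcp.exists_bound_of_continuousOn hf.cont.continuousOn
  obtain ⟨B, hB⟩ := hcp.exists_bound_of_continuousOn hf.dx.cont.continuousOn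
  obtain ⟨D, hD⟩ := hcp.exists_bound_of_continuousOn hf.dx.dx.cont.continuousOn
  refine ⟨|A| + |B| + |D|, by positivity, fun t ht h hh => ?_⟩
  have mem : ∀ y, |y - x| ≤ 1 → (t, y) ∈ Icc (-T) T ×ˢ Icc (x - 1) (x + 1) := fun y hy => by
    rw [abs_le] at hy
    exact ⟨ht, by constructor <;> simp only <;> linarith⟩
  have hD' : ∀ y, |y - x| ≤ 1 → |Dx (Dx f) t y| ≤ |D| := fun y hy =>
    (hD _ (mem y hy)).trans (le_abs_self D)
  have hB' : |Dx f t x| ≤ |B| := (hB _ (mem x (by simp))).trans (le_abs_self B)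
  have hA' : |f t (x + h)| ≤ |A| := (hA _ (mem (x + h) (by simpa using hh))).trans (le_abs_self A)
  have key := taylor_two (hf.hasDx t) (hf.dx.hasDx t) hD' hh
  have := abs_nonneg A; have := abs_nonneg B; have := abs_nonneg D; have := abs_nonneg h
  have hsq : h ^ 2 = |h| * |h| := by rw [← sq, sq_abs]
  refine ⟨by linarith, ?_, key.trans (by gcongr; linarith)⟩
  calc |f t (x + h) - f t x| = |(f t (x + h) - f t x - h * Dx f t x) + h * Dx f t x| := by ring_nf
    _ ≤ |D| * h ^ 2 + |h| * |B| := by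
        refine (abs_add_le _ _).trans (add_le_add key ?_)
        rw [abs_mul]; gcongr
    _ ≤ (|A| + |B| + |D|) * |h| := by rw [hsq]; nlinarith [mul_nonneg (abs_nonneg D) (abs_nonneg h), mul_nonneg (abs_nonneg A) (abs_nonneg h)]

theorem hasDerivAt_of_sq_bound {f : ℝ → ℝ} {f' x C : ℝ}
    (h : ∀ h, |h| ≤ 1 → |f (x + h) - f x - h * f'| ≤ C * h ^ 2) : HasDerivAt f f' x := by
  rw [hasDerivAt_iff_isLittleO_nhds_zero]
  refine (Asymptotics.IsBigO.of_bound C ?_ : _ =O[nhds 0] fun h : ℝ => h ^ 2).trans_isLittleO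
    (Asymptotics.isLittleO_pow_id one_lt_two)
  filter_upwards [Metric.closedBall_mem_nhds (0 : ℝ) one_pos] with y hy
  rw [Metric.mem_closedBall, dist_zero_right] at hy
  simpa using h y hy

theorem contDiff_of_partials {f fx ft : ℝ → ℝ → ℝ} {n : ℕ}
    (hx : ∀ t x, HasDerivAt (f t) (fx t x) x) (ht : ∀ t x, HasDerivAt (fun τ => f τ x) (ft t x) t)
    (cx : ContDiff ℝ n (Function.uncurry fx)) (ct : ContDiff ℝ n (Function.uncurry ft)) :
    ContDiff ℝ (n + 1) (Function.uncurry f) := by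
  let F1 : ℝ → ℝ → (ℝ →L[ℝ] ℝ) := fun t x => ContinuousLinearMap.toSpanSingleton ℝ (ft t x)
  let F2 : ℝ → ℝ → (ℝ →L[ℝ] ℝ) := fun t x => ContinuousLinearMap.toSpanSingleton ℝ (fx t x)
  have s1 : Continuous (Function.uncurry F1) :=
    (ContinuousLinearMap.toSpanSingletonCLE (𝕜 := ℝ) (E := ℝ)).continuous.comp ct.continuous
  have s2 : Continuous (Function.uncurry F2) :=
    (ContinuousLinearMap.toSpanSingletonCLE (𝕜 := ℝ) (E := ℝ)).continuous.comp cx.continuous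
  rw [contDiff_succ_iff_hasFDerivAt]
  refine ⟨fun z => Function.uncurry ft z • ContinuousLinearMap.fst ℝ ℝ ℝ +
    Function.uncurry fx z • ContinuousLinearMap.snd ℝ ℝ ℝ,
    (ct.smul contDiff_const).add (cx.smul contDiff_const), fun z => ?_⟩
  have := (hasStrictFDerivAt_uncurry_coprod (f := f) (f₁ := F1) (f₂ := F2)
      (Eventually.of_forall fun v => (ht v.1 v.2).hasFDerivAt)
      (Eventually.of_forall fun v => (hx v.1 v.2).hasFDerivAt) s1.continuousAt
      s2.continuousAt (u := z)).hasFDerivAt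
  refine this.congr_fderiv ?_
  ext <;> simp [F1, F2, Function.HasUncurry.uncurry, Function.uncurry]

/-- A solution of the two linear systems of a flat connection is smooth. -/
theorem smooth_of_lax {a b c d W p q : ℝ → ℝ → ℝ} (sa : Sm a) (sb : Sm b) (sc : Sm c) (sd : Sm d)
    (sW : Sm W) (cp : Continuous (Function.uncurry p)) (cq : Continuous (Function.uncurry q))
    (px : ∀ t x, HasDerivAt (p t) (q t x) x) (qx : ∀ t x, HasDerivAt (q t) (W t x * p t x) x)
    (pt : ∀ t x, HasDerivAt (fun τ => p τ x) (a t x * p t x + b t x * q t x) t)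
    (qt : ∀ t x, HasDerivAt (fun τ => q τ x) (c t x * p t x + d t x * q t x) t) : Sm p := by
  have key : ∀ n : ℕ, ContDiff ℝ n (Function.uncurry p) ∧ ContDiff ℝ n (Function.uncurry q) := by
    intro n
    induction n with
    | zero => exact ⟨contDiff_zero.2 cp, contDiff_zero.2 cq⟩
    | succ n ih =>
      have le : ∀ f : ℝ → ℝ → ℝ, Sm f → ContDiff ℝ n (Function.uncurry f) := fun f hf =>
        ContDiff.of_le hf (by exact_mod_cast le_top)
      obtain ⟨hp, hq⟩ := ih
      push_cast
      exact ⟨contDiff_of_partials px pt hq (((le a sa).mul hp).add ((le b sb).mul hq)),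
        contDiff_of_partials qx qt ((le W sW).mul hp) (((le c sc).mul hp).add ((le d sd).mul hq))⟩
  exact contDiff_infty.2 fun n => (key n).1

theorem Sm.local_bounds_ge {f : ℝ → ℝ → ℝ} (hf : Sm f) (T x : ℝ) : ∃ C, ∀ S, C ≤ S →
    ∀ t ∈ Icc (-T) T, ∀ h, |h| ≤ 1 → |f t (x + h)| ≤ S ∧ |f t (x + h) - f t x| ≤ S * |h| ∧
      |f t (x + h) - f t x - h * Dx f t x| ≤ S * h ^ 2 := by
  obtain ⟨C, C0, hC⟩ := hf.local_bounds T x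
  refine ⟨C, fun S hS t ht h hh => ?_⟩
  obtain ⟨h1, h2, h3⟩ := hC t ht h hh
  exact ⟨h1.trans hS, h2.trans (mul_le_mul_of_nonneg_right hS (abs_nonneg _)),
    h3.trans (mul_le_mul_of_nonneg_right hS (sq_nonneg _))⟩

theorem flat_err {S M h w P Q k1 k2 k3 k4 : ℝ} (S1 : 1 ≤ S) (hw : |w| ≤ S)
    (hP : |P| ≤ M) (hQ : |Q| ≤ M) (h1 : |k1| ≤ S * h ^ 2) (h2 : |k2| ≤ S * |h|)
    (h3 : |k3| ≤ S * h ^ 2) (h4 : |k4| ≤ S * |h|) :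
    |(k1 + h * k2 * w) * P + (k3 + h * k4) * Q| ≤ 4 * S * S * M * h ^ 2 := by
  have hsq : h ^ 2 = |h| * |h| := by rw [← sq, sq_abs]
  have S0 : 0 ≤ S := by linarith
  have M0 : 0 ≤ M := (abs_nonneg _).trans hP
  have l2 : |h * k2 * w| ≤ S * S * h ^ 2 := by
    rw [abs_mul, abs_mul, hsq]
    calc |h| * |k2| * |w| ≤ |h| * (S * |h|) * S := by gcongr
      _ = _ := by ring
  have l4 : |h * k4| ≤ S * h ^ 2 := by
    rw [abs_mul, hsq]
    calc |h| * |k4| ≤ |h| * (S * |h|) := by gcongr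
      _ = _ := by ring
  have SS : S ≤ S * S := by nlinarith
  have SSh : S * h ^ 2 ≤ S * S * h ^ 2 := by gcongr
  refine (abs_add_le _ _).trans ?_
  rw [abs_mul, abs_mul]
  have u1 : |k1 + h * k2 * w| * |P| ≤ (S * S * h ^ 2 + S * S * h ^ 2) * M :=
    mul_le_mul ((abs_add_le _ _).trans (add_le_add (h1.trans SSh) l2)) hP (abs_nonneg _)
      (by positivity)
  have u2 : |k3 + h * k4| * |Q| ≤ (S * S * h ^ 2 + S * S * h ^ 2) * M :=
    mul_le_mul ((abs_add_le _ _).trans (add_le_add (h3.trans SSh) (l4.trans SSh))) hQ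
      (abs_nonneg _) (by positivity)
  calc _ ≤ _ := add_le_add u1 u2
    _ = _ := by ring

theorem flat_step {a b c d W : ℝ → ℝ → ℝ} (sW : Sm W)
    (ea : ∀ t x, Dx a t x = c t x - b t x * W t x)
    (eb : ∀ t x, Dx b t x = d t x - a t x)
    (ec : ∀ t x, Dx c t x = Dt W t x + W t x * a t x - W t x * d t x)
    (ed : ∀ t x, Dx d t x = W t x * b t x - c t x) {S M δ T x h : ℝ} (S1 : 1 ≤ S) (M0 : 0 ≤ M)
    (δ0 : 0 ≤ δ) {P Q P' Q' : ℝ → ℝ}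
    (bd : ∀ f ∈ ({a, b, c, d} : Set (ℝ → ℝ → ℝ)), ∀ t ∈ Icc (-T) T, |f t (x + h)| ≤ S ∧
      |f t (x + h) - f t x| ≤ S * |h| ∧ |f t (x + h) - f t x - h * Dx f t x| ≤ S * h ^ 2)
    (bw : ∀ t ∈ Icc (-T) T, |W t x| ≤ S) (bp : ∀ t ∈ Icc (-T) T, |P t| ≤ M ∧ |Q t| ≤ M)
    (hP : ∀ t, HasDerivAt P (a t x * P t + b t x * Q t) t)
    (hQ : ∀ t, HasDerivAt Q (c t x * P t + d t x * Q t) t)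
    (hP' : ∀ t, HasDerivAt P' (a t (x + h) * P' t + b t (x + h) * Q' t) t)
    (hQ' : ∀ t, HasDerivAt Q' (c t (x + h) * P' t + d t (x + h) * Q' t) t)
    (i1 : |P' 0 - P 0 - h * Q 0| ≤ δ * h ^ 2)
    (i2 : |Q' 0 - Q 0 - h * (W 0 x * P 0)| ≤ δ * h ^ 2) :
    ∀ t ∈ Icc (-T) T,
      |P' t - P t - h * Q t| ≤ (δ + 4 * S * S * M) * exp (2 * S * T) * h ^ 2 ∧
      |Q' t - Q t - h * (W t x * P t)| ≤ (δ + 4 * S * S * M) * exp (2 * S * T) * h ^ 2 := by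
  intro t ht
  have fin := gronwall
    (f := fun t => (P' t - P t - h * Q t, Q' t - Q t - h * (W t x * P t)))
    (f' := fun t => ((a t (x + h) * P' t + b t (x + h) * Q' t) - (a t x * P t + b t x * Q t)
        - h * (c t x * P t + d t x * Q t),
       (c t (x + h) * P' t + d t (x + h) * Q' t) - (c t x * P t + d t x * Q t)
        - h * (Dt W t x * P t + W t x * (a t x * P t + b t x * Q t))))
    (K := 2 * S) (ε := 4 * S * S * M * h ^ 2)
    (δ := δ * h ^ 2) (by linarith) (by positivity) (by positivity)
    (fun t _ => (HasDerivAt.prodMk (((hP' t).sub (hP t)).sub ((hQ t).const_mul h))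
        (((hQ' t).sub (hQ t)).sub
          (((sW.hasDt t x).mul (hP t)).const_mul h))).hasDerivWithinAt)
    (max_le i1 i2) ?_ ht
  · have e : (δ * h ^ 2 + 4 * S * S * M * h ^ 2) * exp (2 * S * T) =
        (δ + 4 * S * S * M) * exp (2 * S * T) * h ^ 2 := by ring
    rw [e] at fin
    exact ⟨(norm_fst_le _).trans fin, (norm_snd_le _).trans fin⟩
  · intro t ht
    obtain ⟨a1, a2, a3⟩ := bd a (by simp) t ht
    obtain ⟨b1, b2, b3⟩ := bd b (by simp) t ht
    obtain ⟨c1, c2, c3⟩ := bd c (by simp) t ht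
    obtain ⟨d1, d2, d3⟩ := bd d (by simp) t ht
    obtain ⟨p1, p2⟩ := bp t ht
    have lin := linF_norm_le (a := fun t => a t (x + h)) (b := fun t => b t (x + h))
      (c := fun t => c t (x + h)) (d := fun t => d t (x + h)) a1 b1 c1 d1
      (P' t - P t - h * Q t, Q' t - Q t - h * (W t x * P t))
    have e1 := flat_err S1 (bw t ht) p1 p2 a3 b2 b3 a2
    have e2 := flat_err S1 (bw t ht) p1 p2 c3 d2 d3 c2
    have f1 := (abs_add_le _ _).trans (add_le_add ((norm_fst_le _).trans lin) e1)
    have f2 := (abs_add_le _ _).trans (add_le_add ((norm_snd_le _).trans lin) e2)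
    simp only [linF] at f1 f2
    refine max_le ?_ ?_
    · refine le_trans (le_of_eq ?_) f1
      rw [norm_eq_abs]
      simp only [ea, eb]
      ring_nf
    · refine le_trans (le_of_eq ?_) f2
      rw [norm_eq_abs]
      simp only [ec, ed]
      ring_nf

theorem flat_key {a b c d W : ℝ → ℝ → ℝ} (sa : Sm a) (sb : Sm b) (sc : Sm c) (sd : Sm d)
    (sW : Sm W) (ea : ∀ t x, Dx a t x = c t x - b t x * W t x)
    (eb : ∀ t x, Dx b t x = d t x - a t x)
    (ec : ∀ t x, Dx c t x = Dt W t x + W t x * a t x - W t x * d t x)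
    (ed : ∀ t x, Dx d t x = W t x * b t x - c t x) {p₀ q₀ : ℝ → ℝ}
    (hp₀ : ∀ x, HasDerivAt p₀ (q₀ x) x) (hq₀ : ∀ x, HasDerivAt q₀ (W 0 x * p₀ x) x)
    {P Q : ℝ → ℝ → ℝ} (hP0 : ∀ x, P x 0 = p₀ x) (hQ0 : ∀ x, Q x 0 = q₀ x)
    (hP : ∀ x t, HasDerivAt (P x) (a t x * P x t + b t x * Q x t) t)
    (hQ : ∀ x t, HasDerivAt (Q x) (c t x * P x t + d t x * Q x t) t) (T x : ℝ) :
    ∃ C, ∀ t ∈ Icc (-T) T, ∀ h, |h| ≤ 1 →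
      |P (x + h) t - P x t - h * Q x t| ≤ C * h ^ 2 ∧
      |Q (x + h) t - Q x t - h * (W t x * P x t)| ≤ C * h ^ 2 ∧ |Q x t| ≤ C ∧
      |W t x * P x t| ≤ C := by
  obtain ⟨A, hA⟩ := sa.local_bounds_ge T x
  obtain ⟨B, hB⟩ := sb.local_bounds_ge T x
  obtain ⟨C, hC⟩ := sc.local_bounds_ge T x
  obtain ⟨D, hD⟩ := sd.local_bounds_ge T x
  obtain ⟨E, hE⟩ := sW.local_bounds_ge T x
  obtain ⟨S, S1, SA, SB, SC, SD, SE⟩ : ∃ S, 1 ≤ S ∧ A ≤ S ∧ B ≤ S ∧ C ≤ S ∧ D ≤ S ∧ E ≤ S :=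
    ⟨max 1 (max A (max B (max C (max D E)))), by simp, by simp, by simp, by simp, by simp, by simp⟩
  have cP : ContinuousOn (P x) (Icc (-T) T) := fun t _ => (hP x t).continuousAt.continuousWithinAt
  have cQ : ContinuousOn (Q x) (Icc (-T) T) := fun t _ => (hQ x t).continuousAt.continuousWithinAt
  obtain ⟨Mp, hMp⟩ := isCompact_Icc.exists_bound_of_continuousOn cP
  obtain ⟨Mq, hMq⟩ := isCompact_Icc.exists_bound_of_continuousOn cQ
  obtain ⟨M, M0, MP, MQ⟩ : ∃ M, 0 ≤ M ∧ Mp ≤ M ∧ Mq ≤ M :=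
    ⟨max 0 (max Mp Mq), by simp, by simp, by simp⟩
  have cp0 : Continuous p₀ := continuous_iff_continuousAt.2 fun y => (hp₀ y).continuousAt
  have cq0 : Continuous q₀ := continuous_iff_continuousAt.2 fun y => (hq₀ y).continuousAt
  have c0 : Continuous fun y => W 0 y * p₀ y := (sW.cont_x 0).mul cp0
  have c1 : Continuous fun y => Dx W 0 y * p₀ y + W 0 y * q₀ y :=
    ((sW.dx.cont_x 0).mul cp0).add ((sW.cont_x 0).mul cq0)
  obtain ⟨I0, hI0⟩ := (isCompact_closedBall x 1).exists_bound_of_continuousOn c0.continuousOn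
  obtain ⟨I1, hI1⟩ := (isCompact_closedBall x 1).exists_bound_of_continuousOn c1.continuousOn
  obtain ⟨δ, δ0, D0, D1⟩ : ∃ δ, 0 ≤ δ ∧ I0 ≤ δ ∧ I1 ≤ δ :=
    ⟨max 0 (max I0 I1), by simp, by simp, by simp⟩
  have mem : ∀ y, |y - x| ≤ 1 → y ∈ Metric.closedBall x 1 := fun y hy => by
    rwa [Metric.mem_closedBall, dist_eq_norm]
  have bp : ∀ t ∈ Icc (-T) T, |P x t| ≤ M ∧ |Q x t| ≤ M := fun t ht =>
    ⟨(hMp t ht).trans MP, (hMq t ht).trans MQ⟩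
  have bw : ∀ t ∈ Icc (-T) T, |W t x| ≤ S := fun t ht => by
    have := (hE S SE t ht 0 (by simp)).1
    rwa [add_zero] at this
  obtain ⟨G, hG⟩ : ∃ G, G = (δ + 4 * S * S * M) * exp (2 * S * T) := ⟨_, rfl⟩
  have G0 : 0 ≤ G := by rw [hG]; positivity
  have SM0 : 0 ≤ S * M := by positivity
  refine ⟨G + M + S * M, fun t ht h hh => ?_⟩
  have hs := flat_step sW ea eb ec ed S1 M0 δ0 (T := T) (x := x) (h := h) (P := P x) (Q := Q x)
    (P' := P (x + h)) (Q' := Q (x + h)) (fun f hf t ht => by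
      simp only [mem_insert_iff, mem_singleton_iff] at hf
      rcases hf with rfl | rfl | rfl | rfl
      · exact hA S SA t ht h hh
      · exact hB S SB t ht h hh
      · exact hC S SC t ht h hh
      · exact hD S SD t ht h hh) bw bp (hP x) (hQ x) (hP (x + h)) (hQ (x + h))
    (by
      rw [hP0, hP0, hQ0]
      exact taylor_two hp₀ hq₀ (fun y hy => (hI0 y (mem y hy)).trans D0) hh)
    (by
      rw [hP0, hQ0, hQ0]
      exact taylor_two hq₀ (fun y => (sW.hasDx 0 y).mul (hp₀ y))
        (fun y hy => (hI1 y (mem y hy)).trans D1) hh) t ht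
  rw [← hG] at hs
  have up : G * h ^ 2 ≤ (G + M + S * M) * h ^ 2 :=
    mul_le_mul_of_nonneg_right (by linarith) (sq_nonneg h)
  refine ⟨hs.1.trans up, hs.2.trans up, by linarith [(bp t ht).2], ?_⟩
  rw [abs_mul]
  have := mul_le_mul (bw t ht) (bp t ht).1 (abs_nonneg _) (by linarith)
  linarith

theorem continuous_of_sq_bound {f f' : ℝ → ℝ → ℝ} (ct : ∀ x, Continuous fun t => f t x)
    (hf : ∀ T x, ∃ C, ∀ t ∈ Icc (-T) T, ∀ h, |h| ≤ 1 →
        |f t (x + h) - f t x - h * f' t x| ≤ C * h ^ 2 ∧ |f' t x| ≤ C) :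
      Continuous (Function.uncurry f) := by
  rw [continuous_iff_continuousAt]
  rintro ⟨t, x⟩
  obtain ⟨C, hC⟩ := hf (|t| + 1) x
  have C0 : 0 ≤ C := (abs_nonneg _).trans (hC 0 ⟨by linarith [abs_nonneg t], by positivity⟩ 0 (by simp)).2
  rw [ContinuousAt, tendsto_iff_dist_tendsto_zero]
  have lim : Tendsto (fun z : ℝ × ℝ => 2 * C * |z.2 - x| + |f z.1 x - f t x|) (nhds (t, x)) (nhds 0) := by
    have : Continuous fun z : ℝ × ℝ => 2 * C * |z.2 - x| + |f z.1 x - f t x| := by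
      have := (ct x).comp (continuous_fst : Continuous (Prod.fst : ℝ × ℝ → ℝ))
      simp only [Function.comp_def] at this
      fun_prop
    have := this.tendsto (t, x)
    simpa using this
  refine tendsto_of_tendsto_of_tendsto_of_le_of_le' tendsto_const_nhds lim
    (Eventually.of_forall fun _ => dist_nonneg) ?_
  filter_upwards [Metric.ball_mem_nhds (t, x) one_pos] with z hz
  rw [Metric.mem_ball, Prod.dist_eq, max_lt_iff, dist_eq_norm, dist_eq_norm] at hz
  obtain ⟨h1, h2⟩ := hz
  simp only [norm_eq_abs] at h1 h2
  have hz1 : z.1 ∈ Icc (-(|t| + 1)) (|t| + 1) := by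
    rw [mem_Icc, ← abs_le]
    have := abs_add_le (z.1 - t) t
    rw [sub_add_cancel] at this
    linarith
  obtain ⟨k1, k2⟩ := hC z.1 hz1 (z.2 - x) h2.le
  rw [add_sub_cancel] at k1
  rw [dist_eq_norm, norm_eq_abs]
  simp only [Function.uncurry]
  have e : f z.1 z.2 - f t x = (f z.1 z.2 - f z.1 x - (z.2 - x) * f' z.1 x) +
    ((z.2 - x) * f' z.1 x) + (f z.1 x - f t x) := by ring
  rw [e]
  refine (abs_add_three _ _ _).trans ?_
  rw [abs_mul]
  have e1 : C * (z.2 - x) ^ 2 ≤ C * |z.2 - x| := by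
    rw [← sq_abs]
    refine mul_le_mul_of_nonneg_left ?_ C0
    nlinarith [abs_nonneg (z.2 - x)]
  have e2 : |z.2 - x| * |f' z.1 x| ≤ |z.2 - x| * C := by gcongr
  linarith

theorem exists_flat {a b c d W : ℝ → ℝ → ℝ} (sa : Sm a) (sb : Sm b) (sc : Sm c) (sd : Sm d)
    (sW : Sm W) (ea : ∀ t x, Dx a t x = c t x - b t x * W t x)
    (eb : ∀ t x, Dx b t x = d t x - a t x)
    (ec : ∀ t x, Dx c t x = Dt W t x + W t x * a t x - W t x * d t x)
    (ed : ∀ t x, Dx d t x = W t x * b t x - c t x) {p₀ q₀ : ℝ → ℝ}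
    (hp₀ : ∀ x, HasDerivAt p₀ (q₀ x) x) (hq₀ : ∀ x, HasDerivAt q₀ (W 0 x * p₀ x) x) :
    ∃ p q : ℝ → ℝ → ℝ, Sm p ∧ (∀ x, p 0 x = p₀ x) ∧ (∀ t x, HasDerivAt (p t) (q t x) x) ∧
      (∀ t x, HasDerivAt (q t) (W t x * p t x) x) ∧
      (∀ t x, HasDerivAt (fun τ => p τ x) (a t x * p t x + b t x * q t x) t) ∧
      (∀ t x, HasDerivAt (fun τ => q τ x) (c t x * p t x + d t x * q t x) t) := by
  have ex := fun x => linear_ode (sa.cont_t x) (sb.cont_t x) (sc.cont_t x) (sd.cont_t x) (p₀ x, q₀ x)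
  choose P Q hP0 hQ0 hP hQ using ex
  have key := flat_key sa sb sc sd sW ea eb ec ed hp₀ hq₀ hP0 hQ0 hP hQ
  let p : ℝ → ℝ → ℝ := fun t x => P x t
  let q : ℝ → ℝ → ℝ := fun t x => Q x t
  have mem : ∀ t : ℝ, t ∈ Icc (-|t|) |t| := fun t => abs_le.1 le_rfl
  have px : ∀ t x, HasDerivAt (p t) (q t x) x := fun t x => by
    obtain ⟨C, hC⟩ := key |t| x
    exact hasDerivAt_of_sq_bound fun h hh => (hC t (mem t) h hh).1
  have qx : ∀ t x, HasDerivAt (q t) (W t x * p t x) x := fun t x => by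
    obtain ⟨C, hC⟩ := key |t| x
    exact hasDerivAt_of_sq_bound fun h hh => (hC t (mem t) h hh).2.1
  have cp : Continuous (Function.uncurry p) := continuous_of_sq_bound (f := p) (f' := q)
    (fun x => continuous_iff_continuousAt.2 fun t => (hP x t).continuousAt) fun T x => by
      obtain ⟨C, hC⟩ := key T x
      exact ⟨C, fun t ht h hh => ⟨(hC t ht h hh).1, (hC t ht h hh).2.2.1⟩⟩
  have cq : Continuous (Function.uncurry q) := continuous_of_sq_bound (f := q) (f' := fun t x => W t x * P x t)
    (fun x => continuous_iff_continuousAt.2 fun t => (hQ x t).continuousAt) fun T x => by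
      obtain ⟨C, hC⟩ := key T x
      exact ⟨C, fun t ht h hh => ⟨(hC t ht h hh).2.1, (hC t ht h hh).2.2.2⟩⟩
  have pt : ∀ t x, HasDerivAt (fun τ => p τ x) (a t x * p t x + b t x * q t x) t := fun t x => hP x t
  have qt : ∀ t x, HasDerivAt (fun τ => q τ x) (c t x * p t x + d t x * q t x) t := fun t x => hQ x t
  exact ⟨p, q, smooth_of_lax sa sb sc sd sW cp cq px qx pt qt, fun x => hP0 x, px, qx, pt, qt⟩

end KdV

namespace KdV

open Set
set_option linter.unusedSimpArgs false

theorem Sm.hasDeriv_line {f : ℝ → ℝ → ℝ} (hf : Sm f) (a b α β s : ℝ) :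
    HasDerivAt (fun s => f (a + s * α) (b + s * β))
      (α * Dt f (a + s * α) (b + s * β) + β * Dx f (a + s * α) (b + s * β)) s := by
  have h1 := (hf.diff (a + s * α, b + s * β)).hasFDerivAt
  have h2 : HasDerivAt (fun s : ℝ => ((a + s * α, b + s * β) : ℝ × ℝ)) (1 * α, 1 * β) s :=
    (((hasDerivAt_id s).mul_const α).const_add a).prodMk (((hasDerivAt_id s).mul_const β).const_add b)
  refine (h1.comp_hasDerivAt s h2).congr_deriv ?_
  rw [hf.Dt_eq, hf.Dx_eq]
  have : ((1 * α, 1 * β) : ℝ × ℝ) = α • ((1 : ℝ), (0 : ℝ)) + β • ((0 : ℝ), (1 : ℝ)) := by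
    ext <;> simp
  rw [this, map_add, map_smul, map_smul, smul_eq_mul, smul_eq_mul]

/-- Minimum principle for a transport equation, on backward cones. -/
theorem transport_nonneg {ψ b c : ℝ → ℝ → ℝ} (sψ : Sm ψ) (cb : Continuous (Function.uncurry b))
    {M t₁ : ℝ} (hM : ∀ t ∈ Icc 0 t₁, ∀ x, |c t x| ≤ M)
    (eq : ∀ t x, Dt ψ t x + c t x * Dx ψ t x = b t x * ψ t x) (h0 : ∀ x, 0 ≤ ψ 0 x)
    (ht₁ : 0 ≤ t₁) (x₁ : ℝ) : 0 ≤ ψ t₁ x₁ := by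
  have M0 : 0 ≤ M := (abs_nonneg _).trans (hM 0 ⟨le_rfl, ht₁⟩ 0)
  obtain ⟨K, hK⟩ : ∃ K : Set (ℝ × ℝ),
      K = {z | z.1 ∈ Icc 0 t₁ ∧ |z.2 - x₁| ≤ M * (t₁ - z.1)} := ⟨_, rfl⟩
  have closed : IsClosed K := by
    rw [hK]
    refine IsClosed.inter (isClosed_Icc.preimage continuous_fst) ?_
    exact isClosed_le (f := fun z : ℝ × ℝ => |z.2 - x₁|) (g := fun z : ℝ × ℝ => M * (t₁ - z.1))
      (by fun_prop) (by fun_prop)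
  have sub : K ⊆ Icc 0 t₁ ×ˢ Icc (x₁ - M * t₁) (x₁ + M * t₁) := by
    rintro ⟨t, x⟩ hz
    rw [hK] at hz
    obtain ⟨⟨h1, h2⟩, h3⟩ := hz
    simp only at h1 h2 h3
    rw [abs_le] at h3
    have := mul_nonneg M0 h1
    refine ⟨⟨h1, h2⟩, ?_, ?_⟩ <;> simp only <;> nlinarith
  have cpt : IsCompact K := (isCompact_Icc.prod isCompact_Icc).of_isClosed_subset closed sub
  have top : (t₁, x₁) ∈ K := by rw [hK]; exact ⟨⟨ht₁, le_rfl⟩, by simp⟩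
  obtain ⟨B, hB⟩ := cpt.exists_bound_of_continuousOn cb.continuousOn
  obtain ⟨l, hl⟩ : ∃ l, l = |B| + 1 := ⟨_, rfl⟩
  have cg : Continuous fun z : ℝ × ℝ => ψ z.1 z.2 * exp (-l * z.1) := by
    have : Continuous fun z : ℝ × ℝ => ψ z.1 z.2 := sψ.cont
    fun_prop
  obtain ⟨⟨t, x⟩, hz, hmin⟩ := cpt.exists_isMinOn ⟨_, top⟩ cg.continuousOn
  by_contra! hneg
  have g1 := hmin top
  simp only [mem_ofPred_eq] at g1
  have neg : ψ t x < 0 := by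
    by_contra! hc
    have := mul_nonneg hc (exp_pos (-l * t)).le
    have := mul_neg_of_neg_of_pos hneg (exp_pos (-l * t₁))
    linarith
  have hz' := hz
  rw [hK] at hz'
  obtain ⟨⟨t0, tt⟩, hx⟩ := hz'
  simp only at t0 tt hx
  have tpos : 0 < t := by
    rcases t0.lt_or_eq with h | h
    · exact h
    · rw [← h] at neg; linarith [h0 x]
  have hd := (sψ.hasDeriv_line t x (-1) (-(c t x)) 0).mul
    (((hasDerivAt_id (0 : ℝ)).const_mul l).sub_const (l * t)).exp
  simp only [zero_mul, add_zero, id, mul_zero, zero_sub, mul_one] at hd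
  have hb : |b t x| ≤ |B| := (hB _ hz).trans (le_abs_self B)
  have hval : (-1 * Dt ψ t x + -(c t x) * Dx ψ t x) * exp (-(l * t)) +
      ψ t x * (exp (-(l * t)) * l) < 0 := by
    have e : (-1 * Dt ψ t x + -(c t x) * Dx ψ t x) = -(b t x * ψ t x) := by rw [← eq]; ring
    rw [e]
    have : 0 < l - b t x := by rw [hl]; linarith [(abs_le.1 hb).2]
    have := mul_neg_of_neg_of_pos neg (mul_pos (exp_pos (-(l * t))) this)
    linarith
  have hlim := hd.hasDerivWithinAt (s := Ioi 0)
  rw [hasDerivWithinAt_iff_tendsto_slope' self_notMem_Ioi] at hlim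
  have ev : ∀ᶠ s in nhdsWithin (0 : ℝ) (Ioi 0), 0 ≤ slope
      (fun s => ψ (t + s * -1) (x + s * -c t x) * exp (l * s - l * t)) 0 s := by
    filter_upwards [Ioo_mem_nhdsGT tpos] with s hs
    rw [slope_def_field]
    refine div_nonneg ?_ (by linarith [hs.1])
    have mem : (t + s * -1, x + s * -c t x) ∈ K := by
      rw [hK]
      refine ⟨⟨by simp only; linarith [hs.2], by simp only; linarith [hs.1]⟩, ?_⟩
      simp only
      have e : x + s * -c t x - x₁ = (x - x₁) + -(s * c t x) := by ring
      rw [e]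
      refine (abs_add_le _ _).trans ?_
      rw [abs_neg, abs_mul, abs_of_pos hs.1]
      have := mul_le_mul_of_nonneg_left (hM t ⟨t0, tt⟩ x) hs.1.le
      nlinarith
    have := hmin mem
    simp only [mem_ofPred_eq] at this
    have e1 : -l * (t + s * -1) = l * s - l * t := by ring
    have e2 : -l * t = l * 0 - l * t := by ring
    rw [e1, e2] at this
    simp only [zero_mul, add_zero]
    linarith
  exact absurd (ge_of_tendsto hlim ev) (not_le.2 hval)

theorem linear_ode_zero {a b c d p q : ℝ → ℝ} (ha : Continuous a) (hb : Continuous b)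
    (hc : Continuous c) (hd : Continuous d) (hp : ∀ t, HasDerivAt p (a t * p t + b t * q t) t)
    (hq : ∀ t, HasDerivAt q (c t * p t + d t * q t) t) {t : ℝ} (h1 : p t = 0) (h2 : q t = 0) :
    p 0 = 0 := by
  have cpt := isCompact_Icc (a := -|t|) (b := |t|)
  have bdd : ∀ f : ℝ → ℝ, Continuous f → ∃ C, ∀ s ∈ Icc (-|t|) |t|, |f (t + s)| ≤ C := fun f hf =>
    cpt.exists_bound_of_continuousOn (f := fun s => f (t + s)) (by fun_prop)
  obtain ⟨A, hA⟩ := bdd a ha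
  obtain ⟨B, hB⟩ := bdd b hb
  obtain ⟨C, hC⟩ := bdd c hc
  obtain ⟨D, hD⟩ := bdd d hd
  obtain ⟨S, S1, SA, SB, SC, SD⟩ : ∃ S, 1 ≤ S ∧ A ≤ S ∧ B ≤ S ∧ C ≤ S ∧ D ≤ S :=
    ⟨max 1 (max A (max B (max C D))), by simp, by simp, by simp, by simp, by simp⟩
  have key := gronwall (f := fun s => (p (t + s), q (t + s)))
    (f' := fun s => linF (fun s => a (t + s)) (fun s => b (t + s)) (fun s => c (t + s))
      (fun s => d (t + s)) s (p (t + s), q (t + s))) (K := 2 * S) (ε := 0) (δ := 0) (T := |t|)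
    (by linarith) le_rfl le_rfl
    (fun s _ => (HasDerivAt.prodMk ((hp (t + s)).comp_const_add t s)
      ((hq (t + s)).comp_const_add t s)).hasDerivWithinAt) (by simp [h1, h2]) (fun s hs => by
        rw [add_zero]
        exact linF_norm_le ((hA s hs).trans SA) ((hB s hs).trans SB) ((hC s hs).trans SC)
          ((hD s hs).trans SD) _) (t := -t) (by
        constructor
        · exact neg_le_neg (le_abs_self t)
        · exact neg_le_abs t)
  simp only [add_zero, zero_mul, add_neg_cancel] at key
  have := (norm_fst_le _).trans key
  simpa using this

/-- The wave function of a KdV solution is transported with its sign. -/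
theorem Sol.KC.exists_wave {V : ℝ → ℝ → ℝ} (hV : Sol.KC V) (k : ℝ) {p₀ q₀ : ℝ → ℝ}
    (hp₀ : ∀ x, HasDerivAt p₀ (q₀ x) x) (hq₀ : ∀ x, HasDerivAt q₀ ((V 0 x + k ^ 2) * p₀ x) x)
    (pos : ∀ x, 0 < p₀ x) :
    ∃ ψ, Sm ψ ∧ (∀ x, ψ 0 x = p₀ x) ∧ (∀ t x, 0 < ψ t x) ∧
      (∀ t x, Dx (Dx ψ) t x = (V t x + k ^ 2) * ψ t x) ∧
      ∀ t x, Dt ψ t x = -Dx V t x * ψ t x + (2 * V t x - 4 * k ^ 2) * Dx ψ t x := by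
  have s0 := hV.sm
  have sW : Sm fun t x => V t x + k ^ 2 := s0.add (Sm.const _)
  have sb : Sm fun t x => 2 * V t x - 4 * k ^ 2 := (s0.cmul 2).sub (Sm.const _)
  have sc : Sm fun t x => (2 * V t x - 4 * k ^ 2) * (V t x + k ^ 2) - Dx (Dx V) t x :=
    (sb.mul sW).sub s0.dx.dx
  have ea : ∀ t x, Dx (fun t x => -Dx V t x) t x =
      ((2 * V t x - 4 * k ^ 2) * (V t x + k ^ 2) - Dx (Dx V) t x) -
        (2 * V t x - 4 * k ^ 2) * (V t x + k ^ 2) := by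
    intro t x
    rw [s0.dx.Dx_neg]; ring
  have eb : ∀ t x, Dx (fun t x => 2 * V t x - 4 * k ^ 2) t x = Dx V t x - -Dx V t x := by
    intro t x
    simp (maxDischargeDepth := 20) only [Sm.Dx_sub, Sm.Dx_add, Sm.Dx_mul, Sm.Dx_neg, Sm.Dx_const,
      Sm.add, Sm.sub, Sm.mul, Sm.neg, Sm.const, s0, s0.dx, s0.dx.dx]
    ring
  have ec : ∀ t x, Dx (fun t x => (2 * V t x - 4 * k ^ 2) * (V t x + k ^ 2) - Dx (Dx V) t x) t x =
      Dt (fun t x => V t x + k ^ 2) t x + (V t x + k ^ 2) * -Dx V t x -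
        (V t x + k ^ 2) * Dx V t x := by
    intro t x
    simp (maxDischargeDepth := 20) only [Sm.Dx_sub, Sm.Dx_add, Sm.Dx_mul, Sm.Dx_neg, Sm.Dx_const,
      Sm.Dt_add, Sm.Dt_const, Sm.add, Sm.sub, Sm.mul, Sm.neg, Sm.const, s0, s0.dx, s0.dx.dx, hV.eq]
    ring
  obtain ⟨p, q, sp, p0, px, qx, pt, qt⟩ := exists_flat s0.dx.neg sb sc s0.dx sW ea eb ec
    (fun t x => by ring) hp₀ hq₀
  have eqx : Dx p = q := by ext t x; exact (px t x).deriv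
  have ept : ∀ t x, Dt p t x = -Dx V t x * p t x + (2 * V t x - 4 * k ^ 2) * Dx p t x := by
    intro t x; rw [eqx]; exact (pt t x).deriv
  have bddV : ∀ T, ∃ C, ∀ t, |t| ≤ T → ∀ x, |4 * k ^ 2 - 2 * V t x| ≤ C := fun T => by
    obtain ⟨C, -, hC⟩ := hV.bdd' T
    refine ⟨4 * k ^ 2 + 2 * C, fun t ht x => ?_⟩
    have := abs_le.1 ((hC t ht).2.2 x)
    rw [abs_le]
    constructor <;> nlinarith
  have nonneg : ∀ t x, 0 ≤ p t x := by
    intro t x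
    obtain ⟨C, hC⟩ := bddV |t|
    rcases le_total 0 t with h | h
    · refine transport_nonneg sp (b := fun t x => -Dx V t x) (c := fun t x => 4 * k ^ 2 - 2 * V t x)
        s0.dx.neg.cont (M := C) (fun τ hτ x => hC τ ?_ x) (fun t x => ?_)
        (fun x => by rw [p0]; exact (pos x).le) h x
      · rw [abs_of_nonneg hτ.1, abs_of_nonneg h]; exact hτ.2
      · rw [ept]; ring
    · have sr : Sm fun t x => p (-t) x :=
        sp.comp_aff (a := fun t _ => -t) (b := fun _ x => x) (contDiff_fst.neg) contDiff_snd
      have := transport_nonneg (ψ := fun t x => p (-t) x) (t₁ := -t) sr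
        (b := fun t x => Dx V (-t) x) (c := fun t x => -(4 * k ^ 2 - 2 * V (-t) x))
        (by
          have : Continuous fun z : ℝ × ℝ => Dx V z.1 z.2 := s0.dx.cont
          exact this.comp (continuous_fst.neg.prodMk continuous_snd))
        (M := C) (fun τ hτ x => ?_) (fun t x => ?_)
        (fun x => by rw [neg_zero, p0]; exact (pos x).le) (by linarith) x
      · simpa using this
      · rw [abs_neg]
        exact hC _ (by rw [abs_neg, abs_of_nonneg hτ.1, abs_of_nonpos h]; exact hτ.2) x
      · have e1 : Dt (fun t x => p (-t) x) t x = -Dt p (-t) x :=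
          (((sp.hasDt (-t) x).comp t (hasDerivAt_neg t)).deriv).trans (by ring)
        have e2 : Dx (fun t x => p (-t) x) t x = Dx p (-t) x := rfl
        rw [e1, e2, ept]; ring
  have cts : ∀ t x, p t x = 0 → False := by
    intro t x h
    have hq : q t x = 0 :=
      (show IsLocalMin (p t) x from Eventually.of_forall fun y => by rw [h]; exact nonneg t y).hasDerivAt_eq_zero (px t x)
    have := linear_ode_zero (s0.dx.neg.cont_t x) (sb.cont_t x) (sc.cont_t x) (s0.dx.cont_t x)
      (pt · x) (qt · x) h hq
    rw [p0] at this
    exact (pos x).ne' this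
  refine ⟨p, sp, p0, fun t x => (nonneg t x).lt_of_ne fun h => cts t x h.symm, fun t x => ?_, ept⟩
  rw [eqx]; exact (qx t x).deriv

end KdV

namespace KdV

open Set
set_option linter.unusedSimpArgs false

theorem logDeriv_le {ψ ψ1 W : ℝ → ℝ} {m : ℝ} (hm : 0 < m) (hψ : ∀ x, HasDerivAt ψ (ψ1 x) x)
    (hψ1 : ∀ x, HasDerivAt ψ1 (W x * ψ x) x) (pos : ∀ x, 0 < ψ x) (hW : ∀ x, W x ≤ m ^ 2) (x₀ : ℝ) :
    ψ1 x₀ ≤ m * ψ x₀ := by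
  by_contra! hc
  have hexp : ∀ (a x : ℝ), HasDerivAt (fun x => exp (a * x)) (exp (a * x) * (a * 1)) x := fun a x =>
    ((hasDerivAt_id x).const_mul a).exp
  have anti : Antitone fun x => (ψ1 x - m * ψ x) * exp (m * x) := by
    refine antitone_of_hasDerivAt_nonpos (fun x => ((hψ1 x).sub ((hψ x).const_mul m)).mul (hexp m x))
      fun x => ?_
    have e : (W x * ψ x - m * ψ1 x) * exp (m * x) + (ψ1 x - m * ψ x) * (exp (m * x) * (m * 1)) =
        -((m ^ 2 - W x) * ψ x * exp (m * x)) := by ring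
    refine le_trans (le_of_eq e) ?_
    have := mul_nonneg (mul_nonneg (sub_nonneg.2 (hW x)) (pos x).le) (exp_pos (m * x)).le
    simp only [Pi.zero_apply]
    linarith
  obtain ⟨E, hE⟩ : ∃ E, E = (ψ1 x₀ - m * ψ x₀) * exp (m * x₀) := ⟨_, rfl⟩
  have E0 : 0 < E := by rw [hE]; exact mul_pos (by linarith) (exp_pos _)
  have mono : MonotoneOn (fun x => ψ x * exp (-m * x) + E / (2 * m) * exp (-(2 * m) * x)) (Iic x₀) := by
    have hd : ∀ x, HasDerivAt (fun x => ψ x * exp (-m * x) + E / (2 * m) * exp (-(2 * m) * x))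
        (ψ1 x * exp (-m * x) + ψ x * (exp (-m * x) * (-m * 1)) +
          E / (2 * m) * (exp (-(2 * m) * x) * (-(2 * m) * 1))) x := fun x =>
      ((hψ x).mul (hexp _ x)).add ((hexp _ x).const_mul _)
    refine monotoneOn_of_deriv_nonneg (convex_Iic _) (fun x _ => (hd x).continuousAt.continuousWithinAt)
      (fun x _ => (hd x).differentiableAt.differentiableWithinAt) fun x hx => ?_
    rw [interior_Iic] at hx
    rw [(hd x).deriv]
    have h1 : E ≤ (ψ1 x - m * ψ x) * exp (m * x) := by rw [hE]; exact anti (mem_Iio.1 hx).le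
    have e : ψ1 x * exp (-m * x) + ψ x * (exp (-m * x) * (-m * 1)) +
          E / (2 * m) * (exp (-(2 * m) * x) * (-(2 * m) * 1)) =
        ((ψ1 x - m * ψ x) * exp (m * x) - E) * exp (-(2 * m) * x) := by
      have : exp (-m * x) = exp (m * x) * exp (-(2 * m) * x) := by rw [← exp_add]; ring_nf
      rw [this]; field_simp; ring
    rw [e]
    exact mul_nonneg (by linarith) (exp_pos _).le
  have lim : Tendsto (fun x => E / (2 * m) * exp (-(2 * m) * x)) atBot atTop :=
    (tendsto_exp_atTop.comp (tendsto_id.const_mul_atBot_of_neg (by linarith))).const_mul_atTop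
      (by positivity)
  obtain ⟨x, hx, hx0⟩ := ((lim.eventually_gt_atTop
    (ψ x₀ * exp (-m * x₀) + E / (2 * m) * exp (-(2 * m) * x₀))).and (eventually_le_atBot x₀)).exists
  have := mono hx0 (mem_Iic.2 le_rfl) hx0
  simp only at this
  have := mul_pos (pos x) (exp_pos (-m * x))
  linarith

theorem abs_logDeriv_le {ψ ψ1 W : ℝ → ℝ} {m : ℝ} (hm : 0 < m) (hψ : ∀ x, HasDerivAt ψ (ψ1 x) x)
    (hψ1 : ∀ x, HasDerivAt ψ1 (W x * ψ x) x) (pos : ∀ x, 0 < ψ x) (hW : ∀ x, W x ≤ m ^ 2) (x : ℝ) :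
    |ψ1 x| ≤ m * ψ x := by
  rw [abs_le]
  refine ⟨?_, logDeriv_le hm hψ hψ1 pos hW x⟩
  have := logDeriv_le (ψ := fun x => ψ (-x)) (ψ1 := fun x => -ψ1 (-x)) (W := fun x => W (-x)) hm
    (fun x => ((hψ (-x)).comp x (hasDerivAt_neg x)).congr_deriv (by ring))
    (fun x => ((hψ1 (-x)).comp x (hasDerivAt_neg x)).neg.congr_deriv (by ring))
    (fun x => pos _) (fun x => hW _) (-x)
  simp only [neg_neg] at this
  linarith

/-- A continuous function with uniformly bounded square integrals is square integrable. -/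
theorem SqI.of_bound {f : ℝ → ℝ} (hf : Continuous f) {C : ℝ}
    (hC : ∀ R, 0 ≤ R → ∫ x in (-R)..R, f x ^ 2 ≤ C) : SqI f ∧ ∫ x, f x ^ 2 ≤ C := by
  have c2 : Continuous fun x => f x ^ 2 := hf.pow 2
  have hn : Tendsto (fun n : ℕ => -(n : ℝ)) atTop atBot :=
    tendsto_neg_atTop_atBot.comp tendsto_natCast_atTop_atTop
  have hi : Integrable fun x => f x ^ 2 := by
    refine integrable_of_intervalIntegral_norm_bounded (l := atTop) (a := fun n : ℕ => -(n : ℝ))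
      (b := fun n : ℕ => (n : ℝ)) C (fun n => c2.integrableOn_Ioc) hn
      tendsto_natCast_atTop_atTop (Eventually.of_forall fun n => ?_)
    simp only [norm_eq_abs, abs_of_nonneg (sq_nonneg (f _))]
    exact hC n (Nat.cast_nonneg n)
  exact ⟨⟨hf, hi⟩, le_of_tendsto (intervalIntegral_tendsto_integral hi hn
    tendsto_natCast_atTop_atTop) (Eventually.of_forall fun n => hC n (Nat.cast_nonneg n))⟩

/-- The Riccati energy identity: `∫ (v² - k²)²` and `∫ v'²` are controlled by `∫ V²`. -/
theorem riccati_sqI {v v' V : ℝ → ℝ} {k m : ℝ} (hd : ∀ x, HasDerivAt v (v' x) x)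
    (cv' : Continuous v') (eq : ∀ x, V x = v' x + (v x ^ 2 - k ^ 2)) (hV : SqI V)
    (hm : ∀ x, |v x| ≤ m) :
    (SqI fun x => v x ^ 2 - k ^ 2) ∧ SqI v' ∧
      (∫ x, (v x ^ 2 - k ^ 2) ^ 2) ≤ (∫ x, V x ^ 2) + 4 * (m ^ 3 + k ^ 2 * m) ∧
      (∫ x, v' x ^ 2) ≤ (∫ x, V x ^ 2) + 4 * (m ^ 3 + k ^ 2 * m) := by
  have cv : Continuous v := continuous_iff_continuousAt.2 fun x => (hd x).continuousAt
  have m0 : 0 ≤ m := (abs_nonneg _).trans (hm 0)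
  have key : ∀ R, 0 ≤ R → (∫ x in (-R)..R, (v x ^ 2 - k ^ 2) ^ 2) + (∫ x in (-R)..R, v' x ^ 2) ≤
      (∫ x, V x ^ 2) + 4 * (m ^ 3 + k ^ 2 * m) := by
    intro R hR
    have i1 : (∫ x in (-R)..R, (2 * v x ^ 2 * v' x - 2 * k ^ 2 * v' x)) =
        (2 / 3 * v R ^ 3 - 2 * k ^ 2 * v R) - (2 / 3 * v (-R) ^ 3 - 2 * k ^ 2 * v (-R)) := by
      refine intervalIntegral.integral_eq_sub_of_hasDerivAt
        (f := fun x => 2 / 3 * v x ^ 3 - 2 * k ^ 2 * v x) (fun x _ => ?_)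
        (Continuous.intervalIntegrable (by fun_prop) _ _)
      refine ((((hd x).fun_pow 3).const_mul (2 / 3)).sub ((hd x).const_mul (2 * k ^ 2))).congr_deriv ?_
      norm_num; ring
    have i2 : (∫ x in (-R)..R, V x ^ 2) = (∫ x in (-R)..R, (v x ^ 2 - k ^ 2) ^ 2) +
        (∫ x in (-R)..R, v' x ^ 2) + ∫ x in (-R)..R, (2 * v x ^ 2 * v' x - 2 * k ^ 2 * v' x) := by
      rw [← intervalIntegral.integral_add (Continuous.intervalIntegrable (by fun_prop) _ _)
        (Continuous.intervalIntegrable (by fun_prop) _ _), ← intervalIntegral.integral_add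
        (Continuous.intervalIntegrable (by fun_prop) _ _)
        (Continuous.intervalIntegrable (by fun_prop) _ _)]
      refine intervalIntegral.integral_congr fun x _ => ?_
      simp only [eq]; ring
    have i3 : (∫ x in (-R)..R, V x ^ 2) ≤ ∫ x, V x ^ 2 := by
      rw [intervalIntegral.integral_of_le (by linarith)]
      exact setIntegral_le_integral hV.2 (Eventually.of_forall fun x => sq_nonneg _)
    have b3 : ∀ x, |v x ^ 3| ≤ m ^ 3 := fun x => by
      rw [abs_pow]; exact pow_le_pow_left₀ (abs_nonneg _) (hm x) 3
    have a1 := abs_le.1 (b3 R)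
    have a2 := abs_le.1 (b3 (-R))
    have a3 := abs_le.1 (hm R)
    have a4 := abs_le.1 (hm (-R))
    have k0 := sq_nonneg k
    have a5 := mul_le_mul_of_nonneg_left a3.1 k0
    have a6 := mul_le_mul_of_nonneg_left a3.2 k0
    have a7 := mul_le_mul_of_nonneg_left a4.1 k0
    have a8 := mul_le_mul_of_nonneg_left a4.2 k0
    have m3 : 0 ≤ m ^ 3 := by positivity
    linarith
  have n1 : ∀ (f : ℝ → ℝ) R, 0 ≤ R → 0 ≤ ∫ x in (-R)..R, f x ^ 2 := fun f R hR =>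
    intervalIntegral.integral_nonneg (by linarith) fun x _ => sq_nonneg _
  have r1 := SqI.of_bound (f := fun x => v x ^ 2 - k ^ 2) (by fun_prop)
    (C := (∫ x, V x ^ 2) + 4 * (m ^ 3 + k ^ 2 * m)) fun R hR => by
    linarith [key R hR, n1 v' R hR]
  have r2 := SqI.of_bound (f := v') cv'
    (C := (∫ x, V x ^ 2) + 4 * (m ^ 3 + k ^ 2 * m)) fun R hR => by
    linarith [key R hR, n1 (fun x => v x ^ 2 - k ^ 2) R hR]
  exact ⟨r1.1, r2.1, r1.2, r2.2⟩

/-- A positive wave function of a KdV solution at energy `-k²`. -/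
structure Wave (V : ℝ → ℝ → ℝ) (k : ℝ) (ψ : ℝ → ℝ → ℝ) : Prop where
  sm : Sm ψ
  pos : ∀ t x, 0 < ψ t x
  xx : ∀ t x, Dx (Dx ψ) t x = (V t x + k ^ 2) * ψ t x
  t : ∀ t x, Dt ψ t x = -Dx V t x * ψ t x + (2 * V t x - 4 * k ^ 2) * Dx ψ t x

/-- Logarithmic derivative. -/
noncomputable def lg (ψ : ℝ → ℝ → ℝ) : ℝ → ℝ → ℝ := fun t x => Dx ψ t x / ψ t x

/-- Darboux transform. -/
noncomputable def dar (V : ℝ → ℝ → ℝ) (k : ℝ) (ψ : ℝ → ℝ → ℝ) : ℝ → ℝ → ℝ :=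
  fun t x => 2 * lg ψ t x ^ 2 - 2 * k ^ 2 - V t x

namespace Wave

variable {V ψ : ℝ → ℝ → ℝ} {k : ℝ}

theorem lg_sm (h : Wave V k ψ) : Sm (lg ψ) :=
  ContDiff.div h.sm.dx h.sm fun z => (h.pos z.1 z.2).ne'

theorem lg_dx (h : Wave V k ψ) : Dx (lg ψ) = fun t x => V t x + k ^ 2 - lg ψ t x ^ 2 := by
  ext t x
  have := ((h.sm.dx.hasDx t x).div (h.sm.hasDx t x) (h.pos t x).ne').deriv
  refine this.trans ?_
  have hp := (h.pos t x).ne'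
  simp only [lg]
  rw [h.xx]
  field_simp

theorem lg_dt (h : Wave V k ψ) (hs : Sm V) : Dt (lg ψ) = fun t x =>
    -Dx (Dx V) t x + 2 * Dx V t x * lg ψ t x +
      (2 * V t x - 4 * k ^ 2) * (V t x + k ^ 2 - lg ψ t x ^ 2) := by
  ext t x
  have e1 : Dt (Dx ψ) t x = -Dx (Dx V) t x * ψ t x + Dx V t x * Dx ψ t x +
      (2 * V t x - 4 * k ^ 2) * ((V t x + k ^ 2) * ψ t x) := by
    rw [h.sm.comm]
    have : Dt ψ = fun t x => -Dx V t x * ψ t x + (2 * V t x - 4 * k ^ 2) * Dx ψ t x := by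
      ext t x; exact h.t t x
    rw [this]
    simp (maxDischargeDepth := 20) only [Sm.Dx_sub, Sm.Dx_add, Sm.Dx_mul, Sm.Dx_neg, Sm.Dx_const,
      Sm.add, Sm.sub, Sm.mul, Sm.neg, Sm.const, hs, hs.dx, hs.dx.dx, h.sm, h.sm.dx, h.xx]
    ring
  have := ((h.sm.dx.hasDt t x).div (h.sm.hasDt t x) (h.pos t x).ne').deriv
  refine this.trans ?_
  have hp := (h.pos t x).ne'
  simp only [lg]
  rw [e1, h.t]
  field_simp
  ring

theorem dar_sm (h : Wave V k ψ) (hs : Sm V) : Sm (dar V k ψ) :=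
  (((h.lg_sm.pow 2).cmul 2).sub (Sm.const _)).sub hs

theorem dar_dx (h : Wave V k ψ) (hs : Sm V) : Dx (dar V k ψ) = fun t x =>
    4 * lg ψ t x * (V t x + k ^ 2 - lg ψ t x ^ 2) - Dx V t x := by
  have hv := h.lg_sm
  have : dar V k ψ = fun t x => 2 * lg ψ t x ^ 2 - 2 * k ^ 2 - V t x := rfl
  rw [this]
  ext t x
  simp (maxDischargeDepth := 20) only [Sm.Dx_sub, Sm.Dx_add, Sm.Dx_mul, Sm.Dx_neg, Sm.Dx_const,
    Sm.Dx_pow, Sm.add, Sm.sub, Sm.mul, Sm.neg, Sm.const, Sm.pow, hs, hs.dx, hs.dx.dx, hv, h.lg_dx]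
  norm_num
  ring

theorem dar_sol (h : Wave V k ψ) (hV : Sol V) : Sol (dar V k ψ) where
  sm := h.dar_sm hV.sm
  eq t x := by
    have hv := h.lg_sm
    have s0 := hV.sm
    have e : Dt V = fun t x => 6 * V t x * Dx V t x - Dx (Dx (Dx V)) t x := by
      ext t x; exact hV.eq t x
    rw [h.dar_dx s0]
    have : dar V k ψ = fun t x => 2 * lg ψ t x ^ 2 - 2 * k ^ 2 - V t x := rfl
    rw [this]
    simp (maxDischargeDepth := 20) only [Sm.Dx_sub, Sm.Dx_add, Sm.Dx_mul, Sm.Dx_neg, Sm.Dx_const,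
      Sm.Dx_pow, Sm.Dt_pow, Sm.Dt_sub, Sm.Dt_mul, Sm.Dt_const,
      Sm.add, Sm.sub, Sm.mul, Sm.neg, Sm.const, Sm.pow, s0, s0.dx, s0.dx.dx, s0.dx.dx.dx, hv,
      h.lg_dx, h.lg_dt s0, e]
    norm_num
    ring

theorem lg_bdd (h : Wave V k ψ) (t : ℝ) {N : ℝ} (hN : 1 ≤ N) (hV : ∀ x, |V t x| ≤ N) (x : ℝ) :
    |lg ψ t x| ≤ √(N + k ^ 2) := by
  have := abs_logDeriv_le (m := √(N + k ^ 2)) (sqrt_pos.2 (by nlinarith [sq_nonneg k])) (h.sm.hasDx t)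
    (fun x => by rw [← h.xx]; exact h.sm.dx.hasDx t x) (h.pos t) (fun x => by
      rw [sq_sqrt (by nlinarith [sq_nonneg k])]
      linarith [(abs_le.1 (hV x)).2]) x
  rw [lg, abs_div, abs_of_pos (h.pos t x), div_le_iff₀ (h.pos t x)]
  exact this

theorem dar_kc (h : Wave V k ψ) (hV : Sol.KC V) : Sol.KC (dar V k ψ) := by
  have s0 := hV.sm
  have est : ∀ t N m, (∫ x, V t x ^ 2) ≤ N → (∫ x, Dx V t x ^ 2) ≤ N → (∀ x, |lg ψ t x| ≤ m) →
      SqI (dar V k ψ t) ∧ SqI (Dx (dar V k ψ) t) ∧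
      (∫ x, dar V k ψ t x ^ 2) ≤ 2 * N + 8 * (N + 4 * (m ^ 3 + k ^ 2 * m)) ∧
      (∫ x, Dx (dar V k ψ) t x ^ 2) ≤ 32 * m ^ 2 * (N + 4 * (m ^ 3 + k ^ 2 * m)) + 2 * N := by
    intro t N m h1 h2 hm
    have dv : ∀ x, HasDerivAt (lg ψ t) (V t x + k ^ 2 - lg ψ t x ^ 2) x := fun x => by
      have := h.lg_sm.hasDx t x
      rwa [h.lg_dx] at this
    have cv := h.lg_sm.cont_x t
    have cV := s0.cont_x t
    obtain ⟨r1, r2, r3, r4⟩ := riccati_sqI (k := k) dv (by fun_prop) (fun x => by ring) (hV.i0 t) hm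
    have q1 : SqI fun x => 2 * (lg ψ t x ^ 2 - k ^ 2) := r1.cmul 2
    have q2 : SqI fun x => 4 * lg ψ t x * (V t x + k ^ 2 - lg ψ t x ^ 2) := by
      have := (r2.bdd_mul cv hm).cmul 4
      refine ⟨by fun_prop, this.2.congr (Eventually.of_forall fun x => ?_)⟩
      simp only; ring
    have e1 : dar V k ψ t = fun x => 2 * (lg ψ t x ^ 2 - k ^ 2) - V t x := by
      ext x; simp only [dar]; ring
    have e2 : Dx (dar V k ψ) t = fun x =>
      4 * lg ψ t x * (V t x + k ^ 2 - lg ψ t x ^ 2) - Dx V t x := by rw [h.dar_dx s0]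
    have b1 : (∫ x, (2 * (lg ψ t x ^ 2 - k ^ 2)) ^ 2) = 4 * ∫ x, (lg ψ t x ^ 2 - k ^ 2) ^ 2 := by
      rw [← integral_const_mul]; congr 1; ext x; ring
    have b2 : (∫ x, (4 * lg ψ t x * (V t x + k ^ 2 - lg ψ t x ^ 2)) ^ 2) ≤
        (16 * m ^ 2) * ∫ x, (V t x + k ^ 2 - lg ψ t x ^ 2) ^ 2 := by
      rw [← integral_const_mul]
      refine integral_mono q2.2 (r2.2.const_mul _) fun x => ?_
      have : lg ψ t x ^ 2 ≤ m ^ 2 := by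
        rw [← sq_abs]; exact pow_le_pow_left₀ (abs_nonneg _) (hm x) 2
      have := mul_le_mul_of_nonneg_right this (sq_nonneg (V t x + k ^ 2 - lg ψ t x ^ 2))
      simp only
      linarith
    have b3 := int_sq_sub_le q1 (hV.i0 t)
    have b4 := int_sq_sub_le q2 (hV.i1 t)
    rw [e1, e2]
    refine ⟨q1.sub (hV.i0 t), q2.sub (hV.i1 t), ?_, ?_⟩
    · linarith
    · have : 0 ≤ 32 * m ^ 2 := by positivity
      have b5 : 32 * m ^ 2 * (∫ x, (V t x + k ^ 2 - lg ψ t x ^ 2) ^ 2) ≤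
        32 * m ^ 2 * (N + 4 * (m ^ 3 + k ^ 2 * m)) := mul_le_mul_of_nonneg_left (by linarith) this
      linarith
  have main : ∀ T, ∃ C, ∀ t, |t| ≤ T → SqI (dar V k ψ t) ∧ SqI (Dx (dar V k ψ) t) ∧
      (∫ x, dar V k ψ t x ^ 2) ≤ C ∧ (∫ x, Dx (dar V k ψ) t x ^ 2) ≤ C := by
    intro T
    obtain ⟨N, hN, hb⟩ := hV.bdd' T
    obtain ⟨m, hm⟩ : ∃ m, m = √(N + k ^ 2) := ⟨_, rfl⟩
    refine ⟨max (2 * N + 8 * (N + 4 * (m ^ 3 + k ^ 2 * m)))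
      (32 * m ^ 2 * (N + 4 * (m ^ 3 + k ^ 2 * m)) + 2 * N), fun t ht => ?_⟩
    obtain ⟨h1, h2, h3⟩ := hb t ht
    obtain ⟨g1, g2, g3, g4⟩ := est t N m h1 h2 (by rw [hm]; exact h.lg_bdd t hN h3)
    exact ⟨g1, g2, g3.trans (le_max_left _ _), g4.trans (le_max_right _ _)⟩
  refine ⟨h.dar_sol hV.toSol, fun t => ?_, fun t => ?_, fun T => ?_⟩
  · obtain ⟨C, hC⟩ := main |t|; exact (hC t le_rfl).1
  · obtain ⟨C, hC⟩ := main |t|; exact (hC t le_rfl).2.1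
  · obtain ⟨C, hC⟩ := main T; exact ⟨C, fun t ht => (hC t ht).2.2⟩

end Wave

end KdV

namespace KdV

open Set
set_option linter.unusedSimpArgs false

/-- Energy estimate for a damped linear equation with an integrating factor of bounded size. -/
theorem damped_energy {y G ρ h H : ℝ → ℝ} {c m M b e : ℝ} (hc : 0 < c) (hm : 0 < m) (hbe : b ≤ e)
    (cG : Continuous G) (cρ : Continuous ρ) (ch : Continuous h)
    (hy : ∀ x, HasDerivAt y (-(c + ρ x + h x) * y x + G x) x)
    (hH : ∀ x, HasDerivAt H (h x * H x) x) (bH : ∀ x ∈ Icc b e, m ≤ H x ∧ H x ≤ M)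
    (bρ : ∀ x ∈ Ioo b e, |ρ x| ≤ c / 2) :
    y e ^ 2 + c / 2 * (∫ x in b..e, y x ^ 2) ≤
      (M / m) ^ 2 * (y b ^ 2 + 2 / c * ∫ x in b..e, G x ^ 2) := by
  have cy : Continuous y := continuous_iff_continuousAt.2 fun x => (hy x).continuousAt
  have cH : Continuous H := continuous_iff_continuousAt.2 fun x => (hH x).continuousAt
  have hw : ∀ x, HasDerivAt (fun x => H x * y x)
      (h x * H x * y x + H x * (-(c + ρ x + h x) * y x + G x)) x := fun x => (hH x).mul (hy x)
  have i1 := intervalIntegral.integral_eq_sub_of_hasDerivAt (a := b) (b := e)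
    (f := fun x => (H x * y x) ^ 2) (fun x _ => hasDeriv_sq hw x)
    (Continuous.intervalIntegrable (by fun_prop) _ _)
  have i2 : (∫ x in b..e, 2 * (H x * y x * (h x * H x * y x + H x * (-(c + ρ x + h x) * y x + G x))))
      ≤ ∫ x in b..e, (-(c / 2 * m ^ 2 * y x ^ 2) + 2 / c * M ^ 2 * G x ^ 2) := by
    refine intervalIntegral.integral_mono_on_of_le_Ioo hbe
      (Continuous.intervalIntegrable (by fun_prop) _ _)
      (Continuous.intervalIntegrable (by fun_prop) _ _) fun x hx => ?_
    obtain ⟨h1, h2⟩ := bH x (Ioo_subset_Icc_self hx)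
    have h3 := (abs_le.1 (bρ x hx)).1
    have k1 : 2 * (H x * y x * (h x * H x * y x + H x * (-(c + ρ x + h x) * y x + G x))) =
        H x ^ 2 * (-2 * (c + ρ x) * y x ^ 2 + 2 * y x * G x) := by ring
    have k2 : 2 * y x * G x ≤ c / 2 * y x ^ 2 + 2 / c * G x ^ 2 := by
      have : c / 2 * y x ^ 2 + 2 / c * G x ^ 2 - 2 * y x * G x = (c * y x - 2 * G x) ^ 2 / (2 * c) := by
        field_simp; ring
      have := div_nonneg (sq_nonneg (c * y x - 2 * G x)) (by linarith : 0 ≤ 2 * c)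
      linarith
    have k3 : -2 * (c + ρ x) * y x ^ 2 + 2 * y x * G x ≤ -(c / 2 * y x ^ 2) + 2 / c * G x ^ 2 := by
      have := mul_le_mul_of_nonneg_right (by linarith : c ≤ 2 * (c + ρ x)) (sq_nonneg (y x))
      linarith
    have k4 : m ^ 2 ≤ H x ^ 2 := pow_le_pow_left₀ hm.le h1 2
    have k5 : H x ^ 2 ≤ M ^ 2 := pow_le_pow_left₀ (hm.le.trans h1) h2 2
    have k6 := mul_le_mul_of_nonneg_left k3 (sq_nonneg (H x))
    have k7 := mul_le_mul_of_nonneg_right k4 (by positivity : 0 ≤ c / 2 * y x ^ 2)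
    have k8 := mul_le_mul_of_nonneg_right k5 (by positivity : 0 ≤ 2 / c * G x ^ 2)
    rw [k1]
    linarith
  rw [i1, intervalIntegral.integral_add (Continuous.intervalIntegrable (by fun_prop) _ _)
    (Continuous.intervalIntegrable (by fun_prop) _ _), intervalIntegral.integral_neg,
    intervalIntegral.integral_const_mul, intervalIntegral.integral_const_mul] at i2
  obtain ⟨e1, e2⟩ := bH e (right_mem_Icc.2 hbe)
  obtain ⟨b1, b2⟩ := bH b (left_mem_Icc.2 hbe)
  have l1 := mul_le_mul_of_nonneg_right (pow_le_pow_left₀ hm.le e1 2) (sq_nonneg (y e))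
  have l2 := mul_le_mul_of_nonneg_right (pow_le_pow_left₀ (hm.le.trans b1) b2 2) (sq_nonneg (y b))
  rw [mul_pow, mul_pow] at i2
  have key : m ^ 2 * (y e ^ 2 + c / 2 * (∫ x in b..e, y x ^ 2)) ≤
      M ^ 2 * (y b ^ 2 + 2 / c * ∫ x in b..e, G x ^ 2) := by
    generalize (∫ x in b..e, y x ^ 2) = I at *
    generalize (∫ x in b..e, G x ^ 2) = J at *
    linarith
  rw [div_pow, div_mul_eq_mul_div (M ^ 2), le_div_iff₀ (by positivity)]
  exact (mul_comm _ _).trans_le key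

/-- Energy estimate for an expanding linear equation, controlled from the right end. -/
theorem expanding_energy {y G ρ h H : ℝ → ℝ} {c m M b e : ℝ} (hc : 0 < c) (hm : 0 < m) (hbe : b ≤ e)
    (cG : Continuous G) (cρ : Continuous ρ) (ch : Continuous h)
    (hy : ∀ x, HasDerivAt y ((c + ρ x + h x) * y x + G x) x)
    (hH : ∀ x, HasDerivAt H (-h x * H x) x) (bH : ∀ x ∈ Icc b e, m ≤ H x ∧ H x ≤ M)
    (bρ : ∀ x ∈ Ioo b e, |ρ x| ≤ c / 2) :
    y b ^ 2 + c / 2 * (∫ x in b..e, y x ^ 2) ≤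
      (M / m) ^ 2 * (y e ^ 2 + 2 / c * ∫ x in b..e, G x ^ 2) := by
  have := damped_energy (y := fun x => y (-x)) (G := fun x => -G (-x)) (ρ := fun x => ρ (-x))
    (h := fun x => h (-x)) (H := fun x => H (-x)) (b := -e) (e := -b) hc hm (by linarith)
    (by fun_prop) (by fun_prop) (by fun_prop)
    (fun x => ((hy (-x)).comp x (hasDerivAt_neg x)).congr_deriv (by ring))
    (fun x => ((hH (-x)).comp x (hasDerivAt_neg x)).congr_deriv (by ring))
    (fun x hx => bH (-x) ⟨by linarith [hx.2], by linarith [hx.1]⟩)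
    (fun x hx => bρ (-x) ⟨by linarith [hx.2], by linarith [hx.1]⟩)
  simp only [neg_neg, neg_sq] at this
  rwa [intervalIntegral.integral_comp_neg (fun x => y x ^ 2),
    intervalIntegral.integral_comp_neg (fun x => G x ^ 2), neg_neg, neg_neg] at this

/-- A bounded solution of an expanding linear equation on a half line is square integrable. -/
theorem expanding_half_line {y G ρ h H : ℝ → ℝ} {c m M a B Bh : ℝ} (hc : 0 < c) (hm : 0 < m)
    (hG : SqI G) (cρ : Continuous ρ) (ch : Continuous h)
    (hy : ∀ x, HasDerivAt y ((c + ρ x + h x) * y x + G x) x)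
    (hH : ∀ x, HasDerivAt H (-h x * H x) x) (bH : ∀ x, a ≤ x → m ≤ H x ∧ H x ≤ M)
    (bρ : ∀ x, a ≤ x → |ρ x| ≤ c / 2) (bh : ∀ x, a ≤ x → |h x| ≤ Bh) (by' : ∀ x, |y x| ≤ B) :
    IntegrableOn (fun x => y x ^ 2) (Ioi a) ∧
      (∫ x in Ioi a, y x ^ 2) ≤ 4 * (M / m) ^ 2 / c ^ 2 * ∫ x in Ioi a, G x ^ 2 := by
  have cy : Continuous y := continuous_iff_continuousAt.2 fun x => (hy x).continuousAt
  have en : ∀ e, a ≤ e → y a ^ 2 + c / 2 * (∫ x in a..e, y x ^ 2) ≤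
      (M / m) ^ 2 * (y e ^ 2 + 2 / c * ∫ x in Ioi a, G x ^ 2) := fun e he => by
    refine (expanding_energy hc hm he hG.1 cρ ch hy hH (fun x hx => bH x hx.1)
      (fun x hx => bρ x hx.1.le)).trans ?_
    have : ∫ x in a..e, G x ^ 2 ≤ ∫ x in Ioi a, G x ^ 2 := by
      rw [intervalIntegral.integral_of_le he]
      exact setIntegral_mono_set hG.2.integrableOn (Eventually.of_forall fun _ => sq_nonneg _)
        Ioc_subset_Ioi_self.eventuallyLE
    gcongr
  have int : IntegrableOn (fun x => y x ^ 2) (Ioi a) := by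
    refine integrableOn_Ioi_of_intervalIntegral_norm_bounded (l := atTop) (b := fun e : ℝ => e)
      (2 / c * ((M / m) ^ 2 * (B ^ 2 + 2 / c * ∫ x in Ioi a, G x ^ 2))) a
      (fun e => (cy.pow 2).integrableOn_Ioc) tendsto_id ?_
    filter_upwards [eventually_ge_atTop a] with e he
    simp only [norm_eq_abs, abs_of_nonneg (sq_nonneg (y _))]
    have h1 := en e he
    have h2 : y e ^ 2 ≤ B ^ 2 := by
      rw [← sq_abs]; exact pow_le_pow_left₀ (abs_nonneg _) (by' e) 2
    have h3 := mul_le_mul_of_nonneg_left h2 (sq_nonneg (M / m))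
    have h4 : c / 2 * (∫ x in a..e, y x ^ 2) ≤
        (M / m) ^ 2 * (B ^ 2 + 2 / c * ∫ x in Ioi a, G x ^ 2) := by nlinarith [sq_nonneg (y a)]
    calc _ = 2 / c * (c / 2 * (∫ x in a..e, y x ^ 2)) := by field_simp
      _ ≤ _ := mul_le_mul_of_nonneg_left h4 (by positivity)
  refine ⟨int, ?_⟩
  have lim0 : Tendsto (fun x => y x ^ 2) atTop (nhds 0) := by
    refine tendsto_zero_of_hasDerivAt_of_integrableOn_Ioi (a := a) (fun x _ => hasDeriv_sq hy x) ?_ int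
    have : IntegrableOn (fun x => y x ^ 2 + G x ^ 2) (Ioi a) := int.add hG.2.integrableOn
    refine (this.const_mul (2 * (c + c / 2 + Bh) + 1)).mono' (by
      exact Continuous.aestronglyMeasurable (by have := hG.1; fun_prop)) ?_
    filter_upwards [self_mem_ae_restrict measurableSet_Ioi] with x hx
    have hx' : a ≤ x := (mem_Ioi.1 hx).le
    have k1 : |c + ρ x + h x| ≤ c + c / 2 + Bh := by
      refine (abs_add_three _ _ _).trans ?_
      rw [abs_of_pos hc]
      linarith [bρ x hx', bh x hx']
    have k2 : |y x * ((c + ρ x + h x) * y x + G x)| ≤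
        (c + c / 2 + Bh) * y x ^ 2 + |y x * G x| := by
      rw [show y x * ((c + ρ x + h x) * y x + G x) = (c + ρ x + h x) * y x ^ 2 + y x * G x by ring]
      refine (abs_add_le _ _).trans ?_
      rw [abs_mul, abs_of_nonneg (sq_nonneg (y x))]
      gcongr
    have k3 : 2 * |y x * G x| ≤ y x ^ 2 + G x ^ 2 := by
      rw [abs_mul, ← sq_abs (y x), ← sq_abs (G x)]
      nlinarith [sq_nonneg (|y x| - |G x|)]
    have k4 : 0 ≤ c + c / 2 + Bh := (abs_nonneg _).trans k1
    have k5 := mul_nonneg k4 (sq_nonneg (G x))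
    rw [norm_eq_abs, abs_mul, abs_two]
    nlinarith
  have l1 : Tendsto (fun e => y a ^ 2 + c / 2 * (∫ x in a..e, y x ^ 2)) atTop
      (nhds (y a ^ 2 + c / 2 * ∫ x in Ioi a, y x ^ 2)) :=
    ((intervalIntegral_tendsto_integral_Ioi a int tendsto_id).const_mul _).const_add _
  have l2 : Tendsto (fun e => (M / m) ^ 2 * (y e ^ 2 + 2 / c * ∫ x in Ioi a, G x ^ 2)) atTop
      (nhds ((M / m) ^ 2 * (0 + 2 / c * ∫ x in Ioi a, G x ^ 2))) :=
    (lim0.add_const _).const_mul _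
  have fin := le_of_tendsto_of_tendsto l1 l2 (by
    filter_upwards [eventually_ge_atTop a] with e he using en e he)
  have fin2 : c / 2 * (∫ x in Ioi a, y x ^ 2) ≤
      (M / m) ^ 2 * (0 + 2 / c * ∫ x in Ioi a, G x ^ 2) := by linarith [sq_nonneg (y a)]
  calc _ = 2 / c * (c / 2 * (∫ x in Ioi a, y x ^ 2)) := by field_simp
    _ ≤ _ := mul_le_mul_of_nonneg_left fin2 (by positivity)
    _ = _ := by field_simp; ring

/-- Nonlinear version of the damped estimate, by continuation. -/
theorem damped_riccati {y G h H : ℝ → ℝ} {c m M a e : ℝ} (hc : 0 < c) (hm : 0 < m)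
    (cG : Continuous G) (ch : Continuous h)
    (hy : ∀ x, HasDerivAt y (-(c - y x + h x) * y x + G x) x)
    (hH : ∀ x, HasDerivAt H (h x * H x) x) (bH : ∀ x ∈ Icc a e, m ≤ H x ∧ H x ≤ M)
    (small : (M / m) ^ 2 * (y a ^ 2 + 2 / c * ∫ x in a..e, G x ^ 2) < (c / 2) ^ 2) (hae : a ≤ e) :
    (∀ x ∈ Icc a e, |y x| ≤ c / 2) ∧ c / 2 * (∫ x in a..e, y x ^ 2) ≤
      (M / m) ^ 2 * (y a ^ 2 + 2 / c * ∫ x in a..e, G x ^ 2) := by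
  have cy : Continuous y := continuous_iff_continuousAt.2 fun x => (hy x).continuousAt
  have sub : ∀ x ∈ Icc a e, (∀ z ∈ Ioo a x, |y z| ≤ c / 2) →
      y x ^ 2 + c / 2 * (∫ x in a..x, y x ^ 2) ≤
      (M / m) ^ 2 * (y a ^ 2 + 2 / c * ∫ x in a..e, G x ^ 2) := by
    intro x hx hz
    refine (damped_energy (ρ := fun x => -y x) hc hm hx.1 cG cy.neg ch
      (fun x => (hy x).congr_deriv (by ring)) hH
      (fun z hz => bH z ⟨hz.1, hz.2.trans hx.2⟩) (fun z hz' => by rw [abs_neg]; exact hz z hz')).trans ?_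
    have : ∫ x in a..x, G x ^ 2 ≤ ∫ x in a..e, G x ^ 2 :=
      intervalIntegral.integral_mono_interval le_rfl hx.1 hx.2
        (Eventually.of_forall fun _ => sq_nonneg _) (Continuous.intervalIntegrable (by fun_prop) _ _)
    gcongr
  have all : ∀ x ∈ Icc a e, |y x| ≤ c / 2 := by
    by_contra! hcon
    obtain ⟨x1, hx1, hy1⟩ := hcon
    have cpt : IsCompact ({x | c / 2 ≤ |y x|} ∩ Icc a e) :=
      isCompact_Icc.inter_left (isClosed_le continuous_const cy.abs)
    obtain ⟨x0, ⟨h0, hx0⟩, hl⟩ := cpt.exists_isLeast ⟨x1, hy1.le, hx1⟩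
    have := sub x0 hx0 fun z hz => by
      by_contra! hc'
      exact absurd (hl ⟨hc'.le, hz.1.le, hz.2.le.trans hx0.2⟩) (not_le.2 hz.2)
    have n1 : 0 ≤ ∫ x in a..x0, y x ^ 2 :=
      intervalIntegral.integral_nonneg hx0.1 fun _ _ => sq_nonneg _
    have n2 : (c / 2) ^ 2 ≤ y x0 ^ 2 := by
      rw [← sq_abs (y x0)]; exact pow_le_pow_left₀ (by positivity) h0 2
    have n3 : 0 ≤ c / 2 * ∫ x in a..x0, y x ^ 2 := by positivity
    linarith
  refine ⟨all, ?_⟩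
  have := sub e ⟨hae, le_rfl⟩ fun z hz => all z ⟨hz.1.le, hz.2.le⟩
  linarith [sq_nonneg (y e)]

end KdV

namespace KdV

open Set
set_option linter.unusedSimpArgs false

theorem abs_tanh_lt (x : ℝ) : |tanh x| < 1 := abs_lt.2 ⟨neg_one_lt_tanh x, tanh_lt_one x⟩

theorem tanh_sub' (x y : ℝ) : tanh (x - y) = (tanh x - tanh y) / (1 - tanh x * tanh y) := by
  have h1 := cosh_pos x
  have h2 := cosh_pos y
  have h3 := cosh_pos (x - y)
  have h4 : 1 - tanh x * tanh y ≠ 0 := by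
    have := mul_lt_one_of_nonneg_of_lt_one_left (abs_nonneg _) (abs_tanh_lt x) (abs_tanh_lt y).le
    rw [← abs_mul] at this
    have := (abs_lt.1 this).2
    linarith
  rw [eq_div_iff h4, tanh_eq_sinh_div_cosh, tanh_eq_sinh_div_cosh, tanh_eq_sinh_div_cosh]
  rw [cosh_sub] at h3
  rw [sinh_sub, cosh_sub]
  field_simp
  rw [mul_comm (cosh y) (cosh x), mul_div_assoc, div_self h3.ne', mul_one]

/-- The soliton potential with eigenvalue parameter `k`. -/
noncomputable def S (k x : ℝ) : ℝ := -2 * k ^ 2 * (1 - tanh (k * x) ^ 2)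

/-- The denominator of the Darboux transform of a soliton. -/
noncomputable def hh (κ k x : ℝ) : ℝ := κ - k * tanh (k * x)

/-- The logarithmic derivative of `hh`. -/
noncomputable def dd (κ k x : ℝ) : ℝ := -(k ^ 2 * (1 - tanh (k * x) ^ 2)) / hh κ k x

/-- The phase shift. -/
noncomputable def sg (κ k : ℝ) : ℝ := artanh (k / κ) / k

theorem hasDeriv_tanh_mul (k b x : ℝ) :
    HasDerivAt (fun x => tanh (k * (x - b))) ((1 - tanh (k * (x - b)) ^ 2) * k) x :=
  (hasDerivAt_tanh _).comp x ((((hasDerivAt_id x).sub_const b).const_mul k).congr_deriv (by simp))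

theorem hh_pos {κ k : ℝ} (hk : 0 ≤ k) (h : k < κ) (x : ℝ) : 0 < hh κ k x := by
  have := tanh_lt_one (k * x)
  unfold hh
  nlinarith

theorem hasDeriv_hh (κ k b x : ℝ) :
    HasDerivAt (fun x => hh κ k (x - b)) (-(k ^ 2 * (1 - tanh (k * (x - b)) ^ 2))) x :=
  (((hasDeriv_tanh_mul k b x).const_mul k).const_sub κ).congr_deriv (by ring)

theorem hasDeriv_dd {κ k : ℝ} (hk : 0 ≤ k) (h : k < κ) (b x : ℝ) :
    HasDerivAt (fun x => dd κ k (x - b))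
      (S k (x - b) - dd κ k (x - b) ^ 2 - 2 * κ * dd κ k (x - b)) x := by
  have h1 : HasDerivAt (fun x => -(k ^ 2 * (1 - tanh (k * (x - b)) ^ 2)))
      (2 * k ^ 3 * tanh (k * (x - b)) * (1 - tanh (k * (x - b)) ^ 2)) x :=
    (((((hasDeriv_tanh_mul k b x).fun_pow 2).const_sub 1).const_mul (k ^ 2)).fun_neg).congr_deriv
      (by push_cast; ring)
  have hp := (hh_pos hk h (x - b)).ne'
  refine (h1.fun_div (hasDeriv_hh κ k b x) hp).congr_deriv ?_
  unfold dd S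
  field_simp
  unfold hh
  ring

theorem dd_shift {κ k : ℝ} (hk : 0 < k) (h : k < κ) (x : ℝ) :
    -(S k x - dd κ k x ^ 2 - 2 * κ * dd κ k x) + dd κ k x ^ 2 + 2 * κ * dd κ k x =
      S k (x - sg κ k) := by
  have hp := (hh_pos hk.le h x)
  have hκ : 0 < κ := hk.trans h
  have e1 : k * (x - sg κ k) = k * x - artanh (k / κ) := by unfold sg; field_simp
  have e2 : tanh (artanh (k / κ)) = k / κ :=
    tanh_artanh ⟨by linarith [div_pos hk hκ], (div_lt_one hκ).2 h⟩
  have hp' := hp.ne'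
  have e3 : tanh (k * (x - sg κ k)) = (κ * tanh (k * x) - k) / hh κ k x := by
    rw [e1, tanh_sub', e2]
    have : 1 - tanh (k * x) * (k / κ) = hh κ k x / κ := by unfold hh; field_simp
    rw [this]
    field_simp
  unfold S dd
  rw [e3]
  field_simp
  unfold hh
  ring

theorem abs_dd_le {κ k g : ℝ} (hg : 0 < g) (hk : g ≤ k) (h : k + g ≤ κ) (hκ : κ ≤ g⁻¹) (x : ℝ) :
    |dd κ k x| ≤ 4 * g⁻¹ ^ 3 * exp (-(2 * g * |x|)) := by
  have k0 : 0 < k := hg.trans_le hk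
  have h1 : g ≤ hh κ k x := by
    have := tanh_lt_one (k * x)
    unfold hh
    nlinarith
  have h2 := one_sub_tanh_sq_le (k * x)
  have h3 : 0 ≤ 1 - tanh (k * x) ^ 2 := (sub_pos.2 (tanh_sq_lt_one _)).le
  have h4 : exp (-(2 * |k * x|)) ≤ exp (-(2 * g * |x|)) := by
    rw [abs_mul, abs_of_pos k0]
    apply exp_le_exp.2
    nlinarith [mul_le_mul_of_nonneg_right hk (abs_nonneg x)]
  have h5 : k ^ 2 ≤ g⁻¹ ^ 2 := pow_le_pow_left₀ k0.le (by linarith) 2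
  unfold dd
  rw [abs_div, abs_neg, abs_of_nonneg (mul_nonneg (sq_nonneg k) h3), abs_of_pos (hg.trans_le h1),
    div_le_iff₀ (hg.trans_le h1)]
  calc _ ≤ g⁻¹ ^ 2 * (4 * exp (-(2 * g * |x|))) := by gcongr; exact h2.trans (by gcongr)
    _ = 4 * g⁻¹ ^ 3 * exp (-(2 * g * |x|)) * g := by field_simp
    _ ≤ _ := by gcongr

theorem abs_S_le {k g : ℝ} (hg : 0 < g) (hk : g ≤ k) (hκ : k ≤ g⁻¹) (x : ℝ) :
    |S k x| ≤ 8 * g⁻¹ ^ 2 * exp (-(2 * g * |x|)) := by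
  have k0 : 0 < k := hg.trans_le hk
  have h2 := one_sub_tanh_sq_le (k * x)
  have h3 : 0 ≤ 1 - tanh (k * x) ^ 2 := (sub_pos.2 (tanh_sq_lt_one _)).le
  have h4 : exp (-(2 * |k * x|)) ≤ exp (-(2 * g * |x|)) := by
    rw [abs_mul, abs_of_pos k0]
    apply exp_le_exp.2
    nlinarith [mul_le_mul_of_nonneg_right hk (abs_nonneg x)]
  have h5 : k ^ 2 ≤ g⁻¹ ^ 2 := pow_le_pow_left₀ k0.le (by linarith) 2
  have : |S k x| = 2 * k ^ 2 * (1 - tanh (k * x) ^ 2) := by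
    unfold S
    rw [show -2 * k ^ 2 * (1 - tanh (k * x) ^ 2) = -(2 * k ^ 2 * (1 - tanh (k * x) ^ 2)) by ring,
      abs_neg, abs_of_nonneg (by positivity)]
  rw [this]
  calc _ ≤ 2 * g⁻¹ ^ 2 * (4 * exp (-(2 * g * |x|))) := by gcongr; exact h2.trans (by gcongr)
    _ = _ := by ring

theorem continuous_S (k : ℝ) : Continuous (S k) := by
  have := contDiff_tanh.continuous
  unfold S
  fun_prop

theorem integrable_exp_abs {g : ℝ} (hg : 0 < g) (b : ℝ) :
    Integrable (fun x => exp (-(2 * g * |x - b|))) ∧ ∫ x, exp (-(2 * g * |x - b|)) = g⁻¹ := by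
  have e0 : ∀ x ∈ Ioi (0 : ℝ), exp (-(2 * g) * x) = exp (-(2 * g * |x|)) := fun x hx => by
    rw [abs_of_pos hx, neg_mul]
  have e1 : IntegrableOn (fun x : ℝ => exp (-(2 * g * |x|))) (Ioi 0) :=
    (integrableOn_exp_mul_Ioi (a := -(2 * g)) (by linarith) 0).congr_fun e0 measurableSet_Ioi
  have e2 : IntegrableOn (fun x : ℝ => exp (-(2 * g * |x|))) (Iic 0) := by
    refine (integrableOn_exp_mul_Iic (a := 2 * g) (by linarith) 0).congr_fun (fun x hx => ?_)
      measurableSet_Iic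
    simp only [abs_of_nonpos (mem_Iic.1 hx)]
    ring_nf
  have e3 : Integrable (fun x : ℝ => exp (-(2 * g * |x|))) := by
    rw [← integrableOn_univ, ← Iic_union_Ioi (a := (0 : ℝ))]
    exact e2.union e1
  refine ⟨e3.comp_sub_right b, ?_⟩
  rw [integral_sub_right_eq_self (fun x => exp (-(2 * g * |x|))) b,
    integral_comp_abs (f := fun x => exp (-(2 * g * x)))]
  have := integral_exp_mul_Ioi (a := -(2 * g)) (by linarith) 0
  simp only [neg_mul] at this
  rw [this]
  simp only [mul_zero, neg_zero, exp_zero]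
  field_simp

theorem SqI.exp_abs {g : ℝ} (hg : 0 < g) (b : ℝ) : SqI (fun x => exp (-(g * |x - b|))) :=
  ⟨by fun_prop, by
    refine (integrable_exp_abs hg b).1.congr (Eventually.of_forall fun x => ?_)
    simp only []
    rw [← exp_nat_mul]; congr 1; push_cast; ring⟩

theorem int_exp_abs_sq {g : ℝ} (hg : 0 < g) (b : ℝ) :
    ∫ x, exp (-(g * |x - b|)) ^ 2 = g⁻¹ := by
  rw [← (integrable_exp_abs hg b).2]
  refine integral_congr_ae (Eventually.of_forall fun x => ?_)
  simp only []
  rw [← exp_nat_mul]; congr 1; push_cast; ring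

theorem SqI.soliton {k : ℝ} (hk : 0 < k) (b : ℝ) : SqI (fun x => S k (x - b)) := by
  obtain ⟨g, hg, h1, h2⟩ : ∃ g, 0 < g ∧ g ≤ k ∧ k ≤ g⁻¹ :=
    ⟨min k k⁻¹, by positivity, min_le_left _ _, by
      rw [le_inv_comm₀ hk (by positivity)]; exact min_le_right _ _⟩
  refine SqI.of_le ((continuous_S k).comp (by fun_prop)) (SqI.exp_abs hg b)
    (C := (8 * g⁻¹ ^ 2) ^ 2) fun x => ?_
  rw [← mul_pow, ← sq_abs]
  refine pow_le_pow_left₀ (abs_nonneg _) ((abs_S_le hg h1 h2 _).trans ?_) 2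
  gcongr
  nlinarith [mul_nonneg hg.le (abs_nonneg (x - b))]

/-- A range of admissible spectral parameters. -/
structure Box (g κ : ℝ) (n : ℕ) (k : ℕ → ℝ) : Prop where
  pos : 0 < g
  le : g ≤ κ
  inv : κ ≤ g⁻¹
  lo : ∀ j < n, g ≤ k j
  hi : ∀ j < n, k j + g ≤ κ

open Finset in
/-- A sum of solitons. -/
noncomputable def SS (k b : ℕ → ℝ) (n : ℕ) (x : ℝ) : ℝ := ∑ j ∈ range n, S (k j) (x - b j)

open Finset in
/-- A sum of logarithmic derivatives. -/
noncomputable def DD (κ : ℝ) (k b : ℕ → ℝ) (n : ℕ) (x : ℝ) : ℝ :=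
  ∑ j ∈ range n, dd κ (k j) (x - b j)

open Finset in
/-- The product whose logarithmic derivative is `DD`. -/
noncomputable def PP (κ : ℝ) (k b : ℕ → ℝ) (n : ℕ) (x : ℝ) : ℝ :=
  ∏ j ∈ range n, hh κ (k j) (x - b j)

/-- The reference logarithmic derivative of the ground state. -/
noncomputable def vr (κ a : ℝ) (k b : ℕ → ℝ) (n : ℕ) (x : ℝ) : ℝ :=
  -(κ * tanh (κ * (x - a))) + DD κ k b n x

open Finset in
/-- The interaction error. -/
noncomputable def RR (κ a : ℝ) (k b : ℕ → ℝ) (n : ℕ) (x : ℝ) : ℝ :=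
  DD κ k b n x ^ 2 - (∑ j ∈ range n, dd κ (k j) (x - b j) ^ 2) -
    2 * κ * (1 + tanh (κ * (x - a))) * DD κ k b n x

/-- The positions after the Darboux transform. -/
noncomputable def bs (κ : ℝ) (k b : ℕ → ℝ) (j : ℕ) : ℝ := b j + sg κ (k j)

namespace Box

variable {g κ a : ℝ} {n : ℕ} {k b : ℕ → ℝ}

theorem κpos (B : Box g κ n k) : 0 < κ := B.pos.trans_le B.le

theorem kpos (B : Box g κ n k) {j : ℕ} (hj : j < n) : 0 < k j := B.pos.trans_le (B.lo j hj)

theorem klt (B : Box g κ n k) {j : ℕ} (hj : j < n) : k j < κ := by linarith [B.hi j hj, B.pos]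

theorem abs_dd (B : Box g κ n k) {j : ℕ} (hj : j < n) (x : ℝ) :
    |dd κ (k j) x| ≤ 4 * g⁻¹ ^ 3 * exp (-(2 * g * |x|)) :=
  abs_dd_le B.pos (B.lo j hj) (B.hi j hj) B.inv x

theorem hasDeriv_DD (B : Box g κ n k) (x : ℝ) :
    HasDerivAt (DD κ k b n)
      (SS k b n x - (∑ j ∈ Finset.range n, dd κ (k j) (x - b j) ^ 2) - 2 * κ * DD κ k b n x) x := by
  have := HasDerivAt.fun_sum (u := Finset.range n) (A := fun j x => dd κ (k j) (x - b j)) (x := x)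
    fun j hj => hasDeriv_dd (B.kpos (Finset.mem_range.1 hj)).le (B.klt (Finset.mem_range.1 hj)) (b j) x
  refine this.congr_deriv ?_
  rw [Finset.sum_sub_distrib, Finset.sum_sub_distrib, ← Finset.mul_sum]
  rfl

theorem hasDeriv_vr (B : Box g κ n k) (x : ℝ) :
    HasDerivAt (vr κ a k b n)
      (κ ^ 2 + (S κ (x - a) + SS k b n x + RR κ a k b n x) - vr κ a k b n x ^ 2) x := by
  refine ((((hasDeriv_tanh_mul κ a x).const_mul κ).fun_neg).add (B.hasDeriv_DD x)).congr_deriv ?_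
  unfold vr RR S
  ring

theorem vr_shift (B : Box g κ n k) (x : ℝ) :
    2 * vr κ a k b n x ^ 2 - 2 * κ ^ 2 - (S κ (x - a) + SS k b n x + RR κ a k b n x) =
      SS k (bs κ k b) n x + RR κ a k b n x := by
  have h : SS k (bs κ k b) n x =
      -SS k b n x + 2 * (∑ j ∈ Finset.range n, dd κ (k j) (x - b j) ^ 2) + 4 * κ * DD κ k b n x := by
    unfold SS DD bs
    rw [← Finset.sum_neg_distrib, Finset.mul_sum, Finset.mul_sum, ← Finset.sum_add_distrib,
      ← Finset.sum_add_distrib]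
    refine Finset.sum_congr rfl fun j hj => ?_
    have := dd_shift (B.kpos (Finset.mem_range.1 hj)) (B.klt (Finset.mem_range.1 hj)) (x - b j)
    rw [sub_add_eq_sub_sub, ← this]
    ring
  rw [h]
  unfold vr RR S
  ring

theorem abs_DD_le (B : Box g κ n k) {L x : ℝ} (hL : ∀ j < n, L ≤ |x - b j|) :
    |DD κ k b n x| ≤ n * (4 * g⁻¹ ^ 3) * exp (-(2 * g * L)) := by
  have g0 := B.pos
  refine (Finset.abs_sum_le_sum_abs _ _).trans ?_
  refine (Finset.sum_le_card_nsmul _ _ (4 * g⁻¹ ^ 3 * exp (-(2 * g * L))) fun j hj => ?_).trans_eq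
    (by rw [Finset.card_range, nsmul_eq_mul]; ring)
  refine (B.abs_dd (Finset.mem_range.1 hj) _).trans ?_
  gcongr
  exact hL j (Finset.mem_range.1 hj)

theorem abs_DD_le' (B : Box g κ n k) (x : ℝ) : |DD κ k b n x| ≤ n * (4 * g⁻¹ ^ 3) := by
  simpa using B.abs_DD_le (b := b) (L := 0) (x := x) fun j _ => abs_nonneg _

theorem abs_vr_le (B : Box g κ n k) (x : ℝ) : |vr κ a k b n x| ≤ g⁻¹ + n * (4 * g⁻¹ ^ 3) := by
  unfold vr
  refine (abs_add_le _ _).trans (add_le_add ?_ (B.abs_DD_le' x))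
  rw [abs_neg, abs_mul, abs_of_pos B.κpos]
  exact (mul_le_of_le_one_right B.κpos.le (abs_tanh_lt _).le).trans B.inv

theorem hasDeriv_PP (B : Box g κ n k) (x : ℝ) :
    HasDerivAt (PP κ k b n) (DD κ k b n x * PP κ k b n x) x := by
  have := HasDerivAt.fun_finsetProd (u := Finset.range n) (f := fun j x => hh κ (k j) (x - b j))
    (x := x) fun j _ => hasDeriv_hh κ (k j) (b j) x
  refine this.congr_deriv ?_
  unfold DD PP
  rw [Finset.sum_mul]
  refine Finset.sum_congr rfl fun j hj => ?_
  have := (hh_pos (B.kpos (Finset.mem_range.1 hj)).le (B.klt (Finset.mem_range.1 hj)) (x - b j)).ne'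
  rw [← Finset.mul_prod_erase _ _ hj, smul_eq_mul]
  unfold dd
  field_simp

theorem PP_bounds (B : Box g κ n k) (x : ℝ) : g ^ n ≤ PP κ k b n x ∧ PP κ k b n x ≤ (2 * g⁻¹) ^ n := by
  have g0 := B.pos
  have lo : ∀ j ∈ Finset.range n, g ≤ hh κ (k j) (x - b j) := fun j hj => by
    have h1 := (abs_lt.1 (abs_tanh_lt (k j * (x - b j)))).2
    have h2 := B.kpos (Finset.mem_range.1 hj)
    have h3 := B.hi j (Finset.mem_range.1 hj)
    unfold hh
    nlinarith
  have hi : ∀ j ∈ Finset.range n, hh κ (k j) (x - b j) ≤ 2 * g⁻¹ := fun j hj => by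
    have h1 := (abs_lt.1 (abs_tanh_lt (k j * (x - b j)))).1
    have h2 := B.kpos (Finset.mem_range.1 hj)
    have h3 := B.hi j (Finset.mem_range.1 hj)
    have h4 := B.inv
    unfold hh
    nlinarith
  constructor
  · simpa [PP] using Finset.prod_le_prod (s := Finset.range n) (f := fun _ => g) (fun _ _ => g0.le) lo
  · simpa [PP] using Finset.prod_le_prod (s := Finset.range n) (g := fun _ => 2 * g⁻¹)
      (fun j hj => g0.le.trans (lo j hj)) hi

end Box

end KdV

namespace KdV

open Set
set_option linter.unusedSimpArgs false

/-- Separation of the positions. -/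
structure Sep (a L : ℝ) (n : ℕ) (b : ℕ → ℝ) : Prop where
  top : ∀ j < n, b j + L ≤ a
  pair : ∀ i < n, ∀ j < n, i ≠ j → L ≤ |b i - b j|

theorem sum_sq_exp_le {g : ℝ} (hg : 0 < g) (n : ℕ) (b : ℕ → ℝ) :
    SqI (fun x => ∑ j ∈ Finset.range n, exp (-(g * |x - b j|))) ∧
      ∫ x, (∑ j ∈ Finset.range n, exp (-(g * |x - b j|))) ^ 2 ≤ n ^ 2 * g⁻¹ := by
  have h0 : SqI (fun x => ∑ j ∈ Finset.range n, exp (-(g * |x - b j|))) :=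
    SqI.sum _ _ fun j _ => SqI.exp_abs hg (b j)
  refine ⟨h0, ?_⟩
  have h1 : ∀ j, Integrable fun x => exp (-(g * |x - b j|)) ^ 2 := fun j => (SqI.exp_abs hg (b j)).2
  calc _ ≤ ∫ x, n * ∑ j ∈ Finset.range n, exp (-(g * |x - b j|)) ^ 2 := by
        refine integral_mono h0.2 ((integrable_finsetSum _ fun j _ => h1 j).const_mul _) fun x => ?_
        simpa using sq_sum_le_card_mul_sum_sq (s := Finset.range n)
          (f := fun j => exp (-(g * |x - b j|)))
    _ = _ := by
        rw [integral_const_mul, integral_finsetSum _ fun j _ => h1 j]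
        simp only [int_exp_abs_sq hg, Finset.sum_const, Finset.card_range, nsmul_eq_mul]
        ring

namespace Box

variable {g κ a L : ℝ} {n : ℕ} {k b : ℕ → ℝ}

theorem RR_le (B : Box g κ n k) (hS : Sep a L n b) (x : ℝ) :
    |RR κ a k b n x| ≤ (n * (4 * g⁻¹ ^ 3) ^ 2 + 16 * g⁻¹ ^ 4) * exp (-(g * L)) *
      ∑ j ∈ Finset.range n, exp (-(g * |x - b j|)) := by
  have g0 := B.pos
  have e1 : RR κ a k b n x = ∑ j ∈ Finset.range n, (dd κ (k j) (x - b j) *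
      (∑ i ∈ (Finset.range n).erase j, dd κ (k i) (x - b i)) -
      2 * κ * (1 + tanh (κ * (x - a))) * dd κ (k j) (x - b j)) := by
    unfold RR
    rw [Finset.sum_sub_distrib, ← Finset.mul_sum]
    congr 1
    rw [sq]
    nth_rewrite 1 [DD]
    rw [Finset.sum_mul, ← Finset.sum_sub_distrib]
    refine Finset.sum_congr rfl fun j hj => ?_
    rw [DD, ← Finset.add_sum_erase _ _ hj]
    ring
  rw [e1, Finset.mul_sum]
  refine (Finset.abs_sum_le_sum_abs _ _).trans (Finset.sum_le_sum fun j hj => ?_)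
  have hj' := Finset.mem_range.1 hj
  have d1 : |∑ i ∈ (Finset.range n).erase j, dd κ (k i) (x - b i)| * exp (-(2 * g * |x - b j|)) ≤
      n * (4 * g⁻¹ ^ 3) * (exp (-(g * L)) * exp (-(g * |x - b j|))) := by
    refine (mul_le_mul_of_nonneg_right (Finset.abs_sum_le_sum_abs _ _) (exp_nonneg _)).trans ?_
    rw [Finset.sum_mul]
    refine (Finset.sum_le_card_nsmul _ _
      (4 * g⁻¹ ^ 3 * (exp (-(g * L)) * exp (-(g * |x - b j|)))) fun i hi => ?_).trans ?_
    · have hi' := Finset.mem_range.1 (Finset.mem_of_mem_erase hi)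
      refine (mul_le_mul_of_nonneg_right (B.abs_dd hi' _) (exp_nonneg _)).trans ?_
      rw [mul_assoc, ← exp_add, ← exp_add]
      refine mul_le_mul_of_nonneg_left (exp_le_exp.2 ?_) (by positivity)
      have h1 := hS.pair i hi' j hj' (Finset.ne_of_mem_erase hi)
      have h2 : |b i - b j| ≤ |x - b i| + |x - b j| := by
        have := abs_sub_le (b i) x (b j)
        rwa [abs_sub_comm (b i) x] at this
      nlinarith [abs_nonneg (x - b i), mul_le_mul_of_nonneg_left (h1.trans h2) g0.le,
        mul_nonneg g0.le (abs_nonneg (x - b i))]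
    · have h1 := Finset.card_erase_le (s := Finset.range n) (a := j)
      rw [Finset.card_range] at h1
      have h2 : (((Finset.range n).erase j).card : ℝ) ≤ n := by exact_mod_cast h1
      rw [nsmul_eq_mul, mul_assoc (n : ℝ)]
      exact mul_le_mul_of_nonneg_right h2 (by positivity)
  have d2 : (1 + tanh (κ * (x - a))) * exp (-(2 * g * |x - b j|)) ≤
      2 * (exp (-(g * L)) * exp (-(g * |x - b j|))) := by
    have hb := hS.top j hj'
    rw [← exp_add]
    rcases le_total a x with h | h
    · have h1 := tanh_lt_one (κ * (x - a))
      refine mul_le_mul (by linarith) (exp_le_exp.2 ?_) (exp_nonneg _) (by norm_num)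
      have h2 : L ≤ |x - b j| := (by linarith : L ≤ x - b j).trans (le_abs_self _)
      nlinarith [mul_le_mul_of_nonneg_left h2 g0.le]
    · refine (mul_le_mul_of_nonneg_right (one_add_tanh_le _) (exp_nonneg _)).trans ?_
      rw [mul_assoc, ← exp_add]
      refine mul_le_mul_of_nonneg_left (exp_le_exp.2 ?_) (by positivity)
      have h2 : a - b j ≤ (a - x) + |x - b j| := by linarith [le_abs_self (x - b j)]
      have h3 := mul_le_mul_of_nonneg_right B.le (sub_nonneg.2 h)
      have h4 := mul_nonneg g0.le (sub_nonneg.2 h)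
      have h5 := mul_le_mul_of_nonneg_left ((by linarith : L ≤ a - b j).trans h2) g0.le
      linarith
  have d3 := B.abs_dd hj' (x - b j)
  have t0 : 0 ≤ 1 + tanh (κ * (x - a)) := by linarith [neg_one_lt_tanh (κ * (x - a))]
  refine (abs_sub _ _).trans ?_
  rw [abs_mul, abs_mul, abs_of_nonneg (mul_nonneg (by linarith [B.κpos]) t0)]
  generalize exp (-(g * L)) = E1 at *
  calc _ ≤ 4 * g⁻¹ ^ 3 * exp (-(2 * g * |x - b j|)) *
        |∑ i ∈ (Finset.range n).erase j, dd κ (k i) (x - b i)| +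
        2 * g⁻¹ * (1 + tanh (κ * (x - a))) * (4 * g⁻¹ ^ 3 * exp (-(2 * g * |x - b j|))) := by
        have := B.inv
        gcongr
    _ = 4 * g⁻¹ ^ 3 * (|∑ i ∈ (Finset.range n).erase j, dd κ (k i) (x - b i)| *
        exp (-(2 * g * |x - b j|))) +
        8 * g⁻¹ ^ 4 * ((1 + tanh (κ * (x - a))) * exp (-(2 * g * |x - b j|))) := by ring
    _ ≤ 4 * g⁻¹ ^ 3 * (n * (4 * g⁻¹ ^ 3) * (E1 * exp (-(g * |x - b j|)))) +
        8 * g⁻¹ ^ 4 * (2 * (E1 * exp (-(g * |x - b j|)))) := by gcongr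
    _ = _ := by ring

theorem continuous_vr (B : Box g κ n k) : Continuous (vr κ a k b n) :=
  continuous_iff_continuousAt.2 fun x => (B.hasDeriv_vr x).continuousAt

theorem continuous_DD (B : Box g κ n k) : Continuous (DD κ k b n) :=
  continuous_iff_continuousAt.2 fun x => (B.hasDeriv_DD x).continuousAt

theorem sqI_SS (B : Box g κ n k) : SqI (SS k b n) :=
  SqI.sum _ _ fun _ hj => SqI.soliton (B.kpos (Finset.mem_range.1 hj)) _

theorem continuous_RR (B : Box g κ n k) : Continuous (RR κ a k b n) := by
  have h1 := B.continuous_DD (b := b)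
  have h2 := contDiff_tanh.continuous
  have h3 : ∀ j ∈ Finset.range n, Continuous fun x => dd κ (k j) (x - b j) := fun j hj =>
    continuous_iff_continuousAt.2 fun x => (hasDeriv_dd (B.kpos (Finset.mem_range.1 hj)).le
      (B.klt (Finset.mem_range.1 hj)) (b j) x).continuousAt
  have h4 : Continuous fun x => ∑ j ∈ Finset.range n, dd κ (k j) (x - b j) ^ 2 :=
    continuous_finsetSum _ fun j hj => (h3 j hj).pow 2
  unfold RR
  fun_prop

theorem RR_sqI (B : Box g κ n k) (hS : Sep a L n b) : SqI (RR κ a k b n) ∧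
    ∫ x, RR κ a k b n x ^ 2 ≤ (n * (4 * g⁻¹ ^ 3) ^ 2 + 16 * g⁻¹ ^ 4) ^ 2 * (n ^ 2 * g⁻¹) *
      exp (-(2 * g * L)) := by
  obtain ⟨h1, h2⟩ := sum_sq_exp_le B.pos n b
  have h3 : ∀ x, RR κ a k b n x ^ 2 ≤ ((n * (4 * g⁻¹ ^ 3) ^ 2 + 16 * g⁻¹ ^ 4) * exp (-(g * L))) ^ 2 *
      (∑ j ∈ Finset.range n, exp (-(g * |x - b j|))) ^ 2 := fun x => by
    rw [← sq_abs, ← mul_pow]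
    exact pow_le_pow_left₀ (abs_nonneg _) (B.RR_le hS x) 2
  have h4 : SqI (RR κ a k b n) := SqI.of_le B.continuous_RR h1 h3
  refine ⟨h4, (int_sq_le_of_le h4 h1 h3).trans ?_⟩
  refine (mul_le_mul_of_nonneg_left h2 (sq_nonneg _)).trans_eq ?_
  have : exp (-(g * L)) ^ 2 = exp (-(2 * g * L)) := by
    rw [← exp_nat_mul]; congr 1; push_cast; ring
  rw [mul_pow, this]
  ring

end Box

/-- Lipschitz dependence of the soliton on its parameter. -/
theorem S_lipschitz {g : ℝ} (hg : 0 < g) : ∃ C, 0 < C ∧ ∀ k k' b : ℝ, g ≤ k → k ≤ g⁻¹ → g ≤ k' →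
    k' ≤ g⁻¹ → ∫ x, (S k (x - b) - S k' (x - b)) ^ 2 ≤ C * (k - k') ^ 2 := by
  have key : ∀ k k' x : ℝ, g ≤ k → k ≤ g⁻¹ → g ≤ k' → k' ≤ g⁻¹ →
      |S k' x - S k x| ≤ 16 * (g⁻¹ + g⁻¹ ^ 3) * exp (-(g * |x|)) * |k' - k| := by
    intro k k' x h1 h2 h3 h4
    have hd : ∀ k ∈ Icc g g⁻¹, HasDerivWithinAt (fun k => S k x)
        (4 * k * (1 - tanh (k * x) ^ 2) * (k * x * tanh (k * x) - 1)) (Icc g g⁻¹) k := by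
      intro k _
      have e1 : HasDerivAt (fun k => tanh (k * x)) ((1 - tanh (k * x) ^ 2) * x) k :=
        (hasDerivAt_tanh _).comp k (((hasDerivAt_id k).mul_const x).congr_deriv (by simp))
      have e2 : HasDerivAt (fun k : ℝ => -2 * k ^ 2) (-4 * k) k :=
        (((hasDerivAt_id k).fun_pow 2).const_mul (-2)).congr_deriv (by simp; ring)
      have e3 := (e2.mul ((e1.fun_pow 2).const_sub 1)).hasDerivWithinAt (s := Icc g g⁻¹)
      exact e3.congr_deriv (by push_cast; ring)
    refine (convex_Icc g g⁻¹).norm_image_sub_le_of_norm_hasDerivWithin_le hd (fun k hk => ?_)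
      ⟨h1, h2⟩ ⟨h3, h4⟩
    have k0 : 0 < k := hg.trans_le hk.1
    have f1 := one_sub_tanh_sq_le (k * x)
    have f2 : 0 ≤ 1 - tanh (k * x) ^ 2 := (sub_pos.2 (tanh_sq_lt_one _)).le
    have f3 : exp (-(2 * |k * x|)) ≤ exp (-(2 * (g * |x|))) := by
      rw [abs_mul, abs_of_pos k0]
      apply exp_le_exp.2
      nlinarith [mul_le_mul_of_nonneg_right hk.1 (abs_nonneg x)]
    have f4 : |k * x * tanh (k * x) - 1| ≤ g⁻¹ * |x| + 1 := by
      refine (abs_sub _ _).trans ?_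
      rw [abs_one, abs_mul, abs_mul, abs_of_pos k0]
      have := mul_le_mul (mul_le_mul_of_nonneg_right hk.2 (abs_nonneg x)) (abs_tanh_lt (k * x)).le
        (abs_nonneg _) (by positivity)
      linarith
    have f5 : (g⁻¹ * |x| + 1) * exp (-(g * |x|)) ≤ g⁻¹ ^ 2 + 1 := by
      have l1 : g * |x| * exp (-(g * |x|)) ≤ 1 := by
        have := add_one_le_exp (g * |x|)
        rw [exp_neg, ← div_eq_mul_inv, div_le_one (exp_pos _)]
        linarith
      have l2 : exp (-(g * |x|)) ≤ 1 := exp_le_one_iff.2 (by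
        have := mul_nonneg hg.le (abs_nonneg x); linarith)
      have l3 := mul_le_mul_of_nonneg_left l1 (by positivity : 0 ≤ g⁻¹ ^ 2)
      have l4 : g⁻¹ ^ 2 * (g * |x| * exp (-(g * |x|))) = g⁻¹ * |x| * exp (-(g * |x|)) := by
        field_simp
      linarith
    have f6 : exp (-(2 * (g * |x|))) = exp (-(g * |x|)) * exp (-(g * |x|)) := by
      rw [← exp_add]; ring_nf
    rw [norm_eq_abs, abs_mul, abs_mul, abs_of_nonneg f2, abs_of_pos (by linarith : 0 < 4 * k)]
    calc _ ≤ 4 * g⁻¹ * (4 * (exp (-(g * |x|)) * exp (-(g * |x|)))) * (g⁻¹ * |x| + 1) := by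
          rw [f6] at f3
          have := hk.2
          gcongr
          exact f1.trans (by gcongr)
      _ = 16 * g⁻¹ * exp (-(g * |x|)) * ((g⁻¹ * |x| + 1) * exp (-(g * |x|))) := by ring
      _ ≤ 16 * g⁻¹ * exp (-(g * |x|)) * (g⁻¹ ^ 2 + 1) := by gcongr
      _ = _ := by ring
  refine ⟨(16 * (g⁻¹ + g⁻¹ ^ 3)) ^ 2 * g⁻¹, by positivity, fun k k' b h1 h2 h3 h4 => ?_⟩
  have i1 := (SqI.soliton (hg.trans_le h1) b).sub (SqI.soliton (hg.trans_le h3) b)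
  refine (int_sq_le_of_le i1 (SqI.exp_abs hg b)
    (C := (16 * (g⁻¹ + g⁻¹ ^ 3)) ^ 2 * (k - k') ^ 2) fun x => ?_).trans_eq ?_
  · rw [← sq_abs, ← sq_abs (k - k'), ← mul_pow, ← mul_pow]
    refine pow_le_pow_left₀ (abs_nonneg _) ((key k' k (x - b) h3 h4 h1 h2).trans_eq ?_) 2
    ring
  · rw [int_exp_abs_sq hg]; ring

end KdV

namespace KdV

open Set
set_option linter.unusedSimpArgs false

theorem hasDeriv_Iic {f : ℝ → ℝ} (cf : Continuous f) (hf : Integrable f) (x : ℝ) :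
    HasDerivAt (fun x => ∫ z in Iic x, f z) (f x) x := by
  have h : (fun x => ∫ z in Iic x, f z) = fun x => (∫ z in Iic 0, f z) + ∫ z in (0 : ℝ)..x, f z := by
    ext x
    rw [← intervalIntegral.integral_Iic_sub_Iic hf.integrableOn hf.integrableOn]
    ring
  rw [h]
  exact (cf.integral_hasStrictDerivAt 0 x).hasDerivAt.const_add _

/-- A positive function with exponential decay away from `a`. -/
structure Peak (Φ v : ℝ → ℝ) (a g C : ℝ) : Prop where
  gpos : 0 < g
  pos : ∀ x, 0 < Φ x
  cv : Continuous v
  deriv : ∀ x, HasDerivAt Φ (2 * v x * Φ x) x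
  right : ∀ x z, a ≤ x → x ≤ z → Φ z ≤ C * Φ x * exp (-(g * (z - x)))
  left : ∀ x z, x ≤ a → z ≤ x → Φ z ≤ C * Φ x * exp (-(g * (x - z)))
  bdd : ∀ x, |v x| ≤ C

/-- Functions controlled by `A` relative to the weight. -/
structure Adm (Φ : ℝ → ℝ) (a : ℝ) (F : ℝ → ℝ) (A : ℝ) : Prop where
  cont : Continuous F
  int : Integrable (fun x => Φ x * F x)
  left : ∀ x ≤ a, ∫ z in Iic x, |Φ z * F z| ≤ A * Φ x
  right : ∀ x, a ≤ x → ∫ z in Ioi x, |Φ z * F z| ≤ A * Φ x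

/-- The mean with respect to the weight. -/
noncomputable def mean (Φ F : ℝ → ℝ) : ℝ := (∫ z, Φ z * F z) / ∫ z, Φ z

/-- The solution operator of the linearised Riccati equation. -/
noncomputable def JJ (Φ F : ℝ → ℝ) (x : ℝ) : ℝ := (Φ x)⁻¹ * ∫ z in Iic x, Φ z * (F z - mean Φ F)

namespace Peak

variable {Φ v F G : ℝ → ℝ} {a g C A B : ℝ}

theorem cont (P : Peak Φ v a g C) : Continuous Φ :=
  continuous_iff_continuousAt.2 fun x => (P.deriv x).continuousAt

theorem Cpos (P : Peak Φ v a g C) : 0 < C := by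
  have := P.right a a le_rfl le_rfl
  simp only [sub_self, mul_zero, neg_zero, exp_zero, mul_one] at this
  have h := P.pos a
  by_contra! h'
  nlinarith

theorem intOn (P : Peak Φ v a g C) {x : ℝ} (hx : x ≤ a) : IntegrableOn Φ (Iic x) ∧
    ∫ z in Iic x, Φ z ≤ C / g * Φ x := by
  have i1 : IntegrableOn (fun z => C * Φ x * exp (-(g * x)) * exp (g * z)) (Iic x) :=
    (integrableOn_exp_mul_Iic P.gpos x).const_mul _
  have le : ∀ z ∈ Iic x, Φ z ≤ C * Φ x * exp (-(g * x)) * exp (g * z) := fun z hz => by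
    refine (P.left x z hx hz).trans_eq ?_
    rw [mul_assoc (C * Φ x), ← exp_add]; ring_nf
  have i2 : IntegrableOn Φ (Iic x) := by
    refine i1.mono' P.cont.aestronglyMeasurable ?_
    filter_upwards [self_mem_ae_restrict measurableSet_Iic] with z hz
    rw [norm_eq_abs, abs_of_pos (P.pos z)]
    exact le z hz
  refine ⟨i2, (setIntegral_mono_on i2 i1 measurableSet_Iic le).trans_eq ?_⟩
  rw [integral_const_mul, integral_exp_mul_Iic P.gpos, mul_assoc (C * Φ x), ← mul_div_assoc, ← exp_add]
  simp only [neg_add_cancel, exp_zero]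
  ring

theorem reflect (P : Peak Φ v a g C) : Peak (fun x => Φ (-x)) (fun x => -v (-x)) (-a) g C where
  gpos := P.gpos
  pos x := P.pos _
  cv := by have := P.cv; fun_prop
  deriv x := ((P.deriv (-x)).comp x (hasDerivAt_neg x)).congr_deriv (by ring)
  right x z h1 h2 := (P.left (-x) (-z) (by linarith) (by linarith)).trans_eq (by ring_nf)
  left x z h1 h2 := (P.right (-x) (-z) (by linarith) (by linarith)).trans_eq (by ring_nf)
  bdd x := by rw [abs_neg]; exact P.bdd _

theorem intOn_right (P : Peak Φ v a g C) {x : ℝ} (hx : a ≤ x) : IntegrableOn Φ (Ioi x) ∧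
    ∫ z in Ioi x, Φ z ≤ C / g * Φ x := by
  have h := P.reflect.intOn (x := -x) (by linarith)
  refine ⟨?_, ?_⟩
  · have := h.1.comp_neg_Ici
    simp only [neg_neg] at this
    exact this.mono_set Ioi_subset_Ici_self
  · have := h.2
    rwa [integral_comp_neg_Iic (-x) Φ, neg_neg] at this

theorem integrable (P : Peak Φ v a g C) : Integrable Φ := by
  rw [← integrableOn_univ, ← Iic_union_Ioi (a := a)]
  exact (P.intOn le_rfl).1.union (P.intOn_right le_rfl).1

theorem lower (P : Peak Φ v a g C) : exp (-(2 * C)) * Φ a ≤ ∫ z, Φ z := by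
  have mono : Monotone fun x => exp (2 * C * x) * Φ x := by
    refine monotone_of_hasDerivAt_nonneg (f' := fun x => exp (2 * C * x) * (2 * (C + v x) * Φ x))
      (fun x => ?_) fun x => ?_
    · have e : HasDerivAt (fun x => exp (2 * C * x)) (exp (2 * C * x) * (2 * C)) x :=
        (((hasDerivAt_id x).const_mul (2 * C)).exp).congr_deriv (by simp)
      exact (e.mul (P.deriv x)).congr_deriv (by ring)
    · have := (abs_le.1 (P.bdd x)).1
      have h2 := P.pos x
      have : 0 ≤ C + v x := by linarith
      positivity
  have h1 : ∀ z ∈ Icc a (a + 1), exp (-(2 * C)) * Φ a ≤ Φ z := fun z hz => by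
    have h2 := mono hz.1
    simp only at h2
    have h3 : exp (-(2 * C)) * exp (2 * C * z) ≤ exp (2 * C * a) := by
      rw [← exp_add]
      apply exp_le_exp.2
      nlinarith [hz.2, P.Cpos]
    have h4 : exp (-(2 * C)) * (exp (2 * C * a) * Φ a) ≤ exp (2 * C * a) * Φ z :=
      calc _ ≤ exp (-(2 * C)) * (exp (2 * C * z) * Φ z) := by gcongr
        _ = exp (-(2 * C)) * exp (2 * C * z) * Φ z := by ring
        _ ≤ _ := mul_le_mul_of_nonneg_right h3 (P.pos z).le
    have h5 := exp_pos (2 * C * a)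
    nlinarith
  have h2 : ∫ _z in a..(a + 1), exp (-(2 * C)) * Φ a ≤ ∫ z in a..(a + 1), Φ z :=
    intervalIntegral.integral_mono_on (by linarith) (by simp) (P.cont.intervalIntegrable _ _) h1
  rw [intervalIntegral.integral_const, add_sub_cancel_left, one_smul,
    intervalIntegral.integral_of_le (by linarith)] at h2
  exact h2.trans (setIntegral_le_integral P.integrable (Eventually.of_forall fun z => (P.pos z).le))

theorem adm_bdd (P : Peak Φ v a g C) (cF : Continuous F) (hF : ∀ x, |F x| ≤ B) :
    Adm Φ a F (B * (C / g)) := by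
  have hB : 0 ≤ B := (abs_nonneg _).trans (hF 0)
  have i1 : Integrable fun x => Φ x * F x := P.integrable.mul_bdd (c := B) cF.aestronglyMeasurable
    (Eventually.of_forall hF)
  have le : ∀ z, |Φ z * F z| ≤ B * Φ z := fun z => by
    rw [abs_mul, abs_of_pos (P.pos z), mul_comm]
    exact mul_le_mul_of_nonneg_right (hF z) (P.pos z).le
  refine ⟨cF, i1, fun x hx => ?_, fun x hx => ?_⟩
  · refine (setIntegral_mono i1.abs.integrableOn (P.integrable.const_mul B).integrableOn le).trans ?_
    rw [integral_const_mul, mul_assoc]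
    exact mul_le_mul_of_nonneg_left (P.intOn hx).2 hB
  · refine (setIntegral_mono i1.abs.integrableOn (P.integrable.const_mul B).integrableOn le).trans ?_
    rw [integral_const_mul, mul_assoc]
    exact mul_le_mul_of_nonneg_left (P.intOn_right hx).2 hB

theorem le_left (P : Peak Φ v a g C) {x z : ℝ} (hx : x ≤ a) (hz : z ≤ x) : Φ z ≤ C * Φ x := by
  refine (P.left x z hx hz).trans (mul_le_of_le_one_right (mul_pos P.Cpos (P.pos x)).le ?_)
  exact exp_le_one_iff.2 (by have := P.gpos; nlinarith)

theorem le_right (P : Peak Φ v a g C) {x z : ℝ} (hx : a ≤ x) (hz : x ≤ z) : Φ z ≤ C * Φ x := by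
  refine (P.right x z hx hz).trans (mul_le_of_le_one_right (mul_pos P.Cpos (P.pos x)).le ?_)
  exact exp_le_one_iff.2 (by have := P.gpos; nlinarith)

theorem le_top (P : Peak Φ v a g C) (z : ℝ) : Φ z ≤ C * Φ a := by
  rcases le_total z a with h | h
  · exact P.le_left le_rfl h
  · exact P.le_right le_rfl h

theorem sqI (P : Peak Φ v a g C) : SqI Φ := by
  refine ⟨P.cont, ?_⟩
  refine (P.integrable.mul_bdd (c := C * Φ a) P.cont.aestronglyMeasurable
    (Eventually.of_forall fun z => ?_)).congr (Eventually.of_forall fun z => (sq (Φ z)).symm)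
  rw [norm_eq_abs, abs_of_pos (P.pos z)]
  exact P.le_top z

theorem adm_sqI (P : Peak Φ v a g C) (hG : SqI G) {ε : ℝ} (hε : 0 < ε) (h : ∫ x, G x ^ 2 ≤ ε ^ 2) :
    Adm Φ a G ((C ^ 2 / g + 1) * ε) := by
  have i1 : Integrable fun x => Φ x * G x := P.sqI.mul_int hG
  have key : ∀ (s : Set ℝ) (x : ℝ), MeasurableSet s → (∀ z ∈ s, Φ z ≤ C * Φ x) →
      IntegrableOn Φ s → ∫ z in s, Φ z ≤ C / g * Φ x →
      ∫ z in s, |Φ z * G z| ≤ (C ^ 2 / g + 1) * ε * Φ x := by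
    intro s x hs hz i2 hi
    have hx := P.pos x
    have p1 : ∀ z ∈ s, |Φ z * G z| ≤ ε * C * Φ z + Φ x / ε * G z ^ 2 := fun z hz' => by
      have e1 : 2 * |Φ z * G z| ≤ ε / Φ x * Φ z ^ 2 + Φ x / ε * G z ^ 2 := by
        rw [abs_mul, ← sq_abs (Φ z), ← sq_abs (G z)]
        have : ε / Φ x * |Φ z| ^ 2 + Φ x / ε * |G z| ^ 2 - 2 * (|Φ z| * |G z|) =
          (ε * |Φ z| - Φ x * |G z|) ^ 2 / (ε * Φ x) := by field_simp; ring
        have := div_nonneg (sq_nonneg (ε * |Φ z| - Φ x * |G z|)) (mul_pos hε hx).le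
        linarith
      have e2 : ε / Φ x * Φ z ^ 2 ≤ ε * C * Φ z := by
        have := mul_le_mul_of_nonneg_left (mul_le_mul_of_nonneg_right (hz z hz') (P.pos z).le)
          (div_pos hε hx).le
        calc _ = ε / Φ x * (Φ z * Φ z) := by ring
          _ ≤ _ := this
          _ = _ := by field_simp
      have e3 : 0 ≤ Φ x / ε * G z ^ 2 := by positivity
      have e4 : 0 ≤ ε * C * Φ z := by have := P.pos z; have := P.Cpos; positivity
      linarith
    have i3 : IntegrableOn (fun z => ε * C * Φ z) s := i2.const_mul _
    have i4 : IntegrableOn (fun z => Φ x / ε * G z ^ 2) s := (hG.2.const_mul _).integrableOn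
    have i5 : IntegrableOn (fun z => ε * C * Φ z + Φ x / ε * G z ^ 2) s := i3.add i4
    refine (setIntegral_mono_on i1.abs.integrableOn i5 hs p1).trans ?_
    rw [integral_add i3 i4, integral_const_mul, integral_const_mul]
    have q1 : ∫ z in s, G z ^ 2 ≤ ε ^ 2 := (setInt_sq_le hG.2 s).trans h
    calc _ ≤ ε * C * (C / g * Φ x) + Φ x / ε * ε ^ 2 := by
          have := P.Cpos
          gcongr
      _ = _ := by field_simp
  exact ⟨hG.1, i1, fun x hx => key _ x measurableSet_Iic (fun z hz => P.le_left hx hz)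
    (P.intOn hx).1 (P.intOn hx).2, fun x hx => key _ x measurableSet_Ioi
    (fun z hz => P.le_right hx (mem_Ioi.1 hz).le) (P.intOn_right hx).1 (P.intOn_right hx).2⟩

theorem Iic_add_Ioi {f : ℝ → ℝ} (hf : Integrable f) (x : ℝ) :
    (∫ z in Iic x, f z) + ∫ z in Ioi x, f z = ∫ z, f z := by
  have := integral_add_compl (measurableSet_Iic (a := x)) hf
  rwa [compl_Iic] at this

theorem mean_le (P : Peak Φ v a g C) (hF : Adm Φ a F A) : |mean Φ F| ≤ 2 * exp (2 * C) * A := by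
  have h1 : |∫ z, Φ z * F z| ≤ 2 * A * Φ a := by
    refine (abs_integral_le_integral_abs).trans ?_
    rw [← Iic_add_Ioi hF.int.abs a]
    linarith [hF.left a le_rfl, hF.right a le_rfl]
  have h2 := P.lower
  have h3 : 0 < exp (-(2 * C)) * Φ a := mul_pos (exp_pos _) (P.pos a)
  unfold mean
  rw [abs_div, abs_of_pos (h3.trans_le h2), div_le_iff₀ (h3.trans_le h2)]
  have hA : 0 ≤ A := by
    have := (integral_nonneg fun z => abs_nonneg (Φ z * F z)).trans (hF.left a le_rfl)
    exact nonneg_of_mul_nonneg_left this (P.pos a)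
  calc _ ≤ 2 * A * Φ a := h1
    _ = 2 * exp (2 * C) * A * (exp (-(2 * C)) * Φ a) := by rw [exp_neg]; field_simp
    _ ≤ _ := by gcongr

end Peak

theorem Adm.sub {Φ F G : ℝ → ℝ} {a A B : ℝ} (hF : Adm Φ a F A) (hG : Adm Φ a G B) :
    Adm Φ a (fun x => F x - G x) (A + B) := by
  have e : (fun x => Φ x * (F x - G x)) = fun x => Φ x * F x - Φ x * G x := by ext; ring
  have i : Integrable fun x => Φ x * (F x - G x) := by rw [e]; exact hF.int.sub hG.int
  have le : ∀ x, |Φ x * (F x - G x)| ≤ |Φ x * F x| + |Φ x * G x| := fun x => by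
    rw [mul_sub]; exact abs_sub _ _
  have key : ∀ s : Set ℝ, ∫ x in s, |Φ x * (F x - G x)| ≤
      (∫ x in s, |Φ x * F x|) + ∫ x in s, |Φ x * G x| := fun s => by
    rw [← integral_add hF.int.abs.integrableOn hG.int.abs.integrableOn]
    exact setIntegral_mono i.abs.integrableOn (hF.int.abs.add hG.int.abs).integrableOn le
  refine ⟨hF.cont.sub hG.cont, i, fun x hx => (key _).trans ?_, fun x hx => (key _).trans ?_⟩
  · linarith [hF.left x hx, hG.left x hx]
  · linarith [hF.right x hx, hG.right x hx]

end KdV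

namespace KdV

open Set
set_option linter.unusedSimpArgs false

namespace Peak

variable {Φ v F G : ℝ → ℝ} {a g C A B : ℝ}

theorem adm_centered (P : Peak Φ v a g C) (hF : Adm Φ a F A) :
    Adm Φ a (fun x => F x - mean Φ F) (A + 2 * exp (2 * C) * A * (C / g)) :=
  hF.sub (P.adm_bdd continuous_const fun _ => P.mean_le hF)

theorem int_centered (P : Peak Φ v a g C) (hF : Adm Φ a F A) :
    ∫ z, Φ z * (F z - mean Φ F) = 0 := by
  have h3 : 0 < ∫ z, Φ z := (mul_pos (exp_pos _) (P.pos a)).trans_le P.lower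
  have e : (fun z => Φ z * (F z - mean Φ F)) = fun z => Φ z * F z - mean Φ F * Φ z := by ext; ring
  rw [e, integral_sub hF.int (P.integrable.const_mul _), integral_const_mul, mean]
  field_simp
  ring

theorem hasDeriv_JJ (P : Peak Φ v a g C) (hF : Adm Φ a F A) (x : ℝ) :
    HasDerivAt (JJ Φ F) (-2 * v x * JJ Φ F x + F x - mean Φ F) x := by
  have hc := P.adm_centered hF
  have h1 : HasDerivAt (fun x => ∫ z in Iic x, Φ z * (F z - mean Φ F)) (Φ x * (F x - mean Φ F)) x :=
    hasDeriv_Iic (P.cont.mul hc.cont) hc.int x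
  have hx := (P.pos x).ne'
  refine (((P.deriv x).fun_inv hx).mul h1).congr_deriv ?_
  simp only [JJ]
  field_simp
  ring

theorem JJ_le (P : Peak Φ v a g C) (hF : Adm Φ a F A) (x : ℝ) :
    |JJ Φ F x| ≤ (1 + 2 * exp (2 * C) * (C / g)) * A := by
  have hc := P.adm_centered hF
  have hx := P.pos x
  have key : |∫ z in Iic x, Φ z * (F z - mean Φ F)| ≤
      (A + 2 * exp (2 * C) * A * (C / g)) * Φ x := by
    rcases le_total x a with h | h
    · exact abs_integral_le_integral_abs.trans (hc.left x h)
    · have := Iic_add_Ioi hc.int x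
      rw [P.int_centered hF] at this
      rw [eq_neg_of_add_eq_zero_left this, abs_neg]
      exact abs_integral_le_integral_abs.trans (hc.right x h)
  unfold JJ
  rw [abs_mul, abs_inv, abs_of_pos hx, inv_mul_le_iff₀ hx]
  refine key.trans_eq ?_
  ring

theorem JJ_sub (P : Peak Φ v a g C) (hF : Adm Φ a F A) (hG : Adm Φ a G B) (x : ℝ) :
    JJ Φ F x - JJ Φ G x = JJ Φ (fun x => F x - G x) x := by
  have h1 := (P.adm_centered hF).int.integrableOn (s := Iic x)
  have h2 := (P.adm_centered hG).int.integrableOn (s := Iic x)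
  have e : mean Φ (fun x => F x - G x) = mean Φ F - mean Φ G := by
    have : (fun z => Φ z * (F z - G z)) = fun z => Φ z * F z - Φ z * G z := by ext; ring
    simp only [mean]
    rw [this, integral_sub hF.int hG.int]
    ring
  unfold JJ
  rw [e, ← mul_sub, ← integral_sub h1 h2]
  congr 1
  refine integral_congr_ae (Eventually.of_forall fun z => ?_)
  simp only []
  ring

end Peak

/-- A truncated square. -/
noncomputable def trsq (ρ y : ℝ) : ℝ := min |y| ρ ^ 2

theorem trsq_sub_le {ρ : ℝ} (hρ : 0 ≤ ρ) (y z : ℝ) : |trsq ρ y - trsq ρ z| ≤ 2 * ρ * |y - z| := by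
  have h1 : |min |y| ρ - min |z| ρ| ≤ |y - z| :=
    (abs_min_sub_min_le_max _ _ _ _).trans (by
      rw [sub_self, abs_zero, max_eq_left (abs_nonneg _)]; exact abs_abs_sub_abs_le _ _)
  have h2 : |min |y| ρ + min |z| ρ| ≤ 2 * ρ := by
    rw [abs_of_nonneg (by positivity)]
    linarith [min_le_right |y| ρ, min_le_right |z| ρ]
  unfold trsq
  rw [sq_sub_sq, abs_mul]
  exact mul_le_mul h2 h1 (abs_nonneg _) (by positivity)

theorem continuous_trsq (ρ : ℝ) : Continuous (trsq ρ) := by unfold trsq; fun_prop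

open BoundedContinuousFunction in
/-- Solvability of a perturbed Riccati equation with a Lagrange multiplier. -/
theorem riccati_fixed {g C : ℝ} (hg : 0 < g) (hC : 0 < C) : ∃ K ε₀ : ℝ, 0 < K ∧ 0 < ε₀ ∧
    ∀ (Φ v G : ℝ → ℝ) (a ε : ℝ), Peak Φ v a g C → SqI G → 0 < ε → ε ≤ ε₀ → ∫ x, G x ^ 2 ≤ ε ^ 2 →
      ∃ (y : ℝ → ℝ) (μ : ℝ), (∀ x, HasDerivAt y (-2 * v x * y x + G x + μ - y x ^ 2) x) ∧
        (∀ x, |y x| ≤ K * ε) ∧ |μ| ≤ K * ε := by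
  obtain ⟨K1, hK1, hK1'⟩ : ∃ K1, 1 ≤ K1 ∧ K1 = 1 + 2 * exp (2 * C) * (C / g) :=
    ⟨_, by simp; positivity, rfl⟩
  obtain ⟨K2, hK2, hK2'⟩ : ∃ K2, 0 < K2 ∧ K2 = C / g := ⟨_, by positivity, rfl⟩
  obtain ⟨K3, hK3, hK3'⟩ : ∃ K3, 0 < K3 ∧ K3 = C ^ 2 / g + 1 := ⟨_, by positivity, rfl⟩
  obtain ⟨ρ, hρ, hρ'⟩ : ∃ ρ, 0 < ρ ∧ K1 * (2 * ρ * K2) = 1 / 2 :=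
    ⟨1 / (4 * K1 * K2), by positivity, by field_simp; norm_num⟩
  refine ⟨2 * K1 * K3 + 2 * exp (2 * C) * (K3 + ρ * (2 * K1 * K3) * K2), ρ / (2 * K1 * K3), by positivity,
    by positivity, fun Φ v G a ε P hG hε hε₀ hi => ?_⟩
  have aG : Adm Φ a G (K3 * ε) := hK3' ▸ P.adm_sqI hG hε hi
  have trle : ∀ y, |trsq ρ y| ≤ ρ * |y| := fun y => by
    have h0 : 0 ≤ min |y| ρ := by positivity
    unfold trsq
    rw [abs_of_nonneg (sq_nonneg _), sq]
    exact mul_le_mul (min_le_right _ _) (min_le_left _ _) h0 hρ.le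
  have aq : ∀ y : ℝ →ᵇ ℝ, Adm Φ a (fun x => trsq ρ (y x)) (ρ * ‖y‖ * K2) := fun y => by
    rw [hK2']
    refine P.adm_bdd ((continuous_trsq ρ).comp y.continuous) fun x => (trle _).trans ?_
    exact mul_le_mul_of_nonneg_left (y.norm_coe_le_norm x) hρ.le
  have aF := fun y : ℝ →ᵇ ℝ => aG.sub (aq y)
  have JD := fun (y : ℝ →ᵇ ℝ) x => P.hasDeriv_JJ (aF y) x
  have JL := fun (y : ℝ →ᵇ ℝ) x => P.JJ_le (aF y) x
  let T : (ℝ →ᵇ ℝ) → (ℝ →ᵇ ℝ) := fun y =>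
    ofNormedAddCommGroup (JJ Φ fun x => G x - trsq ρ (y x))
      (continuous_iff_continuousAt.2 fun x => (JD y x).continuousAt) _ (JL y)
  have hT : ∀ y x, T y x = JJ Φ (fun x => G x - trsq ρ (y x)) x := fun _ _ => rfl
  have lip : ∀ y z, dist (T y) (T z) ≤ 1 / 2 * dist y z := fun y z => by
    refine (dist_le (by positivity)).2 fun x => ?_
    have e : (fun x => (G x - trsq ρ (y x)) - (G x - trsq ρ (z x))) =
      fun x => trsq ρ (z x) - trsq ρ (y x) := by ext; ring
    have ad : Adm Φ a (fun x => trsq ρ (z x) - trsq ρ (y x)) (2 * ρ * dist y z * K2) := by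
      rw [hK2']
      refine P.adm_bdd ?_ fun x => (trsq_sub_le hρ.le _ _).trans ?_
      · exact ((continuous_trsq ρ).comp z.continuous).sub ((continuous_trsq ρ).comp y.continuous)
      · have h := dist_coe_le_dist (f := y) (g := z) x
        rw [Real.dist_eq, abs_sub_comm] at h
        exact mul_le_mul_of_nonneg_left h (by positivity)
    rw [Real.dist_eq, hT, hT, P.JJ_sub (aF y) (aF z), e]
    refine (P.JJ_le ad x).trans_eq ?_
    rw [← hK1', show K1 * (2 * ρ * dist y z * K2) = K1 * (2 * ρ * K2) * dist y z by ring, hρ']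
  have con : ContractingWith (1 / 2) T :=
    ⟨by norm_num, LipschitzWith.of_dist_le_mul fun y z => by simpa using lip y z⟩
  obtain ⟨y, hy⟩ : ∃ y, T y = y := ⟨_, con.fixedPoint_isFixedPt⟩
  have hyx : ∀ x, y x = JJ Φ (fun x => G x - trsq ρ (y x)) x := fun x => by rw [← hT, hy]
  have ny : ‖y‖ ≤ 2 * K1 * K3 * ε := by
    have h1 : ‖y‖ ≤ K1 * (K3 * ε + ρ * ‖y‖ * K2) := by
      refine (norm_le (by positivity)).2 fun x => ?_
      rw [hyx, hK1']
      exact JL y x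
    have h2 : K1 * (K3 * ε + ρ * ‖y‖ * K2) = K1 * K3 * ε + K1 * (2 * ρ * K2) * (‖y‖ / 2) := by ring
    rw [h2, hρ'] at h1
    have := norm_nonneg y
    have : 0 < K1 * K3 * ε := by positivity
    linarith
  have ny' : ‖y‖ ≤ ρ := by
    refine ny.trans ?_
    rw [le_div_iff₀ (by positivity)] at hε₀
    linarith
  have htr : ∀ x, trsq ρ (y x) = y x ^ 2 := fun x => by
    have := (y.norm_coe_le_norm x).trans ny'
    rw [norm_eq_abs] at this
    rw [trsq, min_eq_left this, sq_abs]
  refine ⟨y, -mean Φ (fun x => G x - trsq ρ (y x)), fun x => ?_, fun x => ?_, ?_⟩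
  · have h := JD y x
    have e : (JJ Φ fun x => G x - trsq ρ (y x)) = y := funext fun x => (hyx x).symm
    rw [e] at h
    exact h.congr_deriv (by rw [htr]; ring)
  · refine (y.norm_coe_le_norm x).trans (ny.trans ?_)
    have : 0 ≤ 2 * exp (2 * C) * (K3 + ρ * (2 * K1 * K3) * K2) * ε := by positivity
    linarith
  · rw [abs_neg]
    refine (P.mean_le (aF y)).trans ?_
    have : ρ * ‖y‖ * K2 ≤ ρ * (2 * K1 * K3 * ε) * K2 := by gcongr
    have h2 := mul_le_mul_of_nonneg_left this (by positivity : 0 ≤ 2 * exp (2 * C))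
    have : 0 ≤ 2 * K1 * K3 * ε := by positivity
    linarith

end KdV

namespace KdV

open Set
set_option linter.unusedSimpArgs false

namespace Box

variable {g κ κ' a L : ℝ} {n : ℕ} {k b : ℕ → ℝ}

theorem mono {g' : ℝ} (B : Box g κ n k) (h0 : 0 < g') (h : g' ≤ g) : Box g' κ n k where
  pos := h0
  le := h.trans B.le
  inv := B.inv.trans (inv_anti₀ h0 h)
  lo j hj := h.trans (B.lo j hj)
  hi j hj := (by linarith : k j + g' ≤ k j + g).trans (B.hi j hj)

theorem perturb (B : Box g κ n k) (h : |κ' - κ| ≤ g / 2) : Box (g / 2) κ' n k := by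
  have h0 := B.pos
  obtain ⟨h1, h2⟩ := abs_le.1 h
  have h3 : g ≤ g⁻¹ := B.le.trans B.inv
  refine ⟨by linarith, by linarith [B.le], ?_, fun j hj => by linarith [B.lo j hj],
    fun j hj => by linarith [B.hi j hj]⟩
  rw [inv_div, div_eq_mul_inv]
  linarith [B.inv]

/-- The weight adapted to the right of the main soliton. -/
theorem right_weight (B : Box g κ n k) : ∃ H : ℝ → ℝ,
    (∀ x, HasDerivAt H (-(κ + vr κ a k b n x) * H x) x) ∧ (∀ x, 0 < H x) ∧
      ∀ x, a ≤ x → (g / 2) ^ n ≤ H x ∧ H x ≤ 2 * g⁻¹ ^ n := by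
  have g0 := B.pos
  have hP : ∀ x, 0 < PP κ k b n x := fun x => (by positivity : 0 < g ^ n).trans_le (B.PP_bounds x).1
  refine ⟨fun x => (1 + exp (-(2 * (κ * (x - a))))) / PP κ k b n x, fun x => ?_,
    fun x => div_pos (by positivity) (hP x), fun x hx => ?_⟩
  · have e1 : HasDerivAt (fun x => 1 + exp (-(2 * (κ * (x - a)))))
        (-(2 * κ) * exp (-(2 * (κ * (x - a))))) x :=
      (((((((hasDerivAt_id x).sub_const a).const_mul κ).const_mul 2).fun_neg).exp).const_add 1).congr_deriv
        (by simp; ring)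
    refine (e1.fun_div (B.hasDeriv_PP x) (hP x).ne').congr_deriv ?_
    have h := one_sub_tanh (κ * (x - a))
    have h2 : 0 < 1 + exp (-(2 * (κ * (x - a)))) := by positivity
    rw [eq_div_iff h2.ne'] at h
    have hp := (hP x).ne'
    unfold vr
    beta_reduce
    generalize exp (-(2 * (κ * (x - a)))) = E at *
    generalize tanh (κ * (x - a)) = T at *
    field_simp
    linear_combination κ * h
  · obtain ⟨h1, h2⟩ := B.PP_bounds (b := b) x
    have h3 : exp (-(2 * (κ * (x - a)))) ≤ 1 := exp_le_one_iff.2 (by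
      have := mul_nonneg B.κpos.le (sub_nonneg.2 hx); linarith)
    have h4 := exp_pos (-(2 * (κ * (x - a))))
    constructor
    · rw [le_div_iff₀ (hP x)]
      calc (g / 2) ^ n * PP κ k b n x ≤ (g / 2) ^ n * (2 * g⁻¹) ^ n := by gcongr
        _ = 1 := by rw [← mul_pow]; field_simp; simp
        _ ≤ _ := by linarith
    · rw [div_le_iff₀ (hP x)]
      calc _ ≤ (2 : ℝ) := by linarith
        _ = 2 * g⁻¹ ^ n * g ^ n := by rw [mul_assoc, ← mul_pow, inv_mul_cancel₀ g0.ne', one_pow, mul_one]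
        _ ≤ _ := by gcongr

/-- The weight adapted to the left of the main soliton. -/
theorem left_weight (B : Box g κ n k) : ∃ H : ℝ → ℝ,
    (∀ x, HasDerivAt H ((κ - vr κ a k b n x) * H x) x) ∧ (∀ x, 0 < H x) ∧
      ∀ x ≤ a, (g / 2) ^ n ≤ H x ∧ H x ≤ 2 * g⁻¹ ^ n := by
  have g0 := B.pos
  have hP : ∀ x, 0 < PP κ k b n x := fun x => (by positivity : 0 < g ^ n).trans_le (B.PP_bounds x).1
  refine ⟨fun x => (1 + exp (2 * (κ * (x - a)))) / PP κ k b n x, fun x => ?_,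
    fun x => div_pos (by positivity) (hP x), fun x hx => ?_⟩
  · have e1 : HasDerivAt (fun x => 1 + exp (2 * (κ * (x - a))))
        ((2 * κ) * exp (2 * (κ * (x - a)))) x :=
      ((((((hasDerivAt_id x).sub_const a).const_mul κ).const_mul 2).exp).const_add 1).congr_deriv
        (by simp; ring)
    refine (e1.fun_div (B.hasDeriv_PP x) (hP x).ne').congr_deriv ?_
    have h := one_sub_tanh (-(κ * (x - a)))
    rw [tanh_neg, mul_neg, neg_neg] at h
    have h2 : 0 < 1 + exp (2 * (κ * (x - a))) := by positivity
    rw [eq_div_iff h2.ne'] at h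
    have hp := (hP x).ne'
    unfold vr
    beta_reduce
    generalize exp (2 * (κ * (x - a))) = E at *
    generalize tanh (κ * (x - a)) = T at *
    field_simp
    linear_combination (-κ) * h
  · obtain ⟨h1, h2⟩ := B.PP_bounds (b := b) x
    have h3 : exp (2 * (κ * (x - a))) ≤ 1 := exp_le_one_iff.2 (by
      have := mul_nonneg B.κpos.le (sub_nonneg.2 hx); linarith)
    have h4 := exp_pos (2 * (κ * (x - a)))
    constructor
    · rw [le_div_iff₀ (hP x)]
      calc (g / 2) ^ n * PP κ k b n x ≤ (g / 2) ^ n * (2 * g⁻¹) ^ n := by gcongr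
        _ = 1 := by rw [← mul_pow]; field_simp; simp
        _ ≤ _ := by linarith
    · rw [div_le_iff₀ (hP x)]
      calc _ ≤ (2 : ℝ) := by linarith
        _ = 2 * g⁻¹ ^ n * g ^ n := by rw [mul_assoc, ← mul_pow, inv_mul_cancel₀ g0.ne', one_pow, mul_one]
        _ ≤ _ := by gcongr

theorem exp_transport {Φ H v : ℝ → ℝ} {c : ℝ} (hΦ : ∀ x, HasDerivAt Φ (2 * v x * Φ x) x)
    (hH : ∀ x, HasDerivAt H ((c - v x) * H x) x) (x z : ℝ) :
    Φ z * H z ^ 2 = Φ x * H x ^ 2 * exp (2 * c * (z - x)) := by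
  have h : ∀ x, HasDerivAt (fun x => Φ x * H x ^ 2 * exp (-(2 * c * x))) 0 x := fun x => by
    have e : HasDerivAt (fun x => exp (-(2 * c * x))) (exp (-(2 * c * x)) * -(2 * c)) x :=
      ((((hasDerivAt_id x).const_mul (2 * c)).fun_neg).exp).congr_deriv (by simp)
    exact (((hΦ x).mul ((hH x).fun_pow 2)).mul e).congr_deriv (by simp; ring)
  have h2 := is_const_of_deriv_eq_zero (fun x => (h x).differentiableAt) (fun x => (h x).deriv) z x

  calc _ = (Φ z * H z ^ 2 * exp (-(2 * c * z))) * exp (2 * c * z) := by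
        rw [mul_assoc, ← exp_add, neg_add_cancel, exp_zero, mul_one]
    _ = _ := by rw [h2, mul_assoc, ← exp_add]; ring_nf

theorem peak (B : Box g κ n k) : ∃ Φ, Peak Φ (vr κ a k b n) a g
    ((2 * g⁻¹ ^ n / (g / 2) ^ n) ^ 2 + (g⁻¹ + n * (4 * g⁻¹ ^ 3))) := by
  have g0 := B.pos
  have hP : ∀ x, 0 < PP κ k b n x := fun x => (by positivity : 0 < g ^ n).trans_le (B.PP_bounds x).1
  have dP : ∀ x, HasDerivAt (fun x => PP κ k b n x ^ 2 * (1 - tanh (κ * (x - a)) ^ 2))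
      (2 * vr κ a k b n x * (PP κ k b n x ^ 2 * (1 - tanh (κ * (x - a)) ^ 2))) x := fun x =>
    (((B.hasDeriv_PP x).fun_pow 2).mul (((hasDeriv_tanh_mul κ a x).fun_pow 2).const_sub 1)).congr_deriv
      (by simp [vr]; ring)
  have pos : ∀ x, 0 < PP κ k b n x ^ 2 * (1 - tanh (κ * (x - a)) ^ 2) := fun x =>
    mul_pos (pow_pos (hP x) 2) (sub_pos.2 (tanh_sq_lt_one _))
  obtain ⟨H, dH, _, bH⟩ := B.right_weight (a := a) (b := b)
  obtain ⟨H', dH', _, bH'⟩ := B.left_weight (a := a) (b := b)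
  set Φ := fun x => PP κ k b n x ^ 2 * (1 - tanh (κ * (x - a)) ^ 2) with hΦ
  have w0 : 0 < (g / 2) ^ n := by positivity
  have C0 : 0 ≤ g⁻¹ + n * (4 * g⁻¹ ^ 3) := by positivity
  set w := (g / 2) ^ n
  set W := 2 * g⁻¹ ^ n
  have W0 : 0 < W := by positivity
  have key : ∀ x z d h1 h2 : ℝ, w ≤ h2 → 0 < h1 → h1 ≤ W → g * d ≤ 2 * κ * d →
      Φ z * h2 ^ 2 = Φ x * h1 ^ 2 * exp (-(2 * κ * d)) →
      Φ z ≤ ((W / w) ^ 2 + (g⁻¹ + n * (4 * g⁻¹ ^ 3))) * Φ x * exp (-(g * d)) := by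
    intro x z d h1 h2 l1 l2 l3 l4 h
    have px := pos x
    have pz := pos z
    have e1 : Φ z * w ^ 2 ≤ Φ x * W ^ 2 * exp (-(g * d)) := by
      calc Φ z * w ^ 2 ≤ Φ z * h2 ^ 2 :=
            mul_le_mul_of_nonneg_left (pow_le_pow_left₀ w0.le l1 2) pz.le
        _ = Φ x * h1 ^ 2 * exp (-(2 * κ * d)) := h
        _ ≤ Φ x * W ^ 2 * exp (-(g * d)) :=
            mul_le_mul (mul_le_mul_of_nonneg_left (pow_le_pow_left₀ l2.le l3 2) px.le)
              (exp_le_exp.2 (by linarith)) (exp_pos _).le (mul_nonneg px.le (sq_nonneg _))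
    have e2 : Φ z ≤ (W / w) ^ 2 * Φ x * exp (-(g * d)) := by
      rw [div_pow]
      rw [← le_div_iff₀ (by positivity)] at e1
      exact e1.trans_eq (by ring)
    refine e2.trans ?_
    have : 0 ≤ (g⁻¹ + n * (4 * g⁻¹ ^ 3)) * Φ x * exp (-(g * d)) :=
      mul_nonneg (mul_nonneg C0 px.le) (exp_pos _).le
    linarith
  have hg := B.le
  refine ⟨Φ, ⟨g0, pos, B.continuous_vr, dP, fun x z hx hz => ?_, fun x z hx hz => ?_, fun x =>
    (B.abs_vr_le x).trans (le_add_of_nonneg_left (sq_nonneg _))⟩⟩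
  · obtain ⟨b1, b2⟩ := bH x hx
    refine key x z (z - x) _ _ (bH z (hx.trans hz)).1 (w0.trans_le b1) b2
      (mul_le_mul_of_nonneg_right (by linarith) (by linarith)) ?_
    rw [exp_transport dP (c := -κ) (fun x => (dH x).congr_deriv (by ring)) x z]
    ring_nf
  · obtain ⟨b1, b2⟩ := bH' x hx
    refine key x z (x - z) _ _ (bH' z (hz.trans hx)).1 (w0.trans_le b1) b2
      (mul_le_mul_of_nonneg_right (by linarith) (by linarith)) ?_
    rw [exp_transport dP (c := κ) dH' x z]
    ring_nf

end Box

end KdV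

namespace KdV

open Set
set_option linter.unusedSimpArgs false

theorem SqI.comp_neg {f : ℝ → ℝ} (hf : SqI f) : SqI (fun x => -f (-x)) :=
  ⟨(hf.1.comp continuous_neg).neg, by simpa using hf.2.comp_neg⟩

theorem exp_weight_inv {H₁ H₂ u₁ u₂ : ℝ → ℝ} {w W : ℝ} {P : ℝ → Prop} (w0 : 0 < w)
    (h1 : ∀ x, HasDerivAt H₁ (u₁ x * H₁ x) x) (h2 : ∀ x, HasDerivAt H₂ (u₂ x * H₂ x) x)
    (p1 : ∀ x, 0 < H₁ x) (p2 : ∀ x, 0 < H₂ x)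
    (b1 : ∀ x, P x → w ≤ H₁ x ∧ H₁ x ≤ W) (b2 : ∀ x, P x → w ≤ H₂ x ∧ H₂ x ≤ W) :
    (∀ x, HasDerivAt (fun x => (H₁ x * H₂ x)⁻¹) (-(u₁ x + u₂ x) * (H₁ x * H₂ x)⁻¹) x) ∧
      ∀ x, P x → (W ^ 2)⁻¹ ≤ (H₁ x * H₂ x)⁻¹ ∧ (H₁ x * H₂ x)⁻¹ ≤ (w ^ 2)⁻¹ := by
  refine ⟨fun x => ?_, fun x hx => ?_⟩
  · have q1 := (p1 x).ne'
    have q2 := (p2 x).ne'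
    refine (((h1 x).mul (h2 x)).fun_inv (mul_ne_zero q1 q2)).congr_deriv ?_
    simp only [Pi.mul_apply]
    field_simp
  · obtain ⟨l1, l2⟩ := b1 x hx
    obtain ⟨l3, l4⟩ := b2 x hx
    have q1 := p1 x
    have q2 := p2 x
    constructor
    · refine inv_anti₀ (mul_pos q1 q2) ?_
      rw [sq]
      exact mul_le_mul l2 l4 q2.le (q1.le.trans l2)
    · refine inv_anti₀ (by positivity) ?_
      rw [sq]
      exact mul_le_mul l1 l3 w0.le q1.le

/-- Square integrability of bounded solutions of the linearized Riccati equation. -/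
theorem riccati_L2 {g : ℝ} (hg : 0 < g) (n : ℕ) : ∃ C, 0 < C ∧
    ∀ (κ₁ κ₂ a B : ℝ) (k b : ℕ → ℝ) (y G r : ℝ → ℝ), Box g κ₁ n k → Box g κ₂ n k → SqI G →
      Continuous r → (∀ x, |r x| ≤ g) → (∀ x, |y x| ≤ B) →
      (∀ x, HasDerivAt y (-(vr κ₁ a k b n x + vr κ₂ a k b n x + r x) * y x + G x) x) →
      SqI y ∧ ∫ x, y x ^ 2 ≤ C * ∫ x, G x ^ 2 := by
  obtain ⟨w, hw, w0⟩ : ∃ w, w = (g / 2) ^ n ∧ 0 < w := ⟨_, rfl, by positivity⟩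
  obtain ⟨W, hW, W0⟩ : ∃ W, W = 2 * g⁻¹ ^ n ∧ 0 < W := ⟨_, rfl, by positivity⟩
  refine ⟨2 * (4 * ((w ^ 2)⁻¹ / (W ^ 2)⁻¹) ^ 2 / (2 * g) ^ 2), by positivity, ?_⟩
  intro κ₁ κ₂ a B k b y G r B₁ B₂ hG cr br hB hy
  have cy : Continuous y := continuous_iff_continuousAt.2 fun x => (hy x).continuousAt
  have hc : 2 * g ≤ κ₁ + κ₂ := by linarith [B₁.le, B₂.le]
  have cv₁ := B₁.continuous_vr (a := a) (b := b)
  have cv₂ := B₂.continuous_vr (a := a) (b := b)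
  have bv : ∀ x s t, |s| ≤ κ₁ → |t| ≤ κ₂ → |vr κ₁ a k b n x + s + (vr κ₂ a k b n x + t)| ≤
      2 * (g⁻¹ + n * (4 * g⁻¹ ^ 3)) + (κ₁ + κ₂) := fun x s t hs ht => by
    have h1 := B₁.abs_vr_le (a := a) (b := b) x
    have h2 := B₂.abs_vr_le (a := a) (b := b) x
    rw [abs_le] at *
    constructor <;> linarith
  have a1 : |κ₁| ≤ κ₁ := (abs_of_pos B₁.κpos).le
  have a2 : |κ₂| ≤ κ₂ := (abs_of_pos B₂.κpos).le
  obtain ⟨R₁, dR₁, pR₁, bR₁⟩ := B₁.right_weight (a := a) (b := b)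
  obtain ⟨R₂, dR₂, pR₂, bR₂⟩ := B₂.right_weight (a := a) (b := b)
  obtain ⟨L₁, dL₁, pL₁, bL₁⟩ := B₁.left_weight (a := a) (b := b)
  obtain ⟨L₂, dL₂, pL₂, bL₂⟩ := B₂.left_weight (a := a) (b := b)
  rw [← hw, ← hW] at bR₁ bR₂ bL₁ bL₂
  obtain ⟨dR, bR⟩ := exp_weight_inv w0 dR₁ dR₂ pR₁ pR₂ bR₁ bR₂
  obtain ⟨dL, bL⟩ := exp_weight_inv w0 dL₁ dL₂ pL₁ pL₂ bL₁ bL₂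
  obtain ⟨i1, j1⟩ := expanding_half_line (y := y) (G := G) (ρ := fun x => -r x) (c := κ₁ + κ₂) (a := a)
    (h := fun x => -(vr κ₁ a k b n x + κ₁ + (vr κ₂ a k b n x + κ₂))) (B := B)
    (by linarith) (by positivity) hG cr.neg (by fun_prop)
    (fun x => (hy x).congr_deriv (by ring)) (fun x => (dR x).congr_deriv (by ring)) bR
    (fun x _ => by rw [abs_neg]; linarith [br x]) (fun x _ => by rw [abs_neg]; exact bv x _ _ a1 a2) hB
  have neg_deriv : ∀ {f : ℝ → ℝ} {f' x : ℝ}, HasDerivAt f f' (-x) →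
      HasDerivAt (fun x => f (-x)) (-f') x := fun {f f' x} h => by
    have := h.comp x (hasDerivAt_neg x)
    exact this.congr_deriv (by ring)
  obtain ⟨i2, j2⟩ := expanding_half_line (y := fun x => y (-x)) (G := fun x => -G (-x))
    (ρ := fun x => r (-x)) (c := κ₁ + κ₂) (a := -a)
    (h := fun x => vr κ₁ a k b n (-x) + -κ₁ + (vr κ₂ a k b n (-x) + -κ₂)) (B := B)
    (by linarith) (by positivity) hG.comp_neg (by fun_prop) (by fun_prop)
    (fun x => (neg_deriv (hy (-x))).congr_deriv (by ring))
    (fun x => (neg_deriv (dL (-x))).congr_deriv (by ring))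
    (fun x hx => bL (-x) (by linarith))
    (fun x _ => by linarith [br (-x)])
    (fun x _ => bv _ _ _ (by rwa [abs_neg]) (by rwa [abs_neg])) (fun x => hB _)
  have i2' : IntegrableOn (fun x => y x ^ 2) (Iic a) := by
    have := (integrableOn_Ici_iff_integrableOn_Ioi (by simp)).2 i2
    have := IntegrableOn.comp_neg_Iic (c := a) this
    simpa using this
  have i : Integrable (fun x => y x ^ 2) := by
    rw [← integrableOn_univ, ← Iic_union_Ioi (a := a)]
    exact i2'.union i1
  have e : ∫ x, y x ^ 2 = (∫ x in Iic a, y x ^ 2) + ∫ x in Ioi a, y x ^ 2 := by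
    rw [← setIntegral_union (by simp [disjoint_left]) measurableSet_Ioi i2' i1, Iic_union_Ioi,
      Measure.restrict_univ]
  rw [integral_comp_neg_Ioi (-a) (fun x => y x ^ 2), neg_neg] at j2
  refine ⟨⟨cy, i⟩, ?_⟩
  have G0 : 0 ≤ ∫ x, G x ^ 2 := integral_nonneg fun _ => sq_nonneg _
  have k1 : ∫ x in Ioi a, G x ^ 2 ≤ ∫ x, G x ^ 2 :=
    setIntegral_le_integral hG.2 (Eventually.of_forall fun _ => sq_nonneg _)
  have k2 : ∫ x in Ioi (-a), (-G (-x)) ^ 2 ≤ ∫ x, G x ^ 2 := by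
    refine (setIntegral_le_integral hG.comp_neg.2 (Eventually.of_forall fun _ => sq_nonneg _)).trans_eq ?_
    have := integral_neg_eq_self (fun x => G x ^ 2) volume
    simpa using this
  have k3 : 4 * ((w ^ 2)⁻¹ / (W ^ 2)⁻¹) ^ 2 / (κ₁ + κ₂) ^ 2 ≤
      4 * ((w ^ 2)⁻¹ / (W ^ 2)⁻¹) ^ 2 / (2 * g) ^ 2 := by gcongr
  have k4 : 0 ≤ 4 * ((w ^ 2)⁻¹ / (W ^ 2)⁻¹) ^ 2 / (κ₁ + κ₂) ^ 2 := by positivity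
  generalize 4 * ((w ^ 2)⁻¹ / (W ^ 2)⁻¹) ^ 2 / (κ₁ + κ₂) ^ 2 = A at *
  generalize 4 * ((w ^ 2)⁻¹ / (W ^ 2)⁻¹) ^ 2 / (2 * g) ^ 2 = A' at *
  rw [e]
  have m1 := mul_le_mul_of_nonneg_left k1 k4
  have m2 := mul_le_mul_of_nonneg_left k2 k4
  have m3 := mul_le_mul_of_nonneg_right k3 G0
  linarith

end KdV

namespace KdV

open Set
set_option linter.unusedSimpArgs false

/-- Square integrable, with a bound on the integral of the square over `s`. -/
structure L2le (s : Set ℝ) (f : ℝ → ℝ) (A : ℝ) : Prop where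
  sqI : SqI f
  le : ∫ x in s, f x ^ 2 ≤ A

namespace L2le

variable {s : Set ℝ} {f h : ℝ → ℝ} {A B : ℝ}

theorem univ (hf : SqI f) (h : ∫ x, f x ^ 2 ≤ A) : L2le Set.univ f A := ⟨hf, by simpa using h⟩

theorem int (hf : L2le Set.univ f A) : ∫ x, f x ^ 2 ≤ A := by simpa using hf.le

theorem nonneg (hf : L2le s f A) : 0 ≤ A := (setInt_sq_nonneg f s).trans hf.le

theorem restrict (hf : L2le Set.univ f A) : L2le s f A := ⟨hf.1, (setInt_sq_le hf.1.2 s).trans hf.int⟩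

theorem mono (hf : L2le s f A) (h : A ≤ B) : L2le s f B := ⟨hf.1, hf.2.trans h⟩

theorem congr (hf : L2le s f A) (e : ∀ x, f x = h x) : L2le s h A := by
  obtain rfl : f = h := funext e
  exact hf

theorem add (hf : L2le s f A) (hg : L2le s h B) : L2le s (fun x => f x + h x) (2 * A + 2 * B) :=
  ⟨hf.1.add hg.1, by linarith [setInt_sq_add_le hf.1 hg.1 s, hf.2, hg.2]⟩

theorem sub (hf : L2le s f A) (hg : L2le s h B) : L2le s (fun x => f x - h x) (2 * A + 2 * B) :=
  ⟨hf.1.sub hg.1, by linarith [setInt_sq_sub_le hf.1 hg.1 s, hf.2, hg.2]⟩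

theorem mul (hf : L2le s f A) (ch : Continuous h) {M : ℝ} (hs : MeasurableSet s) (bh : ∀ x, |h x| ≤ M) :
    L2le s (fun x => h x * f x) (M ^ 2 * A) := by
  refine ⟨hf.1.bdd_mul ch bh, (setInt_sq_le_of_le (hf.1.bdd_mul ch bh) hf.1 hs fun x _ => ?_).trans
    (mul_le_mul_of_nonneg_left hf.2 (sq_nonneg M))⟩
  rw [mul_pow]
  refine mul_le_mul_of_nonneg_right ?_ (sq_nonneg _)
  rw [← sq_abs]
  exact pow_le_pow_left₀ (abs_nonneg _) (bh x) 2

end L2le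

/-- Existence of a ground state near the reference one, for potentials close to a sum of solitons. -/
theorem forward_riccati {g : ℝ} (hg : 0 < g) (n : ℕ) : ∃ C D₀, 0 < C ∧ 0 < D₀ ∧
    ∀ (κ a L E : ℝ) (k b : ℕ → ℝ) (V : ℝ → ℝ), Box g κ n k → Sep a L n b → 0 ≤ L → E ≤ D₀ →
      exp (-(g * L)) ≤ E → L2le univ (fun x => V x - S κ (x - a) - SS k b n x) E →
      ∃ (κ' : ℝ) (v y : ℝ → ℝ), |κ' - κ| ≤ g / 2 ∧ (κ' - κ) ^ 2 ≤ C * E ∧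
        (∀ x, v x = vr κ a k b n x + y x) ∧ (∀ x, y x ^ 2 ≤ C * E) ∧ (∀ x, |y x| ≤ g / 2) ∧
        ∀ x, HasDerivAt v (V x + κ' ^ 2 - v x ^ 2) x := by
  obtain ⟨c, hc, c0⟩ : ∃ c : ℝ, c = (n * (4 * g⁻¹ ^ 3) ^ 2 + 16 * g⁻¹ ^ 4) ^ 2 * (n ^ 2 * g⁻¹) ∧ 0 ≤ c :=
    ⟨_, rfl, by positivity⟩
  obtain ⟨K, ε₀, K0, ε0, fixed⟩ := riccati_fixed (C := (2 * g⁻¹ ^ n / (g / 2) ^ n) ^ 2 +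
    (g⁻¹ + n * (4 * g⁻¹ ^ 3))) hg (by positivity)
  obtain ⟨ε₁, h1, h2⟩ : ∃ ε₁, 0 < ε₁ ∧ (ε₁ ≤ ε₀ ∧ K * ε₁ ≤ g / 2 ∧ K * ε₁ ≤ g ^ 2 / 2) := by
    refine ⟨min ε₀ (min (g / 2 / K) (g ^ 2 / 2 / K)), by positivity, min_le_left _ _, ?_, ?_⟩
    · rw [mul_comm, ← le_div_iff₀ K0]
      exact (min_le_right _ _).trans (min_le_left _ _)
    · rw [mul_comm, ← le_div_iff₀ K0]
      exact (min_le_right _ _).trans (min_le_right _ _)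
  obtain ⟨h2, h3, h4⟩ := h2
  refine ⟨K ^ 2 * (2 + 2 * c) * (1 + (g ^ 2)⁻¹), ε₁ ^ 2 / (2 + 2 * c), by positivity, by positivity, ?_⟩
  intro κ a L E k b V B hS hL hE hexp hV
  have E0 : 0 < E := (exp_pos _).trans_le hexp
  have hR := B.RR_sqI hS
  rw [← hc] at hR
  have hR' : L2le univ (RR κ a k b n) (c * E) := by
    refine L2le.univ hR.1 (hR.2.trans (mul_le_mul_of_nonneg_left (le_trans (exp_le_exp.2 ?_) hexp) c0))
    have := mul_nonneg hg.le hL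
    linarith
  have hG := hV.sub hR'
  obtain ⟨ε, e0, he⟩ : ∃ ε, 0 < ε ∧ ε ^ 2 = (2 + 2 * c) * E :=
    ⟨√((2 + 2 * c) * E), by positivity, sq_sqrt (by positivity)⟩
  have he1 : ε ≤ ε₁ := by
    refine (sq_le_sq₀ e0.le h1.le).1 ?_
    rw [he]
    rw [le_div_iff₀ (by positivity)] at hE
    linarith
  obtain ⟨Φ, P⟩ := B.peak (a := a) (b := b)
  obtain ⟨y, μ, dy, by', bμ⟩ := fixed _ _ _ a ε P hG.1 e0 (he1.trans h2) (hG.int.trans_eq (by rw [he]; ring))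
  have hKε : K * ε ≤ K * ε₁ := mul_le_mul_of_nonneg_left he1 K0.le
  have hμ := abs_le.1 (bμ.trans (hKε.trans h4))
  have hκ := B.le
  have hκ2 : g ^ 2 ≤ κ ^ 2 := pow_le_pow_left₀ hg.le hκ 2
  have g2 : 0 < g ^ 2 := by positivity
  obtain ⟨κ', k0, hk⟩ : ∃ κ', 0 ≤ κ' ∧ κ' ^ 2 = κ ^ 2 + μ :=
    ⟨√(κ ^ 2 + μ), sqrt_nonneg _, sq_sqrt (by linarith)⟩
  have d1 : (κ' - κ) * (κ' + κ) = μ := by linear_combination hk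
  have d2 : g * |κ' - κ| ≤ |μ| := by
    rw [← d1, abs_mul, abs_of_nonneg (by linarith : 0 ≤ κ' + κ), mul_comm]
    exact mul_le_mul_of_nonneg_left (by linarith) (abs_nonneg _)
  have hKε2 : (K * ε) ^ 2 = K ^ 2 * (2 + 2 * c) * E := by rw [mul_pow, he]; ring
  have p0 : 0 ≤ K ^ 2 * (2 + 2 * c) * E := by positivity
  refine ⟨κ', fun x => vr κ a k b n x + y x, y, ?_, ?_, fun _ => rfl, fun x => ?_, fun x =>
    (by' x).trans (hKε.trans h3), fun x => ?_⟩
  · refine le_of_mul_le_mul_left (d2.trans (bμ.trans (hKε.trans h4)) |>.trans_eq ?_) hg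
    ring
  · have : (g * |κ' - κ|) ^ 2 ≤ (K * ε) ^ 2 := pow_le_pow_left₀ (by positivity) (d2.trans bμ) 2
    rw [mul_pow, sq_abs, hKε2, mul_comm, ← le_div_iff₀ g2, div_eq_mul_inv] at this
    nlinarith
  · have : |y x| ^ 2 ≤ (K * ε) ^ 2 := pow_le_pow_left₀ (abs_nonneg _) (by' x) 2
    rw [sq_abs, hKε2] at this
    have p1 : 0 ≤ K ^ 2 * (2 + 2 * c) * E * (g ^ 2)⁻¹ := by positivity
    linarith
  · refine ((B.hasDeriv_vr x).add (dy x)).congr_deriv ?_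
    rw [hk]
    ring

/-- The Darboux transform removes the main soliton, up to an `L²` error. -/
theorem forward_L2 {g : ℝ} (hg : 0 < g) (n : ℕ) : ∃ C, 0 < C ∧
    ∀ (κ κ' a L E A : ℝ) (k b : ℕ → ℝ) (V v y : ℝ → ℝ), Box g κ n k → Sep a L n b → 0 ≤ L →
      exp (-(g * L)) ≤ E → L2le univ (fun x => V x - S κ (x - a) - SS k b n x) E →
      |κ' - κ| ≤ g / 2 → (κ' - κ) ^ 2 ≤ A * E → (∀ x, v x = vr κ a k b n x + y x) →
      (∀ x, |y x| ≤ g / 2) → (∀ x, HasDerivAt v (V x + κ' ^ 2 - v x ^ 2) x) → 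
      L2le univ (fun x => 2 * v x ^ 2 - 2 * κ' ^ 2 - V x - SS k (bs κ' k b) n x) (C * (1 + A) * E) := by
  obtain ⟨C₁, C₁0, hC₁⟩ := riccati_L2 (half_pos hg) n
  obtain ⟨C₂, C₂0, hC₂⟩ := S_lipschitz (half_pos hg)
  obtain ⟨c, hc, c0⟩ : ∃ c : ℝ, c = (n * (4 * (g / 2)⁻¹ ^ 3) ^ 2 + 16 * (g / 2)⁻¹ ^ 4) ^ 2 *
    (n ^ 2 * (g / 2)⁻¹) ∧ 0 ≤ c := ⟨_, rfl, by positivity⟩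
  obtain ⟨m, hm, m0⟩ : ∃ m : ℝ, m = (g / 2)⁻¹ + n * (4 * (g / 2)⁻¹ ^ 3) ∧ 0 ≤ m :=
    ⟨_, rfl, by positivity⟩
  obtain ⟨Q, hQ⟩ : ∃ Q, Q = 2 * (2 * (1 + C₂) + 2 * c) := ⟨_, rfl⟩
  have Q0 : 0 < Q := by rw [hQ]; positivity
  refine ⟨2 * (2 * ((2 * (m + m + g)) ^ 2 * (C₁ * Q)) + 2 * Q) + 2 * c, by positivity, ?_⟩
  intro κ κ' a L E A k b V v y B hS hL hexp hV hκ hκA hvy hy dv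
  have E0 : 0 < E := (exp_pos _).trans_le hexp
  have A0 : 0 ≤ A := nonneg_of_mul_nonneg_left ((sq_nonneg _).trans hκA) E0
  have B₁ := B.mono (half_pos hg) (by linarith)
  have B₂ := B.perturb hκ
  have hR : L2le univ (RR κ' a k b n) (c * E) := by
    have := B₂.RR_sqI hS
    rw [← hc] at this
    refine L2le.univ this.1 (this.2.trans (mul_le_mul_of_nonneg_left (le_trans (exp_le_exp.2 ?_) hexp) c0))
    linarith
  have hSd : L2le univ (fun x => S κ (x - a) - S κ' (x - a)) (C₂ * (A * E)) :=
    L2le.univ ((SqI.soliton B₁.κpos a).sub (SqI.soliton B₂.κpos a))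
      ((hC₂ κ κ' a B₁.le B₁.inv B₂.le B₂.inv).trans
        (mul_le_mul_of_nonneg_left (by linarith [sq_nonneg (κ - κ')]) C₂0.le))
  have hG : L2le univ (fun x => V x - S κ' (x - a) - SS k b n x - RR κ' a k b n x) (Q * (1 + A) * E) := by
    refine (((hV.add hSd).sub hR).congr fun x => by ring).mono ?_
    rw [hQ]
    have : 0 ≤ E * A := by positivity
    have : 0 ≤ C₂ * E := by positivity
    have : 0 ≤ c * (E * A) := by positivity
    nlinarith
  have cv₁ := B₁.continuous_vr (a := a) (b := b)
  have cv₂ := B₂.continuous_vr (a := a) (b := b)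
  have cv : Continuous v := continuous_iff_continuousAt.2 fun x => (dv x).continuousAt
  have cy : Continuous y := by
    have : y = fun x => v x - vr κ a k b n x := by ext x; rw [hvy]; ring
    rw [this]
    fun_prop
  have b₁ : ∀ x, |vr κ a k b n x| ≤ m := fun x => (B₁.abs_vr_le x).trans_eq hm.symm
  have b₂ : ∀ x, |vr κ' a k b n x| ≤ m := fun x => (B₂.abs_vr_le x).trans_eq hm.symm
  obtain ⟨s1, s2⟩ := hC₁ κ κ' a (m + m + g) k b (fun x => v x - vr κ' a k b n x) _ y B₁ B₂ hG.1 cy hy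
    (fun x => by
      simp only [hvy x]
      have h1 := abs_le.1 (b₁ x)
      have h2 := abs_le.1 (b₂ x)
      have h3 := abs_le.1 (hy x)
      rw [abs_le]
      constructor <;> linarith)
    (fun x => ((dv x).fun_sub (B₂.hasDeriv_vr x)).congr_deriv (by rw [hvy x]; ring))
  have hw : L2le univ (fun x => v x - vr κ' a k b n x) (C₁ * (Q * (1 + A) * E)) :=
    L2le.univ s1 (s2.trans (mul_le_mul_of_nonneg_left hG.int C₁0.le))
  have hw2 := hw.mul (h := fun x => 2 * (v x + vr κ' a k b n x)) (M := 2 * (m + m + g)) (by fun_prop)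
    MeasurableSet.univ (fun x => by
      simp only [hvy x]
      have h1 := abs_le.1 (b₁ x)
      have h2 := abs_le.1 (b₂ x)
      have h3 := abs_le.1 (hy x)
      rw [abs_le]
      constructor <;> linarith)
  refine (((hw2.sub hG).add hR).congr fun x => ?_).mono ?_
  · have := B₂.vr_shift (a := a) (b := b) x
    linear_combination (-1 : ℝ) * this
  · have : 0 ≤ c * (A * E) := by positivity
    nlinarith

end KdV

namespace KdV

open Set
set_option linter.unusedSimpArgs false

theorem intervalIntegral_le_Ici {f : ℝ → ℝ} (hf : Integrable (fun x => f x ^ 2)) {p q e : ℝ}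
    (hpq : p ≤ q) (he : e ≤ p) : ∫ x in p..q, f x ^ 2 ≤ ∫ x in Ici e, f x ^ 2 := by
  rw [intervalIntegral.integral_of_le hpq]
  exact setIntegral_mono_set hf.integrableOn (Eventually.of_forall fun _ => sq_nonneg _)
    (LE.le.eventuallyLE fun x hx => he.trans hx.1.le)

theorem setInt_Ici_le_of_interval {f : ℝ → ℝ} (hf : Integrable (fun x => f x ^ 2)) {e A : ℝ}
    (h : ∀ q, ∃ q', q ≤ q' ∧ ∫ x in e..q', f x ^ 2 ≤ A) : ∫ x in Ici e, f x ^ 2 ≤ A := by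
  rw [integral_Ici_eq_integral_Ioi]
  have := intervalIntegral_tendsto_integral_Ioi e hf.integrableOn tendsto_id (l := atTop)
  refine le_of_tendsto this ((eventually_ge_atTop e).mono fun q hq => ?_)
  obtain ⟨q', hq', hA⟩ := h q
  exact (intervalIntegral.integral_mono_interval le_rfl hq hq' (Eventually.of_forall fun _ => sq_nonneg _)
    hf.intervalIntegrable).trans hA

theorem L2le.of_Ici {f : ℝ → ℝ} (hf : SqI f) {A X : ℝ} (h : ∀ e ≤ X, ∫ x in Ici e, f x ^ 2 ≤ A) :
    L2le Set.univ f A := by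
  refine L2le.univ hf ?_
  have := intervalIntegral_tendsto_integral hf.2 tendsto_neg_atTop_atBot tendsto_id
  refine le_of_tendsto this ?_
  filter_upwards [eventually_ge_atTop (-X), eventually_ge_atTop 0] with q h1 h2
  exact (intervalIntegral_le_Ici hf.2 (by simp only [id]; linarith) le_rfl).trans (h (-q) (by linarith))

/-- The Riccati variable of the backward transform stays close to the reference one. -/
theorem backward_riccati {g : ℝ} (hg : 0 < g) (n : ℕ) : ∃ C D₀, 0 < C ∧ 0 < D₀ ∧
    ∀ (κ X E p q : ℝ) (k b : ℕ → ℝ) (y G : ℝ → ℝ), Box g κ n k → 0 < E → E ≤ D₀ →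
      Continuous G → p ≤ X → X ≤ q → y X ^ 2 ≤ E → ∫ x in p..X, G x ^ 2 ≤ E →
      ∫ x in X..q, G x ^ 2 ≤ E →
      (∀ x, HasDerivAt y ((2 * vr κ X k b n x + y x) * y x - G x) x) →
      (∀ x ∈ Icc p q, |y x| ≤ g⁻¹) ∧ ∫ x in p..q, y x ^ 2 ≤ C * E := by
  obtain ⟨w, hw, w0⟩ : ∃ w, w = (g / 2) ^ n ∧ 0 < w := ⟨_, rfl, by positivity⟩
  obtain ⟨W, hW, W0⟩ : ∃ W, W = 2 * g⁻¹ ^ n ∧ 0 < W := ⟨_, rfl, by positivity⟩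
  obtain ⟨P, hP, P0⟩ : ∃ P, P = (W ^ 2 / w ^ 2) ^ 2 * (1 + g⁻¹) ∧ 0 < P := ⟨_, rfl, by positivity⟩
  refine ⟨2 * (g⁻¹ * P), g ^ 2 / (P + 1), by positivity, by positivity, ?_⟩
  intro κ X E p q k b y G B E0 hE cG hp hq hyX hG1 hG2 dy
  have κ0 := B.κpos
  have hκ : κ⁻¹ ≤ g⁻¹ := inv_anti₀ hg B.le
  have bnd : ∀ I : ℝ, I ≤ E → (W ^ 2 / w ^ 2) ^ 2 * (y X ^ 2 + 2 / (2 * κ) * I) ≤ P * E := fun I hI => by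
    rw [hP, mul_assoc]
    refine mul_le_mul_of_nonneg_left ?_ (sq_nonneg _)
    have : 2 / (2 * κ) * I ≤ g⁻¹ * E := by
      have e : 2 / (2 * κ) = κ⁻¹ := by field_simp
      rw [e]
      exact (mul_le_mul_of_nonneg_left hI (by positivity)).trans (mul_le_mul_of_nonneg_right hκ E0.le)
    linarith
  have hPE : P * E < g ^ 2 := by
    rw [le_div_iff₀ (by positivity)] at hE
    linarith
  have hgκ : g ^ 2 ≤ (2 * κ / 2) ^ 2 := by
    rw [mul_div_cancel_left₀ _ (two_ne_zero)]
    exact pow_le_pow_left₀ hg.le B.le 2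
  have fin : ∀ I : ℝ, 2 * κ / 2 * I ≤ P * E → I ≤ g⁻¹ * P * E := fun I hI => by
    rw [mul_div_cancel_left₀ _ (two_ne_zero)] at hI
    have : I ≤ κ⁻¹ * (P * E) := by
      rw [inv_mul_eq_div, le_div_iff₀ κ0]
      linarith
    refine this.trans ?_
    rw [mul_assoc]
    exact mul_le_mul_of_nonneg_right hκ (by positivity)
  have sqb : ∀ H : ℝ, w ≤ H ∧ H ≤ W → w ^ 2 ≤ H ^ 2 ∧ H ^ 2 ≤ W ^ 2 := fun H h =>
    ⟨pow_le_pow_left₀ w0.le h.1 2, pow_le_pow_left₀ (w0.le.trans h.1) h.2 2⟩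
  have cv := B.continuous_vr (a := X) (b := b)
  obtain ⟨R, dR, -, bR⟩ := B.right_weight (a := X) (b := b)
  obtain ⟨H, dH, -, bH⟩ := B.left_weight (a := X) (b := b)
  rw [← hw, ← hW] at bR bH
  obtain ⟨r1, r2⟩ := damped_riccati (y := y) (G := fun x => -G x)
    (h := fun x => -(2 * (vr κ X k b n x + κ))) (H := fun x => R x ^ 2) (c := 2 * κ) (m := w ^ 2)
    (M := W ^ 2) (a := X) (e := q) (by positivity) (by positivity) cG.neg (by fun_prop)
    (fun x => (dy x).congr_deriv (by ring))
    (fun x => ((dR x).fun_pow 2).congr_deriv (by simp; ring)) (fun x hx => sqb _ (bR x hx.1))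
    (by simp only [neg_sq]; exact (bnd _ hG2).trans_lt (hPE.trans_le hgκ)) hq
  have neg_deriv : ∀ {f : ℝ → ℝ} {f' x : ℝ}, HasDerivAt f f' (-x) →
      HasDerivAt (fun x => f (-x)) (-f') x := fun {f f' x} h => by
    have := h.comp x (hasDerivAt_neg x)
    exact this.congr_deriv (by ring)
  have sub : ∀ f : ℝ → ℝ, ∫ x in -X..-p, f (-x) = ∫ x in p..X, f x := fun f => by
    rw [intervalIntegral.integral_comp_neg, neg_neg, neg_neg]
  obtain ⟨l1, l2⟩ := damped_riccati (y := fun x => -y (-x)) (G := fun x => -G (-x))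
    (h := fun x => 2 * (vr κ X k b n (-x) - κ)) (H := fun x => H (-x) ^ 2) (c := 2 * κ) (m := w ^ 2)
    (M := W ^ 2) (a := -X) (e := -p) (by positivity) (by positivity) (by fun_prop) (by fun_prop)
    (fun x => (neg_deriv (dy (-x))).fun_neg.congr_deriv (by ring))
    (fun x => ((neg_deriv (dH (-x))).fun_pow 2).congr_deriv (by simp; ring))
    (fun x hx => sqb _ (bH (-x) (by linarith [hx.1])))
    (by
      simp only [neg_sq, neg_neg]
      rw [sub (fun x => G x ^ 2)]
      exact (bnd _ hG1).trans_lt (hPE.trans_le hgκ)) (by linarith)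
  simp only [neg_sq, neg_neg, abs_neg] at r2 l1 l2
  rw [sub (fun x => G x ^ 2), sub (fun x => y x ^ 2)] at l2
  have cy : Continuous y := continuous_iff_continuousAt.2 fun x => (dy x).continuousAt
  refine ⟨fun x hx => ?_, ?_⟩
  · have hκg : 2 * κ / 2 ≤ g⁻¹ := by linarith [B.inv]
    rcases le_total X x with h | h
    · exact (r1 x ⟨h, hx.2⟩).trans hκg
    · have := l1 (-x) ⟨by linarith, by linarith [hx.1]⟩
      rw [neg_neg] at this
      exact this.trans hκg
  · have ii : ∀ p q, IntervalIntegrable (fun x => y x ^ 2) volume p q := fun p q =>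
      (cy.pow 2).intervalIntegrable _ _
    rw [← intervalIntegral.integral_add_adjacent_intervals (ii p X) (ii X q)]
    linarith [fin _ (r2.trans (bnd _ hG2)), fin _ (l2.trans (bnd _ hG1))]

/-- The backward Darboux transform adds a soliton at the zero of the Riccati variable. -/
theorem backward_L2 {g : ℝ} (hg : 0 < g) (n : ℕ) : ∃ C D₀, 0 < C ∧ 0 < D₀ ∧
    ∀ (κ X L E e : ℝ) (k b : ℕ → ℝ) (V V₁ v : ℝ → ℝ), Box g κ n k → Sep X L n b → 0 ≤ L →
      exp (-(g * L)) ≤ E → E ≤ D₀ → e ≤ X →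
      L2le (Ici e) (fun x => V₁ x - SS k (bs κ k b) n x) E →
      SqI (fun x => V x - S κ (x - X) - SS k b n x) → v X = 0 →
      (∀ x, HasDerivAt v (v x ^ 2 - κ ^ 2 - V₁ x) x) → (∀ x, V x = 2 * v x ^ 2 - 2 * κ ^ 2 - V₁ x) →
      L2le (Ici e) (fun x => V x - S κ (x - X) - SS k b n x) (C * E) := by
  obtain ⟨C₁, D₁, C₁0, D₁0, hC₁⟩ := backward_riccati hg n
  obtain ⟨c, hc, c0⟩ : ∃ c : ℝ, c = (n * (4 * g⁻¹ ^ 3) ^ 2 + 16 * g⁻¹ ^ 4) ^ 2 * (n ^ 2 * g⁻¹) ∧ 0 ≤ c :=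
    ⟨_, rfl, by positivity⟩
  obtain ⟨d, hd, d0⟩ : ∃ d : ℝ, d = n * (4 * g⁻¹ ^ 3) ∧ 0 ≤ d := ⟨_, rfl, by positivity⟩
  obtain ⟨m, hm, m0⟩ : ∃ m : ℝ, m = 2 * (2 * (g⁻¹ + d) + g⁻¹) ∧ 0 ≤ m := ⟨_, rfl, by positivity⟩
  obtain ⟨Q, hQ, Q0⟩ : ∃ Q : ℝ, Q = 2 + 2 * c + d ^ 2 ∧ 0 < Q := ⟨_, rfl, by positivity⟩
  refine ⟨3 * (m ^ 2 * (C₁ * Q) + Q + c), D₁ / Q, by positivity, by positivity, ?_⟩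
  intro κ X L E e k b V V₁ v B hS hL hexp hE he hV₁ hV hvX dv hVv
  have E0 : 0 < E := (exp_pos _).trans_le hexp
  have hR : L2le (Ici e) (RR κ X k b n) (c * E) := by
    have := B.RR_sqI hS
    rw [← hc] at this
    refine L2le.restrict (L2le.univ this.1 (this.2.trans
      (mul_le_mul_of_nonneg_left (le_trans (exp_le_exp.2 ?_) hexp) c0)))
    have := mul_nonneg hg.le hL
    linarith
  have hG := (hV₁.sub hR).mono (B := Q * E) (by
    rw [hQ]; linarith [mul_nonneg (sq_nonneg d) E0.le])
  set G := fun x => V₁ x - SS k (bs κ k b) n x - RR κ X k b n x with hGdef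
  have hQE : Q * E ≤ D₁ := by rw [le_div_iff₀ Q0] at hE; linarith
  have dy : ∀ x, HasDerivAt (fun x => v x - vr κ X k b n x)
      ((2 * vr κ X k b n x + (v x - vr κ X k b n x)) * (v x - vr κ X k b n x) - G x) x := fun x => by
    refine ((dv x).fun_sub (B.hasDeriv_vr x)).congr_deriv ?_
    have := B.vr_shift (a := X) (b := b) x
    simp only [hGdef]
    linear_combination this
  have hyX : (v X - vr κ X k b n X) ^ 2 ≤ Q * E := by
    have e1 : v X - vr κ X k b n X = -DD κ k b n X := by simp [vr, hvX]
    have e2 := B.abs_DD_le (b := b) (L := L) (x := X) fun j hj =>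
      (by linarith [hS.top j hj] : L ≤ X - b j).trans (le_abs_self _)
    rw [← hd] at e2
    have gL := mul_nonneg hg.le hL
    have e3 : exp (-(2 * g * L)) ^ 2 ≤ E := by
      rw [← exp_nat_mul]
      refine le_trans (exp_le_exp.2 ?_) hexp
      push_cast
      linarith
    rw [e1, neg_sq, ← sq_abs]
    calc |DD κ k b n X| ^ 2 ≤ (d * exp (-(2 * g * L))) ^ 2 := pow_le_pow_left₀ (abs_nonneg _) e2 2
      _ = d ^ 2 * exp (-(2 * g * L)) ^ 2 := by ring
      _ ≤ d ^ 2 * E := mul_le_mul_of_nonneg_left e3 (sq_nonneg d)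
      _ ≤ Q * E := mul_le_mul_of_nonneg_right (by rw [hQ]; linarith) E0.le
  refine ⟨hV, setInt_Ici_le_of_interval hV.2 fun q₀ => ⟨max q₀ X, le_max_left _ _, ?_⟩⟩
  have hq : X ≤ max q₀ X := le_max_right _ _
  generalize max q₀ X = q at hq
  obtain ⟨y1, y2⟩ := hC₁ κ X (Q * E) e q k b _ G B (by positivity) hQE hG.1.1 he hq hyX
    ((intervalIntegral_le_Ici hG.1.2 he le_rfl).trans hG.2)
    ((intervalIntegral_le_Ici hG.1.2 hq he).trans hG.2) dy
  have heq := he.trans hq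
  have cv : Continuous v := continuous_iff_continuousAt.2 fun x => (dv x).continuousAt
  have cvr := B.continuous_vr (a := X) (b := b)
  have cG := hG.1.1
  have cR := B.continuous_RR (a := X) (b := b)
  have cy : Continuous fun x => v x - vr κ X k b n x := cv.sub cvr
  have ii : ∀ f : ℝ → ℝ, Continuous f → IntervalIntegrable (fun x => f x ^ 2) volume e q :=
    fun f cf => (cf.pow 2).intervalIntegrable _ _
  calc ∫ x in e..q, (V x - S κ (x - X) - SS k b n x) ^ 2
      ≤ ∫ x in e..q, 3 * (m ^ 2 * (v x - vr κ X k b n x) ^ 2 + G x ^ 2 + RR κ X k b n x ^ 2) := by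
        refine intervalIntegral.integral_mono_on heq (ii _ hV.1) (Continuous.intervalIntegrable
          (by fun_prop) _ _) fun x hx => ?_
        have e1 : V x - S κ (x - X) - SS k b n x =
            2 * (2 * vr κ X k b n x + (v x - vr κ X k b n x)) * (v x - vr κ X k b n x) - G x +
              RR κ X k b n x := by
          have := B.vr_shift (a := X) (b := b) x
          rw [hVv]
          simp only [hGdef]
          linear_combination this
        have e2 : (2 * (2 * vr κ X k b n x + (v x - vr κ X k b n x))) ^ 2 ≤ m ^ 2 := by
          have h1 := abs_le.1 (B.abs_vr_le (a := X) (b := b) x)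
          have h2 := abs_le.1 (y1 x hx)
          rw [← hd] at h1
          refine sq_le_sq' ?_ ?_ <;> rw [hm] <;> linarith
        rw [e1]
        have e3 := mul_le_mul_of_nonneg_right e2 (sq_nonneg (v x - vr κ X k b n x))
        generalize v x - vr κ X k b n x = z at *
        generalize 2 * (2 * vr κ X k b n x + z) = u at *
        have e4 : (u * z) ^ 2 ≤ m ^ 2 * z ^ 2 := by rw [mul_pow]; exact e3
        generalize u * z = t at *
        generalize m ^ 2 * z ^ 2 = T at *
        nlinarith [sq_nonneg (t + G x), sq_nonneg (t - RR κ X k b n x), sq_nonneg (G x + RR κ X k b n x)]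
    _ = 3 * (m ^ 2 * (∫ x in e..q, (v x - vr κ X k b n x) ^ 2) + (∫ x in e..q, G x ^ 2) +
          ∫ x in e..q, RR κ X k b n x ^ 2) := by
        rw [intervalIntegral.integral_const_mul, intervalIntegral.integral_add
          (((ii _ cy).const_mul _).add (ii _ cG)) (ii _ cR), intervalIntegral.integral_add
          ((ii _ cy).const_mul _) (ii _ cG), intervalIntegral.integral_const_mul]
    _ ≤ 3 * (m ^ 2 * (C₁ * (Q * E)) + Q * E + c * E) := by
        have h1 := (intervalIntegral_le_Ici hG.1.2 heq le_rfl).trans hG.2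
        have h2 := (intervalIntegral_le_Ici hR.1.2 heq le_rfl).trans hR.2
        have h3 := mul_le_mul_of_nonneg_left y2 (sq_nonneg m)
        linarith
    _ = _ := by ring

end KdV

namespace KdV

open Set
set_option linter.unusedSimpArgs false

/-- The reciprocal of a wave function is a wave function of the Darboux transform. -/
theorem Wave.inv {V ψ : ℝ → ℝ → ℝ} {k : ℝ} (h : Wave V k ψ) (hs : Sm V) :
    Wave (dar V k ψ) k (fun t x => (ψ t x)⁻¹) := by
  have hp : ∀ t x, ψ t x ≠ 0 := fun t x => (h.pos t x).ne'
  have sφ : Sm (fun t x => (ψ t x)⁻¹) := ContDiff.inv h.sm fun z => hp z.1 z.2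
  have d1 : Dx (fun t x => (ψ t x)⁻¹) = fun t x => -(lg ψ t x * (ψ t x)⁻¹) := by
    ext t x
    refine (((h.sm.hasDx t x).fun_inv (hp t x)).deriv).trans ?_
    have := hp t x
    simp only [lg]; field_simp
  refine ⟨sφ, fun t x => inv_pos.2 (h.pos t x), fun t x => ?_, fun t x => ?_⟩
  · have s1 := h.lg_sm
    rw [d1]
    simp (maxDischargeDepth := 20) only [Sm.Dx_mul, Sm.Dx_neg, Sm.mul, Sm.neg, s1, sφ, d1, h.lg_dx]
    simp only [dar]; ring
  · rw [h.dar_dx hs, d1]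
    refine (((h.sm.hasDt t x).fun_inv (hp t x)).deriv).trans ?_
    have := hp t x
    rw [h.t]
    have e : Dx ψ t x = lg ψ t x * ψ t x := by simp only [lg]; field_simp
    rw [e]
    simp only [dar]
    field_simp
    ring

theorem Wave.lg_inv {V ψ : ℝ → ℝ → ℝ} {k : ℝ} (h : Wave V k ψ) (t x : ℝ) :
    lg (fun t x => (ψ t x)⁻¹) t x = -lg ψ t x := by
  have hp := (h.pos t x).ne'
  have : Dx (fun t x => (ψ t x)⁻¹) t x = -Dx ψ t x / ψ t x ^ 2 :=
    ((h.sm.hasDx t x).fun_inv hp).deriv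
  rw [lg, this, lg]
  field_simp

theorem riccati_sup {w U : ℝ → ℝ} {k M B : ℝ} (hd : ∀ x, HasDerivAt w (w x ^ 2 - k ^ 2 - U x) x)
    (hU : SqI U) (hB : ∫ x, U x ^ 2 ≤ B) (hk : 0 ≤ k) (hM : ∀ x, w x ≤ M) (x : ℝ) :
    w x ≤ k ^ 2 + k + B + 4 := by
  have cw : Continuous w := continuous_iff_continuousAt.mpr fun x => (hd x).continuousAt
  have cU := hU.1
  have hB0 : 0 ≤ B := (integral_nonneg fun x => sq_nonneg (U x)).trans hB
  have bd : BddAbove (range w) := ⟨M, by rintro _ ⟨x, rfl⟩; exact hM x⟩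
  by_contra hx
  push Not at hx
  obtain ⟨_, ⟨x₀, rfl⟩, h0⟩ := exists_lt_of_lt_csSup (range_nonempty w)
    (show sSup (range w) - 1 / 2 < sSup (range w) by linarith)
  have hx' : w x ≤ sSup (range w) := le_csSup bd ⟨x, rfl⟩
  have iU : ∀ p q, p ≤ q → ∫ y in p..q, U y ^ 2 ≤ B := fun p q hpq => by
    rw [intervalIntegral.integral_of_le hpq]
    exact (setIntegral_le_integral hU.2 (Eventually.of_forall fun x => sq_nonneg _)).trans hB
  have step : ∀ y r, x₀ ≤ y → y ≤ x₀ + 1 → (∀ z ∈ Icc x₀ y, r ≤ w z ^ 2) →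
      w x₀ + (r - k ^ 2 - 1 / 2) * (y - x₀) - B / 2 ≤ w y := by
    intro y r h1 h2 hr
    have e := intervalIntegral.integral_eq_sub_of_hasDerivAt (fun z _ => hd z)
      (Continuous.intervalIntegrable (by fun_prop) x₀ y)
    have i1 := intervalIntegral.integral_mono_on h1
      (f := fun z => (r - k ^ 2 - 1 / 2) - 1 / 2 * U z ^ 2)
      (Continuous.intervalIntegrable (by fun_prop) _ _)
      (Continuous.intervalIntegrable (μ := volume) (u := fun z => w z ^ 2 - k ^ 2 - U z) (by fun_prop) x₀ y)
      (fun z hz => by nlinarith [hr z hz, sq_nonneg (U z - 1)])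
    rw [intervalIntegral.integral_sub (Continuous.intervalIntegrable (by fun_prop) _ _)
      (Continuous.intervalIntegrable (by fun_prop) _ _), intervalIntegral.integral_const,
      intervalIntegral.integral_const_mul, smul_eq_mul] at i1
    linarith [iU x₀ y h1]
  have low : ∀ z ∈ Icc x₀ (x₀ + 1), k + B / 2 + 5 / 2 ≤ w z := fun z hz => by
    have := step z 0 hz.1 hz.2 fun _ _ => sq_nonneg _
    nlinarith [hz.1, hz.2, sq_nonneg k]
  have := step (x₀ + 1) ((k + B / 2 + 5 / 2) ^ 2) (by linarith) le_rfl fun z hz =>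
    pow_le_pow_left₀ (by positivity) (low z hz) 2
  have h3 : w (x₀ + 1) ≤ sSup (range w) := le_csSup bd ⟨_, rfl⟩
  nlinarith

/-- A bound on the logarithmic derivative that is uniform in time. -/
theorem Wave.lg_le {V φ : ℝ → ℝ → ℝ} {k B : ℝ} (h : Wave V k φ) (hV : Sol.KC V) (hk : 0 ≤ k)
    (hB : ∫ x, V 0 x ^ 2 ≤ B) (t x : ℝ) : |lg φ t x| ≤ k ^ 2 + k + B + 4 := by
  rw [hV.l2 t 0] at hB
  obtain ⟨N, hN, hb⟩ := hV.bdd' |t|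
  have bd := h.lg_bdd t hN (hb t le_rfl).2.2
  have dv : ∀ x, HasDerivAt (lg φ t) (V t x + k ^ 2 - lg φ t x ^ 2) x := fun x => by
    have := h.lg_sm.hasDx t x
    rwa [h.lg_dx] at this
  refine abs_le.2 ⟨?_, ?_⟩
  · have := riccati_sup (w := fun x => -lg φ t x) (k := k)
      (fun x => ((dv x).fun_neg).congr_deriv (by ring)) (hV.i0 t) hB hk
      (fun x => (neg_le_abs _).trans (bd x)) x
    linarith
  · have := riccati_sup (w := fun x => lg φ t (-x)) (U := fun x => V t (-x)) (k := k) (B := B)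
      (fun x => ((dv (-x)).comp x (hasDerivAt_neg x)).congr_deriv (by ring)) ⟨(hV.i0 t).1.comp continuous_neg, (hV.i0 t).2.comp_neg⟩
      (by rw [integral_neg_eq_self (fun x => V t x ^ 2)]; exact hB) hk
      (fun x => (le_abs_self _).trans (bd (-x))) (-x)
    simpa using this

theorem int_comb₃ {f₁ f₂ f₃ : ℝ → ℝ} (h₁ : Integrable f₁) (h₂ : Integrable f₂) (h₃ : Integrable f₃)
    (a b c : ℝ) : ∫ x, (a * f₁ x + b * f₂ x + c * f₃ x) =
      a * (∫ x, f₁ x) + b * (∫ x, f₂ x) + c * ∫ x, f₃ x := by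
  have i₁ : Integrable fun x => a * f₁ x := h₁.const_mul a
  have i₂ : Integrable fun x => b * f₂ x := h₂.const_mul b
  have i₃ : Integrable fun x => c * f₃ x := h₃.const_mul c
  have i₄ : Integrable fun x => a * f₁ x + b * f₂ x := i₁.add i₂
  rw [integral_add i₄ i₃, integral_add i₁ i₂, integral_const_mul, integral_const_mul,
    integral_const_mul]

theorem barrier_identity {F F1 U U1 χ χ₁ χ₂ P P' : ℝ → ℝ} {q σ : ℝ}
    (hF : ∀ x, HasDerivAt F (F1 x) x) (hF1 : ∀ x, HasDerivAt F1 ((U x + q) * F x) x)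
    (hU : ∀ x, HasDerivAt U (U1 x) x) (cU1 : Continuous U1)
    (hχ : ∀ x, HasDerivAt χ (χ₁ x) x) (hχ₁ : ∀ x, HasDerivAt χ₁ (χ₂ x) x) (cχ₂ : Continuous χ₂)
    (h0 : ∀ x, 2 < |x| → χ x = 0 ∧ χ₁ x = 0 ∧ χ₂ x = 0)
    (hP : ∀ x, HasDerivAt P (P' x) x) (cP' : Continuous P')
    (eP : ∀ x, P x = -U1 x * F x + (2 * U x + σ) * F1 x) :
    ∫ x, P' x * χ x = ∫ x, (σ * (U x + q) * F x * χ x - 3 * U x * F1 x * χ₁ x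
      - U x * F x * χ₂ x) := by
  have cF : Continuous F := continuous_iff_continuousAt.mpr fun x => (hF x).continuousAt
  have cF1 : Continuous F1 := continuous_iff_continuousAt.mpr fun x => (hF1 x).continuousAt
  have cU : Continuous U := continuous_iff_continuousAt.mpr fun x => (hU x).continuousAt
  have cχ : Continuous χ := continuous_iff_continuousAt.mpr fun x => (hχ x).continuousAt
  have cχ₁ : Continuous χ₁ := continuous_iff_continuousAt.mpr fun x => (hχ₁ x).continuousAt
  have hi : ∀ h : ℝ → ℝ, Continuous h → (∀ x, 2 < |x| → h x = 0) → Integrable h := fun h ch hz =>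
    ch.integrable_of_hasCompactSupport (HasCompactSupport.intro (isCompact_Icc (a := -2) (b := 2))
      fun x hx => hz x (by by_contra hle; exact hx (abs_le.mp (not_lt.mp hle))))
  have i1 := ibp_compact hP cP' hχ cχ₁ fun x hx => ⟨(h0 x hx).1, (h0 x hx).2.1⟩
  have i2 := ibp_compact hU cU1 (w := fun x => F x * χ₁ x) (fun x => (hF x).fun_mul (hχ₁ x))
    (by fun_prop) (R := 2) fun x hx => by simp [h0 x hx]
  have i3 := ibp_compact hF1 (by fun_prop) hχ cχ₁ fun x hx => ⟨(h0 x hx).1, (h0 x hx).2.1⟩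
  have a1 := hi (fun x => U1 x * (F x * χ₁ x)) (by fun_prop) fun x hx => by simp [h0 x hx]
  have a2 := hi (fun x => 2 * U x * F1 x * χ₁ x) (by fun_prop) fun x hx => by simp [h0 x hx]
  have a3 := hi (fun x => F1 x * χ₁ x) (by fun_prop) fun x hx => by simp [h0 x hx]
  have a4 := hi (fun x => U x * (F1 x * χ₁ x + F x * χ₂ x)) (by fun_prop) fun x hx => by
    simp [h0 x hx]
  have a5 := hi (fun x => (U x + q) * F x * χ x) (by fun_prop) fun x hx => by simp [h0 x hx]
  have e1 : (∫ x, P x * χ₁ x) = -1 * (∫ x, U1 x * (F x * χ₁ x)) + 1 * (∫ x, 2 * U x * F1 x * χ₁ x) +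
      σ * ∫ x, F1 x * χ₁ x := by
    rw [← int_comb₃ a1 a2 a3]
    congr 1; ext x
    rw [eP]; ring
  have e2 : (∫ x, (σ * (U x + q) * F x * χ x - 3 * U x * F1 x * χ₁ x - U x * F x * χ₂ x)) =
      σ * (∫ x, (U x + q) * F x * χ x) + -1 * (∫ x, 2 * U x * F1 x * χ₁ x) +
      -1 * ∫ x, U x * (F1 x * χ₁ x + F x * χ₂ x) := by
    rw [← int_comb₃ a5 a2 a4]
    congr 1; ext x
    ring
  rw [e2, i1, e1, i2, i3]
  ring

end KdV

namespace KdV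

open Set
set_option linter.unusedSimpArgs false

theorem harnack {F F1 : ℝ → ℝ} {m : ℝ} (hF : ∀ x, HasDerivAt F (F1 x) x) (h : ∀ x, |F1 x| ≤ m * F x)
    (x y : ℝ) : F x ≤ exp (m * |x - y|) * F y := by
  have e : ∀ s : ℝ, ∀ x, HasDerivAt (fun x => F x * exp (s * x)) ((F1 x + s * F x) * exp (s * x)) x := by
    intro s x
    have h1 : HasDerivAt (fun x => exp (s * x)) (exp (s * x) * (s * 1)) x :=
      ((hasDerivAt_id x).const_mul s).exp
    exact ((hF x).fun_mul h1).congr_deriv (by ring)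
  have up := monotone_of_hasDerivAt_nonneg (e m) fun x =>
    mul_nonneg (by linarith [(abs_le.1 (h x)).1]) (exp_pos _).le
  have dn := antitone_of_hasDerivAt_nonpos (e (-m)) fun x =>
    mul_nonpos_of_nonpos_of_nonneg (by linarith [(abs_le.1 (h x)).2]) (exp_pos _).le
  rcases le_total x y with hxy | hxy
  · have := up hxy
    simp only at this
    rw [abs_of_nonpos (by linarith), show m * -(x - y) = m * y - m * x by ring, exp_sub,
      div_mul_eq_mul_div, le_div_iff₀ (exp_pos _)]
    linarith
  · have := dn hxy
    simp only at this
    rw [neg_mul, neg_mul, exp_neg, exp_neg, ← div_eq_mul_inv, ← div_eq_mul_inv,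
      div_le_div_iff₀ (exp_pos _) (exp_pos _)] at this
    rw [abs_of_nonneg (by linarith), mul_sub, exp_sub, div_mul_eq_mul_div, le_div_iff₀ (exp_pos _)]
    linarith

theorem barrier_nonneg {g m σ₀ K : ℝ} (hg : 0 < g) (hm : 0 ≤ m) (hσ : 0 < σ₀) (hK : 0 ≤ K) :
    ∃ δ, 0 < δ ∧ ∀ (F F1 U χ χ₁ χ₂ : ℝ → ℝ) (q σ ε : ℝ), (∀ x, HasDerivAt F (F1 x) x) →
      Continuous F1 → Continuous U → Continuous χ → Continuous χ₁ → Continuous χ₂ →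
      (∀ x, 0 < F x) → (∀ x, |F1 x| ≤ m * F x) → g ^ 2 ≤ q → |ε| = 1 → σ₀ ≤ ε * σ →
      (∀ x, |x| ≤ 1 → χ x = 1) → (∀ x, 0 ≤ χ x ∧ χ x ≤ 1) →
      (∀ x, 2 < |x| → χ x = 0 ∧ χ₁ x = 0 ∧ χ₂ x = 0) → (∀ x, |χ₁ x| ≤ K ∧ |χ₂ x| ≤ K) →
      ∫ x in Icc (-2) 2, U x ^ 2 ≤ δ ^ 2 →
      0 ≤ ε * ∫ x, (σ * (U x + q) * F x * χ x - 3 * U x * F1 x * χ₁ x - U x * F x * χ₂ x) := by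
  obtain ⟨M, hM, M0⟩ : ∃ M, M = exp (m * 2) ∧ 0 < M := ⟨_, rfl, exp_pos _⟩
  obtain ⟨K', hK', K0⟩ : ∃ K', K' = (3 * m + 1) * K ∧ 0 ≤ K' := ⟨_, rfl, by positivity⟩
  obtain ⟨δ, hδ, δ0⟩ : ∃ δ, δ = 4 * g ^ 2 * σ₀ / (5 * M ^ 2 * (σ₀ + K')) ∧ 0 < δ :=
    ⟨_, rfl, by positivity⟩
  refine ⟨δ, δ0, fun F F1 U χ χ₁ χ₂ q σ ε hF cF1 cU cχ cχ₁ cχ₂ F0 hF1 hq hε hτ χ1 χ01 χ0 χK hU => ?_⟩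
  have cF : Continuous F := continuous_iff_continuousAt.mpr fun x => (hF x).continuousAt
  obtain ⟨τ, eτ⟩ : ∃ τ, τ = ε * σ := ⟨_, rfl⟩
  rw [← eτ] at hτ
  have τ0 : 0 < τ := hσ.trans_le hτ
  have e0 : ε * (∫ x, (σ * (U x + q) * F x * χ x - 3 * U x * F1 x * χ₁ x - U x * F x * χ₂ x)) =
      ∫ x in (-2 : ℝ)..2, (τ * q * (F x * χ x) +
        U x * (τ * F x * χ x - ε * (3 * F1 x * χ₁ x + F x * χ₂ x))) := by
    rw [intervalIntegral.integral_of_le (by norm_num), ← integral_Icc_eq_integral_Ioc,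
      setIntegral_eq_integral_of_forall_compl_eq_zero, ← integral_const_mul]
    · congr 1; ext x; rw [eτ]; ring
    · intro x hx
      have := χ0 x (by by_contra hle; exact hx (abs_le.mp (not_lt.mp hle)))
      simp [this]
  have har : ∀ x ∈ Icc (-2 : ℝ) 2, F x ≤ M * F 0 ∧ F 0 ≤ M * F x := by
    intro x hx
    have hx' : |x| ≤ 2 := abs_le.2 hx
    have h1 := harnack hF hF1 x 0
    have h2 := harnack hF hF1 0 x
    rw [sub_zero] at h1
    rw [zero_sub, abs_neg] at h2
    have h3 : exp (m * |x|) ≤ M := by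
      rw [hM]; exact exp_le_exp.2 (mul_le_mul_of_nonneg_left hx' hm)
    exact ⟨h1.trans (mul_le_mul_of_nonneg_right h3 (F0 0).le),
      h2.trans (mul_le_mul_of_nonneg_right h3 (F0 x).le)⟩
  have low : ∀ x ∈ Icc (-2 : ℝ) 2, -((τ + K') * (M * F 0)) * (U x ^ 2 / (2 * δ) + δ / 2) ≤
      U x * (τ * F x * χ x - ε * (3 * F1 x * χ₁ x + F x * χ₂ x)) := by
    intro x hx
    have b1 : |τ * F x * χ x| ≤ τ * F x := by
      rw [abs_of_nonneg (mul_nonneg (mul_nonneg τ0.le (F0 x).le) (χ01 x).1)]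
      exact mul_le_of_le_one_right (mul_nonneg τ0.le (F0 x).le) (χ01 x).2
    have b2 : |F1 x * χ₁ x| ≤ m * F x * K := by
      rw [abs_mul]; exact mul_le_mul (hF1 x) (χK x).1 (abs_nonneg _) (mul_nonneg hm (F0 x).le)
    have b3 : |F x * χ₂ x| ≤ F x * K := by
      rw [abs_mul, abs_of_pos (F0 x)]; exact mul_le_mul_of_nonneg_left (χK x).2 (F0 x).le
    have b4 : |τ * F x * χ x - ε * (3 * F1 x * χ₁ x + F x * χ₂ x)| ≤ (τ + K') * F x := by
      refine (abs_sub _ _).trans ?_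
      rw [abs_mul ε, hε, one_mul, mul_assoc 3]
      have := abs_add_le (3 * (F1 x * χ₁ x)) (F x * χ₂ x)
      rw [abs_mul 3, abs_of_pos (by norm_num : (0 : ℝ) < 3)] at this
      rw [hK']; linarith
    have b5 : |U x| ≤ U x ^ 2 / (2 * δ) + δ / 2 := by
      rw [div_add_div _ _ (by positivity) (by norm_num), le_div_iff₀ (by positivity), ← sq_abs]
      nlinarith [sq_nonneg (|U x| - δ)]
    have b6 : (τ + K') * F x ≤ (τ + K') * (M * F 0) :=
      mul_le_mul_of_nonneg_left (har x hx).1 (by positivity)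
    have b7 := mul_le_mul b5 (b4.trans b6) (abs_nonneg _) (by positivity)
    rw [← abs_mul] at b7
    linarith [(abs_le.1 b7).1]
  have i1 : ∫ x in (-2 : ℝ)..2, (-((τ + K') * (M * F 0)) * (U x ^ 2 / (2 * δ) + δ / 2)) ≤
      ∫ x in (-2 : ℝ)..2, U x * (τ * F x * χ x - ε * (3 * F1 x * χ₁ x + F x * χ₂ x)) :=
    intervalIntegral.integral_mono_on (by norm_num) (Continuous.intervalIntegrable (by fun_prop) _ _)
      (Continuous.intervalIntegrable (by fun_prop) _ _) low
  have i2 : ∫ x in (-2 : ℝ)..2, (U x ^ 2 / (2 * δ) + δ / 2) ≤ 5 / 2 * δ := by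
    rw [intervalIntegral.integral_add (Continuous.intervalIntegrable (by fun_prop) _ _)
      (Continuous.intervalIntegrable (by fun_prop) _ _), intervalIntegral.integral_const,
      intervalIntegral.integral_div, intervalIntegral.integral_of_le (by norm_num),
      ← integral_Icc_eq_integral_Ioc, smul_eq_mul]
    have : (∫ x in Icc (-2 : ℝ) 2, U x ^ 2) / (2 * δ) ≤ δ / 2 := by
      rw [div_le_iff₀ (by positivity)]; linarith
    linarith
  have i3 : 2 * (g ^ 2 * (F 0 / M)) ≤ ∫ x in (-2 : ℝ)..2, q * (F x * χ x) := by
    have q0 : 0 ≤ q := (sq_nonneg g).trans hq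
    have h1 := intervalIntegral.integral_mono_interval (μ := volume) (f := fun x => q * (F x * χ x))
      (a := -1) (b := 1) (c := -2) (d := 2)
      (by norm_num) (by norm_num) (by norm_num) (Eventually.of_forall fun x =>
        mul_nonneg q0 (mul_nonneg (F0 x).le (χ01 x).1))
      (Continuous.intervalIntegrable (by fun_prop) _ _)
    refine le_trans ?_ h1
    have h2 := intervalIntegral.integral_mono_on (μ := volume) (a := (-1 : ℝ)) (b := 1)
      (f := fun _ => g ^ 2 * (F 0 / M)) (g := fun x => q * (F x * χ x)) (by norm_num)
      (Continuous.intervalIntegrable (by fun_prop) _ _)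
      (Continuous.intervalIntegrable (by fun_prop) _ _) fun x hx => by
        rw [χ1 x (abs_le.2 hx), mul_one]
        refine mul_le_mul hq ?_ (by have := F0 0; positivity) q0
        rw [div_le_iff₀' M0]
        exact (har x ⟨by linarith [hx.1], by linarith [hx.2]⟩).2
    rw [intervalIntegral.integral_const, smul_eq_mul] at h2
    linarith
  rw [e0, intervalIntegral.integral_add (Continuous.intervalIntegrable (by fun_prop) _ _)
    (Continuous.intervalIntegrable (by fun_prop) _ _)]
  have i4 : ∫ x in (-2 : ℝ)..2, τ * q * (F x * χ x) = τ * ∫ x in (-2 : ℝ)..2, q * (F x * χ x) := by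
    rw [← intervalIntegral.integral_const_mul]; congr 1; ext x; ring
  rw [intervalIntegral.integral_const_mul] at i1
  have f0 := F0 0
  have i5 := mul_le_mul_of_nonneg_left i2 (show 0 ≤ (τ + K') * (M * F 0) by positivity)
  have i6 := mul_le_mul_of_nonneg_left i3 τ0.le
  have i7 : (τ + K') * (M * F 0) * (5 / 2 * δ) ≤ τ * (2 * (g ^ 2 * (F 0 / M))) := by
    have : (τ + K') * (M * F 0) * (5 / 2 * δ) =
        (2 * (g ^ 2 * (F 0 / M))) * (σ₀ * (τ + K') / (σ₀ + K')) := by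
      rw [hδ]; field_simp; ring
    rw [this, mul_comm τ]
    refine mul_le_mul_of_nonneg_left ?_ (by positivity)
    rw [div_le_iff₀ (by positivity)]
    nlinarith
  rw [i4]
  linarith

theorem Wave.ray {g m σ₀ : ℝ} (hg : 0 < g) (hm : 0 ≤ m) (hσ : 0 < σ₀) :
    ∃ δ, 0 < δ ∧ ∀ (V φ : ℝ → ℝ → ℝ) (κ c s ε : ℝ), Sm V → Wave V κ φ → g ≤ κ → |ε| = 1 →
      (∀ t, 0 ≤ t → ∀ x, |lg φ t x| ≤ m) → σ₀ ≤ ε * (s - 4 * κ ^ 2) →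
      (∀ t, 0 ≤ t → ∫ y in Icc (-2) 2, V t (y + c + s * t) ^ 2 ≤ δ ^ 2) →
      (∀ y, |y| ≤ 2 → 0 < ε * lg φ 0 (y + c)) →
      ∀ t, 0 ≤ t → ∃ y, |y| ≤ 2 ∧ 0 < ε * lg φ t (y + c + s * t) := by
  obtain ⟨χ, χ₁, χ₂, χ₃, C, cχ, d1, d2, d3, c3, χ1, χ01, χ0, χC⟩ := exists_cutoff
  have cχ₁ : Continuous χ₁ := continuous_iff_continuousAt.mpr fun x => (d2 x).continuousAt
  have cχ₂ : Continuous χ₂ := continuous_iff_continuousAt.mpr fun x => (d3 x).continuousAt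
  obtain ⟨K, hK⟩ : ∃ K, ∀ x, |χ₁ x| ≤ K ∧ |χ₂ x| ≤ K := by
    obtain ⟨B, hB⟩ := (isCompact_Icc (a := (-2 : ℝ)) (b := 2)).exists_bound_of_continuousOn
      cχ₂.continuousOn
    refine ⟨max C (max B 0), fun x => ⟨(χC x).1.trans (le_max_left _ _), ?_⟩⟩
    by_cases hx : |x| ≤ 2
    · exact (hB x (abs_le.1 hx)).trans ((le_max_left _ _).trans (le_max_right _ _))
    · rw [(χ0 x (not_le.1 hx)).2.2.1, abs_zero]
      exact (le_max_right _ _).trans (le_max_right _ _)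
  obtain ⟨δ, δ0, hδ⟩ := barrier_nonneg hg hm hσ ((abs_nonneg _).trans (hK 0).1)
  refine ⟨δ, δ0, fun V φ κ c s ε sV hφ hκ hε hlg hs hV h0 t ht => ?_⟩
  obtain ⟨F, hF⟩ : ∃ F : ℝ → ℝ → ℝ, F = fun t y => φ t (y + c + s * t) := ⟨_, rfl⟩
  obtain ⟨U, hU⟩ : ∃ U : ℝ → ℝ → ℝ, U = fun t y => V t (y + c + s * t) := ⟨_, rfl⟩
  have sb : Sm (fun t y : ℝ => y + c + s * t) :=
    (contDiff_snd.add contDiff_const).add (contDiff_const.mul contDiff_fst)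
  have sa : Sm (fun t _ : ℝ => t) := contDiff_fst
  have sF : Sm F := by rw [hF]; exact hφ.sm.comp_aff sa sb
  have sU : Sm U := by rw [hU]; exact sV.comp_aff sa sb
  have shx : ∀ f : ℝ → ℝ → ℝ, Dx (fun t y => f t (y + c + s * t)) = fun t y => Dx f t (y + c + s * t) := by
    intro f; ext t y
    have : (fun y => f t (y + c + s * t)) = fun y => f t (y + (c + s * t)) := by ext y; rw [add_assoc]
    simp only [Dx]
    rw [this, deriv_comp_add_const, add_assoc]
  have F1 : Dx F = fun t y => Dx φ t (y + c + s * t) := by rw [hF, shx]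
  have U1 : Dx U = fun t y => Dx V t (y + c + s * t) := by rw [hU, shx]
  have F2 : Dx (Dx F) = fun t y => (U t y + κ ^ 2) * F t y := by
    rw [F1, shx]; ext t y; rw [hφ.xx, hF, hU]
  have Ft : Dt F = fun t y => -Dx U t y * F t y + (2 * U t y + (s - 4 * κ ^ 2)) * Dx F t y := by
    ext t y
    rw [U1, F1, hF, hU]
    have hl : HasDerivAt (fun τ => ((τ, y + c + s * τ) : ℝ × ℝ)) ((1 : ℝ), s) t :=
      (hasDerivAt_id t).prodMk (by simpa using ((hasDerivAt_id t).const_mul s).const_add (y + c))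
    have h1 := (hφ.sm.diff (t, y + c + s * t)).hasFDerivAt.comp_hasDerivAt t hl
    have h2 : Dt (fun t y => φ t (y + c + s * t)) t y =
      fderiv ℝ (Function.uncurry φ) (t, y + c + s * t) (1, s) := h1.deriv
    have h3 : ((1, s) : ℝ × ℝ) = (1, 0) + s • (0, 1) := by simp
    rw [h2, h3, map_add, map_smul, ← hφ.sm.Dx_eq, ← hφ.sm.Dt_eq, hφ.t, smul_eq_mul]
    ring
  have sFt := sF.dt
  have Fpos : ∀ t x, 0 < F t x := fun t x => by rw [hF]; exact hφ.pos _ _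
  have dD : ∀ t, HasDerivAt (fun τ => ∫ x, Dx F τ x * χ x) (∫ x, Dx (Dt F) t x * χ x) t := by
    intro t
    have cc := cχ.continuous
    have c1 := sF.dx.cont
    have c2 := sFt.dx.cont
    refine param_deriv (f := fun τ x => Dx F τ x * χ x) (f' := fun τ x => Dx (Dt F) τ x * χ x) (R := 2)
      (c1.mul (cc.comp continuous_snd)) (c2.mul (cc.comp continuous_snd)) (fun t x => ?_)
      (fun t x hx => by simp [χ0 x hx]) (fun t x hx => by simp [χ0 x hx]) t
    rw [← sF.comm]
    exact (sF.dx.hasDt t x).mul_const (χ x)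
  have nn : ∀ t, 0 ≤ t → 0 ≤ ε * ∫ x, Dx (Dt F) t x * χ x := by
    intro t ht
    have e := barrier_identity (F := F t) (F1 := Dx F t) (U := U t) (U1 := Dx U t) (χ := χ) (χ₁ := χ₁)
      (χ₂ := χ₂) (P := Dt F t) (P' := Dx (Dt F) t) (q := κ ^ 2) (σ := s - 4 * κ ^ 2)
      (sF.hasDx t) (fun x => by
        have := sF.dx.hasDx t x
        rwa [F2] at this) (sU.hasDx t) (sU.dx.cont_x t) d1 d2 cχ₂
      (fun x hx => ⟨(χ0 x hx).1, (χ0 x hx).2.1, (χ0 x hx).2.2.1⟩) (sFt.hasDx t) (sFt.dx.cont_x t)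
      (fun x => by rw [Ft])
    rw [e]
    refine hδ (F t) (Dx F t) (U t) χ χ₁ χ₂ (κ ^ 2) (s - 4 * κ ^ 2) ε (sF.hasDx t) (sF.dx.cont_x t)
      (sU.cont_x t) cχ.continuous cχ₁ cχ₂ (Fpos t) (fun x => ?_) (pow_le_pow_left₀ hg.le hκ 2) hε hs χ1
      χ01 (fun x hx => ⟨(χ0 x hx).1, (χ0 x hx).2.1, (χ0 x hx).2.2.1⟩) hK (by rw [hU]; exact hV t ht)
    have := hlg t ht (x + c + s * t)
    rw [lg, abs_div, abs_of_pos (hφ.pos _ _), div_le_iff₀ (hφ.pos _ _)] at this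
    rw [F1, hF]
    exact this
  have cD : Continuous (fun τ => ε * ∫ x, Dx F τ x * χ x) :=
    continuous_const.mul (continuous_iff_continuousAt.mpr fun x => (dD x).continuousAt)
  have mono : MonotoneOn (fun τ => ε * ∫ x, Dx F τ x * χ x) (Ici 0) := by
    refine monotoneOn_of_hasDerivWithinAt_nonneg (convex_Ici 0) cD.continuousOn
      (f' := fun t => ε * ∫ x, Dx (Dt F) t x * χ x)
      (fun x _ => ((dD x).const_mul ε).hasDerivWithinAt) fun x hx => ?_
    rw [interior_Ici] at hx
    exact nn x hx.le
  have key := mono (mem_Ici.2 le_rfl) (mem_Ici.2 ht) ht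
  simp only at key
  have sign : ∀ t y, ε * Dx F t y = F t y * (ε * lg φ t (y + c + s * t)) := by
    intro t y
    have := (hφ.pos t (y + c + s * t)).ne'
    rw [F1, hF, lg]; field_simp
  have cDx := sF.dx.cont_x
  have cc := cχ.continuous
  have pos0 : 0 < ε * ∫ x, Dx F 0 x * χ x := by
    rw [← integral_const_mul]
    refine Continuous.integral_pos_of_hasCompactSupport_nonneg_nonzero (x := 0)
      (by have := cDx 0; fun_prop)
      (HasCompactSupport.intro (isCompact_Icc (a := -2) (b := 2)) fun x hx => ?_) (fun x => ?_) ?_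
    · simp [χ0 x (by by_contra hle; exact hx (abs_le.mp (not_lt.mp hle)))]
    · show 0 ≤ ε * (Dx F 0 x * χ x)
      rw [← mul_assoc, sign]
      by_cases hx : |x| ≤ 2
      · have := h0 x hx
        rw [mul_zero, add_zero]
        exact mul_nonneg (mul_nonneg (Fpos _ _).le this.le) (χ01 x).1
      · rw [(χ0 x (not_le.1 hx)).1, mul_zero]
    · rw [← mul_assoc, sign, χ1 0 (by simp), mul_zero, add_zero]
      have := h0 0 (by simp)
      have := Fpos 0 0
      positivity
  by_contra hcon
  push Not at hcon
  have : ε * ∫ x, Dx F t x * χ x ≤ 0 := by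
    rw [← integral_const_mul]
    refine integral_nonpos fun x => ?_
    show ε * (Dx F t x * χ x) ≤ 0
    rw [← mul_assoc, sign]
    by_cases hx : |x| ≤ 2
    · exact mul_nonpos_of_nonpos_of_nonneg (mul_nonpos_of_nonneg_of_nonpos (Fpos _ _).le (hcon x hx))
        (χ01 x).1
    · rw [(χ0 x (not_le.1 hx)).1, mul_zero]
  linarith

end KdV

namespace KdV

open Set
set_option linter.unusedSimpArgs false

namespace Box

variable {g κ κ' a L : ℝ} {n : ℕ} {k k' b : ℕ → ℝ}

theorem perturb₂ (B : Box g κ n k) (h : |κ' - κ| ≤ g / 4) (hk : ∀ j < n, |k' j - k j| ≤ g / 4) :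
    Box (g / 2) κ' n k' := by
  have h0 := B.pos
  obtain ⟨h1, h2⟩ := abs_le.1 h
  have h3 : g ≤ g⁻¹ := B.le.trans B.inv
  refine ⟨by linarith, by linarith [B.le], ?_, fun j hj => ?_, fun j hj => ?_⟩
  · rw [inv_div, div_eq_mul_inv]
    linarith [B.inv]
  · linarith [B.lo j hj, (abs_le.1 (hk j hj)).1]
  · linarith [B.hi j hj, (abs_le.1 (hk j hj)).2]

theorem k_le_inv (B : Box g κ n k) {j : ℕ} (hj : j < n) : k j ≤ g⁻¹ :=
  (B.klt hj).le.trans B.inv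

theorem sg_bounds (B : Box g κ n k) {j : ℕ} (hj : j < n) :
    0 ≤ sg κ (k j) ∧ sg κ (k j) ≤ artanh (1 - g ^ 2) / g := by
  have g0 := B.pos
  have k0 := B.kpos hj
  have κ0 := B.κpos
  have h1 : 0 < k j / κ := by positivity
  have h2 : k j / κ ≤ 1 - g ^ 2 := by
    rw [div_le_iff₀ κ0]
    have : g * κ ≤ 1 := by rw [← le_div_iff₀' g0, one_div]; exact B.inv
    nlinarith [B.hi j hj]
  have h3 : 0 < artanh (k j / κ) := artanh_pos ⟨h1, by nlinarith⟩
  refine ⟨(div_pos h3 k0).le, div_le_div₀ (h3.le.trans ?_) ?_ g0 (B.lo j hj)⟩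
  · exact artanh_le_artanh (by linarith) (by nlinarith) h2
  · exact artanh_le_artanh (by linarith) (by nlinarith) h2

theorem abs_SS_le (B : Box g κ n k) {l x : ℝ} (hl : ∀ j < n, l ≤ |x - b j|) :
    |SS k b n x| ≤ n * (8 * g⁻¹ ^ 2) * exp (-(2 * g * l)) := by
  have g0 := B.pos
  refine (Finset.abs_sum_le_sum_abs _ _).trans ?_
  refine (Finset.sum_le_card_nsmul _ _ (8 * g⁻¹ ^ 2 * exp (-(2 * g * l))) fun j hj => ?_).trans_eq
    (by rw [Finset.card_range, nsmul_eq_mul]; ring)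
  have hj := Finset.mem_range.1 hj
  refine (abs_S_le g0 (B.lo j hj) (B.k_le_inv hj) _).trans ?_
  refine mul_le_mul_of_nonneg_left (exp_le_exp.2 ?_) (by positivity)
  have := mul_le_mul_of_nonneg_left (hl j hj) g0.le
  linarith

theorem int_SS_le (B : Box g κ n k) : ∫ x, SS k b n x ^ 2 ≤ (8 * g⁻¹ ^ 2) ^ 2 * (n ^ 2 * g⁻¹) := by
  have g0 := B.pos
  obtain ⟨h1, h2⟩ := sum_sq_exp_le g0 n b
  refine le_trans ?_ (mul_le_mul_of_nonneg_left h2 (by positivity))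
  rw [← integral_const_mul]
  refine integral_mono B.sqI_SS.2 (h1.2.const_mul _) fun x => ?_
  simp only
  rw [← mul_pow, ← sq_abs]
  refine pow_le_pow_left₀ (abs_nonneg _) ?_ 2
  rw [Finset.mul_sum]
  refine (Finset.abs_sum_le_sum_abs _ _).trans (Finset.sum_le_sum fun j hj => ?_)
  have hj := Finset.mem_range.1 hj
  refine (abs_S_le g0 (B.lo j hj) (B.k_le_inv hj) _).trans ?_
  refine mul_le_mul_of_nonneg_left (exp_le_exp.2 ?_) (by positivity)
  nlinarith [abs_nonneg (x - b j)]

/-- A potential close to a sum of solitons is small on windows away from the solitons. -/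
theorem window (B : Box g κ n k) {f : ℝ → ℝ} {E l p : ℝ}
    (h : L2le Set.univ (fun x => f x - SS k b n x) E) (hl : ∀ j < n, l ≤ p - 2 - b j) (l0 : 0 ≤ l) :
    ∫ y in Icc (-2) 2, f (y + p) ^ 2 ≤ 2 * E + 8 * (n * (8 * g⁻¹ ^ 2)) ^ 2 * exp (-(2 * g * l)) := by
  have g0 := B.pos
  have i1 : SqI fun y => f (y + p) - SS k b n (y + p) := h.sqI.shift p
  have i2 : SqI fun y => SS k b n (y + p) := (B.sqI_SS (b := b)).shift p
  have h1 := setInt_sq_add_le i1 i2 (Icc (-2) 2)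
  have h2 : ∫ y in Icc (-2 : ℝ) 2, (f (y + p) - SS k b n (y + p)) ^ 2 ≤ E := by
    refine (setInt_sq_le i1.2 _).trans ?_
    rw [integral_add_right_eq_self (fun y => (f y - SS k b n y) ^ 2)]
    exact h.int
  have h3 : ∫ y in Icc (-2 : ℝ) 2, SS k b n (y + p) ^ 2 ≤
      4 * (n * (8 * g⁻¹ ^ 2)) ^ 2 * exp (-(2 * g * l)) := by
    have : ∫ y in Icc (-2 : ℝ) 2, SS k b n (y + p) ^ 2 ≤
        ∫ y in Icc (-2 : ℝ) 2, (n * (8 * g⁻¹ ^ 2)) ^ 2 * exp (-(2 * g * l)) := by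
      refine setIntegral_mono_on i2.2.integrableOn (integrableOn_const (by simp)) measurableSet_Icc
        fun y hy => ?_
      have a1 := B.abs_SS_le (b := b) (l := l) (x := y + p) fun j hj =>
        le_trans (by linarith [hl j hj, hy.1]) (le_abs_self _)
      rw [← sq_abs]
      refine (pow_le_pow_left₀ (abs_nonneg _) a1 2).trans ?_
      rw [mul_pow]
      refine mul_le_mul_of_nonneg_left ?_ (by positivity)
      have : exp (-(2 * g * l)) ≤ 1 := exp_le_one_iff.2 (by nlinarith [mul_nonneg g0.le l0])
      nlinarith [exp_pos (-(2 * g * l))]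
    refine this.trans_eq ?_
    rw [setIntegral_const]
    simp only [measureReal_def, Real.volume_Icc, smul_eq_mul]
    rw [ENNReal.toReal_ofReal (by norm_num)]
    ring
  have e : ∀ y, f (y + p) = f (y + p) - SS k b n (y + p) + SS k b n (y + p) := fun y => by ring
  simp only [sub_add_cancel] at h1
  linarith

/-- Signs of the Riccati variable on both sides of the main soliton. -/
theorem vr_sign (B : Box g κ n k) {x l : ℝ} (hl : ∀ j < n, l ≤ x - b j)
    (hE : n * (4 * g⁻¹ ^ 3) * exp (-(2 * g * l)) ≤ g / 4) :
    (a + artanh (3 / 4) / g ≤ x → vr κ a k b n x < -(g / 4)) ∧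
      (x ≤ a - artanh (3 / 4) / g → g / 4 < vr κ a k b n x) := by
  have g0 := B.pos
  have D := abs_le.1 ((B.abs_DD_le (b := b) (L := l) (x := x) fun j hj =>
    (hl j hj).trans (le_abs_self _)).trans hE)
  have a0 : 0 < artanh (3 / 4 : ℝ) := artanh_pos (by norm_num)
  have key : ∀ z, artanh (3 / 4) / g ≤ z → 3 / 4 * g ≤ κ * tanh (κ * z) := by
    intro z hz
    have z0 : 0 < z := (div_pos a0 g0).trans_le hz
    have h1 : artanh (3 / 4) ≤ κ * z := by
      rw [div_le_iff₀ g0] at hz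
      nlinarith [B.le]
    have h2 : (3 / 4 : ℝ) ≤ tanh (κ * z) := by
      by_contra hlt
      have := strictMonoOn_artanh ⟨neg_one_lt_tanh _, tanh_lt_one _⟩ (by norm_num) (not_le.1 hlt)
      rw [artanh_tanh] at this
      linarith
    nlinarith [B.le, B.κpos]
  unfold vr
  refine ⟨fun h => ?_, fun h => ?_⟩
  · have := key (x - a) (by linarith)
    linarith [D.2]
  · have := key (-(x - a)) (by linarith)
    rw [mul_neg, tanh_neg] at this
    linarith [D.1]

end Box

end KdV

namespace KdV

open Set
set_option linter.unusedSimpArgs false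

theorem Wave.lg_hasDeriv {V ψ : ℝ → ℝ → ℝ} {k : ℝ} (h : Wave V k ψ) (t x : ℝ) :
    HasDerivAt (lg ψ t) (lg ψ t x ^ 2 - k ^ 2 - dar V k ψ t x) x := by
  have := h.lg_sm.hasDx t x
  rw [h.lg_dx] at this
  exact this.congr_deriv (by simp only [dar]; ring)

/-- The zero of the Riccati variable moves at about the speed of the main soliton. -/
theorem Wave.track {g η m : ℝ} (hg : 0 < g) (hη : 0 < η) (hm : 0 ≤ m) :
    ∃ δ, 0 < δ ∧ ∀ (V ψ : ℝ → ℝ → ℝ) (κ κ₀ a w : ℝ), Sm V → Wave V κ ψ → g ≤ κ → 0 ≤ w →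
      |4 * κ ^ 2 - 4 * κ₀ ^ 2| ≤ η / 2 → (∀ t, 0 ≤ t → ∀ x, |lg ψ t x| ≤ m) →
      (∀ t, 0 ≤ t → ∀ p, a - w - 2 + (4 * κ₀ ^ 2 - η) * t ≤ p →
        ∫ y in Icc (-2) 2, dar V κ ψ t (y + p) ^ 2 ≤ δ ^ 2) →
      (∀ x, a - w - 4 ≤ x → x ≤ a - w → 0 < lg ψ 0 x) →
      (∀ x, a + w ≤ x → x ≤ a + w + 4 → lg ψ 0 x < 0) →
      ∀ t, 0 ≤ t → ∃ X, a - w - 4 + (4 * κ₀ ^ 2 - η) * t ≤ X ∧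
        X ≤ a + w + 4 + (4 * κ₀ ^ 2 + η) * t ∧ lg ψ t X = 0 := by
  obtain ⟨δ, δ0, ray⟩ := Wave.ray hg hm (half_pos hη)
  refine ⟨δ, δ0, fun V ψ κ κ₀ a w hs hψ hκ hw hk hlg hV hl hr t ht => ?_⟩
  obtain ⟨k1, k2⟩ := abs_le.1 hk
  have hφ := hψ.inv hs
  have ht' : 0 ≤ 2 * η * t := by positivity
  have hlg' : ∀ t, 0 ≤ t → ∀ x, |lg (fun t x => (ψ t x)⁻¹) t x| ≤ m := fun t ht x => by
    rw [hψ.lg_inv, abs_neg]; exact hlg t ht x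
  obtain ⟨y, hy, sy⟩ := ray _ _ κ (a - w - 2) (4 * κ₀ ^ 2 - η) (-1) (hψ.dar_sm hs) hφ hκ (by simp) hlg'
    (by linarith) (fun t ht => by
      simp only [add_assoc]
      exact hV t ht _ le_rfl) (fun y hy => by
      rw [hψ.lg_inv]
      obtain ⟨y1, y2⟩ := abs_le.1 hy
      have := hl (y + (a - w - 2)) (by linarith) (by linarith)
      linarith) t ht
  obtain ⟨z, hz, sz⟩ := ray _ _ κ (a + w + 2) (4 * κ₀ ^ 2 + η) 1 (hψ.dar_sm hs) hφ hκ (by simp) hlg'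
    (by linarith) (fun t ht => by
      simp only [add_assoc]
      refine hV t ht _ ?_
      have : 0 ≤ 2 * η * t := by positivity
      linarith) (fun y hy => by
      rw [hψ.lg_inv]
      obtain ⟨y1, y2⟩ := abs_le.1 hy
      have := hr (y + (a + w + 2)) (by linarith) (by linarith)
      linarith) t ht
  rw [hψ.lg_inv] at sy sz
  obtain ⟨y1, y2⟩ := abs_le.1 hy
  obtain ⟨z1, z2⟩ := abs_le.1 hz
  have hle : y + (a - w - 2) + (4 * κ₀ ^ 2 - η) * t ≤ z + (a + w + 2) + (4 * κ₀ ^ 2 + η) * t := by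
    linarith
  obtain ⟨X, hX, h0⟩ := intermediate_value_Icc' hle (hψ.lg_sm.cont_x t).continuousOn
    (show (0 : ℝ) ∈ _ from ⟨by linarith, by linarith⟩)
  exact ⟨X, by linarith [hX.1], by linarith [hX.2], h0⟩

end KdV

namespace KdV

open Set
set_option linter.unusedSimpArgs false

/-- Existence of the wave that removes the fastest soliton. -/
theorem exists_top_wave {g : ℝ} (hg : 0 < g) (n : ℕ) :
    ∃ C D₀, 0 < C ∧ 0 < D₀ ∧ ∀ (κ a L E : ℝ) (k b : ℕ → ℝ) (V : ℝ → ℝ → ℝ), Sol.KC V →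
      Box g κ n k → Sep a L n b → 0 ≤ L → E ≤ D₀ → exp (-(g * L)) ≤ E →
      L2le Set.univ (fun x => V 0 x - S κ (x - a) - SS k b n x) E →
      ∃ κ' ψ, Wave V κ' ψ ∧ (κ' - κ) ^ 2 ≤ C * E ∧
        L2le Set.univ (fun x => dar V κ' ψ 0 x - SS k (bs κ' k b) n x) (C * E) ∧
        ∀ x, (lg ψ 0 x - vr κ a k b n x) ^ 2 ≤ C * E := by
  obtain ⟨C, D₀, hC, hD, H⟩ := forward_riccati hg n
  obtain ⟨C', hC', H'⟩ := forward_L2 hg n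
  refine ⟨max C (C' * (1 + C)), D₀, by positivity, hD, ?_⟩
  intro κ a L E k b V hV B hS hL hE he h0
  have E0 : 0 ≤ E := h0.nonneg
  obtain ⟨κ', v, y, h1, h2, h3, h4, h5, h6⟩ := H κ a L E k b (V 0) B hS hL hE he h0
  have h7 := H' κ κ' a L E C k b (V 0) v y B hS hL he h0 h1 h2 h3 h5 h6
  have cv : Continuous v := continuous_iff_continuousAt.2 fun x => (h6 x).continuousAt
  have dp : ∀ x, HasDerivAt (fun x => exp (∫ s in (0 : ℝ)..x, v s))
      (v x * exp (∫ s in (0 : ℝ)..x, v s)) x := fun x =>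
    ((cv.integral_hasStrictDerivAt 0 x).hasDerivAt.exp).congr_deriv (by ring)
  obtain ⟨ψ, sm, i0, pos, xx, tt⟩ := hV.exists_wave κ' dp
    (fun x => ((h6 x).mul (dp x)).congr_deriv (by ring)) (fun x => exp_pos _)
  have w : Wave V κ' ψ := ⟨sm, pos, xx, tt⟩
  have l0 : ∀ x, lg ψ 0 x = v x := fun x => by
    have : ψ 0 = fun x => exp (∫ s in (0 : ℝ)..x, v s) := funext i0
    simp only [lg, Dx, this, (dp x).deriv]
    field_simp
  have m1 := mul_le_mul_of_nonneg_right (le_max_left C (C' * (1 + C))) E0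
  refine ⟨κ', ψ, w, h2.trans m1, ?_, fun x => ?_⟩
  · refine (h7.mono (mul_le_mul_of_nonneg_right (le_max_right C (C' * (1 + C))) E0)).congr ?_
    intro x
    simp only [dar, l0]
  · rw [l0, h3, add_sub_cancel_left]
    exact (h4 x).trans m1

/-- A trajectory that stays close to a sum of solitons. -/
structure Fit (k a : ℕ → ℝ) (η θ A W : ℝ) (n : ℕ) (V : ℝ → ℝ → ℝ) (κ : ℕ → ℝ)
    (X : ℝ → ℕ → ℝ) : Prop where
  near : ∀ j < n, (κ j - k j) ^ 2 ≤ A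
  lo : ∀ t, 0 ≤ t → ∀ j < n, a j - W + (4 * k j ^ 2 - η) * t ≤ X t j
  hi : ∀ t, 0 ≤ t → ∀ j < n, X t j ≤ a j + W + (4 * k j ^ 2 + η) * t
  l2 : ∀ t, 0 ≤ t → L2le Set.univ (fun x => V t x - SS κ (X t) n x) A
  lim : Tendsto (fun t => ∫ x in Ici (θ * t), (V t x - SS κ (X t) n x) ^ 2) atTop (nhds 0)

/-- Asymptotic stability of sums of `n` solitons. -/
def Stab (k : ℕ → ℝ) (η θ : ℝ) (n : ℕ) : Prop :=
  ∃ d γ K W, 0 < d ∧ 0 < γ ∧ 0 < K ∧ 0 ≤ W ∧ ∀ (V : ℝ → ℝ → ℝ) (a : ℕ → ℝ) (L ρ : ℝ), Sol.KC V →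
    (∀ j < n, ∀ i < j, a i + L ≤ a j) → 0 ≤ L → exp (-(γ * L)) ≤ ρ → ρ ≤ d →
    L2le Set.univ (fun x => V 0 x - SS k a n x) ρ → ∃ κ X, Fit k a η θ (K * ρ) W n V κ X

theorem stab_zero (k : ℕ → ℝ) (η : ℝ) {θ : ℝ} (hθ : 0 < θ) : Stab k η θ 0 := by
  obtain ⟨δ, hδ, H⟩ := Sol.KC.small_tendsto hθ
  refine ⟨δ ^ 2, 1, 1, 0, by positivity, one_pos, one_pos, le_rfl, ?_⟩
  intro V a L ρ hV _ _ _ hd h0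
  have e : ∀ (κ b : ℕ → ℝ) x, SS κ b 0 x = 0 := fun κ b x => by simp [SS]
  have h1 : ∫ x, V 0 x ^ 2 ≤ ρ := by simpa only [e, sub_zero] using h0.int
  refine ⟨0, 0, fun j hj => absurd hj (by simp), fun t _ j hj => absurd hj (by simp),
    fun t _ j hj => absurd hj (by simp), fun t _ => ?_, ?_⟩
  · simp only [e, sub_zero]
    refine L2le.univ (hV.i0 t) ?_
    rw [hV.l2 0 t, one_mul]
    exact h1
  · simpa only [e, sub_zero] using H V hV (h1.trans hd)

/-- Solitons with separated parameters have separated velocities. -/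
theorem Box.speed_gap {g η κ : ℝ} {n : ℕ} {k : ℕ → ℝ} (B : Box g κ n k) (hη : η ≤ g ^ 2) {i : ℕ}
    (hi : i < n) : 4 * k i ^ 2 + η + 6 * g ^ 2 ≤ 4 * κ ^ 2 - η := by
  have h0 := B.pos
  have h1 := B.lo i hi
  have h2 := B.hi i hi
  nlinarith

/-- Strips with separated velocities stay separated. -/
theorem sep_of_strip {g η W L t X : ℝ} {n : ℕ} {k a b : ℕ → ℝ} (hη : η ≤ g ^ 2)
    (hk : ∀ m ≤ n, Box g (k m) m k) (hL : ∀ j ≤ n, ∀ i < j, a i + L ≤ a j) (ht : 0 ≤ t)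
    (lo : ∀ j < n, a j - W + (4 * k j ^ 2 - η) * t ≤ b j)
    (hi : ∀ j < n, b j ≤ a j + W + (4 * k j ^ 2 + η) * t)
    (hX : a n - W + (4 * k n ^ 2 - η) * t ≤ X) : Sep X (L - 2 * W + 6 * g ^ 2 * t) n b := by
  have key : ∀ j ≤ n, ∀ i < j, (4 * k i ^ 2 + η) * t + 6 * g ^ 2 * t ≤ (4 * k j ^ 2 - η) * t := by
    intro j hj i hi
    have := mul_le_mul_of_nonneg_right ((hk j hj).speed_gap hη hi) ht
    linarith
  have main : ∀ j < n, ∀ i < j, L - 2 * W + 6 * g ^ 2 * t ≤ b j - b i := fun j hj i hij => by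
    linarith [key j hj.le i hij, hL j hj.le i hij, lo j hj, hi i (hij.trans hj)]
  refine ⟨fun j hj => ?_, fun i hi j hj hij => ?_⟩
  · linarith [key n le_rfl j hj, hL n le_rfl j hj, hi j hj]
  · rcases lt_or_gt_of_ne hij with h | h
    · rw [abs_sub_comm]
      exact (main j hj i h).trans (le_abs_self _)
    · exact (main i hi j h).trans (le_abs_self _)

end KdV

namespace KdV

open Set
set_option linter.unusedSimpArgs false

theorem exists_small {M q : ℝ} (hM : 0 ≤ M) (hq : 0 < q) : ∃ d, 0 < d ∧ ∀ ρ ≤ d, M * ρ ≤ q := by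
  refine ⟨q / (M + 1), by positivity, fun ρ h => ?_⟩
  calc M * ρ ≤ M * (q / (M + 1)) := mul_le_mul_of_nonneg_left h hM
    _ = q * (M / (M + 1)) := by ring
    _ ≤ q * 1 := mul_le_mul_of_nonneg_left ((div_le_one (by positivity)).2 (by linarith)) hq.le
    _ = q := mul_one q

set_option maxHeartbeats 400000 in
/-- Position of the fastest soliton at all later times. -/
theorem exists_position {g η A W : ℝ} (hg : 0 < g) (hη : 0 < η) (hηg : η ≤ g ^ 2) (hA : 0 < A)
    (hW : 0 ≤ W) (n : ℕ) : ∃ d c, 0 < d ∧ 0 ≤ c ∧ ∀ (V ψ : ℝ → ℝ → ℝ) (κ' : ℝ) (k a κ : ℕ → ℝ)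
      (Y : ℝ → ℕ → ℝ) (L ρ : ℝ), Sol.KC V → Wave V κ' ψ → (∀ m ≤ n, Box g (k m) m k) →
      (∀ j < n, a j + L ≤ a n) → exp (-(g / 2 * L)) ≤ ρ → ρ ≤ d → (κ' - k n) ^ 2 ≤ A * ρ →
      (∀ x, (lg ψ 0 x - vr (k n) (a n) k a n x) ^ 2 ≤ A * ρ) →
      (∀ j < n, (κ j - k j) ^ 2 ≤ A * ρ) →
      (∀ t, 0 ≤ t → ∀ j < n, Y t j ≤ a j + W + (4 * k j ^ 2 + η) * t) →
      (∀ t, 0 ≤ t → L2le Set.univ (fun x => dar V κ' ψ t x - SS κ (Y t) n x) (A * ρ)) →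
      ∀ t, 0 ≤ t → ∃ X, a n - c + (4 * k n ^ 2 - η) * t ≤ X ∧ X ≤ a n + c + (4 * k n ^ 2 + η) * t ∧
        lg ψ t X = 0 := by
  have hg2 : 0 < g / 2 := by positivity
  obtain ⟨w, hw⟩ : ∃ w, w = artanh (3 / 4) / g := ⟨_, rfl⟩
  have w0 : 0 ≤ w := by
    have a0 : 0 < artanh (3 / 4 : ℝ) := artanh_pos (by norm_num)
    rw [hw]; positivity
  obtain ⟨c₀, hc₀⟩ : ∃ c, c = w + 4 + W := ⟨_, rfl⟩
  have c0 : 0 ≤ c₀ := by linarith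
  obtain ⟨B, hB⟩ : ∃ B, B = 2 * A + 2 * ((8 * (g / 2)⁻¹ ^ 2) ^ 2 * (n ^ 2 * (g / 2)⁻¹)) := ⟨_, rfl⟩
  obtain ⟨m, hm⟩ : ∃ m, m = (2 * g⁻¹) ^ 2 + 2 * g⁻¹ + B + 4 := ⟨_, rfl⟩
  have B0 : 0 ≤ B := by rw [hB]; positivity
  have m0 : 0 ≤ m := by rw [hm]; positivity
  obtain ⟨δ, hδ, H⟩ := Wave.track hg2 hη m0
  obtain ⟨ε, hε⟩ : ∃ ε, ε = min (g / 8) (η * g / 24) := ⟨_, rfl⟩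
  have ε0 : 0 < ε := by rw [hε]; positivity
  have ε1 : ε ≤ g / 8 := by rw [hε]; exact min_le_left _ _
  have ε2 : ε ≤ η * g / 24 := by rw [hε]; exact min_le_right _ _
  obtain ⟨d₁, d₁0, h₁⟩ := exists_small hA.le (show 0 < ε ^ 2 by positivity)
  obtain ⟨d₂, d₂0, h₂⟩ := exists_small (M := n * (4 * g⁻¹ ^ 3) * exp (2 * g * (w + 4)))
    (q := g / 4) (by positivity) (by positivity)
  obtain ⟨d₃, d₃0, h₃⟩ := exists_small
    (M := 2 * A + 8 * (n * (8 * (g / 2)⁻¹ ^ 2)) ^ 2 * exp (g * c₀)) (q := δ ^ 2)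
    (by positivity) (by positivity)
  refine ⟨min (min 1 (exp (-(g / 2 * c₀)))) (min d₁ (min d₂ d₃)), w + 4, by positivity, by linarith, ?_⟩
  intro V ψ κ' k a κ Y L ρ hV hψ hk hL he hd hκ' hy hκ hY h2 t ht
  obtain ⟨⟨r1, r2⟩, r3, r4, r5⟩ : (ρ ≤ 1 ∧ ρ ≤ exp (-(g / 2 * c₀))) ∧ ρ ≤ d₁ ∧ ρ ≤ d₂ ∧ ρ ≤ d₃ := by
    simpa only [le_min_iff] using hd
  replace h₁ := h₁ ρ r3
  replace h₂ := h₂ ρ r4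
  replace h₃ := h₃ ρ r5
  have ρ0 : 0 < ρ := (exp_pos _).trans_le he
  have cL : c₀ ≤ L := by
    have := exp_le_exp.1 (he.trans r2)
    exact le_of_mul_le_mul_left (by linarith) hg2
  have gL : 0 ≤ g * L := mul_nonneg hg.le (c0.trans cL)
  have Aρ : A * ρ ≤ A := mul_le_of_le_one_right hA.le r1
  have Bk := hk n le_rfl
  have kc : |κ' - k n| ≤ ε := abs_le_of_sq_le_sq (hκ'.trans h₁) ε0.le
  have Bn : Box (g / 2) κ' n κ := Bk.perturb₂ (kc.trans (by linarith)) fun j hj =>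
    (abs_le_of_sq_le_sq ((hκ j hj).trans h₁) ε0.le).trans (by linarith)
  have κinv : κ' ≤ 2 * g⁻¹ := by
    have := Bn.inv
    rw [inv_div] at this
    linarith [this, div_eq_mul_inv 2 g]
  have κ0 := Bn.κpos
  have yb : ∀ x, |lg ψ 0 x - vr (k n) (a n) k a n x| < g / 4 := fun x =>
    (abs_le_of_sq_le_sq ((hy x).trans h₁) ε0.le).trans_lt (by linarith)
  have ex : n * (4 * g⁻¹ ^ 3) * exp (-(2 * g * (L - w - 4))) ≤ g / 4 := by
    refine le_trans ?_ h₂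
    have : exp (-(2 * g * (L - w - 4))) ≤ exp (2 * g * (w + 4)) * ρ := by
      refine le_trans ?_ (mul_le_mul_of_nonneg_left he (exp_pos _).le)
      rw [← exp_add]
      exact exp_le_exp.2 (by linarith)
    calc _ ≤ n * (4 * g⁻¹ ^ 3) * (exp (2 * g * (w + 4)) * ρ) :=
          mul_le_mul_of_nonneg_left this (by positivity)
      _ = _ := by ring
  have lgm : ∀ t, 0 ≤ t → ∀ x, |lg ψ t x| ≤ m := by
    intro t _ x
    have b0 : ∫ x, dar V κ' ψ 0 x ^ 2 ≤ B := by
      have e := (h2 0 le_rfl).add (L2le.univ (Bn.sqI_SS (b := Y 0)) Bn.int_SS_le)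
      have e' : L2le Set.univ (dar V κ' ψ 0) _ := e.congr fun x => by ring
      refine e'.int.trans ?_
      rw [hB]
      linarith
    have := hψ.inv hV.sm |>.lg_le (hψ.dar_kc hV) κ0.le b0 t x
    rw [hψ.lg_inv, abs_neg] at this
    refine this.trans ?_
    rw [hm]
    linarith [pow_le_pow_left₀ κ0.le κinv 2]
  refine (H V ψ κ' (k n) (a n) w hV.sm hψ Bn.le w0 ?_ lgm ?_ ?_ ?_ t ht).imp fun X hX =>
    ⟨by linarith [hX.1], by linarith [hX.2.1], hX.2.2⟩
  · have e : 4 * κ' ^ 2 - 4 * k n ^ 2 = 4 * (κ' + k n) * (κ' - k n) := by ring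
    have kn := Bk.κpos
    rw [e, abs_mul, abs_of_pos (by positivity)]
    calc 4 * (κ' + k n) * |κ' - k n| ≤ 4 * (2 * g⁻¹ + g⁻¹) * (η * g / 24) :=
          mul_le_mul (by linarith [Bk.inv]) (kc.trans ε2) (abs_nonneg _) (by positivity)
      _ = η / 2 := by field_simp; norm_num
  · intro t ht p hp
    refine (Bn.window (b := Y t) (l := L - c₀) (h2 t ht) (fun j hj => ?_) (by linarith)).trans ?_
    · have := mul_le_mul_of_nonneg_right (Bk.speed_gap hηg hj) ht
      have := mul_nonneg (sq_nonneg g) ht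
      linarith [hY t ht j hj, hL j hj]
    · refine le_trans ?_ h₃
      have : exp (-(2 * (g / 2) * (L - c₀))) ≤ exp (g * c₀) * ρ := by
        refine le_trans ?_ (mul_le_mul_of_nonneg_left he (exp_pos _).le)
        rw [← exp_add]
        exact exp_le_exp.2 (by linarith)
      have := mul_le_mul_of_nonneg_left this
        (show 0 ≤ 8 * (n * (8 * (g / 2)⁻¹ ^ 2)) ^ 2 by positivity)
      linarith
  · intro x hx1 hx2
    have := (Bk.vr_sign (a := a n) (b := a) (x := x) (l := L - w - 4)
      (fun j hj => by linarith [hL j hj]) ex).2 (by rw [← hw]; linarith)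
    linarith [(abs_lt.1 (yb x)).1]
  · intro x hx1 hx2
    have := (Bk.vr_sign (a := a n) (b := a) (x := x) (l := L - w - 4)
      (fun j hj => by linarith [hL j hj]) ex).1 (by rw [← hw]; linarith)
    linarith [(abs_lt.1 (yb x)).2]

end KdV

namespace KdV

open Set
set_option linter.unusedSimpArgs false

theorem SS_succ_ite (κ b : ℕ → ℝ) (κ' X : ℝ) (n : ℕ) (x : ℝ) :
    SS (fun j => if j < n then κ j else κ') (fun j => if j < n then b j else X) (n + 1) x =
      S κ' (x - X) + SS κ b n x := by
  simp only [SS, Finset.sum_range_succ, lt_irrefl, if_false]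
  rw [add_comm]
  congr 1
  refine Finset.sum_congr rfl fun j hj => ?_
  simp only [Finset.mem_range.1 hj, if_true]

/-- Putting back the fastest soliton. -/
theorem Fit.succ {g η θ A A' W σ c L C D κ' : ℝ} {n : ℕ} {k a κ : ℕ → ℝ} {V ψ : ℝ → ℝ → ℝ}
    {X : ℝ → ℝ} {Y : ℝ → ℕ → ℝ} (hg : 0 < g) (hηg : η ≤ g ^ 2) (hk : ∀ m ≤ n, Box g (k m) m k)
    (hθ : θ < 4 * k n ^ 2 - η) (hL : ∀ j ≤ n, ∀ i < j, a i + L ≤ a j) (hV : Sol.KC V)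
    (hψ : Wave V κ' ψ) (Bn : Box (g / 2) κ' n κ)
    (F : Fit k (bs κ' k a) η θ A W n (dar V κ' ψ) κ Y)
    (hs : ∀ j < n, 0 ≤ sg κ' (k j) ∧ sg κ' (k j) ≤ σ) (hs' : ∀ j < n, 0 ≤ sg κ' (κ j) ∧ sg κ' (κ j) ≤ σ)
    (hW : 0 ≤ W) (hc : 0 ≤ c) (hσ : 0 ≤ σ)
    (hX : ∀ t, 0 ≤ t → a n - c + (4 * k n ^ 2 - η) * t ≤ X t ∧
      X t ≤ a n + c + (4 * k n ^ 2 + η) * t ∧ lg ψ t (X t) = 0)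
    (hD : 0 < D)
    (back : ∀ (κ X L E e : ℝ) (k b : ℕ → ℝ) (V V₁ v : ℝ → ℝ), Box (g / 2) κ n k → Sep X L n b →
      0 ≤ L → exp (-(g / 2 * L)) ≤ E → E ≤ D → e ≤ X →
      L2le (Ici e) (fun x => V₁ x - SS k (bs κ k b) n x) E →
      SqI (fun x => V x - S κ (x - X) - SS k b n x) → v X = 0 →
      (∀ x, HasDerivAt v (v x ^ 2 - κ ^ 2 - V₁ x) x) → (∀ x, V x = 2 * v x ^ 2 - 2 * κ ^ 2 - V₁ x) →
      L2le (Ici e) (fun x => V x - S κ (x - X) - SS k b n x) (C * E))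
    (hLW : 2 * (W + σ + c) ≤ L) (hE : A + exp (-(g / 2 * (L - 2 * (W + σ + c)))) ≤ D)
    (hA₀ : (κ' - k n) ^ 2 ≤ A') (hA₁ : A ≤ A')
    (hA₂ : C * (A + exp (-(g / 2 * (L - 2 * (W + σ + c))))) ≤ A') :
    ∃ κ X, Fit k a η θ A' (W + σ + c) (n + 1) V κ X := by
  obtain ⟨W₁, hW₁⟩ : ∃ w, w = W + σ + c := ⟨_, rfl⟩
  rw [← hW₁] at hLW hE hA₂ ⊢
  have κ0 := Bn.κpos
  obtain ⟨b, hb⟩ : ∃ b : ℝ → ℕ → ℝ, b = fun t j => Y t j - sg κ' (κ j) := ⟨_, rfl⟩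
  have bb : ∀ t, bs κ' κ (b t) = Y t := fun t => by
    ext j
    simp [bs, hb]
  have lo : ∀ t, 0 ≤ t → ∀ j < n, a j - W₁ + (4 * k j ^ 2 - η) * t ≤ b t j := fun t ht j hj => by
    have := F.lo t ht j hj
    simp only [bs] at this
    simp only [hb]
    linarith [hs j hj, hs' j hj]
  have hi : ∀ t, 0 ≤ t → ∀ j < n, b t j ≤ a j + W₁ + (4 * k j ^ 2 + η) * t := fun t ht j hj => by
    have := F.hi t ht j hj
    simp only [bs] at this
    simp only [hb]
    linarith [hs j hj, hs' j hj]
  have sep : ∀ t, 0 ≤ t → Sep (X t) (L - 2 * W₁ + 6 * g ^ 2 * t) n (b t) := fun t ht =>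
    sep_of_strip hηg hk hL ht (lo t ht) (hi t ht) (by linarith [(hX t ht).1])
  have sq : ∀ t, SqI (fun x => V t x - S κ' (x - X t) - SS κ (b t) n x) := fun t =>
    ((hV.i0 t).sub (SqI.soliton κ0 _)).sub Bn.sqI_SS
  have key : ∀ t, 0 ≤ t → ∀ E e, exp (-(g / 2 * (L - 2 * W₁ + 6 * g ^ 2 * t))) ≤ E → E ≤ D →
      e ≤ X t → ∫ x in Ici e, (dar V κ' ψ t x - SS κ (Y t) n x) ^ 2 ≤ E →
      L2le (Ici e) (fun x => V t x - S κ' (x - X t) - SS κ (b t) n x) (C * E) := by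
    intro t ht E e h1 h2 h3 h4
    refine back κ' (X t) _ E e κ (b t) (V t) (dar V κ' ψ t) (lg ψ t) Bn (sep t ht) ?_ h1 h2 h3
      ⟨?_, ?_⟩ (sq t) (hX t ht).2.2 (hψ.lg_hasDeriv t) fun x => ?_
    · have : 0 ≤ 6 * g ^ 2 * t := by positivity
      linarith
    · rw [bb]
      exact (F.l2 t ht).1
    · rw [bb]
      exact h4
    · simp only [dar]
      ring
  refine ⟨fun j => if j < n then κ j else κ', fun t j => if j < n then b t j else X t, ?_, ?_, ?_, ?_, ?_⟩
  · intro j hj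
    rcases Nat.lt_succ_iff_lt_or_eq.1 hj with h | rfl
    · simpa only [h, if_true] using (F.near j h).trans hA₁
    · simpa only [lt_irrefl, if_false] using hA₀
  · intro t ht j hj
    rcases Nat.lt_succ_iff_lt_or_eq.1 hj with h | rfl
    · simpa only [h, if_true] using lo t ht j h
    · simp only [lt_irrefl, if_false]
      linarith [(hX t ht).1]
  · intro t ht j hj
    rcases Nat.lt_succ_iff_lt_or_eq.1 hj with h | rfl
    · simpa only [h, if_true] using hi t ht j h
    · simp only [lt_irrefl, if_false]
      linarith [(hX t ht).2.1]
  · intro t ht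
    simp only [SS_succ_ite, ← sub_sub]
    refine (L2le.of_Ici (sq t) (X := X t) fun e he => ?_).mono hA₂
    refine (key t ht _ e ?_ hE he ?_).le
    · refine (exp_le_exp.2 ?_).trans (le_add_of_nonneg_left (F.l2 0 le_rfl).nonneg)
      have : 0 ≤ g / 2 * (6 * g ^ 2 * t) := by positivity
      linarith
    · exact ((F.l2 t ht).restrict (s := Ici e)).le.trans (le_add_of_nonneg_right (exp_pos _).le)
  · simp only [SS_succ_ite, ← sub_sub]
    have e0 : Tendsto (fun t => exp (-(g / 2 * (L - 2 * W₁ + 6 * g ^ 2 * t)))) atTop (nhds 0) := by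
      refine tendsto_exp_neg_atTop_nhds_zero.comp ?_
      refine Tendsto.const_mul_atTop (by positivity) (tendsto_atTop_add_const_left _ _ ?_)
      exact tendsto_id.const_mul_atTop (by positivity)
    have e1 := F.lim.add e0
    rw [add_zero] at e1
    have e2 := e1.const_mul C
    rw [mul_zero] at e2
    have e3 : ∀ᶠ t in atTop, θ * t ≤ X t := by
      have : Tendsto (fun t => (4 * k n ^ 2 - η - θ) * t) atTop atTop :=
        tendsto_id.const_mul_atTop (by linarith)
      filter_upwards [this.eventually_ge_atTop (c - a n), eventually_ge_atTop 0] with t h1 h2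
      linarith [(hX t h2).1]
    refine squeeze_zero' (Eventually.of_forall fun t => setInt_sq_nonneg _ _) ?_ e2
    filter_upwards [e3, eventually_ge_atTop 0, e1.eventually_le_const hD] with t h1 h2 h3
    exact (key t h2 _ _ (le_add_of_nonneg_left (setInt_sq_nonneg _ _)) h3 h1
      (le_add_of_nonneg_right (exp_pos _).le)).le

end KdV

namespace KdV

open Set
set_option linter.unusedSimpArgs false

theorem stab_succ {g η θ : ℝ} {n : ℕ} {k : ℕ → ℝ} (hg : 0 < g) (hη : 0 < η) (hηg : η ≤ g ^ 2)
    (hk : ∀ m ≤ n, Box g (k m) m k) (hθ : θ < 4 * k n ^ 2 - η) (h : Stab k η θ n) :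
    Stab k η θ (n + 1) := by
  have hg2 : 0 < g / 2 := by positivity
  obtain ⟨d₁, γ', K', W, d₁0, γ0, K0, W0, H⟩ := h
  obtain ⟨σ, hσ, σ0⟩ : ∃ σ, artanh (1 - (g / 2) ^ 2) / (g / 2) ≤ σ ∧ 0 ≤ σ :=
    ⟨max (artanh (1 - (g / 2) ^ 2) / (g / 2)) 0, le_max_left _ _, le_max_right _ _⟩
  obtain ⟨C₁, D₁, C₁0, D₁0, H₁⟩ := exists_top_wave hg n
  obtain ⟨M, hM₁, hM₂, M0⟩ : ∃ M, C₁ ≤ M ∧ exp (γ' * σ) ≤ M ∧ 0 < M :=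
    ⟨max C₁ (exp (γ' * σ)), le_max_left _ _, le_max_right _ _, by positivity⟩
  obtain ⟨A, hA₁, hA₂, A0⟩ : ∃ A, C₁ ≤ A ∧ K' * M ≤ A ∧ 0 < A :=
    ⟨max C₁ (K' * M), le_max_left _ _, le_max_right _ _, by positivity⟩
  obtain ⟨D₂, c, D₂0, c0, H₂⟩ := exists_position hg hη hηg A0 (add_nonneg W0 σ0) n
  obtain ⟨C₃, D₃, C₃0, D₃0, H₃⟩ := backward_L2 hg2 n
  obtain ⟨W₁, hW₁⟩ : ∃ w, w = W + σ + c := ⟨_, rfl⟩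
  obtain ⟨N, hN⟩ : ∃ N, N = A + exp (g * W₁) := ⟨_, rfl⟩
  have N0 : 0 < N := by rw [hN]; positivity
  obtain ⟨e₁, e₁0, h₁⟩ := exists_small M0.le d₁0
  obtain ⟨e₂, e₂0, h₂⟩ := exists_small N0.le D₃0
  obtain ⟨e₃, e₃0, h₃⟩ := exists_small A0.le (show 0 < (g / 4) ^ 2 by positivity)
  refine ⟨min (exp (-(g / 2 * (2 * W₁)))) (min D₁ (min D₂ (min e₁ (min e₂ e₃)))), min (g / 2) γ',
    max A (C₃ * N), W₁, by positivity, by positivity, by positivity, by rw [hW₁]; positivity, ?_⟩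
  intro V a L ρ hV hL L0 he hd h0
  obtain ⟨r1, r2, r3, r4, r5, r6⟩ : ρ ≤ exp (-(g / 2 * (2 * W₁))) ∧ ρ ≤ D₁ ∧ ρ ≤ D₂ ∧ ρ ≤ e₁ ∧
    ρ ≤ e₂ ∧ ρ ≤ e₃ := by simpa only [le_min_iff] using hd
  have ρ0 : 0 < ρ := (exp_pos _).trans_le he
  have he₁ : exp (-(g / 2 * L)) ≤ ρ := (exp_le_exp.2 (neg_le_neg
    (mul_le_mul_of_nonneg_right (min_le_left _ _) L0))).trans he
  have he₂ : exp (-(γ' * L)) ≤ ρ := (exp_le_exp.2 (neg_le_neg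
    (mul_le_mul_of_nonneg_right (min_le_right _ _) L0))).trans he
  have gL : 0 ≤ g / 2 * L := by positivity
  have he₃ : exp (-(g * L)) ≤ ρ := (exp_le_exp.2 (by linarith)).trans he₁
  have LW : 2 * W₁ ≤ L := by
    have := exp_le_exp.1 (he₁.trans r1)
    exact le_of_mul_le_mul_left (by linarith) hg2
  have σL : σ ≤ L := by linarith
  have hL' : ∀ j ≤ n, ∀ i < j, a i + L ≤ a j := fun j hj i hi => hL j (Nat.lt_succ_of_le hj) i hi
  have sep : Sep (a n) L n a := by
    refine ⟨fun j hj => hL' n le_rfl j hj, fun i hi j hj hij => ?_⟩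
    rcases lt_or_gt_of_ne hij with h | h
    · rw [abs_sub_comm]
      exact le_trans (by linarith [hL' j hj.le i h]) (le_abs_self _)
    · exact le_trans (by linarith [hL' i hi.le j h]) (le_abs_self _)
  have Bk := hk n le_rfl
  obtain ⟨κ', ψ, hψ, f1, f2, f3⟩ := H₁ (k n) (a n) L ρ k a V hV Bk sep L0 r2 he₃
    (h0.congr fun x => by simp only [SS, Finset.sum_range_succ]; ring)
  have m1 : C₁ * ρ ≤ A * ρ := mul_le_mul_of_nonneg_right hA₁ ρ0.le
  have m2 : K' * (M * ρ) ≤ A * ρ := by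
    rw [← mul_assoc]
    exact mul_le_mul_of_nonneg_right hA₂ ρ0.le
  have q1 : |κ' - k n| ≤ g / 4 :=
    abs_le_of_sq_le_sq ((f1.trans m1).trans (h₃ ρ r6)) (by positivity)
  have B₀ : Box (g / 2) κ' n k := Bk.perturb₂ q1 fun j _ => by
    rw [sub_self, abs_zero]
    positivity
  have hs : ∀ j < n, 0 ≤ sg κ' (k j) ∧ sg κ' (k j) ≤ σ := fun j hj =>
    ⟨(B₀.sg_bounds hj).1, (B₀.sg_bounds hj).2.trans hσ⟩
  obtain ⟨κ, Y, F⟩ := H (dar V κ' ψ) (bs κ' k a) (L - σ) (M * ρ) (hψ.dar_kc hV)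
    (fun j hj i hi => by
      simp only [bs]
      linarith [hL' j hj.le i hi, (hs j hj).1, (hs i (hi.trans hj)).2]) (by linarith)
    (by
      calc exp (-(γ' * (L - σ))) = exp (γ' * σ) * exp (-(γ' * L)) := by rw [← exp_add]; ring_nf
        _ ≤ M * ρ := mul_le_mul hM₂ he₂ (exp_pos _).le M0.le) (h₁ ρ r4)
    (f2.mono (mul_le_mul_of_nonneg_right hM₁ ρ0.le))
  have κk : ∀ j < n, (κ j - k j) ^ 2 ≤ A * ρ := fun j hj => (F.near j hj).trans m2
  have Bn : Box (g / 2) κ' n κ := Bk.perturb₂ q1 fun j hj =>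
    abs_le_of_sq_le_sq ((κk j hj).trans (h₃ ρ r6)) (by positivity)
  have hs' : ∀ j < n, 0 ≤ sg κ' (κ j) ∧ sg κ' (κ j) ≤ σ := fun j hj =>
    ⟨(Bn.sg_bounds hj).1, (Bn.sg_bounds hj).2.trans hσ⟩
  have P := H₂ V ψ κ' k a κ Y L ρ hV hψ hk (hL' n le_rfl) he₁ r3 (f1.trans m1)
    (fun x => (f3 x).trans m1) κk
    (fun t ht j hj => by
      have := F.hi t ht j hj
      simp only [bs] at this
      linarith [(hs j hj).2])
    (fun t ht => (F.l2 t ht).mono m2)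
  choose! X hX using P
  have ex : exp (-(g / 2 * (L - 2 * W₁))) ≤ exp (g * W₁) * ρ := by
    calc exp (-(g / 2 * (L - 2 * W₁))) = exp (g * W₁) * exp (-(g / 2 * L)) := by
          rw [← exp_add]; ring_nf
      _ ≤ _ := mul_le_mul_of_nonneg_left he₁ (exp_pos _).le
  have hE : K' * (M * ρ) + exp (-(g / 2 * (L - 2 * W₁))) ≤ N * ρ := by
    rw [hN]
    linarith
  have m3 : A * ρ ≤ max A (C₃ * N) * ρ := mul_le_mul_of_nonneg_right (le_max_left _ _) ρ0.le
  have m4 : C₃ * (N * ρ) ≤ max A (C₃ * N) * ρ := by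
    rw [← mul_assoc]
    exact mul_le_mul_of_nonneg_right (le_max_right _ _) ρ0.le
  rw [hW₁] at LW hE ⊢
  exact F.succ hg hηg hk hθ hL' hV hψ Bn hs hs' W0 c0 σ0 hX D₃0 H₃ LW
    (hE.trans (h₂ ρ r5)) ((f1.trans m1).trans m3) (m2.trans m3)
    ((mul_le_mul_of_nonneg_left hE C₃0.le).trans m4)

theorem stab {g η θ : ℝ} {N : ℕ} {k : ℕ → ℝ} (hg : 0 < g) (hη : 0 < η) (hηg : η ≤ g ^ 2) (θ0 : 0 < θ)
    (hk : ∀ m < N, Box g (k m) m k) (hθ : ∀ m < N, θ < 4 * k m ^ 2 - η) : Stab k η θ N := by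
  suffices ∀ n ≤ N, Stab k η θ n from this N le_rfl
  intro n
  induction n with
  | zero => exact fun _ => stab_zero k η θ0
  | succ n ih =>
    exact fun hn => stab_succ hg hη hηg (fun m hm => hk m (by omega)) (hθ n (by omega)) (ih (by omega))

end KdV

namespace KdV
open Set

theorem SqI.of_decay {f : ℝ → ℝ} (hf : Continuous f) {C₀ C₁ : ℝ} (h₀ : ∀ x, |x| ^ 0 * |f x| ≤ C₀)
    (h₁ : ∀ x, |x| ^ 1 * |f x| ≤ C₁) : SqI f := by
  refine ⟨hf, (integrable_inv_one_add_sq.const_mul (C₀ ^ 2 + C₁ ^ 2)).mono'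
    (hf.pow 2).aestronglyMeasurable (Eventually.of_forall fun x => ?_)⟩
  have h2 := pow_le_pow_left₀ (by positivity) (h₀ x) 2
  have h3 := pow_le_pow_left₀ (by positivity) (h₁ x) 2
  simp only [pow_zero, one_mul, pow_one, mul_pow, sq_abs] at h2 h3
  rw [norm_eq_abs, abs_of_nonneg (sq_nonneg _), ← div_eq_mul_inv, le_div_iff₀ (by positivity)]
  linarith

theorem reg_of_isKdVSolution {u : ℝ → ℝ → ℝ} (hu : IsKdVSolution u) :
    Sol.Reg fun t x => -(1 / 3) * u t x := by
  obtain ⟨h0, h1, h2⟩ := hu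
  have s0 : Sm u := h0
  have sq : ∀ {w : ℝ → ℝ → ℝ} (n : ℕ), Sm w → (∀ t, iteratedDeriv n (u t) = w t) →
      ∀ t, SqI fun x => -(1 / 3) * w t x := fun n sw hw t => by
    obtain ⟨C₀, hC₀⟩ := h1 t 0 n
    obtain ⟨C₁, hC₁⟩ := h1 t 1 n
    rw [hw] at hC₀ hC₁
    exact (SqI.of_decay (sw.cont_x t) hC₀ hC₁).cmul _
  have i1 : ∀ t, iteratedDeriv 1 (u t) = Dx u t := fun t => iteratedDeriv_one
  have i2 : ∀ t, iteratedDeriv 2 (u t) = Dx (Dx u) t := fun t => by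
    rw [iteratedDeriv_succ, i1]
    rfl
  have i3 : ∀ t, iteratedDeriv 3 (u t) = Dx (Dx (Dx u)) t := fun t => by
    rw [iteratedDeriv_succ, i2]
    rfl
  have dc : ∀ {w : ℝ → ℝ → ℝ}, Sm w →
      Dx (fun t x => -(1 / 3) * w t x) = fun t x => -(1 / 3) * Dx w t x := fun _ => by
    ext t x
    exact deriv_const_mul_field _
  have d1 : Dx (fun t x => -(1 / 3) * u t x) = fun t x => -(1 / 3) * Dx u t x := dc s0
  have d2 : Dx (fun t x => -(1 / 3) * Dx u t x) = fun t x => -(1 / 3) * Dx (Dx u) t x :=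
    dc s0.dx
  have d3 : Dx (fun t x => -(1 / 3) * Dx (Dx u) t x) = fun t x => -(1 / 3) * Dx (Dx (Dx u)) t x :=
    dc s0.dx.dx
  refine ⟨⟨s0.cmul _, fun t x => ?_⟩, ?_, ?_, ?_, ?_⟩
  · have e1 : Dt (fun t x => -(1 / 3) * u t x) t x = -(1 / 3) * Dt u t x := by
      simp only [Dt]
      exact deriv_const_mul_field _
    have e2 := ((s0.dx.dx.hasDx t x).add ((s0.hasDx t x).fun_pow 2)).deriv
    have e3 := h2 t x
    simp only [d1, d2, d3, e1]
    change Dt u t x + _ = 0 at e3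
    have e4 : deriv (fun y => deriv (deriv (u t)) y + u t y ^ 2) x =
      Dx (Dx (Dx u)) t x + (2 : ℕ) * u t x ^ (2 - 1) * Dx u t x := e2
    rw [e4] at e3
    norm_num at e3
    linarith
  · exact sq 0 s0 fun t => iteratedDeriv_zero
  · rw [d1]; exact sq 1 s0.dx i1
  · rw [d1, d2]; exact sq 2 s0.dx.dx i2
  · rw [d1, d2, d3]; exact sq 3 s0.dx.dx.dx i3

theorem Q_eq {κ : ℝ} (hκ : 0 < κ) (s : ℝ) : Q (4 * κ ^ 2) s = -3 * S κ s := by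
  have h1 : √(4 * κ ^ 2) = 2 * κ := by
    rw [show 4 * κ ^ 2 = (2 * κ) ^ 2 by ring, sqrt_sq (by positivity)]
  have h2 : 0 < cosh (κ * s) := cosh_pos _
  rw [Q, S, h1, mul_assoc, cosh_two_mul, tanh_eq_sinh_div_cosh]
  have h3 := cosh_sq (κ * s)
  have h4 : 1 + (cosh (κ * s) ^ 2 + sinh (κ * s) ^ 2) = 2 * cosh (κ * s) ^ 2 := by rw [h3]; ring
  rw [h4, div_pow, one_sub_div (by positivity), h3, add_sub_cancel_left, ← h3]
  field_simp
  norm_num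

theorem sum_Q_eq {N : ℕ} {κ : ℕ → ℝ} (hκ : ∀ j < N, 0 < κ j) (b : ℕ → ℝ) (x : ℝ) :
    ∑ j : Fin N, Q (4 * κ j ^ 2) (x - b j) = -3 * SS κ b N x := by
  rw [SS, Finset.sum_range, Finset.mul_sum]
  exact Finset.sum_congr rfl fun j _ => Q_eq (hκ j j.2) _

theorem sub_sum_Q_sq {N : ℕ} {κ : ℕ → ℝ} (hκ : ∀ j < N, 0 < κ j) (b : ℕ → ℝ) (v x : ℝ) :
    (v - ∑ j : Fin N, Q (4 * κ j ^ 2) (x - b j)) ^ 2 = 9 * (-(1 / 3) * v - SS κ b N x) ^ 2 := by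
  rw [sum_Q_eq hκ]
  ring

/-- A finite increasing family of positive numbers fits into a box. -/
theorem exists_box {N : ℕ} {k : ℕ → ℝ} (h0 : ∀ m < N, 0 < k m) (h1 : ∀ m < N, ∀ i < m, k i < k m) :
    ∃ g, 0 < g ∧ ∀ m < N, Box g (k m) m k := by
  have a1 : ∀ x : ℝ, 0 < x → ∀ᶠ g in nhdsWithin (0 : ℝ) (Ioi 0), g ≤ x := fun x hx =>
    eventually_nhdsWithin_of_eventually_nhds (eventually_le_nhds hx)
  have a2 : ∀ᶠ g in nhdsWithin (0 : ℝ) (Ioi 0), ∀ m ∈ Finset.range N, Box g (k m) m k := by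
    rw [Filter.eventually_all_finset]
    intro m hm
    rw [Finset.mem_range] at hm
    have a3 : ∀ᶠ g in nhdsWithin (0 : ℝ) (Ioi 0), ∀ i ∈ Finset.range m, g ≤ k i ∧ g ≤ k m - k i := by
      rw [Filter.eventually_all_finset]
      intro i hi
      rw [Finset.mem_range] at hi
      exact (a1 _ (h0 i (hi.trans hm))).and (a1 _ (sub_pos.2 (h1 m hm i hi)))
    filter_upwards [a3, a1 _ (h0 m hm), tendsto_inv_nhdsGT_zero.eventually_ge_atTop (k m),
      self_mem_nhdsWithin] with g b1 b2 b3 b4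
    exact ⟨b4, b2, b3, fun j hj => (b1 j (Finset.mem_range.2 hj)).1, fun j hj => by
      linarith [(b1 j (Finset.mem_range.2 hj)).2]⟩
  obtain ⟨g, hg, g0⟩ := (a2.and self_mem_nhdsWithin).exists
  exact ⟨g, g0, fun m hm => hg m (Finset.mem_range.2 hm)⟩

end KdV

/-- Asymptotic `L²`-stability of the sum of `N` solitons of KdV. -/
theorem kdv_sum_of_solitons_L2_asymptotic_stability
    (N : ℕ) (hN : 2 ≤ N) (c : Fin N → ℝ) (hcpos : ∀ j, 0 < c j) (hc : StrictMono c) :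
    ∃ α₀ A₀ L₀ γ₀ K : ℝ, 0 < α₀ ∧ 0 < A₀ ∧ 0 < L₀ ∧ 0 < γ₀ ∧ 0 < K ∧
      ∀ L α : ℝ, L₀ < L → 0 < α → α < α₀ →
      ∀ x₀ : Fin N → ℝ, StrictMono x₀ →
        (∀ i j : Fin N, (i : ℕ) + 1 = (j : ℕ) → x₀ i + L < x₀ j) →
      ∀ u : ℝ → ℝ → ℝ, IsKdVSolution u →
        L2sq (fun x => u 0 x - ∑ j, Q (c j) (x - x₀ j)) ≤ α ^ 2 →
        ∃ (cf : Fin N → ℝ → ℝ) (X : Fin N → ℝ → ℝ) (cplus : Fin N → ℝ),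
          (∀ j, ∀ t : ℝ, 0 ≤ t → 0 < cf j t) ∧
          Tendsto
            (fun t : ℝ => ∫ x in Set.Ici (c ⟨0, by omega⟩ * t / 10),
              (u t x - ∑ j, Q (cf j t) (x - X j t)) ^ 2)
            atTop (nhds 0) ∧
          (∀ j, 0 < cplus j ∧ Tendsto (cf j) atTop (nhds (cplus j))) ∧
          ∑ j, |cplus j - c j| ≤ K * A₀ * (α + Real.exp (-γ₀ * L)) := by
  have ek : ∃ k : ℕ → ℝ, (∀ m < N, 0 < k m) ∧ ∀ j : Fin N, c j = 4 * k j ^ 2 := by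
    refine ⟨fun j => if h : j < N then √(c ⟨j, h⟩) / 2 else 0, fun m hm => ?_, fun j => ?_⟩
    · have := hcpos ⟨m, hm⟩
      simp only [hm, dif_pos]
      positivity
    · simp only [j.2, dif_pos, div_pow]
      rw [sq_sqrt (hcpos j).le]
      ring
  obtain ⟨k, k0, hk⟩ := ek
  have kmono : ∀ m < N, ∀ i < m, k i < k m := fun m hm i hi => by
    have h1 : c ⟨i, hi.trans hm⟩ < c ⟨m, hm⟩ := hc hi
    rw [hk, hk] at h1
    exact lt_of_pow_lt_pow_left₀ 2 (k0 m hm).le (by linarith)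
  obtain ⟨g, hg, B⟩ := KdV.exists_box k0 kmono
  have N0 : 0 < N := by omega
  have θ0 : 0 < 4 * k 0 ^ 2 / 10 := by have := k0 0 N0; positivity
  obtain ⟨d, γ, K', W, d0, γ0, K'0, W0, H⟩ := KdV.stab (η := g ^ 2) (θ := 4 * k 0 ^ 2 / 10) hg
    (by positivity) le_rfl θ0 B fun m hm => by
      have h1 : k 0 ≤ k m := by
        rcases Nat.eq_zero_or_pos m with rfl | h
        · rfl
        · exact (kmono m hm 0 h).le
      have h2 := pow_le_pow_left₀ (k0 0 N0).le h1 2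
      have h3 := pow_le_pow_left₀ hg.le (B m hm).le 2
      linarith
  obtain ⟨e, e0, he⟩ := KdV.exists_small K'0.le (show 0 < (g / 2) ^ 2 by positivity)
  obtain ⟨d', hd', he', d'0⟩ : ∃ d', d' ≤ d ∧ d' ≤ e ∧ 0 < d' :=
    ⟨min d e, min_le_left _ _, min_le_right _ _, by positivity⟩
  refine ⟨√d', 1, max 1 (-log (d' / 2) / γ), γ / 2, N * (16 * g⁻¹ * √K') + 1, by positivity, one_pos,
    by positivity, by positivity, by positivity, ?_⟩
  intro L α hL hα hα' x₀ hx₀ hsep u hu h0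
  have L0 : 0 < L := one_pos.trans ((le_max_left _ _).trans_lt hL)
  obtain ⟨ρ, hρ⟩ : ∃ ρ, ρ = α ^ 2 / 9 + exp (-(γ * L)) := ⟨_, rfl⟩
  have ρd : ρ ≤ d' := by
    have h1 : α ^ 2 ≤ d' := by
      rw [← sq_sqrt d'0.le]
      exact pow_le_pow_left₀ hα.le hα'.le 2
    have h2 : exp (-(γ * L)) ≤ d' / 2 := by
      rw [← le_log_iff_exp_le (by positivity)]
      have := (le_max_right _ _).trans hL.le
      rw [div_le_iff₀ γ0] at this
      linarith
    linarith
  have ea : ∃ a : ℕ → ℝ, ∀ j : Fin N, x₀ j = a j :=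
    ⟨fun j => if h : j < N then x₀ ⟨j, h⟩ else 0, fun j => by simp⟩
  obtain ⟨a, ha⟩ := ea
  have asep : ∀ j < N, ∀ i < j, a i + L ≤ a j := fun j hj i hi => by
    have h1 := hsep ⟨j - 1, by omega⟩ ⟨j, hj⟩ (by simp only; omega)
    have h2 := hx₀.monotone (show (⟨i, by omega⟩ : Fin N) ≤ ⟨j - 1, by omega⟩ by
      rw [Fin.mk_le_mk]
      omega)
    rw [ha, ha] at h1 h2
    simp only at h1 h2
    linarith
  have hV := (KdV.reg_of_isKdVSolution hu).kc
  have b0 : KdV.L2le Set.univ (fun x => -(1 / 3) * u 0 x - KdV.SS k a N x) ρ := by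
    refine KdV.L2le.univ ((hV.i0 0).sub
      (KdV.SqI.sum _ _ fun j hj => KdV.SqI.soliton (k0 j (Finset.mem_range.1 hj)) _)) ?_
    simp only [L2sq, hk, ha, KdV.sub_sum_Q_sq k0, integral_const_mul] at h0
    have := exp_pos (-(γ * L))
    linarith
  obtain ⟨κ, X, F⟩ := H _ a L ρ hV asep L0.le (by rw [hρ]; linarith [sq_nonneg α]) (ρd.trans hd') b0
  have κb : ∀ j < N, |κ j - k j| ≤ g / 2 := fun j hj =>
    abs_le_of_sq_le_sq ((F.near j hj).trans (he ρ (ρd.trans he'))) (by positivity)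
  have κ0 : ∀ j < N, 0 < κ j := fun j hj => by
    linarith [(abs_le.1 (κb j hj)).1, (B j hj).le]
  refine ⟨fun j _ => 4 * κ j ^ 2, fun j t => X t j, fun j => 4 * κ j ^ 2, fun j t _ => ?_, ?_,
    fun j => ⟨?_, tendsto_const_nhds⟩, ?_⟩
  · have := κ0 j j.2
    positivity
  · have e1 : ∀ t, c ⟨0, N0⟩ * t / 10 = 4 * k 0 ^ 2 / 10 * t := fun t => by
      rw [hk]
      simp only
      ring
    simp only [e1, KdV.sub_sum_Q_sq κ0, integral_const_mul]
    simpa using F.lim.const_mul 9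
  · have := κ0 j j.2
    positivity
  · obtain ⟨s, hs⟩ : ∃ s, s = α + exp (-(γ / 2) * L) := ⟨_, rfl⟩
    have s0 : 0 < s := by rw [hs]; positivity
    have ρs : ρ ≤ s ^ 2 := by
      have h1 : exp (-(γ * L)) = exp (-(γ / 2) * L) ^ 2 := by
        rw [← exp_nat_mul]
        ring_nf
      rw [hρ, hs, h1]
      have := mul_pos hα (exp_pos (-(γ / 2) * L))
      linarith [sq_nonneg α, add_sq α (exp (-(γ / 2) * L))]
    have t1 : ∀ j : Fin N, |4 * κ j ^ 2 - c j| ≤ 16 * g⁻¹ * √K' * s := fun j => by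
      have h1 : |κ j - k j| ≤ √K' * s := by
        refine abs_le_of_sq_le_sq ?_ (by positivity)
        rw [mul_pow, sq_sqrt K'0.le]
        exact (F.near j j.2).trans (mul_le_mul_of_nonneg_left ρs K'0.le)
      have h2 := (B j j.2).inv
      have h3 := (abs_le.1 (κb j j.2)).2
      have h4 := (B j j.2).le
      have h5 := κ0 j j.2
      have h6 := k0 j j.2
      rw [hk, show 4 * κ j ^ 2 - 4 * k j ^ 2 = 4 * (κ j + k j) * (κ j - k j) by ring, abs_mul,
        abs_of_pos (by positivity)]
      calc _ ≤ 16 * g⁻¹ * (√K' * s) :=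
            mul_le_mul (by linarith) h1 (abs_nonneg _) (by positivity)
        _ = _ := by ring
    rw [← hs, mul_one]
    calc ∑ j : Fin N, |4 * κ j ^ 2 - c j| ≤ ∑ _j : Fin N, 16 * g⁻¹ * √K' * s :=
          Finset.sum_le_sum fun j _ => t1 j
      _ = N * (16 * g⁻¹ * √K') * s := by
          rw [Finset.sum_const, Finset.card_univ, Fintype.card_fin, nsmul_eq_mul]
          ring
      _ ≤ _ := by linarith
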